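/- For every nonzero integer h ≥ 1, the logarithmically averaged two-point correlation of the Liouville function vanishes: lim_{N→∞} (1/log N) Σ_{n≤N} λ(n)λ(n+h)/n = 0. -/

import Mathlib

open Filter Topology

/-- The Liouville function `λ(n) = (-1)^Ω(n)`, where `Ω(n)` is the number of prime
factors of `n` counted with multiplicity. -/
def liouville (n : ℕ) : ℤ := (-1) ^ (ArithmeticFunction.cardFactors n)

section
open Finset (Icc Ico Ioc Ioo abs_sum_le_sum_abs card_filter_le card_le_card card_le_card_of_injOn card_range card_univ coe_filter mem_Icc mem_Ico mem_Ioc mem_Ioo mem_coe mem_filter mem_image mem_offDiag mem_product mem_range mem_union mem_univ mul_sum prod_congr prod_const range single_le_sum sum_Icc_succ_top sum_Ico_succ_top sum_Ioc_consecutive sum_add_distrib sum_bij sum_boole sum_coe_sort sum_comm sum_congr sum_const sum_div sum_eq_single sum_eq_zero sum_filter sum_image sum_ite_eq sum_ite_eq' sum_ite_mem sum_le_card_nsmul sum_le_sum sum_le_sum_of_subset_of_nonneg sum_mul sum_mul_sum sum_nonneg sum_pos sum_product sum_product' sum_range_succ sum_range_succ' sum_sub_distrib univ)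
open Real (add_one_le_exp div_rpow exp exp_add exp_le_exp exp_le_one_iff exp_log exp_mul exp_nat_mul exp_neg exp_one_lt_d9 exp_pos exp_sub exp_sum exp_zero inv_rpow le_log_iff_exp_le log_div log_exp log_le_log log_le_sub_one_of_pos log_mul log_natCast_nonneg log_pos log_pow log_two_gt_d9 log_two_lt_d9 mul_rpow mul_self_sqrt norm_eq_abs norm_of_nonneg one_le_exp one_le_rpow pi_gt_three pi_lt_d2 pi_pos rpow_add rpow_le_rpow rpow_le_rpow_of_exponent_le rpow_mul rpow_natCast rpow_neg rpow_one rpow_sub sin sq_sqrt sqrt sqrt_div sqrt_eq_rpow sqrt_mul sqrt_pos sqrt_sq)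
open Complex (I_sq abs_re_le_norm add_re conj_mul' conj_ofReal exp_eq_one_iff mem_reProdIm mul_conj' natCast_log normSq_apply normSq_eq_norm_sq norm_real ofRealCLM ofReal_exp ofReal_mul ofReal_pow ofReal_re ofReal_sum one_im one_re re_le_norm re_sum real_smul sq_norm sub_im sub_re)
open Nat (Coprime ModEq abs_cast card_Ico card_Ioc cast_add cast_div_le cast_le cast_mul cast_nonneg cast_sub cast_zero coprime_primes divisors eq_of_mul_eq_mul_left floor_le floor_mono floor_natCast lcm_pos le_ceil le_floor le_induction le_of_dvd lt_floor_add_one mem_divisors mul_div_cancel' one_le_iff_ne_zero one_le_two_pow pow_le_pow_right sub_le)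

section
noncomputable def ee (x : ℝ) : ℂ := Complex.exp (x * Complex.I)
lemma ee_norm (x : ℝ) : ‖ee x‖ = 1 := Complex.norm_exp_ofReal_mul_I x
lemma ee_add (x y : ℝ) : ee (x + y) = ee x * ee y := by
  simp [ee, ← Complex.exp_add, add_mul]
lemma ee_zero : ee 0 = 1 := by simp [ee]
lemma ee_conj (x : ℝ) : (starRingEnd ℂ) (ee x) = ee (-x) := by
  simp [ee, ← Complex.exp_conj]
lemma ee_nat_mul (j : ℕ) (x : ℝ) : ee (j * x) = ee x ^ j := by
  simp only [ee, ← Complex.exp_nat_mul]; congr 1; push_cast; ring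
lemma ee_ne (x : ℝ) : ee x ≠ 0 := Complex.exp_ne_zero _
lemma ee_neg (x : ℝ) : ee (-x) = (ee x)⁻¹ := by
  refine eq_inv_of_mul_eq_one_left ?_
  rw [← ee_add]; simp [ee_zero]
lemma ee_sub (x y : ℝ) : ee (x - y) = ee x * ee (-y) := by rw [sub_eq_add_neg, ee_add]
lemma ee_sub_one_le (x : ℝ) : ‖ee x - 1‖ ≤ |x| := by
  have := Real.norm_exp_I_mul_ofReal_sub_one_le (x := x)
  rwa [mul_comm, norm_eq_abs] at this
lemma ee_sub_le (x y : ℝ) : ‖ee x - ee y‖ ≤ |x - y| := by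
  have : ee x - ee y = ee y * (ee (x - y) - 1) := by
    rw [mul_sub, ← ee_add]; ring_nf
  rw [this, norm_mul, ee_norm, one_mul]; exact ee_sub_one_le _
lemma ee_sub_one_ge (x : ℝ) (hx : |x| ≤ Real.pi) : 2 / Real.pi * |x| ≤ ‖ee x - 1‖ := by
  have h1 : ‖ee x - 1‖ = 2 * |sin (x / 2)| := by
    have := Complex.norm_exp_I_mul_ofReal_sub_one x
    rw [mul_comm] at this
    rw [ee, this, norm_eq_abs, abs_mul]; norm_num
  have h2 := Real.mul_abs_le_abs_sin (x := x / 2) (by rw [abs_div]; norm_num; linarith)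
  rw [h1]; rw [abs_div] at h2; norm_num at h2 ⊢
  have : 2 / Real.pi * |x| = 2 * (|x| / Real.pi) := by ring
  linarith
lemma geom_leK (K : ℕ) (x : ℝ) : ‖∑ j ∈ range K, ee (j * x)‖ ≤ K := by
  refine (norm_sum_le _ _).trans ?_
  simp [ee_norm]
lemma geom_le' (K : ℕ) (x : ℝ) (h0 : x ≠ 0) (hx : |x| ≤ Real.pi) :
    ‖∑ j ∈ range K, ee (j * x)‖ ≤ Real.pi / |x| := by
  have hx0 : 0 < |x| := abs_pos.mpr h0
  have h1 := ee_sub_one_ge x hx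
  have h3 : 0 < 2 / Real.pi * |x| := by positivity
  have h2 : ee x ≠ 1 := by
    intro h; rw [h] at h1; simp at h1; linarith
  simp_rw [ee_nat_mul]
  rw [geom_sum_eq h2, norm_div]
  have h4 : ‖ee x ^ K - 1‖ ≤ 2 := by
    refine (norm_sub_le _ _).trans ?_
    rw [norm_pow, ee_norm]; norm_num
  calc _ ≤ 2 / (2 / Real.pi * |x|) := by gcongr
    _ = _ := by field_simp
lemma schur {ι : Type*} (S : Finset ι) (a : ι → ℂ) (k : ι → ι → ℂ) (C : ℝ)
    (hs : ∀ m ∈ S, ∀ n ∈ S, ‖k m n‖ = ‖k n m‖)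
    (hC : ∀ n ∈ S, ∑ m ∈ S, ‖k m n‖ ≤ C) :
    ‖∑ m ∈ S, ∑ n ∈ S, a m * (starRingEnd ℂ) (a n) * k m n‖ ≤ C * ∑ n ∈ S, ‖a n‖ ^ 2 := by
  have h1 : ∑ m ∈ S, ∑ n ∈ S, ‖a n‖ ^ 2 * ‖k m n‖ ≤ C * ∑ n ∈ S, ‖a n‖ ^ 2 := by
    rw [sum_comm, mul_sum]
    refine sum_le_sum fun n hn => ?_
    rw [← mul_sum, mul_comm]; gcongr; exact hC n hn
  have h2 : ∑ m ∈ S, ∑ n ∈ S, ‖a m‖ ^ 2 * ‖k m n‖ = ∑ m ∈ S, ∑ n ∈ S, ‖a n‖ ^ 2 * ‖k m n‖ := by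
    rw [sum_comm]
    exact sum_congr rfl fun n hn => sum_congr rfl fun m hm => by rw [hs m hm n hn]
  calc _ ≤ ∑ m ∈ S, ∑ n ∈ S, (‖a m‖ ^ 2 * ‖k m n‖ + ‖a n‖ ^ 2 * ‖k m n‖) / 2 := by
        refine (norm_sum_le _ _).trans (sum_le_sum fun m _ => (norm_sum_le _ _).trans
          (sum_le_sum fun n _ => ?_))
        rw [norm_mul, norm_mul, RCLike.norm_conj]
        nlinarith [mul_nonneg (sq_nonneg (‖a m‖ - ‖a n‖)) (norm_nonneg (k m n))]
    _ = ((∑ m ∈ S, ∑ n ∈ S, ‖a m‖ ^ 2 * ‖k m n‖) + ∑ m ∈ S, ∑ n ∈ S, ‖a n‖ ^ 2 * ‖k m n‖) / 2 := by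
        simp_rw [← sum_div, sum_add_distrib]
    _ ≤ _ := by linarith
lemma normsq_sum {ι : Type*} (S : Finset ι) (a : ι → ℂ) :
    ((‖∑ n ∈ S, a n‖ ^ 2 : ℝ) : ℂ) = ∑ m ∈ S, ∑ n ∈ S, a m * (starRingEnd ℂ) (a n) := by
  push_cast
  rw [← mul_conj', map_sum, sum_mul_sum]
lemma mv_kernel {ι : Type*} (S : Finset ι) (a : ι → ℂ) (x : ι → ℝ) (K : ℕ) (C : ℝ)
    (hC : ∀ n ∈ S, ∑ m ∈ S, ‖∑ j ∈ range K, ee (j * (x m - x n))‖ ^ 2 ≤ C) :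
    ∑ j ∈ range K, ∑ i ∈ range K, ‖∑ n ∈ S, a n * ee (((j : ℝ) - i) * x n)‖ ^ 2
      ≤ C * ∑ n ∈ S, ‖a n‖ ^ 2 := by
  set g : ι → ι → ℂ := fun m n => ∑ j ∈ range K, ee (j * (x m - x n)) with hg
  have hgs : ∀ m n, ‖g m n‖ = ‖g n m‖ := by
    intro m n
    rw [← RCLike.norm_conj (g m n)]
    simp only [hg, map_sum, ee_conj]
    congr 2; ext j; congr 1; ring
  have key : ((∑ j ∈ range K, ∑ i ∈ range K,
      ‖∑ n ∈ S, a n * ee (((j : ℝ) - i) * x n)‖ ^ 2 : ℝ) : ℂ)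
      = ∑ m ∈ S, ∑ n ∈ S, a m * (starRingEnd ℂ) (a n) * ((‖g m n‖ ^ 2 : ℝ) : ℂ) := by
    push_cast [-ofReal_pow]
    have e1 : ∀ j ∈ range K, ∀ i ∈ range K,
        (((‖∑ n ∈ S, a n * ee (((j : ℝ) - i) * x n)‖ ^ 2 : ℝ)) : ℂ)
        = ∑ m ∈ S, ∑ n ∈ S, a m * (starRingEnd ℂ) (a n) *
          (ee (j * (x m - x n)) * (starRingEnd ℂ) (ee (i * (x m - x n)))) := by
      intro j _ i _
      rw [normsq_sum]
      refine sum_congr rfl fun m _ => sum_congr rfl fun n _ => ?_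
      rw [map_mul, ee_conj, ee_conj, ← ee_add, mul_mul_mul_comm, ← ee_add]
      congr 2; ring
    rw [sum_congr rfl fun j hj => sum_congr rfl fun i hi => e1 j hj i hi]
    simp_rw [hg, normsq_sum, mul_sum]
    simp_rw [sum_comm (s := range K) (t := S)]
  have h := schur S a (fun m n => ((‖g m n‖ ^ 2 : ℝ) : ℂ)) C
    (fun m _ n _ => by rw [hgs]) (fun n hn => by
      refine le_trans (le_of_eq ?_) (hC n hn)
      refine sum_congr rfl fun m _ => ?_
      rw [norm_real, norm_eq_abs, abs_of_nonneg (by positivity)])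
  rw [← key, norm_real, norm_eq_abs] at h
  exact (le_abs_self _).trans h
lemma mv_count (𝒯 : Finset ℤ) (T : ℕ) (hT : ∀ t ∈ 𝒯, |t| ≤ T) (D : ℝ → ℝ) (hD : ∀ t, 0 ≤ D t) :
    (T : ℝ) * ∑ t ∈ 𝒯, D t ≤
      ∑ j ∈ range (2 * T), ∑ i ∈ range (2 * T), D ((j : ℝ) - i) := by
  classical
  have h1 : ∀ t ∈ 𝒯, (T : ℝ) * D t ≤ ∑ q ∈ (range (2 * T) ×ˢ range (2 * T)).filter
      (fun q => (q.1 : ℤ) - q.2 = t), D ((q.1 : ℝ) - q.2) := by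
    intro t ht
    have e : ∀ q ∈ (range (2 * T) ×ˢ range (2 * T)).filter
      (fun q => (q.1 : ℤ) - q.2 = t), D ((q.1 : ℝ) - q.2) = D t := by
      intro q hq
      rw [← (mem_filter.mp hq).2]; push_cast; rfl
    rw [sum_congr rfl e, sum_const, nsmul_eq_mul]
    gcongr
    · exact hD _
    · have hb := abs_le.mp (hT t ht)
      rw [← card_range T]
      refine card_le_card_of_injOn (fun k => ((k + t + (if t < 0 then -t else 0)).toNat,
        (k + (if t < 0 then -t else 0)).toNat)) ?_ ?_
      · intro k hk
        simp only [Finset.coe_range, Set.mem_Iio] at hk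
        simp only [coe_filter, mem_product, mem_range]
        show (_ ∧ _) ∧ _
        have hc := card_range T
        split_ifs <;> dsimp only <;> omega
      · intro k hk l hl h
        simp only [Prod.mk.injEq] at h
        split_ifs at h <;> omega
  rw [mul_sum, ← sum_product']
  refine (sum_le_sum h1).trans ?_
  rw [← Finset.sum_biUnion]
  · refine sum_le_sum_of_subset_of_nonneg (fun q hq => ?_) (fun q _ _ => hD _)
    simp only [Finset.mem_biUnion, mem_filter] at hq
    obtain ⟨_, _, h, _⟩ := hq; exact h
  · intro s _ t _ hst
    simp only [Function.onFun]
    rw [Finset.disjoint_left]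
    intro q h1 h2
    simp only [mem_filter] at h1 h2
    exact hst (h1.2.symm.trans h2.2)
lemma log_sub_ge {Y : ℝ} {m n : ℕ} (hm : 0 < m) (hn : 0 < n)
    (hm2 : m ≤ Y) (hn2 : n ≤ Y) : |(m : ℝ) - n| / Y ≤ |Real.log m - Real.log n| := by
  wlog h : n ≤ m generalizing m n
  · rw [abs_sub_comm, abs_sub_comm (Real.log m)]
    exact this hn hm hn2 hm2 (by omega)
  have h' : (n : ℝ) ≤ m := by exact_mod_cast h
  have hm' : (0 : ℝ) < m := by exact_mod_cast hm
  have hn' : (0 : ℝ) < n := by exact_mod_cast hn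
  rw [abs_of_nonneg (by linarith), abs_of_nonneg (by
    rw [sub_nonneg]; exact log_le_log hn' h')]
  have := log_le_sub_one_of_pos (x := (n : ℝ) / m) (by positivity)
  rw [log_div hn'.ne' hm'.ne'] at this
  have h2 : ((m : ℝ) - n) / Y ≤ (m - n) / m := by gcongr
  have h3 : ((m : ℝ) - n) / m = 1 - n / m := by field_simp
  linarith
lemma sum_min_le (n M : ℕ) (S : Finset ℕ) (F : ℕ → ℝ) (K B : ℝ) (hK : 0 < K) (hB : 0 < B)
    (h1 : ∀ m ∈ S, F m ≤ K) (h2 : ∀ m ∈ S, m ≠ n → F m ≤ B ^ 2 / (K * ((m : ℝ) - n) ^ 2))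
    (hM : ∀ m ∈ S, m ≤ M) (hn : n ≤ M) :
    ∑ m ∈ S, F m ≤ 3 * K + 4 * B := by
  classical
  set k0 : ℕ := ⌊B / K⌋₊ + 1 with hk0
  have hk1 : B / K ≤ k0 := by rw [hk0]; push_cast; exact (lt_floor_add_one _).le
  have hk2 : (k0 : ℝ) ≤ B / K + 1 := by
    rw [hk0]; push_cast; gcongr; exact floor_le (by positivity)
  have hkp : (0 : ℝ) < k0 := by rw [hk0]; positivity
  set f : ℕ → ℝ := fun d => if d ≤ k0 then K else B ^ 2 / (K * (d : ℝ) ^ 2) with hf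
  have hf0 : ∀ d, 0 ≤ f d := by intro d; simp only [hf]; split_ifs <;> positivity
  have hfS : ∀ N, ∑ d ∈ Icc 1 N, f d ≤ K * k0 + B := by
    intro N
    have a1 : ∑ d ∈ Icc 1 N, f d ≤ ∑ d ∈ Icc 1 k0, K +
        ∑ d ∈ Ioc k0 (max k0 N), B ^ 2 / K * ((d : ℝ) ^ 2)⁻¹ := by
      have : ∑ d ∈ Icc 1 N, f d ≤ ∑ d ∈ Icc 1 k0 ∪ Ioc k0 (max k0 N), f d := by
        refine sum_le_sum_of_subset_of_nonneg (fun d hd => ?_) (fun d _ _ => hf0 d)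
        simp only [mem_union, mem_Icc, mem_Ioc] at *
        have := le_max_right k0 N
        omega
      rw [Finset.sum_union] at this
      · refine this.trans (add_le_add (sum_le_sum fun d hd => ?_)
          (sum_le_sum fun d hd => ?_))
        · simp only [hf, mem_Icc] at *; rw [if_pos hd.2]
        · simp only [hf, mem_Ioc] at *; rw [if_neg (by omega)]
          rw [← div_eq_mul_inv, div_div]
      · rw [Finset.disjoint_left]; intro d; simp only [mem_Icc, mem_Ioc]; omega
    have a2 := sum_Ioc_inv_sq_le_sub (α := ℝ) (k := k0) (n := max k0 N) (by omega) (le_max_left _ _)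
    have a3 : B ^ 2 / K * (k0 : ℝ)⁻¹ ≤ B := by
      rw [div_mul_eq_mul_div, div_le_iff₀ hK, ← div_eq_mul_inv, div_le_iff₀ hkp]
      rw [div_le_iff₀ hK] at hk1; nlinarith
    rw [← mul_sum] at a1
    have a4 : B ^ 2 / K * ∑ d ∈ Ioc k0 (max k0 N), ((d : ℝ) ^ 2)⁻¹ ≤ B := by
      refine le_trans (mul_le_mul_of_nonneg_left a2 (by positivity)) ?_
      have : (0 : ℝ) ≤ ((max k0 N : ℕ) : ℝ)⁻¹ := by positivity
      have h5 : 0 ≤ B ^ 2 / K := by positivity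
      nlinarith
    simp at a1
    nlinarith
  have hle : ∀ m ∈ S, F m ≤ if m = n then K else f (((m : ℤ) - n).natAbs) := by
    intro m hm
    split_ifs with h
    · exact h1 m hm
    · simp only [hf]
      split_ifs with h'
      · exact h1 m hm
      · refine (h2 m hm h).trans (le_of_eq ?_)
        have : ((((m : ℤ) - n).natAbs : ℕ) : ℝ) = |(m : ℝ) - n| := by
          rw [Nat.cast_natAbs]; push_cast; rfl
        rw [this, sq_abs]
  have hsub : ∑ m ∈ S, (if m = n then K else f (((m : ℤ) - n).natAbs)) ≤
      K + (∑ d ∈ Icc 1 M, f d + ∑ d ∈ Icc 1 M, f d) := by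
    have c1 : ∀ A : Finset ℕ, A ⊆ S → (∀ m ∈ A, m ≠ n) →
        (∀ m ∈ A, ∀ l ∈ A, ((m : ℤ) - n).natAbs = ((l : ℤ) - n).natAbs → m = l) →
        ∑ m ∈ A, (if m = n then K else f (((m : ℤ) - n).natAbs)) ≤ ∑ d ∈ Icc 1 M, f d := by
      intro A hA hAn hinj
      rw [sum_congr rfl fun m hm => if_neg (hAn m hm),
        ← sum_image (f := f) (g := fun m : ℕ => ((m : ℤ) - n).natAbs) (fun m hm l hl h => hinj m hm l hl h)]
      refine sum_le_sum_of_subset_of_nonneg (fun d hd => ?_) (fun d _ _ => hf0 d)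
      obtain ⟨m, hm, rfl⟩ := mem_image.mp hd
      have := hM m (hA hm); have := hAn m hm
      rw [mem_Icc]; omega
    rw [← Finset.sum_filter_add_sum_filter_not S (fun m => m = n)]
    refine add_le_add ?_ ?_
    · rw [sum_congr rfl fun m hm => if_pos (mem_filter.mp hm).2, sum_const,
        nsmul_eq_mul]
      have : ((S.filter (fun m => m = n)).card : ℝ) ≤ 1 := by
        have : (S.filter (fun m => m = n)).card ≤ ({n} : Finset ℕ).card :=
          card_le_card (by intro m; simp)
        exact_mod_cast this
      nlinarith
    · rw [← Finset.sum_filter_add_sum_filter_not _ (fun m => m < n)]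
      refine add_le_add (c1 _ ?_ ?_ ?_) (c1 _ ?_ ?_ ?_)
      all_goals first
        | (intro m hm; simp only [mem_filter] at hm; first | exact hm.1.1 | exact hm.1.2)
        | (intro m hm l hl h; simp only [mem_filter] at hm hl; omega)
  have := hfS M
  have h6 : K * k0 ≤ B + K := by
    calc K * k0 ≤ K * (B / K + 1) := by gcongr
      _ = _ := by field_simp
  linarith [sum_le_sum hle]
lemma mean_value (𝒯 : Finset ℤ) (T : ℕ) (hT0 : 1 ≤ T) (hT : ∀ t ∈ 𝒯, |t| ≤ T) (Y : ℝ) (hY : 0 < Y)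
    (S : Finset ℕ) (hS : ∀ n ∈ S, Y ≤ n ∧ n ≤ 20 * Y) (a : ℕ → ℂ) :
    ∑ t ∈ 𝒯, ‖∑ n ∈ S, a n * ee (-t * Real.log n)‖ ^ 2 ≤ 600 * (T + Y) * ∑ n ∈ S, ‖a n‖ ^ 2 := by
  have hT0' : (1 : ℝ) ≤ T := by exact_mod_cast hT0
  have hpi := pi_pos
  have h1 := mv_count 𝒯 T hT (fun t => ‖∑ n ∈ S, a n * ee (-t * Real.log n)‖ ^ 2)
    (fun t => by positivity)
  have h2 := mv_kernel S a (fun n => - Real.log n) (2 * T)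
    ((2 * T) * (3 * (2 * T) + 4 * (20 * Real.pi * Y))) ?_
  · have h3 : ∀ j i : ℕ, ∑ n ∈ S, a n * ee (((j : ℝ) - i) * (- Real.log n)) =
      ∑ n ∈ S, a n * ee (-((j : ℝ) - i) * Real.log n) := by
      intro j i; refine sum_congr rfl fun n _ => ?_; congr 2; ring
    simp_rw [h3] at h2
    have h4 := h1.trans h2
    have hA : 0 ≤ ∑ n ∈ S, ‖a n‖ ^ 2 := by positivity
    have hp := pi_lt_d2
    have h5 : (T : ℝ) * ∑ t ∈ 𝒯, ‖∑ n ∈ S, a n * ee (-t * Real.log n)‖ ^ 2 ≤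
        T * (600 * (T + Y) * ∑ n ∈ S, ‖a n‖ ^ 2) := by
      refine h4.trans ?_
      rw [← mul_assoc (T : ℝ)]
      refine mul_le_mul_of_nonneg_right ?_ hA
      nlinarith [mul_pos (lt_of_lt_of_le one_pos hT0') hY, mul_pos (lt_of_lt_of_le one_pos hT0') (lt_of_lt_of_le one_pos hT0')]
    exact le_of_mul_le_mul_left h5 (by linarith)
  · intro n hn
    have hK : (0 : ℝ) < 2 * T := by linarith
    have hn0 : (0 : ℝ) < n := hY.trans_le (hS n hn).1
    have := sum_min_le n (⌊20 * Y⌋₊) S (fun m => ‖∑ j ∈ range (2 * T),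
      ee (j * (-Real.log m - -Real.log n))‖ ^ 2 / (2 * T)) (2 * T) (20 * Real.pi * Y) hK
      (by positivity) ?_ ?_ (fun m hm => le_floor (hS m hm).2) (le_floor (hS n hn).2)
    · rw [← sum_div, div_le_iff₀ hK] at this
      linarith
    · intro m _
      rw [div_le_iff₀ hK, ← sq]
      gcongr
      exact_mod_cast geom_leK (2 * T) _
    · intro m hm hmn
      have hm0 : (0 : ℝ) < m := hY.trans_le (hS m hm).1
      have hlog := log_sub_ge (Y := 20 * Y) (m := m) (n := n) (by exact_mod_cast hm0)
        (by exact_mod_cast hn0) (hS m hm).2 (hS n hn).2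
      have hne : 0 < |(m : ℝ) - n| := abs_pos.mpr (sub_ne_zero.mpr (by exact_mod_cast hmn))
      have hpos : 0 < |(m : ℝ) - n| / (20 * Y) := by positivity
      have e : |(-Real.log m - -Real.log n)| = |Real.log m - Real.log n| := by
        rw [abs_sub_comm]; congr 1; ring
      have hle3 : |Real.log m - Real.log n| ≤ Real.pi := by
        have hl20 : Real.log 20 ≤ 3 := by
          rw [Real.log_le_iff_le_exp (by norm_num)]
          have := Real.exp_one_gt_d9
          calc (20 : ℝ) ≤ 2.7182818283 ^ 3 := by norm_num
            _ ≤ (exp 1) ^ 3 := by gcongr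
            _ = _ := by rw [← exp_nat_mul]; norm_num
        have g : ∀ k ∈ S, Real.log Y ≤ Real.log k ∧ Real.log k ≤ Real.log Y + 3 := by
          intro k hk
          refine ⟨log_le_log hY (hS k hk).1, ?_⟩
          have := log_le_log (hY.trans_le (hS k hk).1) (hS k hk).2
          rw [log_mul (by norm_num) hY.ne'] at this
          linarith
        have := g m hm; have := g n hn
        have := pi_gt_three
        rw [abs_le]; constructor <;> linarith
      have := geom_le' (2 * T) (-Real.log m - -Real.log n)
        (by rw [← abs_pos, e]; linarith) (by rw [e]; exact hle3)
      rw [e] at this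
      rw [div_le_iff₀ hK]
      calc _ ≤ (Real.pi / (|(m : ℝ) - n| / (20 * Y))) ^ 2 := by
            gcongr; exact this.trans (by gcongr)
        _ = _ := by rw [← sq_abs ((m : ℝ) - n)]; field_simp
end
section
lemma vdc (M : ℕ) (z : ℕ → ℂ) : ‖∑ n ∈ range M, z n‖ ^ 2 ≤
    2 * ∑ h ∈ range M, ‖∑ n ∈ range (M - h), z (n + h) * (starRingEnd ℂ) (z n)‖ := by
  have h1 : ∀ M : ℕ, ‖∑ n ∈ range M, z n‖ ^ 2 ≤
      2 * (∑ m ∈ range M, ∑ n ∈ range (m + 1), z m * (starRingEnd ℂ) (z n)).re := by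
    intro M
    induction M with
    | zero => simp
    | succ M ih =>
      rw [sum_range_succ, sum_range_succ _ M, add_re]
      have e : ‖∑ n ∈ range M, z n + z M‖ ^ 2 = ‖∑ n ∈ range M, z n‖ ^ 2 + ‖z M‖ ^ 2
          + 2 * (z M * (starRingEnd ℂ) (∑ n ∈ range M, z n)).re := by
        rw [← normSq_eq_norm_sq, Complex.normSq_add, normSq_eq_norm_sq,
          normSq_eq_norm_sq]
        congr 2
        rw [← Complex.conj_re, map_mul, Complex.conj_conj, mul_comm]
      rw [e, sum_range_succ, ← mul_sum, ← map_sum, add_re, mul_conj']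
      norm_cast
      nlinarith [sq_nonneg ‖z M‖]
  refine (h1 M).trans ?_
  have h2 : ∑ m ∈ range M, ∑ n ∈ range (m + 1), z m * (starRingEnd ℂ) (z n) =
      ∑ h ∈ range M, ∑ n ∈ range (M - h), z (n + h) * (starRingEnd ℂ) (z n) := by
    rw [← Finset.sum_range_diag_flip M (fun h n => z (n + h) * (starRingEnd ℂ) (z n))]
    refine sum_congr rfl fun m _ => ?_
    rw [← Finset.sum_range_reflect]
    refine sum_congr rfl fun n hn => ?_
    rw [mem_range] at hn
    rw [show m + 1 - 1 - n = m - n by omega, show m - n + n = m by omega]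
  rw [h2]
  refine mul_le_mul_of_nonneg_left ?_ (by norm_num)
  exact (re_le_norm _).trans (norm_sum_le _ _)
lemma sum_inv_sqrt (N : ℕ) : ∑ h ∈ range N, 1 / √((h : ℝ) + 1) ≤ 2 * √N := by
  induction N with
  | zero => simp
  | succ N ih =>
    rw [sum_range_succ]
    have h1 : √((N : ℝ) + 1) ^ 2 = N + 1 := sq_sqrt (by positivity)
    have h2 : √(N : ℝ) ^ 2 = N := sq_sqrt (by positivity)
    have h3 : 0 < √((N : ℝ) + 1) := by positivity
    have : 1 / √((N : ℝ) + 1) ≤ 2 * √((N : ℝ) + 1) - 2 * √N := by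
      rw [div_le_iff₀ h3]; nlinarith [sq_nonneg (√((N : ℝ) + 1) - √N)]
    push_cast; linarith
open fwdDiff in
lemma weyl_poly (k : ℕ) : ∃ C : ℝ, 1 ≤ C ∧ ∀ (β : ℝ) (φ : ℝ → ℝ) (N : ℕ), 1 ≤ N → β ≠ 0 →
    ((fwdDiff 1)^[k + 1] φ = fun _ => β) → |β| * N ^ k ≤ Real.pi → ∀ M ≤ N,
    ‖∑ n ∈ range M, ee (φ n)‖ ≤ C * N * (|β| * N ^ (k + 1)) ^ (-(1 / 2 ^ (k + 1)) : ℝ) := by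
  induction k with
  | zero =>
    refine ⟨2, by norm_num, fun β φ N hN hβ hφ hb M hM => ?_⟩
    have hb0 : 0 < |β| := abs_pos.mpr hβ
    have hN' : (1 : ℝ) ≤ N := by exact_mod_cast hN
    have hlin : ∀ n : ℕ, φ n = φ 0 + n * β := by
      intro n
      induction n with
      | zero => simp
      | succ n ih =>
        have := congrFun hφ n
        simp only [zero_add, Function.iterate_one, fwdDiff] at this
        push_cast; linarith
    have e1 : ∑ n ∈ range M, ee (φ n) = ee (φ 0) * ∑ n ∈ range M, ee (n * β) := by
      rw [mul_sum]; refine sum_congr rfl fun n _ => ?_; rw [hlin, ee_add]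
    rw [e1, norm_mul, ee_norm, one_mul]
    have h1 := (geom_leK M β).trans (cast_le.mpr hM)
    have h2 := geom_le' M β hβ (by simpa using hb)
    set G := ‖∑ n ∈ range M, ee (n * β)‖
    have h3 : G ≤ √(4 * (N / |β|)) := by
      refine Real.le_sqrt_of_sq_le ?_
      have : G ^ 2 ≤ N * (Real.pi / |β|) := by
        rw [sq]; exact mul_le_mul h1 h2 (norm_nonneg _) (by positivity)
      refine this.trans ?_
      rw [show (N : ℝ) * (Real.pi / |β|) = Real.pi * (N / |β|) by ring]
      gcongr; exact Real.pi_le_four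
    refine h3.trans (le_of_eq ?_)
    have e2 : (-(1 / 2 ^ (0 + 1)) : ℝ) = -(1 / 2) := by norm_num
    rw [e2, rpow_neg (by positivity), ← sqrt_eq_rpow]
    rw [show (4 : ℝ) * (N / |β|) = (2 * N) ^ 2 / (|β| * N ^ (0 + 1)) by field_simp; ring,
      sqrt_div (by positivity), sqrt_sq (by positivity)]
    rfl
  | succ k ih =>
    obtain ⟨C, hC1, hC⟩ := ih
    refine ⟨√(2 * Real.pi + 4 * C), ?_, fun β φ N hN hβ hφ hb M hM => ?_⟩
    · refine Real.le_sqrt_of_sq_le ?_; nlinarith [pi_gt_three]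
    have hb0 : 0 < |β| := abs_pos.mpr hβ
    have hN' : (1 : ℝ) ≤ N := by exact_mod_cast hN
    have hpi := pi_gt_three
    set s : ℝ := 1 / 2 ^ (k + 1) with hs
    have hs0 : 0 < s := by positivity
    have hs1 : s ≤ 1 / 2 := by
      rw [hs, pow_succ]
      have : (1 : ℝ) ≤ 2 ^ k := one_le_pow₀ (by norm_num)
      gcongr; linarith
    set x : ℝ := |β| * N ^ (k + 2) with hx
    have hx0 : 0 < x := by positivity
    have hxN : x ≤ Real.pi * N := by
      rw [hx, pow_succ, ← mul_assoc]; gcongr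
    have hxs : (N : ℝ) ≤ Real.pi * N ^ 2 * x ^ (-s) := by
      have : x ^ s ≤ Real.pi * N := by
        calc x ^ s ≤ (Real.pi * N) ^ s := by gcongr
          _ ≤ (Real.pi * N) ^ (1 : ℝ) := rpow_le_rpow_of_exponent_le (by nlinarith) (by linarith)
          _ = _ := rpow_one _
      rw [rpow_neg hx0.le, ← div_eq_mul_inv, le_div_iff₀ (by positivity)]
      nlinarith
    have hh : ∀ h : ℕ, 1 ≤ h → h < N → ‖∑ n ∈ range (M - h), ee (φ (n + h : ℕ)) *
        (starRingEnd ℂ) (ee (φ n))‖ ≤ C * N * x ^ (-s) * (√N * (1 / √h)) := by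
      intro h h1 h2
      have hh0 : (1 : ℝ) ≤ h := by exact_mod_cast h1
      have hdiff : (fwdDiff 1)^[k + 1] (fun y : ℝ => φ (y + h) - φ y) = fun _ => β * h := by
        have e0 : (fun y : ℝ => φ (y + h) - φ y) = ∑ j ∈ range h, fun y : ℝ => (fwdDiff 1 φ) (y + j) := by
          funext y
          rw [Finset.sum_apply]
          have := Finset.sum_range_sub (fun j : ℕ => φ (y + j)) h
          simp only [cast_zero, add_zero] at this
          simp only [fwdDiff]
          rw [← this]
          refine sum_congr rfl fun j _ => ?_
          push_cast; ring_nf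
        rw [e0, fwdDiff_iter_finsetSum]
        funext y
        rw [Finset.sum_apply]
        have : ∀ j ∈ range h, (fwdDiff 1)^[k + 1] (fun y : ℝ => (fwdDiff 1 φ) (y + j)) y = β := by
          intro j _
          have := fwdDiff_iter_comp_add 1 (fwdDiff 1 φ) (j : ℝ) (k + 1) y
          rw [this, ← Function.iterate_succ_apply, hφ]
        rw [sum_congr rfl this]; simp; ring
      have hβh : |β * h| = |β| * h := by rw [abs_mul, abs_of_nonneg (by positivity : (0 : ℝ) ≤ h)]
      have := hC (β * h) (fun y : ℝ => φ (y + h) - φ y) N hN (by positivity) hdiff (by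
        rw [hβh]
        refine le_trans ?_ hb
        rw [pow_succ, mul_assoc]
        have : (h : ℝ) ≤ N := by exact_mod_cast h2.le
        rw [mul_comm (h : ℝ)]
        gcongr) (M - h) (by omega)
      have e3 : ∀ n : ℕ, ee (φ (n + h : ℕ)) * (starRingEnd ℂ) (ee (φ n)) = ee (φ (n + h) - φ n) := by
        intro n; rw [ee_conj, ee_sub]; push_cast; rfl
      simp_rw [e3]
      refine this.trans ?_
      rw [hβh]
      have hNh : (1 : ℝ) ≤ N / h := by
        rw [le_div_iff₀ (by linarith)]; rw [one_mul]; exact_mod_cast h2.le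
      have e4 : |β| * h * (N : ℝ) ^ (k + 1) = x * ((N : ℝ) / h)⁻¹ := by
        rw [hx]; field_simp; ring
      rw [e4, mul_rpow hx0.le (by positivity), inv_rpow (by positivity),
        ← rpow_neg (by positivity), neg_neg, ← mul_assoc]
      gcongr
      calc ((N : ℝ) / h) ^ s ≤ (N / h) ^ (1 / 2 : ℝ) := rpow_le_rpow_of_exponent_le hNh hs1
        _ = √N * (1 / √h) := by
          rw [← sqrt_eq_rpow, sqrt_div (by positivity)]; ring
    have hv := vdc M (fun n => ee (φ n))
    have hsum : ∑ h ∈ range M, ‖∑ n ∈ range (M - h), ee (φ (n + h : ℕ)) *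
        (starRingEnd ℂ) (ee (φ n))‖ ≤ N + C * N * x ^ (-s) * (2 * N) := by
      rcases Nat.eq_zero_or_pos M with h0 | h0
      · subst h0; simp; positivity
      obtain ⟨M', rfl⟩ : ∃ M', M = M' + 1 := ⟨M - 1, by omega⟩
      rw [sum_range_succ']
      rw [add_comm]
      refine add_le_add ?_ ?_
      · refine (norm_sum_le _ _).trans ?_
        simp [ee_norm]; exact_mod_cast hM
      · calc _ ≤ ∑ h ∈ range M', C * N * x ^ (-s) * (√N * (1 / √((h : ℝ) + 1))) := by
              refine sum_le_sum fun h hh' => ?_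
              have := hh (h + 1) (by omega) (by rw [mem_range] at hh'; omega)
              push_cast at this ⊢; exact this
          _ ≤ C * N * x ^ (-s) * (√N * (2 * √N)) := by
              rw [← mul_sum, ← mul_sum]
              gcongr
              exact (sum_inv_sqrt M').trans (by gcongr; omega)
          _ = _ := by
              rw [show √(N : ℝ) * (2 * √N) = 2 * (√N * √N) by ring, mul_self_sqrt (by positivity)]
    have hfin : ‖∑ n ∈ range M, ee (φ n)‖ ^ 2 ≤ (2 * Real.pi + 4 * C) * (N ^ 2 * x ^ (-s)) := by
      nlinarith
    have e5 : √(2 * Real.pi + 4 * C) * N * x ^ (-(1 / 2 ^ (k + 1 + 1)) : ℝ) =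
        √((2 * Real.pi + 4 * C) * (N ^ 2 * x ^ (-s))) := by
      rw [sqrt_mul (by positivity), sqrt_mul (by positivity), sqrt_sq (by positivity),
        sqrt_eq_rpow (x ^ (-s)), ← rpow_mul hx0.le, mul_assoc]
      congr 3; rw [hs]; field_simp; ring
    rw [e5]
    exact Real.le_sqrt_of_sq_le hfin
open fwdDiff in
lemma taylor_phase (k : ℕ) (τ u : ℝ) (hu : 0 < u) :
    (fwdDiff 1)^[k + 1] (fun y : ℝ => τ * Real.log u - τ * ∑ i ∈ range (k + 1),
      (-y / u) ^ (i + 1) / (i + 1)) = fun _ => - τ * (-1 / u) ^ (k + 1) * k.factorial := by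
  have e : (fun y : ℝ => τ * Real.log u - τ * ∑ i ∈ range (k + 1), (-y / u) ^ (i + 1) / (i + 1))
      = ∑ i ∈ range (k + 2), (if i = 0 then τ * Real.log u else - τ * (-1 / u) ^ i / i) •
        (fun y : ℝ => y ^ i) := by
    funext y
    rw [Finset.sum_apply, sum_range_succ' _ (k + 1), mul_sum, sub_eq_add_neg,
      ← Finset.sum_neg_distrib, add_comm]
    congr 1
    · refine sum_congr rfl fun i _ => ?_
      simp only [Nat.add_eq_zero_iff, one_ne_zero, and_false, if_false, Pi.smul_apply, smul_eq_mul]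
      rw [show (-y / u) ^ (i + 1) = (-1 / u) ^ (i + 1) * y ^ (i + 1) by rw [← mul_pow]; congr 1; ring]
      push_cast; ring
    · simp
  rw [e, fwdDiff_iter_finsetSum, sum_range_succ, sum_eq_zero]
  · rw [fwdDiff_iter_const_smul, fwdDiff_iter_eq_factorial, zero_add]
    funext y
    simp only [Nat.add_eq_zero_iff, one_ne_zero, and_false, if_false, Pi.smul_apply, smul_eq_mul,
      Pi.natCast_apply]
    rw [Nat.factorial_succ]; push_cast; field_simp
  · intro i hi
    rw [fwdDiff_iter_const_smul, fwdDiff_iter_pow_eq_zero_of_lt (mem_range.mp hi), smul_zero]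
lemma weyl_block (k : ℕ) : ∃ C : ℝ, 1 ≤ C ∧ ∀ (τ Y : ℝ) (N u : ℕ), 1 ≤ N → τ ≠ 0 → 1 ≤ Y →
    Y ≤ u → u ≤ 8 * Y → 2 * (N : ℝ) ≤ Y → k.factorial * |τ| * N ^ k ≤ Y ^ (k + 1) → ∀ M ≤ N,
    ‖∑ n ∈ range M, ee (τ * Real.log (u + n))‖ ≤
      C * N * (|τ| * (N / Y) ^ (k + 1)) ^ (-(1 / 2 ^ (k + 1)) : ℝ) +
      2 * N * (|τ| * (N / Y) ^ (k + 2)) := by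
  obtain ⟨C, hC1, hC⟩ := weyl_poly k
  set s : ℝ := 1 / 2 ^ (k + 1) with hs
  have hs0 : 0 < s := by positivity
  refine ⟨C * ((8 : ℝ) ^ (k + 1)) ^ s, ?_, ?_⟩
  · have : (1 : ℝ) ≤ ((8 : ℝ) ^ (k + 1)) ^ s :=
      one_le_rpow (one_le_pow₀ (by norm_num)) hs0.le
    nlinarith
  intro τ Y N u hN hτ hY1 hYu hu8 hNY hb M hM
  have hu : (0 : ℝ) < u := by linarith
  have hY : 0 < Y := by linarith
  have hN' : (1 : ℝ) ≤ N := by exact_mod_cast hN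
  have ht : 0 < |τ| := abs_pos.mpr hτ
  have hf1 : (1 : ℝ) ≤ k.factorial := by exact_mod_cast k.factorial_pos
  set P : ℝ → ℝ := fun y : ℝ => τ * Real.log u - τ * ∑ i ∈ range (k + 1),
      (-y / u) ^ (i + 1) / (i + 1) with hP
  set β : ℝ := - τ * (-1 / u) ^ (k + 1) * k.factorial with hβ
  have hβa : |β| = |τ| * k.factorial / u ^ (k + 1) := by
    rw [hβ, abs_mul, abs_mul, abs_neg, abs_pow, abs_div, abs_neg, abs_one, abs_of_pos hu,
      abs_cast, div_pow, one_pow]; ring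
  have hβ0 : β ≠ 0 := by rw [← abs_pos, hβa]; positivity
  have h1 := hC β P N hN hβ0 (taylor_phase k τ u hu) (by
    have : |β| * N ^ k ≤ 1 := by
      rw [hβa, div_mul_eq_mul_div, div_le_one (by positivity)]
      calc |τ| * k.factorial * (N : ℝ) ^ k = k.factorial * |τ| * N ^ k := by ring
        _ ≤ Y ^ (k + 1) := hb
        _ ≤ _ := by gcongr
    linarith [pi_gt_three]) M hM
  have h2 : ∀ n ∈ range M, ‖ee (τ * Real.log (u + n)) - ee (P n)‖ ≤
      2 * (|τ| * (N / Y) ^ (k + 2)) := by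
    intro n hn
    have hnN : (n : ℝ) ≤ N := by exact_mod_cast (mem_range.mp hn).le.trans hM
    refine (ee_sub_le _ _).trans ?_
    have hx : |(-(n : ℝ) / u)| = n / u := by
      rw [abs_div, abs_neg, abs_cast, abs_of_pos hu]
    have hnu : (n : ℝ) / u ≤ N / Y := by gcongr
    have hNY2 : (N : ℝ) / Y ≤ 1 / 2 := by rw [div_le_iff₀ hY]; linarith
    have h3 := Real.abs_log_sub_add_sum_range_le (x := -(n : ℝ) / u) (by rw [hx]; linarith) (k + 1)
    rw [hx] at h3
    have e : τ * Real.log (u + n) - P n = τ * (∑ i ∈ range (k + 1),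
        (-(n : ℝ) / u) ^ (i + 1) / (i + 1) + Real.log (1 - -(n : ℝ) / u)) := by
      have : (u : ℝ) + n = u * (1 - -(n : ℝ) / u) := by field_simp; ring
      rw [this, log_mul hu.ne' (by
        have : 0 ≤ (n : ℝ) / u := by positivity
        rw [neg_div]; linarith)]
      simp only [hP]; ring
    rw [e, abs_mul, mul_left_comm]
    gcongr
    refine h3.trans ?_
    rw [div_le_iff₀ (by linarith)]
    have : ((n : ℝ) / u) ^ (k + 2) ≤ (N / Y) ^ (k + 2) := by gcongr
    have h0 : 0 ≤ ((N : ℝ) / Y) ^ (k + 2) := by positivity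
    calc _ ≤ ((N : ℝ) / Y) ^ (k + 2) := this
      _ ≤ _ := by nlinarith
  have h3 : ‖∑ n ∈ range M, ee (τ * Real.log (u + n)) - ∑ n ∈ range M, ee (P n)‖ ≤
      2 * N * (|τ| * (N / Y) ^ (k + 2)) := by
    rw [← sum_sub_distrib]
    refine (norm_sum_le _ _).trans ((sum_le_sum h2).trans ?_)
    rw [sum_const, nsmul_eq_mul, card_range, ← mul_assoc, mul_comm (M : ℝ) 2]
    gcongr
  have h4 : C * N * (|β| * N ^ (k + 1)) ^ (-s) ≤
      C * ((8 : ℝ) ^ (k + 1)) ^ s * N * (|τ| * (N / Y) ^ (k + 1)) ^ (-s) := by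
    have : (|β| * N ^ (k + 1)) ^ (-s) ≤ ((8 : ℝ) ^ (k + 1)) ^ s * (|τ| * (N / Y) ^ (k + 1)) ^ (-s) := by
      rw [rpow_neg (by positivity), rpow_neg (by positivity), ← div_eq_mul_inv,
        ← div_rpow (by positivity) (by positivity), ← inv_rpow (by positivity)]
      refine rpow_le_rpow (by positivity) ?_ hs0.le
      rw [← one_div, div_le_div_iff₀ (by positivity) (by positivity), one_mul, hβa]
      rw [show (8 : ℝ) ^ (k + 1) * (|τ| * k.factorial / u ^ (k + 1) * N ^ (k + 1)) =
        k.factorial * (|τ| * (8 * N / u) ^ (k + 1)) by rw [div_pow, mul_pow]; ring]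
      have h5 : (N : ℝ) / Y ≤ 8 * N / u := by
        rw [div_le_div_iff₀ hY hu]; nlinarith
      have h6 : |τ| * ((N : ℝ) / Y) ^ (k + 1) ≤ |τ| * (8 * N / u) ^ (k + 1) := by gcongr
      have h7 : 0 ≤ |τ| * (8 * N / u) ^ (k + 1) := by positivity
      nlinarith
    calc _ ≤ C * N * (((8 : ℝ) ^ (k + 1)) ^ s * (|τ| * (N / Y) ^ (k + 1)) ^ (-s)) := by gcongr
      _ = _ := by ring
  have h5 := norm_le_norm_add_norm_sub' (∑ n ∈ range M, ee (τ * Real.log (u + n)))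
    (∑ n ∈ range M, ee (P n))
  linarith
lemma blocks (z : ℕ → ℂ) (N : ℕ) (hN : 1 ≤ N) (B : ℝ) (u v : ℕ)
    (h : ∀ w, u < w → w ≤ v → ∀ M ≤ N, ‖∑ n ∈ range M, z (w + n)‖ ≤ B) (huv : u ≤ v) (hB : 0 ≤ B) :
    ‖∑ n ∈ Ioc u v, z n‖ ≤ (((v : ℝ) - u) / N + 1) * B := by
  have hN' : (1 : ℝ) ≤ N := by exact_mod_cast hN
  induction hd : v - u using Nat.strong_induction_on generalizing u with
  | _ d ih =>
    have hv' : (u : ℝ) ≤ v := by exact_mod_cast huv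
    rcases le_or_gt (v - u) N with h0 | h0
    · have h1 : ∑ n ∈ Ioc u v, z n = ∑ n ∈ range (v - u), z (u + 1 + n) := by
        rw [show Ioc u v = Ico (u + 1) (v + 1) by ext; simp,
          Finset.sum_Ico_eq_sum_range, show v + 1 - (u + 1) = v - u by omega]
      have h3 : 0 ≤ ((v : ℝ) - u) / N := div_nonneg (by linarith) (by linarith)
      rcases huv.eq_or_lt with h2 | h2
      · rw [← h2]; simp [hB]
      · rw [h1]; refine (h (u + 1) (by omega) (by omega) _ h0).trans ?_
        nlinarith
    · have h1 := ih (v - (u + N)) (by omega) (u + N) (fun w hw hw' => h w (by omega) hw')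
        (by omega) rfl
      have h2 : ∑ n ∈ Ioc u v, z n = ∑ n ∈ range N, z (u + 1 + n) +
          ∑ n ∈ Ioc (u + N) v, z n := by
        rw [← sum_Ioc_consecutive z (show u ≤ u + N by omega) (show u + N ≤ v by omega)]
        congr 1
        rw [show Ioc u (u + N) = Ico (u + 1) (u + N + 1) by ext; simp,
          Finset.sum_Ico_eq_sum_range, show u + N + 1 - (u + 1) = N by omega]
      rw [h2]
      refine (norm_add_le _ _).trans ((add_le_add (h (u + 1) (by omega) (by omega) N le_rfl) h1).trans
        (le_of_eq ?_))
      push_cast; field_simp; ring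
set_option maxHeartbeats 2000000 in
lemma weyl_log (A : ℕ) : ∃ c C : ℝ, 0 < c ∧ c ≤ 1 / 2 ∧ 1 ≤ C ∧ ∀ (Y τ : ℝ) (u v : ℕ), 1 ≤ Y →
    Y ^ (1 / 2 : ℝ) ≤ |τ| → |τ| ≤ Y ^ (A : ℝ) → Y ≤ u → u ≤ v → v ≤ 8 * Y →
    ‖∑ n ∈ Ioc u v, ee (τ * Real.log n)‖ ≤ C * Y ^ (1 - c) := by
  set k : ℕ := 4 * A with hk
  obtain ⟨C, hC1, hC⟩ := weyl_block k
  set s : ℝ := 1 / 2 ^ (k + 1) with hs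
  have hs0 : 0 < s := by positivity
  have hs1 : s ≤ 1 := by
    rw [hs, div_le_one (by positivity)]; exact one_le_pow₀ (by norm_num)
  set r : ℝ := 1 / (k + 3 / 2) with hr
  have hr0 : 0 < r := by positivity
  have hr1 : r ≤ 1 := by
    rw [hr, div_le_one (by positivity)]; have : (0 : ℝ) ≤ k := by positivity
    linarith
  have hrk : r * (k + 3 / 2) = 1 := by rw [hr]; field_simp
  have hAr : A * r ≤ 1 / 4 := by
    have : (k : ℝ) = 4 * A := by rw [hk]; push_cast; ring
    nlinarith
  set Y0 : ℝ := max (4 ^ (1 / r)) ((k.factorial : ℝ) ^ 2) with hY0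
  set C2 : ℝ := C * ((2 : ℝ) ^ (k + 1)) ^ s + 2 with hC2
  have hC20 : 2 ≤ C2 := by rw [hC2]; have : 0 < C * ((2 : ℝ) ^ (k + 1)) ^ s := by positivity
                           linarith
  refine ⟨r * s / 4, 8 * C2 + 7 * Y0, by positivity, by nlinarith, ?_, ?_⟩
  · have : 0 ≤ Y0 := le_trans (by positivity) (le_max_right _ _)
    linarith
  intro Y τ u v hY h1 h2 hYu huv hv8
  have hYp : 0 < Y := by linarith
  set c := r * s / 4 with hc
  have hc0 : 0 < c := by positivity
  have hc1 : c ≤ 1 / 2 := by rw [hc]; nlinarith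
  have hY00 : 0 ≤ Y0 := le_trans (by positivity) (le_max_right _ _)
  have hYc : 0 < Y ^ (1 - c) := by positivity
  have huv' : (u : ℝ) ≤ v := by exact_mod_cast huv
  rcases lt_or_ge Y Y0 with hlt | hge
  · have : ‖∑ n ∈ Ioc u v, ee (τ * Real.log n)‖ ≤ v - u := by
      refine (norm_sum_le _ _).trans ?_
      simp [ee_norm]; rw [cast_sub huv]
    have h4 : (1 : ℝ) ≤ Y ^ (1 - c) := one_le_rpow hY (by linarith)
    linarith [le_mul_of_one_le_right (show 0 ≤ 8 * C2 + 7 * Y0 by linarith) h4]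
  have ht : 0 < |τ| := lt_of_lt_of_le (by positivity) h1
  set z : ℝ := |τ| ^ (-r) with hz
  have hz0 : 0 < z := by positivity
  have hzl : Y ^ (-(1 / 4) : ℝ) ≤ z := by
    rw [hz, rpow_neg ht.le, rpow_neg hYp.le]
    gcongr
    calc |τ| ^ r ≤ (Y ^ (A : ℝ)) ^ r := by gcongr
      _ = Y ^ (A * r) := by rw [← rpow_mul hYp.le]
      _ ≤ _ := rpow_le_rpow_of_exponent_le hY hAr
  have hzu : z ≤ Y ^ (-(r / 2)) := by
    rw [hz, rpow_neg ht.le, rpow_neg hYp.le]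
    gcongr
    calc Y ^ (r / 2) = (Y ^ (1 / 2 : ℝ)) ^ r := by rw [← rpow_mul hYp.le]; ring_nf
      _ ≤ _ := by gcongr
  have hzτ : ∀ e : ℝ, |τ| * z ^ e = z ^ (e - (k + 3 / 2)) := by
    intro e
    have : |τ| = z ^ (-(k + 3 / 2) : ℝ) := by
      rw [hz, ← rpow_mul ht.le, show -r * -((k : ℝ) + 3 / 2) = 1 by linarith, rpow_one]
    nth_rewrite 1 [this]
    rw [← rpow_add hz0]; ring_nf
  have hz2 : z ≤ 1 / 2 := by
    have h3 : (2 : ℝ) ≤ Y ^ (r / 2) := by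
      calc (2 : ℝ) = (4 ^ (1 / r)) ^ (r / 2) := by
            rw [← rpow_mul (by norm_num), show 1 / r * (r / 2) = 1 / 2 by field_simp,
              ← sqrt_eq_rpow, show (4 : ℝ) = 2 ^ 2 by norm_num, sqrt_sq (by norm_num)]
        _ ≤ _ := by gcongr; exact (le_max_left _ _).trans hge
    refine hzu.trans ?_
    rw [rpow_neg hYp.le, ← one_div]; gcongr
  have hzY : 1 ≤ z * Y := by
    calc (1 : ℝ) ≤ Y ^ (3 / 4 : ℝ) := one_le_rpow hY (by norm_num)
      _ = Y ^ (-(1 / 4) : ℝ) * Y ^ (1 : ℝ) := by rw [← rpow_add hYp]; norm_num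
      _ ≤ z * Y := by rw [rpow_one]; gcongr
  set N : ℕ := ⌊z * Y⌋₊ with hN
  have hN1 : 1 ≤ N := le_floor (by simpa using hzY)
  have hN1' : (1 : ℝ) ≤ N := by exact_mod_cast hN1
  have hNle : (N : ℝ) ≤ z * Y := floor_le (by positivity)
  have hNge : z * Y / 2 ≤ N := by
    have := lt_floor_add_one (z * Y); rw [← hN] at this; linarith
  have hNYz : (N : ℝ) / Y ≤ z := by rw [div_le_iff₀ hYp]; exact hNle
  have hNYz2 : z / 2 ≤ (N : ℝ) / Y := by rw [le_div_iff₀ hYp]; linarith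
  have hfac : k.factorial * |τ| * (N : ℝ) ^ k ≤ Y ^ (k + 1) := by
    have a1 : |τ| * z ^ k ≤ Y ^ (3 / 8 : ℝ) := by
      have := hzτ k
      rw [rpow_natCast, show (k : ℝ) - (k + 3 / 2) = -(3 / 2) by ring] at this
      rw [this]
      calc z ^ (-(3 / 2) : ℝ) ≤ (Y ^ (-(1 / 4) : ℝ)) ^ (-(3 / 2) : ℝ) :=
            Real.rpow_le_rpow_of_nonpos (by positivity) hzl (by norm_num)
        _ = _ := by rw [← rpow_mul hYp.le]; norm_num
    have a2 : (k.factorial : ℝ) ≤ Y ^ (5 / 8 : ℝ) := by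
      calc (k.factorial : ℝ) = √((k.factorial : ℝ) ^ 2) := (sqrt_sq (by positivity)).symm
        _ ≤ √Y := Real.sqrt_le_sqrt ((le_max_right _ _).trans hge)
        _ = Y ^ (1 / 2 : ℝ) := sqrt_eq_rpow _
        _ ≤ _ := rpow_le_rpow_of_exponent_le hY (by norm_num)
    calc k.factorial * |τ| * (N : ℝ) ^ k ≤ k.factorial * |τ| * (z * Y) ^ k := by gcongr
      _ = k.factorial * (|τ| * z ^ k) * Y ^ k := by rw [mul_pow]; ring
      _ ≤ Y ^ (5 / 8 : ℝ) * Y ^ (3 / 8 : ℝ) * Y ^ k := by gcongr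
      _ = Y ^ (k + 1) := by rw [← rpow_add hYp]; norm_num; ring
  set B : ℝ := N * (C2 * z ^ (s / 2)) with hB
  have hblock : ∀ w : ℕ, u < w → w ≤ v → ∀ M ≤ N,
      ‖∑ n ∈ range M, ee (τ * Real.log ((w + n : ℕ) : ℝ))‖ ≤ B := by
    intro w hw hwv M hM
    have hw1 : (u : ℝ) ≤ w := by exact_mod_cast hw.le
    have hw2 : (w : ℝ) ≤ v := by exact_mod_cast hwv
    have := hC τ Y N w hN1 (abs_pos.mp ht) hY (by linarith) (by linarith)
      (by linarith [mul_le_mul_of_nonneg_right hz2 hYp.le]) hfac M hM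
    push_cast
    refine this.trans ?_
    have b1 : (|τ| * ((N : ℝ) / Y) ^ (k + 1)) ^ (-s) ≤ ((2 : ℝ) ^ (k + 1)) ^ s * z ^ (s / 2) := by
      have b2 : ((2 : ℝ) ^ (k + 1))⁻¹ * z ^ (-(1 / 2) : ℝ) ≤ |τ| * ((N : ℝ) / Y) ^ (k + 1) := by
        have := hzτ ((k + 1 : ℕ) : ℝ)
        rw [rpow_natCast, show ((k + 1 : ℕ) : ℝ) - (k + 3 / 2) = -(1 / 2) by push_cast; ring] at this
        rw [← this]
        calc _ = |τ| * (z / 2) ^ (k + 1) := by rw [div_pow]; ring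
          _ ≤ _ := by gcongr
      refine (Real.rpow_le_rpow_of_nonpos (by positivity) b2 (by linarith)).trans (le_of_eq ?_)
      rw [mul_rpow (by positivity) (by positivity), inv_rpow (by positivity),
        rpow_neg (by positivity), inv_inv, ← rpow_mul hz0.le]
      ring_nf
    have b3 : |τ| * ((N : ℝ) / Y) ^ (k + 2) ≤ z ^ (s / 2) := by
      have := hzτ ((k + 2 : ℕ) : ℝ)
      rw [rpow_natCast, show ((k + 2 : ℕ) : ℝ) - (k + 3 / 2) = 1 / 2 by push_cast; ring] at this
      calc _ ≤ |τ| * z ^ (k + 2) := by gcongr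
        _ = z ^ (1 / 2 : ℝ) := this
        _ ≤ _ := Real.rpow_le_rpow_of_exponent_ge hz0 (by linarith) (by linarith)
    calc _ ≤ C * N * (((2 : ℝ) ^ (k + 1)) ^ s * z ^ (s / 2)) + 2 * N * z ^ (s / 2) := by gcongr
      _ = _ := by rw [hB, hC2]; ring
  have hfin := blocks (fun n : ℕ => ee (τ * Real.log n)) N hN1 B u v hblock huv (by positivity)
  refine hfin.trans ?_
  have hz3 : z ^ (s / 2) ≤ Y ^ (-c) := by
    calc z ^ (s / 2) ≤ (Y ^ (-(r / 2))) ^ (s / 2) := by gcongr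
      _ = _ := by rw [← rpow_mul hYp.le, hc]; ring_nf
  have : (((v : ℝ) - u) / N + 1) * B = (v - u + N) * (C2 * z ^ (s / 2)) := by
    rw [hB]; field_simp
  rw [this]
  have hY1 : Y ^ (1 - c) = Y * Y ^ (-c) := by
    rw [sub_eq_add_neg, rpow_add hYp, rpow_one]
  calc _ ≤ (8 * Y) * (C2 * Y ^ (-c)) := by
        gcongr; linarith [mul_le_mul_of_nonneg_right hz2 hYp.le]
    _ = 8 * C2 * Y ^ (1 - c) := by rw [hY1]; ring
    _ ≤ _ := by gcongr; linarith
end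
section
noncomputable def gg (τ x : ℝ) : ℂ := x * ee (τ * Real.log x) / (1 + τ * Complex.I)
lemma one_tau_ne (τ : ℝ) : (1 + τ * Complex.I : ℂ) ≠ 0 := by
  intro h; simpa using congrArg Complex.re h
lemma one_tau_norm (τ : ℝ) : max 1 |τ| ≤ ‖(1 + τ * Complex.I : ℂ)‖ := by
  refine max_le ?_ ?_
  · simpa using abs_re_le_norm (1 + τ * Complex.I : ℂ)
  · simpa using Complex.abs_im_le_norm (1 + τ * Complex.I : ℂ)
lemma gg_deriv (τ x : ℝ) (hx : 0 < x) : HasDerivAt (gg τ) (ee (τ * Real.log x)) x := by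
  have h1 : HasDerivAt (fun x : ℝ => (x : ℂ)) 1 x := ofRealCLM.hasDerivAt
  have h2 : HasDerivAt (fun x : ℝ => ee (τ * Real.log x))
      (Complex.exp ((τ * Real.log x : ℝ) * Complex.I) * (((τ * x⁻¹ : ℝ) : ℂ) * Complex.I)) x :=
    ((((Real.hasDerivAt_log hx.ne').const_mul τ).ofReal_comp).mul_const Complex.I).cexp
  have h3 := (h1.mul h2).div_const (1 + τ * Complex.I)
  refine h3.congr_deriv ?_
  have hx' : (x : ℂ) ≠ 0 := by exact_mod_cast hx.ne'
  rw [div_eq_iff (one_tau_ne τ)]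
  simp only [ee]
  push_cast
  field_simp
lemma gg_norm (τ x : ℝ) (hx : 0 ≤ x) : ‖gg τ x‖ ≤ x / max 1 |τ| := by
  rw [gg, norm_div, norm_mul, ee_norm, mul_one, norm_real, norm_of_nonneg hx]
  gcongr; exact one_tau_norm τ
lemma gg_lip (τ x y : ℝ) (hx : 0 < x) (hxy : x ≤ y) : ‖gg τ y - gg τ x‖ ≤ y - x := by
  have := (convex_Icc x y).norm_image_sub_le_of_norm_hasDerivWithin_le (C := 1)
    (fun z hz => (gg_deriv τ z (hx.trans_le hz.1)).hasDerivWithinAt) (fun z _ => (ee_norm _).le)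
    (Set.left_mem_Icc.mpr hxy) (Set.right_mem_Icc.mpr hxy)
  rwa [one_mul, norm_of_nonneg (by linarith)] at this
lemma gg_step (τ : ℝ) (n : ℕ) (hn : 1 ≤ n) :
    ‖ee (τ * Real.log (n + 1 : ℕ)) - (gg τ (n + 1 : ℕ) - gg τ n)‖ ≤ |τ| / n := by
  have hn' : (1 : ℝ) ≤ n := by exact_mod_cast hn
  have := (convex_Icc (n : ℝ) (n + 1 : ℕ)).norm_image_sub_le_of_norm_hasDerivWithin_le (C := |τ| / n)
    (f := fun z : ℝ => gg τ z - z * ee (τ * Real.log (n + 1 : ℕ)))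
    (f' := fun z => ee (τ * Real.log z) - 1 * ee (τ * Real.log (n + 1 : ℕ)))
    (fun z hz => ((gg_deriv τ z (by linarith [hz.1])).sub
      ((ofRealCLM.hasDerivAt (x := z)).mul_const _)).hasDerivWithinAt) (fun z hz => by
      rw [one_mul]
      refine (ee_sub_le _ _).trans ?_
      rw [← mul_sub, abs_mul, div_eq_mul_inv]
      have hz0 : 0 < z := by linarith [hz.1]
      gcongr
      have hz2 := hz.2
      push_cast at hz2 ⊢
      rw [abs_sub_comm, abs_of_nonneg (sub_nonneg.mpr (log_le_log hz0 hz2)), ← log_div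
        (by positivity) (by positivity)]
      refine (log_le_sub_one_of_pos (by positivity)).trans ?_
      rw [div_sub_one hz0.ne', ← one_div]
      have := hz.1
      gcongr; linarith)
    (Set.left_mem_Icc.mpr (by push_cast; linarith)) (Set.right_mem_Icc.mpr (by push_cast; linarith))
  rw [norm_sub_rev]
  have e : ‖((n + 1 : ℕ) : ℝ) - n‖ = 1 := by push_cast; simp
  rw [e, mul_one] at this
  refine le_of_eq_of_le ?_ this
  congr 1; push_cast; ring
lemma weyl_main (A : ℕ) : ∃ c C : ℝ, 0 < c ∧ c ≤ 1 / 2 ∧ 1 ≤ C ∧ ∀ Y τ x y : ℝ, 1 ≤ Y →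
    |τ| ≤ Y ^ (A : ℝ) → Y ≤ x → x ≤ y → y ≤ 4 * Y →
    ‖∑ n ∈ Ioc ⌊x⌋₊ ⌊y⌋₊, ee (τ * Real.log n) - (gg τ y - gg τ x)‖ ≤ C * Y ^ (1 - c) := by
  obtain ⟨c, C, hc, hc2, hC, H⟩ := weyl_log (2 * A)
  refine ⟨c, C + 32, hc, hc2, by linarith, ?_⟩
  intro Y τ x y hY hτ hx hxy hy
  have hY1 : 1 ≤ Y ^ (1 - c) := one_le_rpow hY (by linarith)
  set u := ⌊x⌋₊ with hu
  set v := ⌊y⌋₊ with hv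
  have hu1 : 1 ≤ u := le_floor (by simp; linarith)
  have hux : (u : ℝ) ≤ x := floor_le (by linarith)
  have hux' := lt_floor_add_one x
  have hvy : (v : ℝ) ≤ y := floor_le (by linarith)
  have hvy' := lt_floor_add_one y
  have huv : u ≤ v := floor_mono hxy
  have hu1' : (1 : ℝ) ≤ u := by exact_mod_cast hu1
  have huv' : (u : ℝ) ≤ v := by exact_mod_cast huv
  have hYu : Y / 2 ≤ u := by linarith
  have hM : ‖∑ n ∈ Ioc u v, ee (τ * Real.log n) - (gg τ v - gg τ u)‖ ≤ (C + 30) * Y ^ (1 - c) := by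
    rcases le_or_gt |τ| (Y ^ (1 / 2 : ℝ)) with ht | ht
    · have e : gg τ v - gg τ u = ∑ n ∈ Ico u v, (gg τ (n + 1 : ℕ) - gg τ n) :=
        (Finset.sum_Ico_sub (fun n : ℕ => gg τ n) huv).symm
      have e2 : ∑ n ∈ Ioc u v, ee (τ * Real.log n) = ∑ n ∈ Ico u v,
          ee (τ * Real.log (n + 1 : ℕ)) := by
        rw [Finset.sum_Ico_add' (fun n : ℕ => ee (τ * Real.log n))]
        rw [show Ioc u v = Ico (u + 1) (v + 1) by ext; simp]
      rw [e, e2, ← sum_sub_distrib]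
      have hs : ∀ n ∈ Ico u v, ‖ee (τ * Real.log (n + 1 : ℕ)) - (gg τ (n + 1 : ℕ) - gg τ n)‖ ≤
          |τ| / (Y / 2) := by
        intro n hn
        rw [mem_Ico] at hn
        refine (gg_step τ n (hu1.trans hn.1)).trans ?_
        have : (u : ℝ) ≤ n := by exact_mod_cast hn.1
        gcongr; linarith
      refine (norm_sum_le _ _).trans ((sum_le_card_nsmul _ _ _ hs).trans ?_)
      rw [nsmul_eq_mul, card_Ico, cast_sub huv]
      have h3 : Y ^ (1 / 2 : ℝ) ≤ Y ^ (1 - c) := rpow_le_rpow_of_exponent_le hY (by linarith)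
      calc ((v : ℝ) - u) * (|τ| / (Y / 2)) ≤ 4 * Y * (|τ| / (Y / 2)) := by gcongr; linarith
        _ = 8 * |τ| := by field_simp; ring
        _ ≤ 8 * Y ^ (1 - c) := by linarith
        _ ≤ _ := by gcongr; linarith
    · have h4 : ∀ w : ℝ, 0 ≤ w → w ≤ 4 * Y → ‖gg τ w‖ ≤ 4 * Y ^ (1 - c) := by
        intro w hw hw'
        refine (gg_norm τ w hw).trans ?_
        calc w / max 1 |τ| ≤ 4 * Y / Y ^ (1 / 2 : ℝ) := by
              gcongr; exact ht.le.trans (le_max_right _ _)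
          _ = 4 * Y ^ (1 - 1 / 2 : ℝ) := by rw [rpow_sub (by linarith), rpow_one]; ring
          _ ≤ _ := by gcongr <;> linarith
      have h5 := h4 v (by linarith) (by linarith)
      have h6 := h4 u (by linarith) (by linarith)
      have h7 : ‖∑ n ∈ Ioc u v, ee (τ * Real.log n)‖ ≤ (C + 16) * Y ^ (1 - c) := by
        rcases le_or_gt 4 Y with h8 | h8
        · refine (H (Y / 2) τ u v (by linarith) ?_ ?_ hYu huv (by linarith)).trans ?_
          · exact (rpow_le_rpow (by linarith) (by linarith) (by norm_num)).trans ht.le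
          · refine hτ.trans ?_
            rw [cast_mul, rpow_mul (by linarith)]
            gcongr
            norm_num; nlinarith
          · have : (Y / 2) ^ (1 - c) ≤ Y ^ (1 - c) :=
              rpow_le_rpow (by linarith) (by linarith) (by linarith)
            have h9 := mul_le_mul_of_nonneg_left this (show 0 ≤ C by linarith)
            rw [add_mul]; linarith
        · have : ‖∑ n ∈ Ioc u v, ee (τ * Real.log n)‖ ≤ v - u := by
            refine (norm_sum_le _ _).trans ?_
            simp [ee_norm]; rw [cast_sub huv]
          rw [add_mul]
          have h9 : 0 ≤ C * Y ^ (1 - c) := by positivity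
          linarith
      refine (norm_sub_le _ _).trans ?_
      have := norm_sub_le (gg τ v) (gg τ u)
      rw [add_mul] at h7 ⊢
      linarith
  have h1 := gg_lip τ u x (by linarith) hux
  have h2 := gg_lip τ v y (by linarith) hvy
  calc _ = ‖(∑ n ∈ Ioc u v, ee (τ * Real.log n) - (gg τ v - gg τ u)) - (gg τ y - gg τ v) +
        (gg τ x - gg τ u)‖ := by congr 1; ring
    _ ≤ _ := by
      refine (norm_add_le _ _).trans ((add_le_add_left (norm_sub_le _ _) _).trans ?_)
      rw [add_mul] at hM ⊢
      linarith
end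
section
lemma gg_scale (τ Y s : ℝ) (hY : 0 < Y) : gg τ (Y * exp s) =
    gg τ Y * Complex.exp (s * (1 + τ * Complex.I)) := by
  rw [gg, gg, log_mul hY.ne' (Real.exp_ne_zero _), log_exp, mul_add, ee_add, mul_add (s : ℂ),
    Complex.exp_add, mul_one, ee, ee]
  push_cast; ring_nf
lemma geom_exp (K : ℕ) (z : ℂ) (h0 : z ≠ 0) (hz : ‖z‖ ≤ 1 / 2) (hr : ‖Complex.exp (K * z)‖ ≤ 2) :
    ‖∑ k ∈ range K, Complex.exp (k * z)‖ ≤ 6 / ‖z‖ := by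
  have h1 := Complex.norm_exp_sub_one_sub_id_le (x := z) (by linarith)
  have hz0 : 0 < ‖z‖ := norm_pos_iff.mpr h0
  have h2 : ‖z‖ / 2 ≤ ‖Complex.exp z - 1‖ := by
    have := norm_sub_norm_le z (z - (Complex.exp z - 1))
    rw [sub_sub_cancel, norm_sub_rev z] at this
    nlinarith
  have h3 : Complex.exp z ≠ 1 := by
    intro h; rw [h] at h2; simp at h2; linarith
  simp_rw [Complex.exp_nat_mul]
  rw [geom_sum_eq h3, norm_div, ← Complex.exp_nat_mul]
  calc _ ≤ (2 + 1) / (‖z‖ / 2) := by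
        gcongr; refine (norm_sub_le _ _).trans ?_; simpa using hr
    _ = _ := by field_simp; norm_num
lemma gg_avg (K : ℕ) (τ Y ε : ℝ) (hK : 1 ≤ K) (hY : 0 < Y) (hε : |ε| = 1 / 8) (hτ : |τ| ≤ K) (h0 : τ ≠ 0) :
    ‖∑ k ∈ range K, gg τ (Y * exp (ε * k / K))‖ ≤ K * (48 * Y / τ ^ 2) := by
  have hK' : (1 : ℝ) ≤ K := by exact_mod_cast hK
  have ht : 0 < |τ| := abs_pos.mpr h0
  set w : ℂ := 1 + τ * Complex.I with hw
  have hw1 := one_tau_norm τ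
  rw [← hw] at hw1
  have hw2 : |τ| ≤ ‖w‖ := (le_max_right _ _).trans hw1
  have hw3 : ‖w‖ ≤ 1 + |τ| := (norm_add_le _ _).trans (by simp)
  set z : ℂ := (ε / K : ℝ) * w with hz
  have hzn : ‖z‖ = ‖w‖ / (8 * K) := by
    rw [hz, norm_mul, norm_real, norm_eq_abs, abs_div, hε, abs_cast]; field_simp
  have e : ∀ k : ℕ, gg τ (Y * exp (ε * k / K)) = gg τ Y * Complex.exp (k * z) := by
    intro k; rw [gg_scale _ _ _ hY]; congr 2; rw [hz]; push_cast; ring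
  simp_rw [e]
  rw [← mul_sum, norm_mul]
  have h1 := geom_exp K z (by rw [← norm_pos_iff, hzn]; exact div_pos (by linarith) (by linarith))
    (by rw [hzn, div_le_iff₀ (by positivity)]; linarith) (by
      have e1 : (K : ℂ) * z = (ε : ℂ) * w := by
        have : (K : ℂ) ≠ 0 := by exact_mod_cast (by omega : K ≠ 0)
        rw [hz]; push_cast; field_simp
      rw [e1, Complex.norm_exp, hw]
      simp
      have h3 : ε ≤ 1 / 8 := (le_abs_self _).trans hε.le
      have := exp_one_lt_d9
      calc exp ε ≤ exp (1 / 8) := exp_le_exp.mpr h3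
        _ ≤ 1 / (1 - 1 / 8) := Real.exp_bound_div_one_sub_of_interval (by norm_num) (by norm_num)
        _ ≤ 2 := by norm_num)
  calc _ ≤ (Y / |τ|) * (6 / (|τ| / (8 * K))) := by
        gcongr
        · exact (gg_norm τ Y hY.le).trans (by gcongr; exact le_max_right _ _)
        · refine h1.trans ?_
          rw [hzn]; gcongr
    _ = _ := by rw [← sq_abs τ]; field_simp; norm_num
lemma sum_inv_sq_int : ∃ Z : ℝ, 0 ≤ Z ∧ ∀ (𝒯 : Finset ℤ) (t : ℤ),
    ∑ s ∈ 𝒯, 1 / ((s - t : ℤ) : ℝ) ^ 2 ≤ Z := by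
  have hs : Summable (fun n : ℤ => 1 / (n : ℝ) ^ 2) := Real.summable_one_div_int_pow.mpr (by norm_num)
  refine ⟨∑' n : ℤ, 1 / (n : ℝ) ^ 2, tsum_nonneg fun _ => by positivity, fun 𝒯 t => ?_⟩
  rw [← (Equiv.subRight t).tsum_eq]
  exact ((Equiv.subRight t).summable_iff.mpr hs).sum_le_tsum _ (fun _ _ => by positivity)
lemma hm_kernel : ∃ c C : ℝ, 0 < c ∧ c ≤ 1 / 2 ∧ 1 ≤ C ∧ ∀ (Y τ : ℝ) (K : ℕ), 3 ≤ Y → τ ≠ 0 → |τ| ≤ 2 * Y ^ 2 →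
    Y ^ c ≤ K →
    ‖∑ k ∈ range K, ∑ n ∈ Ioc ⌊Y * exp (-(1 / 8) * k / K)⌋₊
      ⌊3 * Y * exp (1 / 8 * k / K)⌋₊, ee (τ * Real.log n)‖ ≤ K * (C * (Y / τ ^ 2 + Y ^ (1 - c))) := by
  obtain ⟨c, C, hc, hc2, hC, H⟩ := weyl_main 5
  refine ⟨c, C + 192, hc, hc2, by linarith, ?_⟩
  intro Y τ K hY h0 hτ hK
  have hYc : 1 ≤ Y ^ c := one_le_rpow (by linarith) hc.le
  have hK1 : (1 : ℝ) ≤ K := hYc.trans hK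
  have ht : 0 < |τ| := abs_pos.mpr h0
  have hY1 : 0 < Y ^ (1 - c) := by positivity
  set x : ℕ → ℝ := fun k => Y * exp (-(1 / 8) * k / K) with hx
  set y : ℕ → ℝ := fun k => 3 * Y * exp (1 / 8 * k / K) with hy
  have hxy : ∀ k ∈ range K, 7 / 8 * Y ≤ x k ∧ x k ≤ Y ∧ 3 * Y ≤ y k ∧ y k ≤ 4 * (7 / 8 * Y) := by
    intro k hk
    have hk1 : (k : ℝ) / K ≤ 1 := by
      rw [div_le_one (by linarith)]; exact_mod_cast (mem_range.mp hk).le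
    have hk0 : 0 ≤ (k : ℝ) / K := by positivity
    have a1 := add_one_le_exp (-(1 / 8) * k / K)
    have a2 : exp (-(1 / 8) * k / K) ≤ 1 := exp_le_one_iff.mpr (by rw [mul_div_assoc]; linarith)
    have a3 : 1 ≤ exp (1 / 8 * k / K) := one_le_exp (by rw [mul_div_assoc]; linarith)
    have a4 : exp (1 / 8 * k / K) ≤ 8 / 7 := by
      calc _ ≤ exp (1 / 8) := exp_le_exp.mpr (by rw [mul_div_assoc]; linarith)
        _ ≤ 1 / (1 - 1 / 8) := Real.exp_bound_div_one_sub_of_interval (by norm_num) (by norm_num)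
        _ = _ := by norm_num
    rw [mul_div_assoc] at a1
    refine ⟨?_, ?_, ?_, ?_⟩ <;> simp only [hx, hy, mul_div_assoc] at * <;> nlinarith
  have hmain : ∀ k ∈ range K, ‖∑ n ∈ Ioc ⌊x k⌋₊ ⌊y k⌋₊, ee (τ * Real.log n) -
      (gg τ (y k) - gg τ (x k))‖ ≤ C * Y ^ (1 - c) := by
    intro k hk
    obtain ⟨h1, h2, h3, h4⟩ := hxy k hk
    refine (H (7 / 8 * Y) τ (x k) (y k) (by linarith) ?_ h1 (by linarith) h4).trans ?_
    · rw [rpow_natCast]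
      have : (2 : ℝ) ≤ 7 / 8 * Y := by linarith
      have h6 : (2 : ℝ) ^ 3 ≤ (7 / 8 * Y) ^ 3 := by gcongr
      have h7 : (7 / 8 * Y) ^ 5 = (7 / 8 * Y) ^ 3 * ((7 / 8) ^ 2 * Y ^ 2) := by ring
      rw [h7]
      refine hτ.trans ?_
      calc 2 * Y ^ 2 ≤ 2 ^ 3 * ((7 / 8) ^ 2 * Y ^ 2) := by nlinarith
        _ ≤ _ := by gcongr
    · gcongr; · linarith
      linarith
  have hG : ‖∑ k ∈ range K, (gg τ (y k) - gg τ (x k))‖ ≤ K * (192 * (Y / τ ^ 2 + Y ^ (1 - c))) := by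
    rcases le_or_gt |τ| K with h1 | h1
    · rw [sum_sub_distrib]
      have b1 := gg_avg K τ (3 * Y) (1 / 8) (by exact_mod_cast hK1) (by linarith) (by norm_num) h1 h0
      have b2 := gg_avg K τ Y (-(1 / 8)) (by exact_mod_cast hK1) (by linarith) (by norm_num) h1 h0
      refine (norm_sub_le _ _).trans ((add_le_add b1 b2).trans ?_)
      rw [← mul_add]; gcongr
      rw [← add_div, mul_add, mul_div_assoc']
      have : 0 ≤ 192 * Y ^ (1 - c) := by positivity
      refine le_add_of_le_of_nonneg (le_of_eq (by ring)) this
    · have : ∀ k ∈ range K, ‖gg τ (y k) - gg τ (x k)‖ ≤ 192 * (Y / τ ^ 2 + Y ^ (1 - c)) := by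
        intro k hk
        obtain ⟨h1', h2, h3, h4⟩ := hxy k hk
        have d : ∀ w, 0 ≤ w → w ≤ 4 * Y → ‖gg τ w‖ ≤ 4 * Y ^ (1 - c) := by
          intro w hw hw'
          refine (gg_norm τ w hw).trans ?_
          calc w / max 1 |τ| ≤ 4 * Y / Y ^ c := by
                gcongr; exact (hK.trans h1.le).trans (le_max_right _ _)
            _ = _ := by rw [rpow_sub (by linarith), rpow_one]; ring
        have d1 := d (y k) (by linarith) (by linarith)
        have d2 := d (x k) (by linarith) (by linarith)
        have d3 : 0 ≤ Y / τ ^ 2 := by positivity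
        refine (norm_sub_le _ _).trans ?_
        linarith
      refine (norm_sum_le _ _).trans ((sum_le_card_nsmul _ _ _ this).trans (by simp))
  have hD : ‖∑ k ∈ range K, (∑ n ∈ Ioc ⌊x k⌋₊ ⌊y k⌋₊, ee (τ * Real.log n) -
      (gg τ (y k) - gg τ (x k)))‖ ≤ K * (C * Y ^ (1 - c)) :=
    (norm_sum_le _ _).trans ((sum_le_card_nsmul _ _ _ hmain).trans (by simp))
  rw [sum_sub_distrib] at hD
  have := norm_le_norm_add_norm_sub' (∑ k ∈ range K, ∑ n ∈ Ioc ⌊x k⌋₊ ⌊y k⌋₊,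
    ee (τ * Real.log n)) (∑ k ∈ range K, (gg τ (y k) - gg τ (x k)))
  refine (this.trans (add_le_add hG hD)).trans ?_
  rw [← mul_add]; gcongr
  have d3 : 0 ≤ C * (Y / τ ^ 2) := by positivity
  rw [add_mul, mul_add C]; linarith
lemma hm : ∃ c C : ℝ, 0 < c ∧ c ≤ 1 / 2 ∧ 1 ≤ C ∧ ∀ (Y : ℝ) (𝒯 : Finset ℤ), 3 ≤ Y →
    (𝒯.card : ℝ) ≤ Y ^ c → (∀ t ∈ 𝒯, |(t : ℝ)| ≤ Y ^ 2) → ∀ (S : Finset ℕ) (b : ℕ → ℂ),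
    (∀ n ∈ S, Y < n ∧ n ≤ 3 * Y) →
    ∑ t ∈ 𝒯, ‖∑ n ∈ S, b n * ee (-t * Real.log n)‖ ^ 2 ≤ C * Y * ∑ n ∈ S, ‖b n‖ ^ 2 := by
  obtain ⟨c, C, hc, hc2, hC, H⟩ := hm_kernel
  obtain ⟨Z, hZ0, hZ⟩ := sum_inv_sq_int
  refine ⟨c, 4 + C * (Z + 1), hc, hc2, by nlinarith, ?_⟩
  intro Y 𝒯 hY hcard hT S b hS
  have hYc : 1 ≤ Y ^ c := one_le_rpow (by linarith) hc.le
  set C' := 4 + C * (Z + 1) with hC'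
  set K := ⌈Y ^ c⌉₊ with hK
  have hK1 : Y ^ c ≤ K := le_ceil _
  have hK0 : (0 : ℝ) < K := by linarith
  set I : ℕ → Finset ℕ := fun k => Ioc ⌊Y * exp (-(1 / 8) * k / K)⌋₊
      ⌊3 * Y * exp (1 / 8 * k / K)⌋₊ with hI
  have hIS : ∀ k, S ⊆ I k := by
    intro k n hn
    obtain ⟨h1, h2⟩ := hS n hn
    have a2 : exp (-(1 / 8) * k / K) ≤ 1 := exp_le_one_iff.mpr (by
      rw [mul_div_assoc]; have : 0 ≤ (k : ℝ) / K := by positivity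
      linarith)
    have a3 : 1 ≤ exp (1 / 8 * k / K) := one_le_exp (by positivity)
    simp only [hI, mem_Ioc]
    exact ⟨(Nat.floor_lt (by positivity)).mpr (by nlinarith), le_floor (by nlinarith)⟩
  have hIc : ∀ k ∈ range K, ((I k).card : ℝ) ≤ 4 * Y := by
    intro k hk
    have hk1 : (k : ℝ) / K ≤ 1 := by
      rw [div_le_one (by linarith)]; exact_mod_cast (mem_range.mp hk).le
    simp only [hI, card_Ioc]
    calc ((⌊3 * Y * exp (1 / 8 * k / K)⌋₊ - ⌊Y * exp (-(1 / 8) * k / K)⌋₊ : ℕ) : ℝ)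
        ≤ ⌊3 * Y * exp (1 / 8 * k / K)⌋₊ := by exact_mod_cast sub_le _ _
      _ ≤ 3 * Y * exp (1 / 8 * k / K) := floor_le (by positivity)
      _ ≤ 3 * Y * (1 / (1 - 1 / 8)) := by
          gcongr
          refine le_trans (exp_le_exp.mpr ?_)
            (Real.exp_bound_div_one_sub_of_interval (x := 1 / 8) (by norm_num) (by norm_num))
          rw [mul_div_assoc]; linarith
      _ ≤ _ := by linarith
  set B : ℤ → ℂ := fun t => ∑ n ∈ S, b n * ee (-t * Real.log n) with hB
  set E := ∑ t ∈ 𝒯, ‖B t‖ ^ 2 with hE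
  set D : ℕ → ℂ := fun n => ∑ t ∈ 𝒯, (starRingEnd ℂ) (B t) * ee (-t * Real.log n) with hD
  have hE0 : 0 ≤ E := sum_nonneg fun _ _ => by positivity
  have hED : E ≤ √(∑ n ∈ S, ‖b n‖ ^ 2) * √(∑ n ∈ S, ‖D n‖ ^ 2) := by
    have e1 : (E : ℂ) = ∑ n ∈ S, b n * D n := by
      rw [hE]; push_cast
      simp_rw [hD, mul_sum]
      rw [sum_comm]
      refine sum_congr rfl fun t _ => ?_
      rw [← conj_mul']
      nth_rewrite 2 [hB]
      rw [mul_sum]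
      exact sum_congr rfl fun n _ => by ring
    calc E = ‖(E : ℂ)‖ := by rw [norm_real, norm_of_nonneg hE0]
      _ ≤ ∑ n ∈ S, ‖b n‖ * ‖D n‖ := by
          rw [e1]; exact (norm_sum_le _ _).trans (sum_le_sum fun n _ => (norm_mul_le _ _))
      _ ≤ _ := Real.sum_mul_le_sqrt_mul_sqrt _ _ _
  have hDE : ∑ n ∈ S, ‖D n‖ ^ 2 ≤ C' * Y * E := by
    have h1 : K * ∑ n ∈ S, ‖D n‖ ^ 2 ≤ ∑ k ∈ range K, ∑ n ∈ I k, ‖D n‖ ^ 2 := by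
      have : ∑ k ∈ range K, ∑ n ∈ S, ‖D n‖ ^ 2 = K * ∑ n ∈ S, ‖D n‖ ^ 2 := by simp
      rw [← this]
      exact sum_le_sum fun k _ => sum_le_sum_of_subset_of_nonneg (hIS k)
        fun _ _ _ => by positivity
    set k0 : ℤ → ℤ → ℂ := fun t s => ∑ k ∈ range K, ∑ n ∈ I k,
      ee (((s - t : ℤ) : ℝ) * Real.log n) with hk0
    have h2 : ((∑ k ∈ range K, ∑ n ∈ I k, ‖D n‖ ^ 2 : ℝ) : ℂ) =
        ∑ t ∈ 𝒯, ∑ s ∈ 𝒯, (starRingEnd ℂ) (B t) * (starRingEnd ℂ) ((starRingEnd ℂ) (B s)) * k0 t s := by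
      rw [ofReal_sum]
      simp_rw [ofReal_sum, hD, normsq_sum, hk0, mul_sum]
      have sw : ∀ (J : Finset ℕ) (G : ℕ → ℤ → ℤ → ℂ), ∑ n ∈ J, ∑ t ∈ 𝒯, ∑ s ∈ 𝒯, G n t s =
          ∑ t ∈ 𝒯, ∑ s ∈ 𝒯, ∑ n ∈ J, G n t s := fun J G => by
        rw [sum_comm]; exact sum_congr rfl fun t _ => sum_comm
      simp_rw [sw]
      refine sum_congr rfl fun t _ => sum_congr rfl fun s _ =>
        sum_congr rfl fun k _ => sum_congr rfl fun n _ => ?_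
      rw [map_mul, ee_conj, mul_mul_mul_comm, ← ee_add]
      congr 2; push_cast; ring
    have h3 := schur 𝒯 (fun t => (starRingEnd ℂ) (B t)) k0 (K * (C' * Y)) (by
      intro m _ n _
      rw [← RCLike.norm_conj]
      simp only [hk0, map_sum, ee_conj]
      congr 1
      refine sum_congr rfl fun k _ => sum_congr rfl fun j _ => ?_
      congr 1; push_cast; ring) (by
      intro s hs
      have hp : ∀ t ∈ 𝒯, ‖k0 t s‖ ≤ K * (C * (Y * (1 / ((t - s : ℤ) : ℝ) ^ 2) + Y ^ (1 - c)) +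
          if t = s then 4 * Y else 0) := by
        intro t ht
        split_ifs with h
        · have : ‖k0 t s‖ ≤ K * (4 * Y) := by
            refine (norm_sum_le _ _).trans ((sum_le_card_nsmul _ _ (4 * Y) fun k hk => ?_).trans (by simp))
            refine (norm_sum_le _ _).trans ?_
            simp only [ee_norm]; simpa using hIc k hk
          refine this.trans ?_
          gcongr
          have : 0 ≤ C * (Y * (1 / ((t - s : ℤ) : ℝ) ^ 2) + Y ^ (1 - c)) := by positivity
          linarith
        · rw [add_zero]
          have h5 := H Y ((s - t : ℤ) : ℝ) K hY (by
            rw [Int.cast_ne_zero]; omega) (by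
            push_cast
            refine (abs_sub _ _).trans ?_
            linarith [hT t ht, hT s hs]) hK1
          refine h5.trans (le_of_eq ?_)
          rw [show ((s - t : ℤ) : ℝ) ^ 2 = ((t - s : ℤ) : ℝ) ^ 2 by push_cast; ring, mul_one_div]
      refine (sum_le_sum hp).trans ?_
      rw [← mul_sum]
      gcongr
      rw [sum_add_distrib, sum_ite_eq' 𝒯 s, if_pos hs, ← mul_sum,
        sum_add_distrib, ← mul_sum, sum_const, nsmul_eq_mul]
      have h6 := hZ 𝒯 s
      have h7 : (𝒯.card : ℝ) * Y ^ (1 - c) ≤ Y := by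
        calc _ ≤ Y ^ c * Y ^ (1 - c) := by gcongr
          _ = Y := by rw [← rpow_add (by linarith)]; simp
      calc _ ≤ C * (Y * Z + Y) + 4 * Y := by gcongr
        _ = C' * Y := by rw [hC']; ring)
    rw [← h2, norm_real, norm_eq_abs] at h3
    have h4 := h1.trans ((le_abs_self _).trans h3)
    simp only [RCLike.norm_conj] at h4
    rw [mul_assoc] at h4
    exact le_of_mul_le_mul_left h4 hK0
  have hC'0 : 0 ≤ C' * Y := by rw [hC']; positivity
  have hb : 0 ≤ ∑ n ∈ S, ‖b n‖ ^ 2 := sum_nonneg fun _ _ => by positivity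
  rcases hE0.eq_or_lt with h | h
  · rw [← h]; positivity
  have h8 : E * E ≤ (C' * Y * ∑ n ∈ S, ‖b n‖ ^ 2) * E := by
    calc E * E ≤ (√(∑ n ∈ S, ‖b n‖ ^ 2) * √(∑ n ∈ S, ‖D n‖ ^ 2)) * (√(∑ n ∈ S, ‖b n‖ ^ 2) * √(∑ n ∈ S, ‖D n‖ ^ 2)) := by
          gcongr
      _ = (∑ n ∈ S, ‖b n‖ ^ 2) * ∑ n ∈ S, ‖D n‖ ^ 2 := by
          rw [mul_mul_mul_comm, mul_self_sqrt hb, mul_self_sqrt (sum_nonneg fun _ _ => by positivity)]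
      _ ≤ (∑ n ∈ S, ‖b n‖ ^ 2) * (C' * Y * E) := by gcongr
      _ = _ := by ring
  exact le_of_mul_le_mul_right h8 h
end
section
/-- number of elements of `P` dividing `n` -/
noncomputable def om (P : Finset ℕ) (n : ℕ) : ℝ := ∑ p ∈ P, if p ∣ n then (1 : ℝ) else 0
noncomputable def sumInv (P : Finset ℕ) : ℝ := ∑ p ∈ P, 1 / (p : ℝ)
lemma om_nonneg (P : Finset ℕ) (n : ℕ) : 0 ≤ om P n :=
  sum_nonneg fun _ _ => by split_ifs <;> norm_num
lemma card_dvd (N d : ℕ) : ∑ n ∈ Ioc 0 N, (if d ∣ n then (1 : ℝ) else 0) = (N / d : ℕ) := by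
  rw [← sum_filter, sum_const, nsmul_eq_mul, mul_one, Nat.Ioc_filter_dvd_card_eq_div]
lemma turan_kubilius (P : Finset ℕ) (N : ℕ) (hP : ∀ p ∈ P, p.Prime ∧ p ≤ N) :
    ∑ n ∈ Ioc 0 N, (om P n - sumInv P) ^ 2 ≤ 3 * N * sumInv P := by
  set L := sumInv P with hL
  have hL0 : 0 ≤ L := sum_nonneg fun _ _ => by positivity
  have h1 : N * L - N ≤ ∑ n ∈ Ioc 0 N, om P n := by
    unfold om
    rw [sum_comm]
    simp_rw [card_dvd]
    have hc : (P.card : ℝ) ≤ N := by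
      have : P ⊆ Ioc 0 N := fun p hp => mem_Ioc.mpr ⟨(hP p hp).1.pos, (hP p hp).2⟩
      exact_mod_cast (card_le_card this).trans (by simp)
    have : ∑ p ∈ P, ((N : ℝ) * (1 / p) - 1) ≤ ∑ p ∈ P, ((N / p : ℕ) : ℝ) := by
      refine sum_le_sum fun p hp => ?_
      have := lt_floor_add_one ((N : ℝ) / p)
      rw [Nat.floor_div_eq_div] at this
      rw [mul_one_div]; linarith
    rw [sum_sub_distrib, ← mul_sum] at this
    simp at this
    have h2 : ∑ p ∈ P, ((p : ℝ))⁻¹ = L := by simp [hL, sumInv]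
    rw [h2] at this
    linarith
  have h2 : ∑ n ∈ Ioc 0 N, om P n ^ 2 ≤ N * L ^ 2 + N * L := by
    have e : ∀ n, om P n ^ 2 = ∑ p ∈ P, ∑ q ∈ P, if p ∣ n ∧ q ∣ n then (1 : ℝ) else 0 := by
      intro n
      rw [sq, om, sum_mul_sum]
      refine sum_congr rfl fun p _ => sum_congr rfl fun q _ => ?_
      rw [ite_and]; split_ifs <;> simp
    simp_rw [e]
    rw [sum_comm]
    have e2 : N * L ^ 2 + N * L = ∑ p ∈ P, ∑ q ∈ P, ((N : ℝ) * (1 / p * (1 / q)) + if p = q then N * (1 / (p : ℝ)) else 0) := by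
      simp_rw [sum_add_distrib, sum_ite_eq, ← mul_sum]
      rw [← sum_mul, hL, sumInv, sum_ite_mem, Finset.inter_self, ← mul_sum]; ring
    rw [e2]
    refine sum_le_sum fun p hp => ?_
    rw [sum_comm]
    refine sum_le_sum fun q hq => ?_
    have hp0 : (0 : ℝ) < p := by exact_mod_cast (hP p hp).1.pos
    have hq0 : (0 : ℝ) < q := by exact_mod_cast (hP q hq).1.pos
    split_ifs with h
    · subst h
      simp only [and_self, card_dvd]
      have : ((N / p : ℕ) : ℝ) ≤ N / p := cast_div_le
      have h9 : (N : ℝ) * (1 / p) = N / p := mul_one_div _ _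
      have : 0 ≤ (N : ℝ) * (1 / p * (1 / p)) := by positivity
      linarith
    · have hc := (coprime_primes (hP p hp).1 (hP q hq).1).mpr h
      have : ∀ n, (p ∣ n ∧ q ∣ n) ↔ p * q ∣ n := fun n =>
        ⟨fun h => hc.mul_dvd_of_dvd_of_dvd h.1 h.2, fun h => ⟨dvd_of_mul_right_dvd h, dvd_of_mul_left_dvd h⟩⟩
      simp_rw [this, card_dvd]
      refine cast_div_le.trans (le_of_eq ?_)
      push_cast; field_simp; ring
  have e : ∑ n ∈ Ioc 0 N, (om P n - L) ^ 2 = ∑ n ∈ Ioc 0 N, om P n ^ 2 -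
      2 * L * ∑ n ∈ Ioc 0 N, om P n + N * L ^ 2 := by
    have : ∀ n, (om P n - L) ^ 2 = om P n ^ 2 - 2 * L * om P n + L ^ 2 := fun n => by ring
    simp_rw [this, sum_add_distrib, sum_sub_distrib, ← mul_sum]
    simp
  rw [e]; nlinarith
/-- multiplication of a prime polynomial with a polynomial -/
lemma poly_mul (G : ℕ → ℂ) (hG : ∀ m n, G (m * n) = G m * G n) (P S S' : Finset ℕ) (hP : ∀ p ∈ P, 0 < p)
    (hS' : ∀ p ∈ P, ∀ m ∈ S, p * m ∈ S') (k : ℕ → ℝ) :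
    (∑ p ∈ P, G p) * ∑ m ∈ S, (k m : ℂ) * G m =
      ∑ n ∈ S', ((∑ p ∈ P, if p ∣ n ∧ n / p ∈ S then k (n / p) else 0 : ℝ) : ℂ) * G n := by
  rw [sum_mul]
  simp_rw [ofReal_sum, sum_mul]
  rw [sum_comm]
  refine sum_congr rfl fun p hp => ?_
  have hp0 := hP p hp
  rw [mul_sum]
  have : ∀ n ∈ S', (((if p ∣ n ∧ n / p ∈ S then k (n / p) else 0 : ℝ)) : ℂ) * G n =
      if n ∈ S.image (p * ·) then ((k (n / p) : ℝ) : ℂ) * G n else 0 := by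
    intro n _
    by_cases h : p ∣ n ∧ n / p ∈ S
    · rw [if_pos h, if_pos]
      exact mem_image.mpr ⟨n / p, h.2, mul_div_cancel' h.1⟩
    · rw [if_neg h, if_neg]; · simp
      intro h2
      obtain ⟨m, hm, rfl⟩ := mem_image.mp h2
      exact h ⟨dvd_mul_right _ _, by rwa [Nat.mul_div_cancel_left _ hp0]⟩
  rw [sum_congr rfl this, sum_ite_mem, Finset.inter_eq_right.mpr (fun n hn => by
    obtain ⟨m, hm, rfl⟩ := mem_image.mp hn; exact hS' p hp m hm),
    sum_image (fun a _ b _ h => eq_of_mul_eq_mul_left hp0 h)]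
  refine sum_congr rfl fun m _ => ?_
  rw [Nat.mul_div_cancel_left _ hp0, hG]; ring
/-- moments of `om` -/
lemma moment (P : Finset ℕ) (N k : ℕ) (hP : ∀ p ∈ P, p.Prime) :
    ∑ n ∈ Ioc 0 N, om P n ^ k ≤ k.factorial * N * exp (2 * sumInv P) := by
  have h1 : ∀ n, om P n ^ k ≤ k.factorial * ∏ p ∈ P, (1 + if p ∣ n then (2 : ℝ) else 0) := by
    intro n
    have h0 := om_nonneg P n
    have h2 : om P n ^ k / k.factorial ≤ exp (om P n) := Real.pow_div_factorial_le_exp _ h0 k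
    rw [div_le_iff₀ (by positivity)] at h2
    refine h2.trans ?_
    rw [mul_comm, om, exp_sum]
    gcongr with p hp
    split_ifs
    · linarith [exp_one_lt_d9]
    · simp
  have h2 : ∑ n ∈ Ioc 0 N, ∏ p ∈ P, (1 + if p ∣ n then (2 : ℝ) else 0) ≤
      N * ∏ p ∈ P, (1 + 2 * (1 / (p : ℝ))) := by
    simp_rw [Finset.prod_one_add]
    rw [sum_comm, mul_sum]
    refine sum_le_sum fun D hD => ?_
    have hD' := Finset.mem_powerset.mp hD
    have : ∀ n, ∏ p ∈ D, (if p ∣ n then (2 : ℝ) else 0) = 2 ^ D.card * if (∏ p ∈ D, p) ∣ n then 1 else 0 := by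
      intro n
      by_cases h : ∀ p ∈ D, p ∣ n
      · rw [if_pos (Finset.prod_primes_dvd n (fun p hp => (hP p (hD' hp)).prime) h), mul_one,
          prod_congr rfl (fun p hp => if_pos (h p hp)), prod_const]
      · rw [if_neg (fun h' => h fun p hp => (Finset.dvd_prod_of_mem _ hp).trans h'), mul_zero]
        push Not at h
        obtain ⟨p, hp, h⟩ := h
        exact Finset.prod_eq_zero hp (if_neg h)
    simp_rw [this]
    rw [← mul_sum, card_dvd, Finset.prod_mul_distrib, prod_const]
    calc (2 : ℝ) ^ D.card * ((N / ∏ p ∈ D, p : ℕ) : ℝ) ≤ 2 ^ D.card * (N / ((∏ p ∈ D, p : ℕ) : ℝ)) := by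
          gcongr; exact cast_div_le
      _ = _ := by push_cast; simp only [one_div]; rw [Finset.prod_inv_distrib]; ring
  have h3 : ∏ p ∈ P, (1 + 2 * (1 / (p : ℝ))) ≤ exp (2 * sumInv P) := by
    rw [sumInv, mul_sum, exp_sum]
    gcongr with p hp
    linarith [add_one_le_exp (2 * (1 / (p : ℝ)))]
  calc _ ≤ ∑ n ∈ Ioc 0 N, k.factorial * ∏ p ∈ P, (1 + if p ∣ n then (2 : ℝ) else 0) :=
        sum_le_sum fun n _ => h1 n
    _ ≤ k.factorial * (N * exp (2 * sumInv P)) := by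
        rw [← mul_sum]; gcongr; exact h2.trans (by gcongr)
    _ = _ := by ring
end
section
/-- primes in (x,y] -/
noncomputable def prs (x y : ℝ) : Finset ℕ := (Ioc ⌊x⌋₊ ⌊y⌋₊).filter Nat.Prime
lemma mem_Iof {x y : ℝ} (hx : 0 ≤ x) (hy : 0 ≤ y) {n : ℕ} :
    n ∈ Ioc ⌊x⌋₊ ⌊y⌋₊ ↔ x < n ∧ (n : ℝ) ≤ y := by
  rw [mem_Ioc, Nat.floor_lt hx, Nat.le_floor_iff hy]
lemma mem_prs {x y : ℝ} (hx : 0 ≤ x) (hy : 0 ≤ y) {p : ℕ} :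
    p ∈ prs x y ↔ (x < p ∧ (p : ℝ) ≤ y) ∧ p.Prime := by
  rw [prs, mem_filter, mem_Iof hx hy]
lemma prs_sum_split {x y z : ℝ} (hxy : x ≤ y) (hyz : y ≤ z) {M : Type*} [AddCommMonoid M] (F : ℕ → M) :
    ∑ p ∈ prs x z, F p = ∑ p ∈ prs x y, F p + ∑ p ∈ prs y z, F p := by
  simp only [prs, sum_filter]
  exact (sum_Ioc_consecutive _ (floor_mono hxy) (floor_mono hyz)).symm
lemma theta_diff : ∃ x0 : ℝ, 1 ≤ x0 ∧ ∀ x, x0 ≤ x → x ≤ Chebyshev.theta (8 * x) - Chebyshev.theta x := by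
  have h1 : Tendsto (fun y : ℝ => (Real.log (y + 2)) / (y + 2)) atTop (𝓝 0) := by
    have := (Real.isLittleO_log_id_atTop).tendsto_div_nhds_zero
    exact this.comp (tendsto_atTop_add_const_right _ 2 tendsto_id)
  have h2 : Tendsto (fun y : ℝ => Real.log y / y ^ (1 / 2 : ℝ)) atTop (𝓝 0) :=
    (isLittleO_log_rpow_atTop (by norm_num)).tendsto_div_nhds_zero
  obtain ⟨a, ha⟩ := eventually_atTop.mp ((h1.eventually (gt_mem_nhds (show (0:ℝ) < 1/32 by norm_num))).and
    (h2.eventually (gt_mem_nhds (show (0:ℝ) < 1/64 by norm_num))))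
  refine ⟨max 1 a, le_max_left _ _, fun x hx => ?_⟩
  have hx1 : 1 ≤ x := (le_max_left _ _).trans hx
  obtain ⟨h3, h4⟩ := ha (8 * x) (by linarith [(le_max_right (1:ℝ) a).trans hx])
  rw [div_lt_iff₀ (by linarith)] at h3
  rw [← sqrt_eq_rpow, div_lt_iff₀ (sqrt_pos.mpr (by linarith))] at h4
  have h5 := Chebyshev.theta_ge' (show 1 ≤ 8 * x by linarith)
  have h6 := Chebyshev.theta_le_log4_mul_x (show 0 ≤ x by linarith)
  have h7 : Real.log 4 = 2 * Real.log 2 := by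
    rw [show (4:ℝ) = 2 ^ 2 by norm_num, log_pow]; norm_num
  have h8 : 2 * √(8 * x) * Real.log (8 * x) ≤ 2 * √(8 * x) * (1 / 64 * √(8 * x)) := by gcongr
  have h9 : √(8 * x) * √(8 * x) = 8 * x := mul_self_sqrt (by linarith)
  have l1 := log_two_gt_d9
  have l2 := log_two_lt_d9
  have h10 : (8 * x - 1) * 0.69 ≤ (8 * x - 1) * Real.log 2 := by gcongr; · linarith
                                                                 · linarith
  have h11 : Real.log 4 * x ≤ 1.4 * x := by gcongr; linarith
  linarith
lemma prs_block : ∃ x0 : ℝ, 1 ≤ x0 ∧ ∀ x, x0 ≤ x → 1 / (8 * Real.log (8 * x)) ≤ sumInv (prs x (8 * x)) ∧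
    x / Real.log (8 * x) ≤ (prs x (8 * x)).card := by
  obtain ⟨x0, h0, hx0⟩ := theta_diff
  refine ⟨x0, h0, fun x hx => ?_⟩
  have hx1 := h0.trans hx
  have hl : 0 < Real.log (8 * x) := log_pos (by linarith)
  have e : Chebyshev.theta (8 * x) - Chebyshev.theta x = ∑ p ∈ prs x (8 * x), Real.log p := by
    rw [Chebyshev.theta, Chebyshev.theta, prs, sum_filter, sum_filter, sum_filter,
      ← sum_Ioc_consecutive _ (Nat.zero_le ⌊x⌋₊) (floor_mono (by linarith : x ≤ 8 * x))]
    ring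
  have h1 := hx0 x hx
  rw [e] at h1
  have h2 : ∑ p ∈ prs x (8 * x), Real.log p ≤ (prs x (8 * x)).card * Real.log (8 * x) := by
    rw [← nsmul_eq_mul]
    refine sum_le_card_nsmul _ _ _ fun p hp => ?_
    rw [mem_prs (by linarith) (by linarith)] at hp
    exact log_le_log (by linarith [hp.1.1]) hp.1.2
  have h3 : x / Real.log (8 * x) ≤ (prs x (8 * x)).card := by rw [div_le_iff₀ hl]; linarith
  refine ⟨?_, h3⟩
  calc 1 / (8 * Real.log (8 * x)) = (x / Real.log (8 * x)) * (1 / (8 * x)) := by field_simp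
    _ ≤ (prs x (8 * x)).card * (1 / (8 * x)) := by gcongr
    _ ≤ _ := by
      rw [← nsmul_eq_mul]
      refine Finset.card_nsmul_le_sum _ _ _ fun p hp => ?_
      rw [mem_prs (by linarith) (by linarith)] at hp
      have : 0 < (p : ℝ) := by linarith [hp.1.1]
      exact one_div_le_one_div_of_le this hp.1.2
lemma sumInv_nonneg (P : Finset ℕ) : 0 ≤ sumInv P := sum_nonneg fun _ _ => by positivity
/-- Mertens lower bound -/
lemma mertens : ∃ a0 : ℝ, 1 ≤ a0 ∧ ∀ a b, a0 ≤ a → a ≤ b →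
    (Real.log b - Real.log (a + 3)) / 24 ≤ sumInv (prs (exp a) (exp b)) := by
  obtain ⟨x0, h0, hx0⟩ := prs_block
  have hk : Real.log 8 ≤ 3 := by
    have := log_two_lt_d9
    rw [show (8:ℝ) = 2 ^ 3 by norm_num, log_pow]; push_cast; linarith
  have hk0 : 0 < Real.log 8 := log_pos (by norm_num)
  refine ⟨max 1 x0, le_max_left _ _, fun a b ha hab => ?_⟩
  have ha1 : 1 ≤ a := (le_max_left _ _).trans ha
  have key : ∀ n : ℕ, (Real.log (a + Real.log 8 * (n + 1)) - Real.log (a + Real.log 8)) / 24 ≤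
      sumInv (prs (exp a) (exp (a + Real.log 8 * n))) := by
    intro n
    induction n with
    | zero => simpa using sumInv_nonneg _
    | succ n ih =>
      have hx : exp (a + Real.log 8 * n) ≥ x0 := by
        have := add_one_le_exp (a + Real.log 8 * n)
        have h2 : 0 ≤ Real.log 8 * n := by positivity
        linarith [(le_max_right (1:ℝ) x0).trans ha]
      have h1 := (hx0 _ hx).1
      have e1 : 8 * exp (a + Real.log 8 * n) = exp (a + Real.log 8 * (n + 1)) := by
        rw [show a + Real.log 8 * (n + 1) = Real.log 8 + (a + Real.log 8 * n) by ring,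
          exp_add (Real.log 8), exp_log (by norm_num)]
      rw [e1, log_exp] at h1
      rw [sumInv, prs_sum_split (y := exp (a + Real.log 8 * n)) (by gcongr; nlinarith [(cast_nonneg n : (0:ℝ) ≤ n)])
        (by gcongr; simp)]
      push_cast
      have hz : 0 < a + Real.log 8 * (n + 1) := by positivity
      have h3 : Real.log (a + Real.log 8 * (n + 1 + 1)) - Real.log (a + Real.log 8 * (n + 1)) ≤
          Real.log 8 / (a + Real.log 8 * (n + 1)) := by
        rw [← log_div (by positivity) hz.ne']
        refine (log_le_sub_one_of_pos (by positivity)).trans (le_of_eq ?_)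
        field_simp; ring
      have h4 : Real.log 8 / (a + Real.log 8 * (n + 1)) ≤ 3 / (a + Real.log 8 * (n + 1)) := by gcongr
      have h5 : 1 / (8 * (a + Real.log 8 * (n + 1))) = 3 / (a + Real.log 8 * (n + 1)) / 24 := by field_simp; norm_num
      simp only [sumInv] at ih h1
      linarith
  have hf := floor_le (show 0 ≤ (b - a) / Real.log 8 by apply div_nonneg <;> linarith)
  have hf2 := lt_floor_add_one ((b - a) / Real.log 8)
  set n := ⌊(b - a) / Real.log 8⌋₊
  rw [le_div_iff₀ hk0] at hf
  rw [div_lt_iff₀ hk0] at hf2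
  have h1 := key n
  have h2 : sumInv (prs (exp a) (exp (a + Real.log 8 * n))) ≤ sumInv (prs (exp a) (exp b)) := by
    rw [sumInv, sumInv, prs_sum_split (z := exp b) (y := exp (a + Real.log 8 * n)) (by gcongr; simp; positivity)
      (by gcongr; linarith)]
    have := sumInv_nonneg (prs (exp (a + Real.log 8 * n)) (exp b))
    simp only [sumInv] at this
    linarith
  have h3 : Real.log b ≤ Real.log (a + Real.log 8 * (n + 1)) := log_le_log (by linarith) (by linarith)
  have h4 : Real.log (a + Real.log 8) ≤ Real.log (a + 3) := log_le_log (by linarith) (by linarith)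
  linarith
end
section
noncomputable def GG (f : ℕ → ℂ) (t : ℤ) (n : ℕ) : ℂ := f n / n * ee (-t * Real.log n)
lemma GG_mul {f : ℕ → ℂ} (hf : ∀ m n, f (m * n) = f m * f n) (t : ℤ) (m n : ℕ) :
    GG f t (m * n) = GG f t m * GG f t n := by
  rcases eq_or_ne m 0 with rfl | hm
  · simp [GG]
  rcases eq_or_ne n 0 with rfl | hn
  · simp [GG]
  simp only [GG]
  rw [hf, cast_mul, cast_mul, log_mul (by exact_mod_cast hm) (by exact_mod_cast hn), mul_add, ee_add]
  field_simp
noncomputable def DD (f : ℕ → ℂ) (X Y : ℝ) (t : ℤ) : ℂ := ∑ n ∈ Ioc ⌊X⌋₊ ⌊Y⌋₊, GG f t n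
/-- the v-th block of primes -/
noncomputable def Iv (h : ℝ) (v : ℕ) : Finset ℕ := prs (exp (v / h)) (exp ((v + 1) / h))
noncomputable def QQ (f : ℕ → ℂ) (h : ℝ) (v : ℕ) (t : ℤ) : ℂ := ∑ p ∈ Iv h v, GG f t p
lemma mem_Iv {h : ℝ} {v p : ℕ} : p ∈ Iv h v ↔ (exp (v / h) < p ∧ (p : ℝ) ≤ exp ((v + 1) / h)) ∧ p.Prime :=
  mem_prs (exp_pos _).le (exp_pos _).le
lemma Iv_union {h : ℝ} (hh : 0 < h) {V0 V1 : ℕ} (hV : V0 ≤ V1) {M : Type*} [AddCommMonoid M] (F : ℕ → M) :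
    ∑ v ∈ Ico V0 V1, ∑ p ∈ Iv h v, F p = ∑ p ∈ prs (exp (V0 / h)) (exp (V1 / h)), F p := by
  induction V1, hV using le_induction with
  | base => simp [prs]
  | succ n hn ih =>
    rw [sum_Ico_succ_top hn, ih, prs_sum_split (z := exp ((n + 1 : ℕ) / h)) (y := exp (n / h))]
    · simp [Iv]
    · gcongr
    · gcongr; simp
lemma exp_inv_le {h : ℝ} (hh : 3 ≤ h) : exp (1 / h) ≤ 1 + 2 / h := by
  have h1 : 1 / h ≤ 1 / 3 := one_div_le_one_div_of_le (by norm_num) hh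
  have h0 : 0 ≤ 1 / h := by positivity
  have := Real.exp_bound_div_one_sub_of_interval h0 (by linarith)
  refine this.trans ?_
  rw [div_le_iff₀ (by linarith), show 2 / h = 2 * (1 / h) by ring]
  nlinarith
set_option maxHeartbeats 1000000 in
/-- factorization -/
lemma factor {f : ℕ → ℂ} (hf : ∀ m n, f (m * n) = f m * f n) (hb : ∀ n, ‖f n‖ ≤ 1) {h X : ℝ} (hh : 4 ≤ h) (hX : h ≤ X)
    {V0 V1 : ℕ} (hV : V0 ≤ V1) (hVX : exp (V1 / h) ≤ X)
    (hL : 0 < sumInv (prs (exp (V0 / h)) (exp (V1 / h)))) :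
    ∃ b : ℕ → ℂ, (∀ t : ℤ, DD f X (2 * X) t = (1 / sumInv (prs (exp (V0 / h)) (exp (V1 / h))) : ℝ) *
      ∑ v ∈ Ico V0 V1, QQ f h v t * DD f (X * exp (-(v / h))) (2 * (X * exp (-(v / h)))) t +
      ∑ n ∈ Ioc ⌊X⌋₊ ⌊3 * X⌋₊, b n * ee (-t * Real.log n)) ∧
      ∑ n ∈ Ioc ⌊X⌋₊ ⌊3 * X⌋₊, ‖b n‖ ^ 2 ≤
        64 / X * (1 / sumInv (prs (exp (V0 / h)) (exp (V1 / h))) + 1 / h) := by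
  have k1 : ∀ z : ℝ, (1 + z) ^ 2 ≤ 2 * (z - 1) ^ 2 + 8 := fun z => by linarith [sq_nonneg (z - 3)]
  have k2 : ∀ z : ℝ, (1 - z) ^ 2 ≤ 2 * (z - 1) ^ 2 := fun z => by linarith [sq_nonneg (z - 1)]
  set P := prs (exp (V0 / h)) (exp (V1 / h)) with hP
  set L := sumInv P with hLdef
  have h0 : 0 < h := by linarith
  have X0 : 0 < X := by linarith
  have he := exp_inv_le (show 3 ≤ h by linarith)
  have h2h : 2 / h ≤ 2 / 4 := by gcongr
  have he' : exp (1 / h) ≤ 3 / 2 := by linarith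
  set S : ℕ → Finset ℕ := fun v => Ioc ⌊X * exp (-(v / h))⌋₊ ⌊2 * (X * exp (-(v / h)))⌋₊ with hS
  have mS : ∀ v n : ℕ, n ∈ S v ↔ X * exp (-(v / h)) < n ∧ (n : ℝ) ≤ 2 * (X * exp (-(v / h))) := fun v n =>
    mem_Iof (by positivity) (by positivity)
  have mN : ∀ n : ℕ, n ∈ Ioc ⌊X⌋₊ ⌊3 * X⌋₊ ↔ X < n ∧ (n : ℝ) ≤ 3 * X := fun n =>
    mem_Iof (by positivity) (by positivity)
  set c : ℕ → ℝ := fun n => ∑ v ∈ Ico V0 V1, ∑ p ∈ Iv h v, if p ∣ n ∧ n / p ∈ S v then 1 else 0 with hc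
  have om_eq : ∀ n, om P n = ∑ v ∈ Ico V0 V1, ∑ p ∈ Iv h v, if p ∣ n then (1 : ℝ) else 0 := fun n => by
    rw [Iv_union h0 hV, om]
  have ev : ∀ v : ℕ, exp (-(v / h)) * exp ((v + 1) / h) = exp (1 / h) := fun v => by
    rw [← exp_add]; congr 1; field_simp; ring
  have ev' : ∀ v : ℕ, exp (-(v / h)) * exp (v / h) = 1 := fun v => by
    rw [← exp_add]; simp
  have prodmem : ∀ v, ∀ p ∈ Iv h v, ∀ m ∈ S v, X < (p * m : ℕ) ∧ ((p * m : ℕ) : ℝ) ≤ 2 * X * exp (1 / h) := by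
    intro v p hp m hm
    rw [mem_Iv] at hp; rw [mS] at hm
    push_cast
    constructor
    · calc X = exp (v / h) * (X * exp (-(v / h))) := by rw [mul_left_comm, mul_comm (exp _), ev', mul_one]
        _ < p * m := mul_lt_mul'' hp.1.1 hm.1 (exp_pos _).le (by positivity)
    · calc (p : ℝ) * m ≤ exp ((v + 1) / h) * (2 * (X * exp (-(v / h)))) := by gcongr; exacts [hp.1.2, hm.2]
        _ = 2 * X * (exp (-(v / h)) * exp ((v + 1) / h)) := by ring
        _ = _ := by rw [ev]
  have c_nonneg : ∀ n, 0 ≤ c n := fun n => sum_nonneg fun v _ => sum_nonneg fun p _ => by split_ifs <;> norm_num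
  have c_le : ∀ n, c n ≤ om P n := fun n => by
    rw [om_eq]
    refine sum_le_sum fun v _ => sum_le_sum fun p _ => ?_
    split_ifs with h1 h2 h2
    exacts [le_rfl, absurd h1.1 h2, zero_le_one, le_rfl]
  have c_zero : ∀ n : ℕ, 2 * X * exp (1 / h) < n → c n = 0 := fun n hn =>
    sum_eq_zero fun v _ => sum_eq_zero fun p hp => if_neg fun hc => by
      have := (prodmem v p hp _ hc.2).2
      rw [mul_div_cancel' hc.1] at this; linarith
  have c_mid : ∀ n : ℕ, X * exp (1 / h) < n → (n : ℝ) ≤ 2 * X → c n = om P n := fun n h1 h2 => by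
    rw [om_eq]
    refine sum_congr rfl fun v _ => sum_congr rfl fun p hp => ?_
    refine if_congr (and_iff_left_of_imp fun hpn => ?_) rfl rfl
    rw [mem_Iv] at hp
    have hp0 : (0:ℝ) < p := (exp_pos _).trans hp.1.1
    rw [mS, Nat.cast_div hpn hp0.ne', lt_div_iff₀ hp0, div_le_iff₀ hp0]
    constructor
    · calc X * exp (-(v / h)) * p ≤ X * exp (-(v / h)) * exp ((v + 1) / h) := by gcongr; exact hp.1.2
        _ = X * exp (1 / h) := by rw [mul_assoc, ev]
        _ < n := h1
    · calc (n : ℝ) ≤ 2 * X * 1 := by linarith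
        _ = 2 * (X * exp (-(v / h))) * exp (v / h) := by rw [← ev' v]; ring
        _ ≤ _ := by gcongr; exact hp.1.1.le
  set β : ℕ → ℝ := fun n => (if (n : ℝ) ≤ 2 * X then 1 else 0) - c n / L with hβ
  refine ⟨fun n => (β n : ℂ) * (f n / n), fun t => ?_, ?_⟩
  · have e1 : ∑ v ∈ Ico V0 V1, QQ f h v t * DD f (X * exp (-(v / h))) (2 * (X * exp (-(v / h)))) t =
        ∑ n ∈ Ioc ⌊X⌋₊ ⌊3 * X⌋₊, (c n : ℂ) * GG f t n := by
      simp only [hc, ofReal_sum (s := Ico V0 V1), sum_mul]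
      rw [sum_comm]
      refine sum_congr rfl fun v _ => ?_
      have := poly_mul (GG f t) (GG_mul hf t) (Iv h v) (S v) (Ioc ⌊X⌋₊ ⌊3 * X⌋₊)
        (fun p hp => (mem_Iv.mp hp).2.pos) (fun p hp m hm => by
          have h3 := prodmem v p hp m hm
          rw [mN]; refine ⟨h3.1, h3.2.trans ?_⟩
          have : 2 * X * exp (1 / h) ≤ 2 * X * (3/2) := by gcongr
          linarith) (fun _ => 1)
      simp only [Complex.ofReal_one, one_mul] at this
      exact this
    have e2 : DD f X (2 * X) t = ∑ n ∈ Ioc ⌊X⌋₊ ⌊3 * X⌋₊, ((if (n : ℝ) ≤ 2 * X then 1 else 0 : ℝ) : ℂ) * GG f t n := by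
      have : Ioc ⌊X⌋₊ ⌊2 * X⌋₊ = (Ioc ⌊X⌋₊ ⌊3 * X⌋₊).filter (fun n : ℕ => (n : ℝ) ≤ 2 * X) := by
        ext n; rw [mem_filter, mN, mem_Iof X0.le (by positivity)]
        constructor
        · exact fun h => ⟨⟨h.1, by linarith [h.2]⟩, h.2⟩
        · exact fun h => ⟨h.1.1, h.2⟩
      rw [DD, this, sum_filter]
      refine sum_congr rfl fun n _ => ?_
      split_ifs <;> simp
    rw [e1, e2, mul_sum, ← sum_add_distrib]
    refine sum_congr rfl fun n _ => ?_
    simp only [hβ, GG]; push_cast; ring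
  · have hLne := hL.ne'
    set Eg := (Ioc ⌊X⌋₊ ⌊X * exp (1 / h)⌋₊) ∪ Ioc ⌊2 * X⌋₊ ⌊2 * X * exp (1 / h)⌋₊ with hEg
    have hβ2 : ∀ n ∈ Ioc ⌊X⌋₊ ⌊3 * X⌋₊, β n ^ 2 ≤ 2 / L ^ 2 * (om P n - L) ^ 2 + if n ∈ Eg then 8 else 0 := by
      intro n hn
      rw [mN] at hn
      have e3 : 2 / L ^ 2 * (om P n - L) ^ 2 = 2 * (om P n / L - 1) ^ 2 := by
        rw [div_sub_one hLne, div_pow]; ring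
      have hx := c_nonneg n
      have hy := c_le n
      have hx' : 0 ≤ c n / L := div_nonneg hx hL.le
      have hy' : c n / L ≤ om P n / L := div_le_div_of_nonneg_right hy hL.le
      rw [e3]
      simp only [hEg, mem_union, mem_Iof X0.le (show 0 ≤ X * exp (1 / h) by positivity),
        mem_Iof (show 0 ≤ 2 * X by positivity) (show 0 ≤ 2 * X * exp (1 / h) by positivity)]
      split_ifs with hE
      · have : |β n| ≤ 1 + om P n / L := by
          rw [abs_le]; simp only [hβ]; constructor <;> split_ifs <;> linarith
        have h5 : β n ^ 2 ≤ (1 + om P n / L) ^ 2 := sq_le_sq' (by linarith [abs_le.mp this]) (abs_le.mp this).2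
        exact h5.trans (k1 _)
      · push Not at hE
        rw [add_zero]
        by_cases h2 : (n : ℝ) ≤ 2 * X
        · have h3 : X * exp (1 / h) < n := hE.1 hn.1
          simp only [hβ, if_pos h2, c_mid n h3 h2]
          exact k2 _
        · have h3 := hE.2 (by linarith)
          simp only [hβ, if_neg h2, c_zero n h3]
          simp; positivity
    have hcard : (Eg.card : ℝ) ≤ 8 * X / h := by
      have cI : ∀ x : ℝ, 0 ≤ x → ((Ioc ⌊x⌋₊ ⌊x * exp (1 / h)⌋₊).card : ℝ) ≤ x * (2 / h) + 1 := by
        intro x hx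
        have h3 : x ≤ x * exp (1 / h) := le_mul_of_one_le_right hx (one_le_exp (by positivity))
        rw [card_Ioc, cast_sub (floor_mono h3)]
        have := floor_le (hx.trans h3)
        have := lt_floor_add_one x
        have : x * exp (1 / h) ≤ x * (1 + 2 / h) := by gcongr
        linarith
      have h6 := cI X X0.le
      have h7 := cI (2 * X) (by positivity)
      have h8 := (cast_le (α := ℝ)).mpr (Finset.card_union_le (Ioc ⌊X⌋₊ ⌊X * exp (1 / h)⌋₊)
        (Ioc ⌊2 * X⌋₊ ⌊2 * X * exp (1 / h)⌋₊))
      rw [← hEg] at h8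
      have h9 : 1 ≤ X / h := by rw [le_div_iff₀ h0]; linarith
      have : X * (2 / h) + 2 * X * (2 / h) + 2 * (X / h) = 8 * X / h := by field_simp; ring
      push_cast at h8
      linarith
    have hTK := turan_kubilius P ⌊3 * X⌋₊ (fun p hp => by
      have := (mem_prs (exp_pos _).le (exp_pos _).le).mp hp
      refine ⟨this.2, le_floor (by linarith [this.1.2])⟩)
    have hfl : (⌊3 * X⌋₊ : ℝ) ≤ 3 * X := floor_le (by positivity)
    have hsum : ∑ n ∈ Ioc ⌊X⌋₊ ⌊3 * X⌋₊, β n ^ 2 ≤ 2 / L ^ 2 * (3 * (3 * X) * L) + 8 * (8 * X / h) := by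
      refine (sum_le_sum hβ2).trans ?_
      rw [sum_add_distrib, ← mul_sum]
      gcongr
      · refine (sum_le_sum_of_subset_of_nonneg (Finset.Ioc_subset_Ioc_left (Nat.zero_le _)) fun _ _ _ => sq_nonneg _).trans
          (hTK.trans ?_)
        gcongr
      · rw [sum_ite_mem, sum_const, nsmul_eq_mul, mul_comm]
        gcongr
        exact (cast_le.mpr (card_le_card Finset.inter_subset_right)).trans hcard
    have : ∀ n ∈ Ioc ⌊X⌋₊ ⌊3 * X⌋₊, ‖(β n : ℂ) * (f n / n)‖ ^ 2 ≤ β n ^ 2 * (1 / X ^ 2) := by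
      intro n hn
      rw [mN] at hn
      have hn0 : 0 < (n : ℝ) := X0.trans hn.1
      rw [norm_mul, mul_pow, norm_real, norm_eq_abs, sq_abs, norm_div, Complex.norm_natCast, div_pow]
      gcongr
      · exact pow_le_one₀ (norm_nonneg _) (hb n)
      · exact hn.1.le
    refine (sum_le_sum this).trans ?_
    rw [← sum_mul]
    calc _ ≤ (2 / L ^ 2 * (3 * (3 * X) * L) + 8 * (8 * X / h)) * (1 / X ^ 2) := by gcongr
      _ = 18 / X * (1 / L) + 64 / X * (1 / h) := by field_simp; ring
      _ ≤ 64 / X * (1 / L) + 64 / X * (1 / h) := by gcongr; norm_num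
      _ = _ := by ring
end
section
lemma om_mono {P : Finset ℕ} {m n : ℕ} (h : m ∣ n) : om P m ≤ om P n :=
  sum_le_sum fun p _ => by
    split_ifs with h1 h2 h2
    exacts [le_rfl, absurd (h1.trans h) h2, zero_le_one, le_rfl]
lemma sumInv_Iv {h : ℝ} (hh : 1 ≤ h) (u : ℕ) : sumInv (Iv h u) ≤ 3 := by
  have hE : 1 ≤ exp (u / h) := one_le_exp (by positivity)
  have h2 : exp ((u + 1) / h) ≤ exp (u / h) * 3 := by
    rw [add_div, exp_add]; gcongr
    have : 1 / h ≤ 1 := by rw [div_le_one (by linarith)]; exact hh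
    exact (exp_le_exp.mpr this).trans (by linarith [exp_one_lt_d9])
  set E := exp (u / h)
  have h1 : ∀ p ∈ Iv h u, 1 / (p : ℝ) ≤ 1 / E := fun p hp => by
    rw [mem_Iv] at hp; exact one_div_le_one_div_of_le (by linarith) hp.1.1.le
  refine (sum_le_card_nsmul _ _ _ h1).trans ?_
  have h3 : ((Iv h u).card : ℝ) ≤ 3 * E := by
    have : (Iv h u).card ≤ ⌊3 * E⌋₊ - ⌊E⌋₊ := by
      refine (card_filter_le _ _).trans ?_
      rw [card_Ioc]; exact Nat.sub_le_sub_right (floor_mono (by linarith)) _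
    refine (cast_le.mpr (this.trans (sub_le _ _))).trans (floor_le (by linarith))
  rw [nsmul_eq_mul]
  calc ((Iv h u).card : ℝ) * (1 / E) ≤ 3 * E * (1 / E) := by gcongr
    _ = 3 := by field_simp
lemma power_coef {f : ℕ → ℂ} (hf : ∀ m n, f (m * n) = f m * f n) {h Y0 : ℝ} (hh : 1 ≤ h) (hY0 : 0 < Y0) (u : ℕ)
    (S : Finset ℕ) (hS : ∀ n ∈ S, Y0 < n ∧ (n : ℝ) ≤ 2 * Y0) (l : ℕ) :
    ∃ k : ℕ → ℝ, (∀ n, 0 ≤ k n ∧ k n ≤ om (Iv h u) n ^ l) ∧ ∀ t : ℤ, QQ f h u t ^ l * ∑ n ∈ S, GG f t n =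
      ∑ n ∈ Ioc ⌊Y0 * exp (u / h) ^ l⌋₊ ⌊2 * Y0 * exp ((u + 1) / h) ^ l⌋₊, (k n : ℂ) * GG f t n := by
  induction l with
  | zero =>
    refine ⟨fun n => if n ∈ S then 1 else 0, fun n => by dsimp only; split_ifs <;> simp, fun t => ?_⟩
    rw [pow_zero, one_mul]
    have : S ⊆ Ioc ⌊Y0 * exp (u / h) ^ 0⌋₊ ⌊2 * Y0 * exp ((u + 1) / h) ^ 0⌋₊ := fun n hn => by
      rw [mem_Iof (by positivity) (by positivity)]; simpa using hS n hn
    rw [← Finset.sum_subset this]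
    · exact sum_congr rfl fun n hn => by simp [hn]
    · intro n _ hn; simp [hn]
  | succ l ih =>
    obtain ⟨k, hk, ih⟩ := ih
    set S' := Ioc ⌊Y0 * exp (u / h) ^ l⌋₊ ⌊2 * Y0 * exp ((u + 1) / h) ^ l⌋₊ with hS'
    refine ⟨fun n => ∑ p ∈ Iv h u, if p ∣ n ∧ n / p ∈ S' then k (n / p) else 0, fun n => ⟨?_, ?_⟩, fun t => ?_⟩
    · exact sum_nonneg fun p _ => by split_ifs; exacts [(hk _).1, le_rfl]
    · rw [pow_succ]
      nth_rewrite 2 [om]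
      rw [mul_sum]
      refine sum_le_sum fun p _ => ?_
      have := om_nonneg (Iv h u) n
      split_ifs with h1 h2 h2
      · rw [mul_one]
        exact (hk _).2.trans (pow_le_pow_left₀ (om_nonneg _ _) (om_mono (Nat.div_dvd_of_dvd h1.1)) _)
      · exact absurd h1.1 h2
      · positivity
      · simp
    · rw [pow_succ', mul_assoc, ih, QQ]
      refine poly_mul (GG f t) (GG_mul hf t) _ _ _ (fun p hp => (mem_Iv.mp hp).2.pos) (fun p hp m hm => ?_) k
      rw [mem_Iv] at hp
      rw [hS', mem_Iof (by positivity) (by positivity)] at hm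
      rw [mem_Iof (by positivity) (by positivity)]
      push_cast
      constructor
      · calc Y0 * exp (u / h) ^ (l + 1) = exp (u / h) * (Y0 * exp (u / h) ^ l) := by ring
          _ < p * m := mul_lt_mul'' hp.1.1 hm.1 (exp_pos _).le (by positivity)
      · calc (p : ℝ) * m ≤ exp ((u + 1) / h) * (2 * Y0 * exp ((u + 1) / h) ^ l) := by
              gcongr; exacts [hp.1.2, hm.2]
          _ = _ := by ring
/-- mean value for `Q^l R` -/
lemma power {f : ℕ → ℂ} (hf : ∀ m n, f (m * n) = f m * f n) (hb : ∀ n, ‖f n‖ ≤ 1) {h Y0 : ℝ} (hh : 1 ≤ h) (hY0 : 0 < Y0)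
    (u l : ℕ) (hl : (l : ℝ) ≤ h) (S : Finset ℕ) (hS : ∀ n ∈ S, Y0 < n ∧ (n : ℝ) ≤ 2 * Y0) (𝒯 : Finset ℤ) (T : ℕ) (hT : 1 ≤ T)
    (h𝒯 : ∀ t ∈ 𝒯, |t| ≤ T) (hTY : (T : ℝ) ≤ 2 * (Y0 * exp (l * (u / h)))) :
    ∑ t ∈ 𝒯, ‖QQ f h u t ^ l * ∑ n ∈ S, GG f t n‖ ^ 2 ≤ 10 ^ 7 * (2 * l).factorial := by
  obtain ⟨k, hk, e⟩ := power_coef hf hh hY0 u S hS l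
  simp_rw [e]
  rw [exp_nat_mul] at hTY
  set Y := Y0 * exp (u / h) ^ l with hY
  have Ypos : 0 < Y := by positivity
  have hup : 2 * Y0 * exp ((u + 1) / h) ^ l ≤ 6 * Y := by
    rw [hY, add_div, exp_add, mul_pow, ← exp_nat_mul (1 / h)]
    have : (l : ℝ) * (1 / h) ≤ 1 := by rw [mul_one_div, div_le_one (by linarith)]; exact hl
    have h3 : exp (l * (1 / h)) ≤ 3 := (exp_le_exp.mpr this).trans (by linarith [exp_one_lt_d9])
    calc _ ≤ 2 * Y0 * (exp (u / h) ^ l * 3) := by gcongr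
      _ = _ := by ring
  set S' := Ioc ⌊Y⌋₊ ⌊2 * Y0 * exp ((u + 1) / h) ^ l⌋₊ with hS'
  have mS' : ∀ n ∈ S', Y < n ∧ (n : ℝ) ≤ 6 * Y := fun n hn => by
    rw [hS', mem_Iof (by positivity) (by positivity)] at hn; exact ⟨hn.1, hn.2.trans hup⟩
  have mv := mean_value 𝒯 T hT h𝒯 Y Ypos S' (fun n hn => ⟨(mS' n hn).1.le, by linarith [(mS' n hn).2]⟩)
    (fun n => (k n : ℂ) * (f n / n))
  have e2 : ∀ t : ℤ, ∑ n ∈ S', (k n : ℂ) * GG f t n = ∑ n ∈ S', (k n : ℂ) * (f n / n) * ee (-t * Real.log n) := fun t =>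
    sum_congr rfl fun n _ => by rw [GG]; ring
  simp_rw [e2]
  refine mv.trans ?_
  have h1 : ∑ n ∈ S', ‖(k n : ℂ) * (f n / n)‖ ^ 2 ≤ 1 / Y ^ 2 * ((2 * l).factorial * (6 * Y) * 730) := by
    calc _ ≤ ∑ n ∈ S', 1 / Y ^ 2 * om (Iv h u) n ^ (2 * l) := by
          refine sum_le_sum fun n hn => ?_
          have hn0 := Ypos.trans (mS' n hn).1
          rw [norm_mul, mul_pow, norm_real, norm_eq_abs, sq_abs, norm_div, Complex.norm_natCast, div_pow, mul_comm]
          have h5 : k n ^ 2 ≤ om (Iv h u) n ^ (2 * l) := by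
            rw [mul_comm 2 l, pow_mul]; exact pow_le_pow_left₀ (hk n).1 (hk n).2 2
          have h6 : ‖f n‖ ^ 2 ≤ 1 := pow_le_one₀ (norm_nonneg _) (hb n)
          have h7 : Y ^ 2 ≤ (n : ℝ) ^ 2 := pow_le_pow_left₀ Ypos.le (mS' n hn).1.le 2
          gcongr
      _ ≤ 1 / Y ^ 2 * ∑ n ∈ Ioc 0 ⌊6 * Y⌋₊, om (Iv h u) n ^ (2 * l) := by
          rw [← mul_sum]; refine mul_le_mul_of_nonneg_left ?_ (by positivity)
          refine sum_le_sum_of_subset_of_nonneg (fun n hn => ?_) fun n _ _ => pow_nonneg (om_nonneg _ _) _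
          rw [mem_Ioc]
          exact ⟨by exact_mod_cast Ypos.trans (mS' n hn).1, le_floor (mS' n hn).2⟩
      _ ≤ _ := by
          gcongr
          refine (moment _ _ _ fun p hp => (mem_Iv.mp hp).2).trans ?_
          gcongr
          · exact floor_le (by positivity)
          · have h8 := sumInv_Iv hh u
            calc exp (2 * sumInv (Iv h u)) ≤ exp (6 : ℕ) := by gcongr; push_cast; linarith
              _ = exp 1 ^ 6 := by rw [← exp_nat_mul]; simp
              _ ≤ 3 ^ 6 := by gcongr; linarith [exp_one_lt_d9]
              _ ≤ 730 := by norm_num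
  calc 600 * ((T : ℝ) + Y) * ∑ n ∈ S', ‖(k n : ℂ) * (f n / n)‖ ^ 2
      ≤ 600 * (2 * Y + Y) * (1 / Y ^ 2 * ((2 * l).factorial * (6 * Y) * 730)) := by gcongr
    _ = 7884000 * (2 * l).factorial := by field_simp; ring
    _ ≤ _ := by gcongr; norm_num
end
section
noncomputable def EN (f : ℕ → ℂ) (X : ℝ) (𝒯 : Finset ℤ) : ℝ := ∑ t ∈ 𝒯, ‖DD f X (2 * X) t‖ ^ 2
def good (f : ℕ → ℂ) (a : ℝ) (w : ℕ) (t : ℤ) : Prop :=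
  ∀ v ∈ Ico (w ^ 42) (w ^ 44), ‖QQ f ((w : ℝ) ^ 40) v t‖ ≤ exp (-((a - 2 / w) * (v / (w : ℝ) ^ 40)))
lemma sq_add_norm (x y : ℂ) : ‖x + y‖ ^ 2 ≤ 2 * ‖x‖ ^ 2 + 2 * ‖y‖ ^ 2 := by
  have := pow_le_pow_left₀ (norm_nonneg _) (norm_add_le x y) 2
  nlinarith [sq_nonneg (‖x‖ - ‖y‖)]
lemma sq_sum_norm {ι : Type*} (s : Finset ι) (g : ι → ℂ) : ‖∑ i ∈ s, g i‖ ^ 2 ≤ s.card * ∑ i ∈ s, ‖g i‖ ^ 2 :=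
  (pow_le_pow_left₀ (norm_nonneg _) (norm_sum_le _ _) 2).trans sq_sum_le_card_mul_sum_sq
/-- trivial energy bound -/
lemma coef_sq {f : ℕ → ℂ} (hb : ∀ n, ‖f n‖ ≤ 1) {Y : ℝ} (hY : 1 ≤ Y) :
    ∑ n ∈ Ioc ⌊Y⌋₊ ⌊2 * Y⌋₊, ‖f n / n‖ ^ 2 ≤ 2 / Y := by
  have mS : ∀ n ∈ Ioc ⌊Y⌋₊ ⌊2 * Y⌋₊, Y < n ∧ (n : ℝ) ≤ 2 * Y := fun n => (mem_Iof (by positivity) (by positivity)).mp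
  have : ∀ n ∈ Ioc ⌊Y⌋₊ ⌊2 * Y⌋₊, ‖f n / n‖ ^ 2 ≤ 1 / Y ^ 2 := fun n hn => by
    have := (mS n hn).1
    rw [norm_div, Complex.norm_natCast, div_pow]
    have h6 : ‖f n‖ ^ 2 ≤ 1 := pow_le_one₀ (norm_nonneg _) (hb n)
    gcongr
  refine (sum_le_card_nsmul _ _ _ this).trans ?_
  rw [nsmul_eq_mul, card_Ioc]
  have h2 : ((⌊2 * Y⌋₊ - ⌊Y⌋₊ : ℕ) : ℝ) ≤ 2 * Y :=
    (cast_le.mpr (sub_le _ _)).trans (floor_le (by positivity))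
  calc _ ≤ 2 * Y * (1 / Y ^ 2) := by gcongr
    _ = _ := by field_simp
lemma EN_triv {f : ℕ → ℂ} (hb : ∀ n, ‖f n‖ ≤ 1) {Y : ℝ} (hY : 1 ≤ Y) (𝒯 : Finset ℤ) (T : ℕ) (hT : 1 ≤ T)
    (h𝒯 : ∀ t ∈ 𝒯, |t| ≤ T) (hTY : (T : ℝ) ≤ Y) : EN f Y 𝒯 ≤ 2400 := by
  have mS : ∀ n ∈ Ioc ⌊Y⌋₊ ⌊2 * Y⌋₊, Y < n ∧ (n : ℝ) ≤ 2 * Y := fun n => (mem_Iof (by positivity) (by positivity)).mp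
  have mv := mean_value 𝒯 T hT h𝒯 Y (by linarith) (Ioc ⌊Y⌋₊ ⌊2 * Y⌋₊)
    (fun n hn => ⟨(mS n hn).1.le, by linarith [(mS n hn).2]⟩) (fun n => f n / n)
  refine mv.trans ?_
  have h1 := coef_sq hb hY
  calc _ ≤ 600 * (Y + Y) * (2 / Y) := by gcongr
    _ = 2400 := by field_simp; norm_num
/-- energy via factorization at stage `w` -/
lemma efactor {f : ℕ → ℂ} (hf : ∀ m n, f (m * n) = f m * f n) (hb : ∀ n, ‖f n‖ ≤ 1) :
    ∀ᶠ w : ℕ in atTop, ∀ (X : ℝ) (𝒯 : Finset ℤ) (T : ℕ), exp ((w : ℝ) ^ 4) ≤ X → 1 ≤ T → (∀ t ∈ 𝒯, |t| ≤ T) →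
      (T : ℝ) ≤ X → EN f X 𝒯 ≤ 2 * w ^ 44 * ∑ v ∈ Ico (w ^ 42) (w ^ 44), ∑ t ∈ 𝒯, ‖QQ f ((w : ℝ) ^ 40) v t *
        DD f (X * exp (-(v / (w : ℝ) ^ 40))) (2 * (X * exp (-(v / (w : ℝ) ^ 40)))) t‖ ^ 2 +
        4000000 / Real.log w := by
  obtain ⟨a0, ha0, hM⟩ := mertens
  have ev1 : ∀ᶠ w : ℕ in atTop, (w : ℝ) ^ 40 ≤ exp w := by
    have := (Real.isLittleO_pow_exp_atTop (n := 40)).bound (one_pos)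
    filter_upwards [tendsto_natCast_atTop_atTop.eventually this] with w hw
    simpa using hw
  have ev2 : ∀ᶠ w : ℕ in atTop, a0 ≤ w := tendsto_natCast_atTop_atTop.eventually_ge_atTop a0
  have ev3 : ∀ᶠ w : ℕ in atTop, (24 : ℝ) ≤ Real.log w :=
    (Real.tendsto_log_atTop.comp tendsto_natCast_atTop_atTop).eventually_ge_atTop 24
  filter_upwards [ev1, ev2, ev3, eventually_ge_atTop 4] with w hw1 hw2 hw3 hw4 X 𝒯 T hX hT h𝒯 hTX
  have w4 : (4 : ℝ) ≤ w := by exact_mod_cast hw4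
  have w1 : (1 : ℝ) ≤ w := by linarith
  have hh : (4 : ℝ) ≤ (w : ℝ) ^ 40 := w4.trans (le_self_pow₀ w1 (by norm_num))
  have e0 : ((w ^ 42 : ℕ) : ℝ) / (w : ℝ) ^ 40 = w ^ 2 := by push_cast; field_simp
  have e1 : ((w ^ 44 : ℕ) : ℝ) / (w : ℝ) ^ 40 = w ^ 4 := by push_cast; field_simp
  have hV : w ^ 42 ≤ w ^ 44 := pow_le_pow_right (by omega) (by norm_num)
  have hL : Real.log w / 24 ≤ sumInv (prs (exp ((w ^ 42 : ℕ) / (w : ℝ) ^ 40)) (exp ((w ^ 44 : ℕ) / (w : ℝ) ^ 40))) := by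
    rw [e0, e1]
    refine le_trans ?_ (hM _ _ (hw2.trans (le_self_pow₀ w1 (by norm_num))) (pow_le_pow_right₀ w1 (by norm_num)))
    have : Real.log ((w : ℝ) ^ 2 + 3) ≤ Real.log ((w : ℝ) ^ 3) := log_le_log (by positivity) (by nlinarith)
    rw [log_pow] at this ⊢
    push_cast at this ⊢
    linarith
  obtain ⟨b, hb1, hb2⟩ := factor hf hb hh (hw1.trans ((exp_le_exp.mpr (le_self_pow₀ w1 (by norm_num))).trans hX)) hV
    (by rw [e1]; exact hX) (lt_of_lt_of_le (by linarith) hL)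
  set L := sumInv (prs (exp ((w ^ 42 : ℕ) / (w : ℝ) ^ 40)) (exp ((w ^ 44 : ℕ) / (w : ℝ) ^ 40)))
  have hL1 : 1 ≤ L := by linarith
  have X0 : 0 < X := (exp_pos _).trans_le hX
  have mv := mean_value 𝒯 T hT h𝒯 X X0 (Ioc ⌊X⌋₊ ⌊3 * X⌋₊) (fun n hn => by
    rw [mem_Iof X0.le (by positivity)] at hn; exact ⟨hn.1.le, by linarith [hn.2]⟩) b
  have h1 : 1 / L + 1 / (w : ℝ) ^ 40 ≤ 25 / Real.log w := by
    have h2 : 1 / L ≤ 24 / Real.log w := by rw [div_le_div_iff₀ (by linarith) (by linarith)]; linarith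
    have h3 : 1 / (w : ℝ) ^ 40 ≤ 1 / Real.log w := one_div_le_one_div_of_le (by linarith)
      ((Real.log_le_self (by linarith)).trans (le_self_pow₀ w1 (by norm_num)))
    calc _ ≤ 24 / Real.log w + 1 / Real.log w := add_le_add h2 h3
      _ = _ := by ring
  have herr : 600 * ((T : ℝ) + X) * ∑ n ∈ Ioc ⌊X⌋₊ ⌊3 * X⌋₊, ‖b n‖ ^ 2 ≤ 2000000 / Real.log w := by
    calc _ ≤ 600 * (X + X) * (64 / X * (25 / Real.log w)) := by
          gcongr; exact hb2.trans (by gcongr)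
      _ = 1920000 / Real.log w := by field_simp; norm_num
      _ ≤ _ := by gcongr; norm_num
  rw [EN]
  simp_rw [hb1]
  calc _ ≤ ∑ t ∈ 𝒯, (2 * (w ^ 44 * ∑ v ∈ Ico (w ^ 42) (w ^ 44), ‖QQ f ((w : ℝ) ^ 40) v t *
        DD f (X * exp (-(v / (w : ℝ) ^ 40))) (2 * (X * exp (-(v / (w : ℝ) ^ 40)))) t‖ ^ 2) +
        2 * ‖∑ n ∈ Ioc ⌊X⌋₊ ⌊3 * X⌋₊, b n * ee (-t * Real.log n)‖ ^ 2) := by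
        refine sum_le_sum fun t _ => (sq_add_norm _ _).trans ?_
        gcongr
        rw [norm_mul, mul_pow, norm_real]
        have h4 : ‖1 / L‖ ^ 2 ≤ 1 := by
          rw [norm_of_nonneg (by positivity)]
          exact pow_le_one₀ (by positivity) (by rw [div_le_one (by linarith)]; exact hL1)
        refine (mul_le_of_le_one_left (by positivity) h4).trans ((sq_sum_norm _ _).trans ?_)
        gcongr
        rw [card_Ico]; exact_mod_cast sub_le _ _
    _ ≤ _ := by
        rw [sum_add_distrib, ← mul_sum, ← mul_sum, ← mul_sum, sum_comm, ← mul_assoc]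
        have : 4000000 / Real.log w = 2 * (2000000 / Real.log w) := by ring
        rw [this]
        gcongr
        exact mv.trans herr
lemma bad_power {f : ℕ → ℂ} (hf : ∀ m n, f (m * n) = f m * f n) (hb : ∀ n, ‖f n‖ ≤ 1) {h Y0 α : ℝ} (hh : 1 ≤ h)
    (hY0 : 0 < Y0) (u l : ℕ) (hl : (l : ℝ) ≤ h) (S : Finset ℕ) (hS : ∀ n ∈ S, Y0 < n ∧ (n : ℝ) ≤ 2 * Y0) (𝒯 : Finset ℤ)
    (T : ℕ) (hT : 1 ≤ T) (h𝒯 : ∀ t ∈ 𝒯, |t| ≤ T) (hTY : (T : ℝ) ≤ 2 * (Y0 * exp (l * (u / h))))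
    (hbad : ∀ t ∈ 𝒯, exp (-(α * (u / h))) < ‖QQ f h u t‖) :
    ∑ t ∈ 𝒯, ‖∑ n ∈ S, GG f t n‖ ^ 2 ≤ exp (2 * α * (l * (u / h))) * (10 ^ 7 * (2 * l).factorial) := by
  refine le_trans ?_ (mul_le_mul_of_nonneg_left (power hf hb hh hY0 u l hl S hS 𝒯 T hT h𝒯 hTY) (exp_pos _).le)
  rw [mul_sum]
  refine sum_le_sum fun t ht => ?_
  rw [norm_mul, mul_pow, ← mul_assoc]
  refine le_mul_of_one_le_left (by positivity) ?_
  calc (1 : ℝ) = exp (2 * α * (l * (u / h))) * (exp (-(α * (u / h))) ^ l) ^ 2 := by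
        rw [← pow_mul, ← exp_nat_mul, ← exp_add]; push_cast
        rw [← exp_zero]; congr 1; ring
    _ ≤ _ := by rw [norm_pow]; gcongr; exact (hbad t ht).le
lemma fact_bd : ∀ᶠ w : ℕ in atTop, ∀ (z : ℝ) (l : ℕ), (w : ℝ) ^ 2 ≤ z → z ≤ (w : ℝ) ^ 32 → (l : ℝ) ≤ z / w ^ 2 + 1 →
    ((2 * l).factorial : ℝ) ≤ exp (z / w) ∧ (l : ℝ) ≤ w ^ 40 := by
  have ev : ∀ᶠ w : ℕ in atTop, (4 * (w : ℝ) ^ 30) ^ 4 ≤ exp w := by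
    have := ((Real.isLittleO_pow_exp_atTop (n := 120)).const_mul_left 256).bound (one_pos)
    filter_upwards [tendsto_natCast_atTop_atTop.eventually this] with w hw
    simp at hw
    refine le_trans (le_of_eq ?_) hw; ring
  filter_upwards [ev, eventually_ge_atTop 4] with w hw hw4 z l hz1 hz2 hl
  have w4 : (4 : ℝ) ≤ w := by exact_mod_cast hw4
  have h1 : (l : ℝ) ≤ 2 * (z / w ^ 2) := by
    have : 1 ≤ z / (w : ℝ) ^ 2 := by rw [le_div_iff₀ (by positivity)]; linarith
    linarith
  have h2 : z / (w : ℝ) ^ 2 ≤ (w : ℝ) ^ 30 := by rw [div_le_iff₀ (by positivity), ← pow_add]; exact hz2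
  constructor
  · calc ((2 * l).factorial : ℝ) ≤ ((2 * l : ℕ) : ℝ) ^ (2 * l) := by exact_mod_cast Nat.factorial_le_pow _
      _ ≤ (4 * (w : ℝ) ^ 30) ^ (2 * l) := by gcongr; push_cast; linarith
      _ ≤ (exp (w / 4)) ^ (2 * l) := by
          gcongr
          refine le_of_pow_le_pow_left₀ (n := 4) (by norm_num) (exp_pos _).le (hw.trans (le_of_eq ?_))
          rw [← exp_nat_mul]; congr 1; push_cast; ring
      _ = exp (l * w / 2) := by rw [← exp_nat_mul]; congr 1; push_cast; ring
      _ ≤ exp (z / w) := by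
          refine exp_le_exp.mpr ?_
          calc (l : ℝ) * w / 2 ≤ 2 * (z / w ^ 2) * w / 2 := by gcongr
            _ = z / w := by field_simp
  · calc (l : ℝ) ≤ 2 * (w : ℝ) ^ 30 := by linarith
      _ ≤ (w : ℝ) ^ 10 * w ^ 30 := by
          gcongr; exact (by linarith : (2:ℝ) ≤ w).trans (le_self_pow₀ (by linarith) (by norm_num))
      _ = _ := by rw [← pow_add]
end
section
lemma ev_pow_exp (C : ℝ) (n : ℕ) {a : ℝ} (ha : 0 < a) : ∀ᶠ w : ℕ in atTop, C * (w : ℝ) ^ n * exp (-(a * w)) ≤ 1 / Real.log w := by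
  have h1 := (Real.tendsto_pow_mul_exp_neg_atTop_nhds_zero (n + 1)).comp
    (Filter.Tendsto.const_mul_atTop ha (tendsto_natCast_atTop_atTop (R := ℝ)))
  have h2 := (h1.const_mul (|C| / a ^ (n + 1))).eventually (gt_mem_nhds (show |C| / a ^ (n + 1) * 0 < 1 by simp))
  filter_upwards [h2, eventually_ge_atTop 3] with w hw hw3
  have w3 : (3 : ℝ) ≤ w := by exact_mod_cast hw3
  have hl : 0 < Real.log w := log_pos (by linarith)
  rw [le_div_iff₀ hl]
  calc C * (w : ℝ) ^ n * exp (-(a * w)) * Real.log w ≤ |C| * (w : ℝ) ^ n * exp (-(a * w)) * w := by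
        gcongr
        · exact le_abs_self C
        · exact Real.log_le_self (by linarith)
    _ = |C| / a ^ (n + 1) * ((a * w) ^ (n + 1) * exp (-(a * w))) := by rw [mul_pow, pow_succ (w : ℝ)]; field_simp
    _ ≤ 1 := hw.le
lemma ve_bounds {w v : ℕ} (hw : 1 ≤ w) (hv : v ∈ Ico (w ^ 42) (w ^ 44)) :
    (w : ℝ) ^ 2 ≤ v / (w : ℝ) ^ 40 ∧ v / (w : ℝ) ^ 40 ≤ (w : ℝ) ^ 4 := by
  have w0 : (0 : ℝ) < w := by exact_mod_cast hw
  rw [mem_Ico] at hv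
  rw [le_div_iff₀ (by positivity), div_le_iff₀ (by positivity), ← pow_add, ← pow_add]
  exact ⟨by exact_mod_cast hv.1, by exact_mod_cast hv.2.le⟩
lemma card_V (w : ℕ) : ((Ico (w ^ 42) (w ^ 44)).card : ℝ) ≤ (w : ℝ) ^ 44 := by
  rw [card_Ico]; exact_mod_cast sub_le _ _
open Classical in
lemma sum_cover {ι κ : Type*} (𝒯 : Finset ι) (U : Finset κ) (p : κ → ι → Prop) (F : ι → ℝ) (hF : ∀ t, 0 ≤ F t)
    (h : ∀ t ∈ 𝒯, ∃ u ∈ U, p u t) : ∑ t ∈ 𝒯, F t ≤ ∑ u ∈ U, ∑ t ∈ 𝒯.filter (p u), F t := by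
  simp_rw [sum_filter]
  rw [sum_comm]
  refine sum_le_sum fun t ht => ?_
  obtain ⟨u, hu, hp⟩ := h t ht
  refine le_trans (le_of_eq (if_pos hp).symm) (single_le_sum (f := fun u => if p u t then F t else 0) (fun u _ => ?_) hu)
  split_ifs; exacts [hF t, le_rfl]
lemma bad_ex {f : ℕ → ℂ} {a : ℝ} {w : ℕ} {t : ℤ} (h : ¬ good f a w t) : ∃ u ∈ Ico (w ^ 42) (w ^ 44),
    exp (-((a - 2 / w) * (u / (w : ℝ) ^ 40))) < ‖QQ f ((w : ℝ) ^ 40) u t‖ := by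
  rw [good] at h; push Not at h; exact h
/-- first stage -/
lemma stage1 {f : ℕ → ℂ} (hf : ∀ m n, f (m * n) = f m * f n) (hb : ∀ n, ‖f n‖ ≤ 1) {a : ℝ} (ha : 0 < a) :
    ∀ᶠ w : ℕ in atTop, ∀ (X : ℝ) (𝒯 : Finset ℤ) (T : ℕ), 1 ≤ T → (∀ t ∈ 𝒯, |t| ≤ T) →
      (T : ℝ) ≤ X * exp (-(w : ℝ) ^ 4) → (∀ t ∈ 𝒯, good f a w t) → EN f X 𝒯 ≤ 4000001 / Real.log w := by
  have ev2 : ∀ᶠ w : ℕ in atTop, 4 / a ≤ w := tendsto_natCast_atTop_atTop.eventually_ge_atTop (4 / a)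
  filter_upwards [efactor hf hb, ev2, ev_pow_exp 4800 88 ha, eventually_ge_atTop 4] with w hw hw2 hw3 hw4 X 𝒯 T hT h𝒯 hTX hg
  have w4 : (4 : ℝ) ≤ w := by exact_mod_cast hw4
  have T1 : (1 : ℝ) ≤ T := by exact_mod_cast hT
  have hXe : exp ((w : ℝ) ^ 4) ≤ X := by
    have := mul_le_mul_of_nonneg_right (T1.trans hTX) (exp_pos ((w : ℝ) ^ 4)).le
    rwa [one_mul, mul_assoc, ← exp_add, neg_add_cancel, exp_zero, mul_one] at this
  have X0 : 0 < X := (exp_pos _).trans_le hXe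
  refine (hw X 𝒯 T hXe hT h𝒯 (hTX.trans (mul_le_of_le_one_right X0.le (by simp)))).trans ?_
  have hα : a / 2 ≤ a - 2 / w := by
    have : 2 / (w : ℝ) ≤ a / 2 := by
      rw [div_le_iff₀ ha] at hw2
      rw [div_le_div_iff₀ (by linarith) (by norm_num)]; linarith
    linarith
  have key : ∀ v ∈ Ico (w ^ 42) (w ^ 44), ∑ t ∈ 𝒯, ‖QQ f ((w : ℝ) ^ 40) v t *
        DD f (X * exp (-(v / (w : ℝ) ^ 40))) (2 * (X * exp (-(v / (w : ℝ) ^ 40)))) t‖ ^ 2 ≤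
        exp (-(a * w)) * 2400 := by
    intro v hv
    obtain ⟨b1, b2⟩ := ve_bounds (by omega) hv
    have hY : (T : ℝ) ≤ X * exp (-(v / (w : ℝ) ^ 40)) := hTX.trans (by gcongr)
    refine le_trans ?_ (mul_le_mul_of_nonneg_left (EN_triv hb (T1.trans hY) 𝒯 T hT h𝒯 hY) (exp_pos _).le)
    rw [EN, mul_sum]
    refine sum_le_sum fun t ht => ?_
    rw [norm_mul, mul_pow]
    gcongr
    calc ‖QQ f ((w : ℝ) ^ 40) v t‖ ^ 2 ≤ exp (-((a - 2 / w) * (v / (w : ℝ) ^ 40))) ^ 2 := by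
          gcongr; exact hg t ht v hv
      _ = exp (-(2 * ((a - 2 / w) * (v / (w : ℝ) ^ 40)))) := by
          rw [← exp_nat_mul]; congr 1; push_cast; ring
      _ ≤ _ := by
          refine exp_le_exp.mpr (neg_le_neg ?_)
          calc a * w ≤ 2 * (a / 2 * w ^ 2) := by nlinarith
            _ ≤ _ := by
              refine mul_le_mul_of_nonneg_left (mul_le_mul hα b1 (by positivity) (by linarith)) (by norm_num)
  have h2 : ∑ v ∈ Ico (w ^ 42) (w ^ 44), ∑ t ∈ 𝒯, ‖QQ f ((w : ℝ) ^ 40) v t *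
        DD f (X * exp (-(v / (w : ℝ) ^ 40))) (2 * (X * exp (-(v / (w : ℝ) ^ 40)))) t‖ ^ 2 ≤
        w ^ 44 * (exp (-(a * w)) * 2400) := by
    refine (sum_le_card_nsmul _ _ _ key).trans ?_
    rw [nsmul_eq_mul]; gcongr; exact card_V w
  calc _ ≤ 2 * (w : ℝ) ^ 44 * (w ^ 44 * (exp (-(a * w)) * 2400)) + 4000000 / Real.log w := by gcongr
    _ = 4800 * (w : ℝ) ^ 88 * exp (-(a * w)) + 4000000 / Real.log w := by ring
    _ ≤ 1 / Real.log w + 4000000 / Real.log w := by gcongr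
    _ = _ := by ring
/-- later stages -/
lemma stage2 {f : ℕ → ℂ} (hf : ∀ m n, f (m * n) = f m * f n) (hb : ∀ n, ‖f n‖ ≤ 1) {a : ℝ} (ha : 0 < a) (ha1 : a ≤ 1) :
    ∀ᶠ w : ℕ in atTop, ∀ (X : ℝ) (𝒯 : Finset ℤ) (T : ℕ), 1 ≤ T → (∀ t ∈ 𝒯, |t| ≤ T) →
      (T : ℝ) ≤ X → exp ((w : ℝ) ^ 16) ≤ X → (∀ t ∈ 𝒯, good f a (w ^ 4) t ∧ ¬ good f a w t) →
      EN f X 𝒯 ≤ 4000001 / Real.log w := by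
  classical
  have ev2 : ∀ᶠ w : ℕ in atTop, 4 / a ≤ w := tendsto_natCast_atTop_atTop.eventually_ge_atTop (4 / a)
  have hp4 : Tendsto (fun w : ℕ => w ^ 4) atTop atTop := tendsto_pow_atTop (by norm_num)
  filter_upwards [hp4.eventually (efactor hf hb), ev2, ev_pow_exp (2 * 10 ^ 7) 396 one_pos, fact_bd, eventually_ge_atTop 4] with
    w hw hw2 hw3 hfb hw4 X 𝒯 T hT h𝒯 hTX hX hg
  have w4 : (4 : ℝ) ≤ w := by exact_mod_cast hw4
  have w1 : (1 : ℝ) ≤ w := by linarith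
  have X0 : 0 < X := (exp_pos _).trans_le hX
  have hlogw : 0 < Real.log w := log_pos (by linarith)
  refine (hw X 𝒯 T (by push_cast; rwa [← pow_mul]) hT h𝒯 hTX).trans ?_
  have hα : 0 ≤ a - 2 / w := by
    have : 2 / (w : ℝ) ≤ a := by
      rw [div_le_iff₀ ha] at hw2
      rw [div_le_iff₀ (by linarith)]; linarith
    linarith
  set W := w ^ 4 with hW
  have hWc : (W : ℝ) = (w : ℝ) ^ 4 := by rw [hW]; push_cast; rfl
  have key : ∀ v ∈ Ico (W ^ 42) (W ^ 44), ∑ t ∈ 𝒯, ‖QQ f ((W : ℝ) ^ 40) v t *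
        DD f (X * exp (-(v / (W : ℝ) ^ 40))) (2 * (X * exp (-(v / (W : ℝ) ^ 40)))) t‖ ^ 2 ≤
        w ^ 44 * (10 ^ 7 * exp (-(1 * w))) := by
    intro v hv
    obtain ⟨b1, b2⟩ := ve_bounds (Nat.one_le_pow _ _ (by omega)) hv
    set y := (v : ℝ) / (W : ℝ) ^ 40 with hy
    rw [hWc, ← pow_mul] at b1 b2
    norm_num at b1 b2
    set D : ℤ → ℂ := fun t => DD f (X * exp (-y)) (2 * (X * exp (-y))) t with hD
    have hu : ∀ u ∈ Ico (w ^ 42) (w ^ 44), ∑ t ∈ 𝒯.filter fun t =>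
        exp (-((a - 2 / w) * (u / (w : ℝ) ^ 40))) < ‖QQ f ((w : ℝ) ^ 40) u t‖, ‖QQ f ((W : ℝ) ^ 40) v t * D t‖ ^ 2 ≤
        10 ^ 7 * exp (-(1 * w)) := by
      intro u hu
      obtain ⟨c1, c2⟩ := ve_bounds (by omega) hu
      set x := (u : ℝ) / (w : ℝ) ^ 40 with hx
      set B := 𝒯.filter fun t => exp (-((a - 2 / w) * x)) < ‖QQ f ((w : ℝ) ^ 40) u t‖ with hB
      have x0 : 0 < x := lt_of_lt_of_le (by positivity) c1
      set l := ⌈y / x⌉₊ with hl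
      have l1 : y ≤ l * x := by have := le_ceil (y / x); rwa [div_le_iff₀ x0] at this
      have y0 : 0 ≤ y := by positivity
      have l2 : l * x ≤ y + x := by
        have := (Nat.ceil_lt_add_one (show 0 ≤ y / x by positivity)).le
        calc (l : ℝ) * x ≤ (y / x + 1) * x := by gcongr
          _ = y + x := by field_simp
      have l3 : (l : ℝ) ≤ y / w ^ 2 + 1 := by
        have := (Nat.ceil_lt_add_one (show 0 ≤ y / x by positivity)).le
        refine this.trans (by gcongr)
      obtain ⟨f1, f2⟩ := hfb y l ((pow_le_pow_right₀ w1 (by norm_num)).trans b1)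
        (b2.trans (pow_le_pow_right₀ w1 (by norm_num))) l3
      have bp := bad_power hf hb (Y0 := X * exp (-y)) (one_le_pow₀ w1 : (1:ℝ) ≤ (w : ℝ) ^ 40) (by positivity) u l f2
        (Ioc ⌊X * exp (-y)⌋₊ ⌊2 * (X * exp (-y))⌋₊) (fun n hn => (mem_Iof (by positivity) (by positivity)).mp hn)
        B T hT (fun t ht => h𝒯 t (mem_filter.mp ht).1) (by
          rw [mul_assoc, ← exp_add]
          have : 1 ≤ exp (-y + l * x) := one_le_exp (by linarith)
          nlinarith) (fun t ht => (mem_filter.mp ht).2)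
      calc _ ≤ ∑ t ∈ B, exp (-(2 * ((a - 2 / W) * y))) * ‖D t‖ ^ 2 := by
            refine sum_le_sum fun t ht => ?_
            rw [norm_mul, mul_pow]
            gcongr
            have := (hg t (mem_filter.mp ht).1).1 v hv
            calc _ ≤ exp (-((a - 2 / W) * y)) ^ 2 := by gcongr
              _ = _ := by rw [← exp_nat_mul]; congr 1; push_cast; ring
        _ ≤ exp (-(2 * ((a - 2 / W) * y))) * (exp (2 * (a - 2 / w) * (l * x)) * (10 ^ 7 * exp (y / w))) := by
            rw [← mul_sum]; gcongr; exact bp.trans (by gcongr)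
        _ = 10 ^ 7 * exp (-(2 * ((a - 2 / W) * y)) + 2 * (a - 2 / w) * (l * x) + y / w) := by
            rw [exp_add, exp_add]; ring
        _ ≤ _ := by
            gcongr
            have h1 : 2 * (a - 2 / w) * (l * x) ≤ 2 * (a - 2 / w) * (y + w ^ 4) := by gcongr; linarith
            have h2 : (a - 2 / w) * (w : ℝ) ^ 4 ≤ 1 * (w : ℝ) ^ 4 := by
              gcongr; have : 0 ≤ 2 / (w : ℝ) := by positivity
              linarith
            have h3 : 2 / (W : ℝ) * y ≤ 1 / 2 * (y / w) := by
              rw [hWc]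
              have : (w : ℝ) ^ 4 = w ^ 3 * w := by ring
              rw [this, ← div_div, div_mul_eq_mul_div, mul_div_assoc]
              refine mul_le_mul_of_nonneg_right ?_ (by positivity)
              rw [div_le_iff₀ (by positivity)]
              have : (4:ℝ) ≤ w ^ 3 := w4.trans (le_self_pow₀ w1 (by norm_num))
              linarith
            have h4 : 2 / (w : ℝ) * y = 2 * (y / w) := by ring
            have h5 : (w : ℝ) ^ 7 ≤ y / w := by rw [le_div_iff₀ (by linarith), ← pow_succ]; exact b1
            have h6 : 2 * (w : ℝ) ^ 4 + w ≤ w ^ 7 := by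
              have : (64 : ℝ) ≤ w ^ 3 := by
                calc (64 : ℝ) = 4 ^ 3 := by norm_num
                  _ ≤ _ := by gcongr
              have e7 : (w : ℝ) ^ 7 = w ^ 3 * w ^ 4 := by ring
              have : (w : ℝ) ≤ w ^ 4 := le_self_pow₀ w1 (by norm_num)
              have := mul_le_mul_of_nonneg_right ‹(64:ℝ) ≤ w ^ 3› (show (0:ℝ) ≤ (w : ℝ) ^ 4 by positivity)
              linarith
            linarith
    calc _ ≤ ∑ u ∈ Ico (w ^ 42) (w ^ 44), ∑ t ∈ 𝒯.filter fun t =>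
        exp (-((a - 2 / w) * (u / (w : ℝ) ^ 40))) < ‖QQ f ((w : ℝ) ^ 40) u t‖, ‖QQ f ((W : ℝ) ^ 40) v t * D t‖ ^ 2 :=
          sum_cover _ _ _ _ (fun _ => sq_nonneg _) (fun t ht => bad_ex (hg t ht).2)
      _ ≤ _ := by
          refine (sum_le_card_nsmul _ _ _ hu).trans ?_
          rw [nsmul_eq_mul]; gcongr; exact card_V w
  have h2 := sum_le_card_nsmul _ _ _ key
  rw [nsmul_eq_mul] at h2
  have h3 : 1 / Real.log W ≤ 1 / Real.log w := by
    rw [hWc]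
    exact one_div_le_one_div_of_le hlogw (log_le_log (by linarith) (le_self_pow₀ w1 (by norm_num)))
  calc _ ≤ 2 * (W : ℝ) ^ 44 * (W ^ 44 * (w ^ 44 * (10 ^ 7 * exp (-(1 * w))))) + 4000000 * (1 / Real.log W) := by
        rw [mul_one_div]; gcongr; exact h2.trans (by gcongr; exact card_V W)
    _ = 2 * 10 ^ 7 * (w : ℝ) ^ 396 * exp (-(1 * w)) + 4000000 * (1 / Real.log W) := by rw [hWc]; ring
    _ ≤ 1 / Real.log w + 4000000 * (1 / Real.log w) := by gcongr
    _ = _ := by ring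
/-- counting the last bad set -/
lemma stage3 {f : ℕ → ℂ} (hf : ∀ m n, f (m * n) = f m * f n) (hb : ∀ n, ‖f n‖ ≤ 1) (hf1 : f 1 = 1) {a : ℝ} (ha : 0 < a) :
    ∀ᶠ w : ℕ in atTop, ∀ (X : ℝ) (𝒯 : Finset ℤ) (T : ℕ), 1 ≤ T → (∀ t ∈ 𝒯, |t| ≤ T) →
      (T : ℝ) ≤ X → (w : ℝ) ^ 8 ≤ Real.log X → Real.log X ≤ (w : ℝ) ^ 32 → (∀ t ∈ 𝒯, ¬ good f a w t) →
      (𝒯.card : ℝ) ≤ X ^ (4 * a) := by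
  classical
  have ev2 : ∀ᶠ w : ℕ in atTop, 4 / a ≤ w := tendsto_natCast_atTop_atTop.eventually_ge_atTop (4 / a)
  filter_upwards [ev2, ev_pow_exp (10 ^ 7) 44 one_pos, fact_bd, eventually_ge_atTop 4] with
    w hw2 hw3 hfb hw4 X 𝒯 T hT h𝒯 hTX hX1 hX2 hg
  have w4 : (4 : ℝ) ≤ w := by exact_mod_cast hw4
  have w1 : (1 : ℝ) ≤ w := by linarith
  have X0 : 0 < X := lt_of_lt_of_le (by exact_mod_cast hT) hTX
  have h2w : 2 / (w : ℝ) ≤ a / 2 := by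
    rw [div_le_iff₀ ha] at hw2
    rw [div_le_div_iff₀ (by linarith) (by norm_num)]; linarith
  set z := Real.log X with hz
  have z0 : 0 < z := lt_of_lt_of_le (by positivity) hX1
  have hu : ∀ u ∈ Ico (w ^ 42) (w ^ 44), ∑ t ∈ 𝒯.filter fun t =>
      exp (-((a - 2 / w) * (u / (w : ℝ) ^ 40))) < ‖QQ f ((w : ℝ) ^ 40) u t‖, (1 : ℝ) ≤
      10 ^ 7 * exp (3 * a * z + z / w) := by
    intro u hu
    obtain ⟨c1, c2⟩ := ve_bounds (by omega) hu
    set x := (u : ℝ) / (w : ℝ) ^ 40 with hx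
    set B := 𝒯.filter fun t => exp (-((a - 2 / w) * x)) < ‖QQ f ((w : ℝ) ^ 40) u t‖ with hB
    have x0 : 0 < x := lt_of_lt_of_le (by positivity) c1
    set l := ⌈z / x⌉₊ with hl
    have l1 : z ≤ l * x := by have := le_ceil (z / x); rwa [div_le_iff₀ x0] at this
    have l0 := (Nat.ceil_lt_add_one (show 0 ≤ z / x by positivity)).le
    have l2 : l * x ≤ z + x := by
      calc (l : ℝ) * x ≤ (z / x + 1) * x := by gcongr
        _ = z + x := by field_simp
    obtain ⟨f1, f2⟩ := hfb z l ((pow_le_pow_right₀ w1 (by norm_num)).trans hX1) hX2 (l0.trans (by gcongr))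
    have bp := bad_power hf hb (Y0 := 1 / 2) (one_le_pow₀ w1 : (1:ℝ) ≤ (w : ℝ) ^ 40) (by norm_num) u l f2
      {1} (by simp; norm_num) B T hT (fun t ht => h𝒯 t (mem_filter.mp ht).1) (by
        rw [← mul_assoc]; norm_num
        calc (T : ℝ) ≤ X := hTX
          _ = exp z := (exp_log X0).symm
          _ ≤ _ := exp_le_exp.mpr l1) (fun t ht => (mem_filter.mp ht).2)
    have e1 : ∀ t : ℤ, ‖∑ n ∈ ({1} : Finset ℕ), GG f t n‖ ^ 2 = 1 := fun t => by simp [GG, hf1, ee_zero]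
    simp_rw [e1] at bp
    refine bp.trans ?_
    calc _ ≤ exp (2 * (a - 2 / w) * (l * x)) * (10 ^ 7 * exp (z / w)) := by gcongr
      _ = 10 ^ 7 * exp (2 * (a - 2 / w) * (l * x) + z / w) := by rw [exp_add]; ring
      _ ≤ _ := by
        gcongr 10 ^ 7 * exp (?_ + _)
        have h1 : (w : ℝ) ^ 4 ≤ z / 2 := by
          have : (w : ℝ) ^ 8 = w ^ 4 * w ^ 4 := by ring
          have h4 : (4 : ℝ) ≤ w ^ 4 := w4.trans (le_self_pow₀ w1 (by norm_num))
          have := mul_le_mul_of_nonneg_right h4 (show (0:ℝ) ≤ (w : ℝ) ^ 4 by positivity)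
          linarith
        calc 2 * (a - 2 / w) * (l * x) ≤ 2 * a * (z + z / 2) := by
              have : 0 ≤ 2 / (w : ℝ) := by positivity
              gcongr <;> linarith
          _ = 3 * a * z := by ring
  have h1 : (𝒯.card : ℝ) = ∑ t ∈ 𝒯, (1 : ℝ) := by simp
  have h3 := (sum_cover 𝒯 _ _ (fun _ => (1 : ℝ)) (fun _ => zero_le_one) (fun t ht => bad_ex (hg t ht))).trans
    (sum_le_card_nsmul _ _ _ hu)
  rw [h1]
  refine h3.trans ?_
  rw [nsmul_eq_mul, Real.rpow_def_of_pos X0, ← hz]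
  have h5 : 10 ^ 7 * (w : ℝ) ^ 44 ≤ exp (z / w) := by
    have h6 : 10 ^ 7 * (w : ℝ) ^ 44 * exp (-(1 * w)) ≤ 1 := hw3.trans (by
      rw [div_le_one (log_pos (by linarith)), le_log_iff_exp_le (by linarith)]
      linarith [exp_one_lt_d9])
    have h7 := mul_le_mul_of_nonneg_right h6 (exp_pos w).le
    rw [mul_assoc, ← exp_add] at h7
    simp only [one_mul, neg_add_cancel, exp_zero, mul_one] at h7
    refine h7.trans (exp_le_exp.mpr ?_)
    rw [le_div_iff₀ (by linarith), ← sq]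
    exact (pow_le_pow_right₀ w1 (by norm_num)).trans hX1
  calc _ ≤ (w : ℝ) ^ 44 * (10 ^ 7 * exp (3 * a * z + z / w)) := by gcongr; exact card_V w
    _ = (10 ^ 7 * (w : ℝ) ^ 44) * exp (3 * a * z + z / w) := by ring
    _ ≤ exp (z / w) * exp (3 * a * z + z / w) := by gcongr
    _ = exp (3 * a * z + 2 / w * z) := by rw [← exp_add]; congr 1; ring
    _ ≤ _ := by
      gcongr
      have := mul_le_mul_of_nonneg_right h2w z0.le
      nlinarith
open Classical in
/-- the chain of stages -/
lemma chain {f : ℕ → ℂ} (hf : ∀ m n, f (m * n) = f m * f n) (hb : ∀ n, ‖f n‖ ≤ 1) {a : ℝ} (ha : 0 < a) (ha1 : a ≤ 1) :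
    ∃ w0 : ℕ, 3 ≤ w0 ∧ ∀ (X : ℝ) (𝒯 : Finset ℤ) (T : ℕ), 1 ≤ T → (∀ t ∈ 𝒯, |t| ≤ T) → (T : ℝ) ≤ X →
      ∀ w : ℕ, w0 ≤ w → (w : ℝ) ^ 8 ≤ Real.log X → ∃ w' : ℕ, w ≤ w' ∧ (w' : ℝ) ^ 8 ≤ Real.log X ∧
        Real.log X < (w' : ℝ) ^ 32 ∧ EN f X (𝒯.filter fun t => ¬ good f a w t) ≤
          EN f X (𝒯.filter fun t => ¬ good f a w' t) + 2 * (4000001 / Real.log w) := by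
  obtain ⟨w0, hw0⟩ := eventually_atTop.mp (stage2 hf hb ha ha1)
  refine ⟨max w0 3, le_max_right _ _, fun X 𝒯 T hT h𝒯 hTX => ?_⟩
  have X0 : 0 < X := lt_of_lt_of_le (by exact_mod_cast hT) hTX
  suffices H : ∀ n w : ℕ, max w0 3 ≤ w → ⌊Real.log X⌋₊ - w ≤ n → (w : ℝ) ^ 8 ≤ Real.log X → ∃ w' : ℕ, w ≤ w' ∧
      (w' : ℝ) ^ 8 ≤ Real.log X ∧ Real.log X < (w' : ℝ) ^ 32 ∧ EN f X (𝒯.filter fun t => ¬ good f a w t) ≤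
          EN f X (𝒯.filter fun t => ¬ good f a w' t) + 2 * (4000001 / Real.log w) from
    fun w hw hX => H _ w hw le_rfl hX
  intro n
  induction n with
  | zero =>
    intro w hw hn hX
    have w3 : 3 ≤ w := (le_max_right _ _).trans hw
    exfalso
    have h1 : w ^ 8 ≤ ⌊Real.log X⌋₊ := le_floor (by exact_mod_cast hX)
    have h2 : w < w ^ 8 := lt_self_pow₀ (by omega) (by norm_num)
    omega
  | succ n ih =>
    intro w hw hn hX
    have w3 : 3 ≤ w := (le_max_right _ _).trans hw
    have w3' : (3 : ℝ) ≤ w := by exact_mod_cast w3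
    have hl : 0 < Real.log w := log_pos (by linarith)
    rcases lt_or_ge (Real.log X) ((w : ℝ) ^ 32) with h | h
    · exact ⟨w, le_rfl, hX, h, le_add_of_nonneg_right (by positivity)⟩
    have hlt : w < w ^ 4 := lt_self_pow₀ (by omega) (by norm_num)
    have hX' : ((w ^ 4 : ℕ) : ℝ) ^ 8 ≤ Real.log X := by push_cast; rwa [← pow_mul]
    have hfl : w < ⌊Real.log X⌋₊ := by
      have h1 : w ^ 8 ≤ ⌊Real.log X⌋₊ := le_floor (by exact_mod_cast hX)
      exact lt_of_lt_of_le (lt_self_pow₀ (by omega) (by norm_num)) h1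
    obtain ⟨w', h1, h2, h3, h4⟩ := ih (w ^ 4) (hw.trans hlt.le) (by omega) hX'
    refine ⟨w', hlt.le.trans h1, h2, h3, ?_⟩
    have st := hw0 w ((le_max_left _ _).trans hw) X (𝒯.filter fun t => good f a (w ^ 4) t ∧ ¬ good f a w t) T hT
      (fun t ht => h𝒯 t (mem_filter.mp ht).1) hTX (by
        rw [← le_log_iff_exp_le X0]; exact (pow_le_pow_right₀ (by linarith) (by norm_num)).trans h)
      (fun t ht => (mem_filter.mp ht).2)
    have e : Real.log ((w ^ 4 : ℕ) : ℝ) = 4 * Real.log w := by push_cast; rw [log_pow]; norm_num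
    rw [e] at h4
    have h5 : EN f X (𝒯.filter fun t => ¬ good f a w t) ≤ EN f X (𝒯.filter fun t => ¬ good f a (w ^ 4) t) +
        EN f X (𝒯.filter fun t => good f a (w ^ 4) t ∧ ¬ good f a w t) := by
      simp only [EN, sum_filter]
      rw [← sum_add_distrib]
      refine sum_le_sum fun t _ => ?_
      have := sq_nonneg ‖DD f X (2 * X) t‖
      by_cases g1 : good f a w t <;> by_cases g2 : good f a (w ^ 4) t <;> simp [g1, g2]
    have h6 : 2 * (4000001 / (4 * Real.log w)) = 4000001 / Real.log w / 2 := by field_simp; norm_num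
    have h7 : 0 < 4000001 / Real.log w := by positivity
    linarith
end
section
namespace Sel
open BoundingSieve
open scoped ArithmeticFunction.Moebius
variable (s : BoundingSieve) (R : ℕ)
def DR : Finset ℕ := (divisors s.prodPrimes).filter (· ≤ R)
noncomputable def SR : ℝ := ∑ l ∈ DR s R, s.selbergTerms l
noncomputable def wt (d : ℕ) : ℝ :=
  (s.nu d)⁻¹ * μ d * (∑ l ∈ DR s R, if d ∣ l then s.selbergTerms l else 0) / SR s R
lemma mem_DR {d : ℕ} : d ∈ DR s R ↔ d ∣ s.prodPrimes ∧ d ≤ R := by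
  simp [DR, prodPrimes_ne_zero]
lemma SR_pos (hR : 1 ≤ R) : 0 < SR s R :=
  sum_pos (fun l hl => selbergTerms_pos ((mem_DR s R).1 hl).1)
    ⟨1, (mem_DR s R).2 ⟨one_dvd _, hR⟩⟩
lemma wt_one (hR : 1 ≤ R) : wt s R 1 = 1 := by
  have := (SR_pos s R hR).ne'
  rw [wt, s.nu_mult.map_one]
  simp only [one_dvd, if_true, ArithmeticFunction.moebius_apply_one, Int.cast_one, inv_one, one_mul]
  exact div_self this
lemma wt_zero {d : ℕ} (hd : R < d) : wt s R d = 0 := by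
  have : (∑ l ∈ DR s R, if d ∣ l then s.selbergTerms l else 0) = 0 := by
    refine sum_eq_zero fun l hl => if_neg fun h => ?_
    have h1 := (mem_DR s R).1 hl
    have := le_of_dvd (Nat.pos_of_ne_zero (ne_zero_of_dvd_ne_zero prodPrimes_ne_zero h1.1)) h
    omega
  rw [wt, this]; simp
lemma wt_le (hR : 1 ≤ R) {d : ℕ} (hd : d ∣ s.prodPrimes) : |wt s R d| ≤ 1 := by
  have hS := SR_pos s R hR
  have hn := nu_pos_of_dvd_prodPrimes hd
  have hg := selbergTerms_pos hd
  set A := (∑ l ∈ DR s R, if d ∣ l then s.selbergTerms l else 0) with hA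
  have hA0 : 0 ≤ A := sum_nonneg fun l hl => by
    split_ifs
    · exact (selbergTerms_pos ((mem_DR s R).1 hl).1).le
    · rfl
  have key : (s.selbergTerms d * (s.nu d)⁻¹) * A ≤ s.selbergTerms d * SR s R := by
    rw [← sum_divisors_selbergTerms_eq_selbergTerms_mul_nu_inv hd, hA, ← sum_filter,
      ← sum_filter, sum_mul_sum, ← sum_product', SR, mul_sum]
    have hfac : ∀ x ∈ ((divisors s.prodPrimes).filter (· ∣ d)) ×ˢ ((DR s R).filter (d ∣ ·)),
        ∃ m, x.2 = d * m ∧ d.Coprime m ∧ x.1 ∣ d ∧ x.1 * (x.2 / d) = x.1 * m ∧ x.2 ∣ s.prodPrimes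
          ∧ x.2 ≤ R := by
      rintro ⟨k, l⟩ hx
      simp only [mem_product, mem_filter, mem_DR, mem_divisors] at hx
      obtain ⟨m, rfl⟩ := hx.2.2
      refine ⟨m, rfl, ?_, hx.1.2, ?_, hx.2.1⟩
      · exact Nat.coprime_of_squarefree_mul (squarefree_of_dvd_prodPrimes hx.2.1.1)
      · simp only
        rw [Nat.mul_div_cancel_left _ (Nat.pos_of_ne_zero (ne_zero_of_dvd_ne_zero prodPrimes_ne_zero hd))]
    have himg : ∀ x ∈ ((divisors s.prodPrimes).filter (· ∣ d)) ×ˢ ((DR s R).filter (d ∣ ·)),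
        x.1 * (x.2 / d) ∈ DR s R := by
      intro x hx
      obtain ⟨m, h1, h2, h3, h4, h5, h6⟩ := hfac x hx
      rw [h4, mem_DR]
      have hdv : x.1 * m ∣ x.2 := h1 ▸ Nat.mul_dvd_mul_right h3 m
      exact ⟨hdv.trans h5, (le_of_dvd (Nat.pos_of_ne_zero
        (ne_zero_of_dvd_ne_zero prodPrimes_ne_zero h5)) hdv).trans h6⟩
    calc _ = ∑ x ∈ ((divisors s.prodPrimes).filter (· ∣ d)) ×ˢ ((DR s R).filter (d ∣ ·)),
          s.selbergTerms d * s.selbergTerms (x.1 * (x.2 / d)) := by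
          refine sum_congr rfl fun x hx => ?_
          obtain ⟨m, h1, h2, h3, h4, h5, h6⟩ := hfac x hx
          rw [h4, h1, selbergTerms_isMultiplicative.map_mul_of_coprime h2,
            selbergTerms_isMultiplicative.map_mul_of_coprime (h2.coprime_dvd_left h3)]
          ring
      _ = ∑ y ∈ (((divisors s.prodPrimes).filter (· ∣ d)) ×ˢ ((DR s R).filter (d ∣ ·))).image
            (fun x => x.1 * (x.2 / d)), s.selbergTerms d * s.selbergTerms y := by
          rw [sum_image]
          intro x hx y hy hxy
          obtain ⟨m, h1, h2, h3, h4, h5, h6⟩ := hfac x hx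
          obtain ⟨m', h1', h2', h3', h4', h5', h6'⟩ := hfac y hy
          simp only [h4, h4'] at hxy
          have hk : x.1 = y.1 := by
            apply Nat.dvd_antisymm
            · exact ((h2'.coprime_dvd_left h3).dvd_of_dvd_mul_right (hxy ▸ Dvd.intro _ rfl))
            · exact ((h2.coprime_dvd_left h3').dvd_of_dvd_mul_right (hxy ▸ Dvd.intro _ rfl))
          have h0 : 0 < y.1 := Nat.pos_of_ne_zero fun h => by
            rw [h, zero_dvd_iff] at h3'; exact prodPrimes_ne_zero (zero_dvd_iff.1 (h3' ▸ hd))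
          rw [hk] at hxy
          have := eq_of_mul_eq_mul_left h0 hxy
          exact Prod.ext hk (by rw [h1, h1', this])
      _ ≤ _ := sum_le_sum_of_subset_of_nonneg
          (fun y hy => by
            obtain ⟨x, hx, rfl⟩ := mem_image.1 hy
            exact himg x hx)
          (fun y hy _ => mul_nonneg hg.le (selbergTerms_pos ((mem_DR s R).1 hy).1).le)
  have key2 : (s.nu d)⁻¹ * A ≤ SR s R := by
    rw [mul_assoc] at key; exact le_of_mul_le_mul_left key hg
  have hmu : |((μ d : ℤ) : ℝ)| ≤ 1 := by
    have := ArithmeticFunction.abs_moebius_le_one (n := d); exact_mod_cast this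
  rw [wt, abs_div, abs_of_pos hS, div_le_one hS, abs_mul, abs_mul, abs_of_pos (inv_pos.2 hn),
    abs_of_nonneg hA0]
  calc _ ≤ (s.nu d)⁻¹ * 1 * A := by
        exact mul_le_mul_of_nonneg_right (mul_le_mul_of_nonneg_left hmu (inv_pos.2 hn).le) hA0
    _ ≤ _ := by rw [mul_one]; exact key2
lemma inner_sum {l : ℕ} (hl : l ∣ s.prodPrimes) :
    (∑ d ∈ s.prodPrimes.divisors, if l ∣ d then s.nu d * wt s R d else 0)
      = if l ≤ R then μ l * s.selbergTerms l / SR s R else 0 := by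
  have hsq : ∀ {m}, m ∣ s.prodPrimes → Squarefree m := squarefree_of_dvd_prodPrimes
  have hmob : ∀ m, m ∣ s.prodPrimes → (∑ d ∈ s.prodPrimes.divisors,
      if l ∣ d ∧ d ∣ m then ((μ d : ℤ) : ℝ) else 0) = if m = l then ((μ l : ℤ) : ℝ) else 0 := by
    intro m hm
    have hm0 : m ≠ 0 := ne_zero_of_dvd_ne_zero prodPrimes_ne_zero hm
    by_cases hlm : l ∣ m
    · obtain ⟨k, rfl⟩ := hlm
      have hl0 : 0 < l := Nat.pos_of_ne_zero (left_ne_zero_of_mul hm0)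
      have hk0 : k ≠ 0 := right_ne_zero_of_mul hm0
      have : (∑ d ∈ s.prodPrimes.divisors, if l ∣ d ∧ d ∣ l * k then ((μ d : ℤ) : ℝ) else 0)
          = ∑ e ∈ k.divisors, ((μ l : ℤ) : ℝ) * μ e := by
        rw [← sum_filter]
        symm
        refine sum_bij (fun e _ => l * e) ?_ ?_ ?_ ?_
        · intro e he
          have := Nat.mul_dvd_mul_left l (Nat.dvd_of_mem_divisors he)
          simp only [mem_filter, mem_divisors]
          exact ⟨⟨this.trans hm, prodPrimes_ne_zero⟩, Dvd.intro _ rfl, this⟩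
        · intro a _ b _ h; exact eq_of_mul_eq_mul_left hl0 h
        · intro d hd
          simp only [mem_filter, mem_divisors] at hd
          obtain ⟨e, rfl⟩ := hd.2.1
          exact ⟨e, mem_divisors.2 ⟨Nat.dvd_of_mul_dvd_mul_left hl0 hd.2.2, hk0⟩, rfl⟩
        · intro e he
          have hc : l.Coprime e := (Nat.coprime_of_squarefree_mul (hsq hm)).coprime_dvd_right
            (Nat.dvd_of_mem_divisors he)
          rw [ArithmeticFunction.isMultiplicative_moebius.map_mul_of_coprime hc]; push_cast; rfl
      rw [this, ← mul_sum]
      have h2 : (∑ e ∈ k.divisors, ((μ e : ℤ) : ℝ)) = if k = 1 then 1 else 0 := by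
        have h3 := congrArg (fun F : ArithmeticFunction ℤ => ((F k : ℤ) : ℝ))
          ArithmeticFunction.moebius_mul_coe_zeta
        simp only [ArithmeticFunction.coe_mul_zeta_apply, ArithmeticFunction.one_apply] at h3
        push_cast at h3; exact h3
      rw [h2]
      have : l * k = l ↔ k = 1 := by
        constructor
        · intro h; exact eq_of_mul_eq_mul_left hl0 (by omega)
        · rintro rfl; simp
      simp [this]
    · rw [if_neg (by rintro rfl; exact hlm dvd_rfl)]
      exact sum_eq_zero fun d _ => if_neg fun h => hlm (h.1.trans h.2)
  calc _ = ∑ d ∈ s.prodPrimes.divisors, ∑ m ∈ DR s R,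
        (if l ∣ d ∧ d ∣ m then ((μ d : ℤ) : ℝ) else 0) * s.selbergTerms m / SR s R := by
        refine sum_congr rfl fun d hd => ?_
        have hn := nu_ne_zero (s := s) (Nat.dvd_of_mem_divisors hd)
        by_cases hld : l ∣ d
        · simp only [hld, if_true, true_and, wt]
          rw [mul_div_assoc', ← mul_assoc, ← mul_assoc, mul_inv_cancel₀ hn, one_mul, mul_sum,
            sum_div]
          refine sum_congr rfl fun m _ => ?_
          split_ifs <;> simp
        · simp [hld]
    _ = ∑ m ∈ DR s R, (if m = l then ((μ l : ℤ) : ℝ) else 0) * s.selbergTerms m / SR s R := by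
        rw [sum_comm]
        refine sum_congr rfl fun m hm => ?_
        rw [← hmob m ((mem_DR s R).1 hm).1, ← sum_div, ← sum_mul]
    _ = _ := by
        simp only [ite_mul, zero_mul, ite_div, zero_div, sum_ite_eq', mem_DR, hl, true_and]
lemma main_eq (hR : 1 ≤ R) : s.mainSum (lambdaSquared (wt s R)) = 1 / SR s R := by
  have hS := SR_pos s R hR
  rw [mainSum_lambdaSquared_eq_sum_mul_sum_sq]
  calc _ = ∑ l ∈ s.prodPrimes.divisors, if l ≤ R then s.selbergTerms l / (SR s R)^2 else 0 := by
        refine sum_congr rfl fun l hl => ?_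
        have hl' := Nat.dvd_of_mem_divisors hl
        have hg := (selbergTerms_pos hl').ne'
        rw [inner_sum s R hl']
        split_ifs
        · have hm : ((μ l : ℤ) : ℝ)^2 = 1 := by
            have := ArithmeticFunction.moebius_sq_eq_one_of_squarefree (squarefree_of_dvd_prodPrimes hl')
            exact_mod_cast this
          rw [div_pow, mul_pow, hm]; field_simp
        · simp
    _ = _ := by
        rw [← sum_filter, ← sum_div]
        change SR s R / _ = _
        field_simp
lemma err_le (hR : 1 ≤ R) : s.errSum (lambdaSquared (wt s R)) ≤
    ∑ d1 ∈ DR s R, ∑ d2 ∈ DR s R, |s.rem (d1.lcm d2)| := by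
  have h1 : ∀ d ∈ s.prodPrimes.divisors, |lambdaSquared (wt s R) d| ≤
      ∑ d1 ∈ DR s R, ∑ d2 ∈ DR s R, if d1.lcm d2 = d then 1 else 0 := by
    intro d hd
    have hd' := Nat.dvd_of_mem_divisors hd
    have hsub : d.divisors ⊆ s.prodPrimes.divisors := Nat.divisors_subset_of_dvd prodPrimes_ne_zero hd'
    have e : lambdaSquared (wt s R) d = ∑ d1 ∈ d.divisors.filter (· ≤ R),
        ∑ d2 ∈ d.divisors.filter (· ≤ R), if d = d1.lcm d2 then wt s R d1 * wt s R d2 else 0 := by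
      rw [lambdaSquared]
      simp only [sum_filter]
      refine sum_congr rfl fun a _ => ?_
      split_ifs with h
      · refine sum_congr rfl fun b _ => ?_
        split_ifs with h2 h3 <;> first | rfl | simp [wt_zero s R (not_le.1 h3)]
      · exact sum_eq_zero fun b _ => by simp [wt_zero s R (not_le.1 h)]
    rw [e]
    have hs2 : d.divisors.filter (· ≤ R) ⊆ DR s R := Finset.filter_subset_filter _ hsub
    refine (abs_sum_le_sum_abs _ _).trans ((sum_le_sum fun a ha =>
      (abs_sum_le_sum_abs _ _).trans (sum_le_sum (g := fun b => if a.lcm b = d then (1:ℝ) else 0)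
        fun b hb => ?_)).trans
      ((sum_le_sum fun a _ => sum_le_sum_of_subset_of_nonneg hs2
        fun b _ _ => by split_ifs <;> norm_num).trans
      (sum_le_sum_of_subset_of_nonneg hs2 fun a _ _ => sum_nonneg
        fun b _ => by split_ifs <;> norm_num)))
    by_cases h : a.lcm b = d
    · rw [if_pos h.symm, if_pos h, abs_mul]
      exact mul_le_one₀ (wt_le s R hR ((mem_DR s R).1 (hs2 ha)).1) (abs_nonneg _)
        (wt_le s R hR ((mem_DR s R).1 (hs2 hb)).1)
    · rw [if_neg (Ne.symm h), if_neg h, abs_zero]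
  rw [errSum]
  refine (sum_le_sum fun d hd => mul_le_mul_of_nonneg_right (h1 d hd) (abs_nonneg _)).trans
    (le_of_eq ?_)
  simp only [sum_mul, ite_mul, one_mul, zero_mul]
  rw [sum_comm]
  refine sum_congr rfl fun a ha => ?_
  rw [sum_comm]
  refine sum_congr rfl fun b hb => ?_
  rw [sum_ite_eq, if_pos]
  exact mem_divisors.2 ⟨Nat.lcm_dvd ((mem_DR s R).1 ha).1 ((mem_DR s R).1 hb).1, prodPrimes_ne_zero⟩
lemma SR_ge (G : ℕ →* ℝ) (hG0 : ∀ n, 0 ≤ G n) (hG1 : ∀ p : ℕ, p.Prime → G p < 1)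
    (hGp : ∀ p : ℕ, p.Prime → p ∣ s.prodPrimes → G p = s.nu p)
    (hP : ∀ p : ℕ, p.Prime → p ≤ R → p ∣ s.prodPrimes) : ∑ n ∈ Icc 1 R, G n ≤ SR s R := by
  have hmaps : ∀ n ∈ Icc 1 R, UniqueFactorizationMonoid.radical n ∈ DR s R := by
    intro n hn
    obtain ⟨h1, h2⟩ := mem_Icc.1 hn
    have h0 : n ≠ 0 := by omega
    have hle : UniqueFactorizationMonoid.radical n ≤ n :=
      le_of_dvd (by omega) UniqueFactorizationMonoid.radical_dvd_self
    refine (mem_DR s R).2 ⟨?_, hle.trans h2⟩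
    rw [Nat.radical_eq_prod_primeFactors] 
    refine Finset.prod_primes_dvd _ (fun p hp => (Nat.prime_of_mem_primeFactors hp).prime) fun p hp => ?_
    exact hP p (Nat.prime_of_mem_primeFactors hp) ((le_of_dvd (by omega) (Nat.dvd_of_mem_primeFactors hp)).trans h2)
  rw [← Finset.sum_fiberwise_of_maps_to hmaps, SR]
  refine sum_le_sum fun l hl => ?_
  obtain ⟨hl1, hl2⟩ := (mem_DR s R).1 hl
  have hl0 : 0 < l := Nat.pos_of_ne_zero (ne_zero_of_dvd_ne_zero prodPrimes_ne_zero hl1)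
  have hGl : G l = s.nu l := by
    rw [← prod_primeFactors_nu hl1]
    conv_lhs => rw [← Nat.prod_primeFactors_of_squarefree (squarefree_of_dvd_prodPrimes hl1)]
    rw [map_prod]
    exact prod_congr rfl fun p hp =>
      hGp p (Nat.prime_of_mem_primeFactors hp) ((Nat.dvd_of_mem_primeFactors hp).trans hl1)
  have hs := (EulerProduct.summable_and_hasSum_factoredNumbers_prod_filter_prime_geometric (f := G)
    (fun {p} hp => by rw [norm_of_nonneg (hG0 p)]; exact hG1 p hp) l.primeFactors).2
  have hs := (hasSum_subtype_iff_indicator (f := (G : ℕ → ℝ))).1 hs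
  have hprod : ∏ p ∈ l.primeFactors with p.Prime, (1 - G p)⁻¹ = ∏ p ∈ l.primeFactors, (1 - s.nu p)⁻¹ := by
    rw [Finset.filter_true_of_mem fun p hp => Nat.prime_of_mem_primeFactors hp]
    exact prod_congr rfl fun p hp => by
      rw [hGp p (Nat.prime_of_mem_primeFactors hp) ((Nat.dvd_of_mem_primeFactors hp).trans hl1)]
  rw [hprod] at hs
  rw [selbergTerms_apply, ← hGl]
  set B := (Icc 1 R).filter (fun n => UniqueFactorizationMonoid.radical n = l)
  have hB : ∀ n ∈ B, n = l * (n / l) ∧ (n / l) ∈ Nat.factoredNumbers l.primeFactors := by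
    intro n hn
    obtain ⟨h1, h2⟩ := mem_filter.1 hn
    have h1 := mem_Icc.1 h1
    have hd : l ∣ n := h2 ▸ UniqueFactorizationMonoid.radical_dvd_self
    refine ⟨(mul_div_cancel' hd).symm, ?_⟩
    refine Nat.mem_factoredNumbers_of_primeFactors_subset
      (Nat.div_pos (le_of_dvd (by omega) hd) hl0).ne' ?_
    rw [← h2, Nat.primeFactors_radical]
    exact Nat.primeFactors_mono (h2 ▸ Nat.div_dvd_of_dvd hd) (by omega)
  calc _ = ∑ n ∈ B, G l * G (n / l) := sum_congr rfl fun n hn => by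
          conv_lhs => rw [(hB n hn).1, map_mul]
    _ = G l * ∑ k ∈ B.image (· / l), (Nat.factoredNumbers l.primeFactors).indicator G k := by
          rw [sum_image, mul_sum]
          · exact sum_congr rfl fun n hn => by rw [Set.indicator_of_mem (hB n hn).2]
          · intro a ha b hb hab
            simp only at hab
            rw [(hB a ha).1, (hB b hb).1, hab]
    _ ≤ _ := mul_le_mul_of_nonneg_left (sum_le_hasSum _ (fun k _ =>
          Set.indicator_nonneg (fun k _ => hG0 k) k) hs) (hG0 l)
theorem selberg (hR : 1 ≤ R) (G : ℕ →* ℝ) (hG0 : ∀ n, 0 ≤ G n) (hG1 : ∀ p : ℕ, p.Prime → G p < 1)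
    (hGp : ∀ p : ℕ, p.Prime → p ∣ s.prodPrimes → G p = s.nu p)
    (hP : ∀ p : ℕ, p.Prime → p ≤ R → p ∣ s.prodPrimes) (hM : 0 ≤ s.totalMass) :
    s.siftedSum ≤ s.totalMass / (∑ n ∈ Icc 1 R, G n) +
      ∑ d1 ∈ DR s R, ∑ d2 ∈ DR s R, |s.rem (d1.lcm d2)| := by
  refine (siftedSum_le_mainSum_errSum_of_upperMoebius _
    (upperMoebius_lambdaSquared _ (wt_one s R hR))).trans (add_le_add ?_ (err_le s R hR))
  rw [main_eq s R hR, mul_one_div]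
  refine div_le_div_of_nonneg_left hM ?_ (SR_ge s R G hG0 hG1 hGp hP)
  refine lt_of_lt_of_le one_pos ((map_one G).symm.le.trans
    (single_le_sum (fun n _ => hG0 n) (mem_Icc.2 ⟨le_rfl, hR⟩)))
end Sel
end
section
noncomputable def Wt (K : ℕ) (ζ : ℂ) (τ : ℝ) (n : ℕ) : ℝ :=
  1 / K * ‖∑ j ∈ range K, (ζ * ee (τ * Real.log n)) ^ j‖ ^ 2
lemma Wt_nonneg (K : ℕ) (ζ : ℂ) (τ : ℝ) (n : ℕ) : 0 ≤ Wt K ζ τ n := by rw [Wt]; positivity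
lemma Wt_expand (K : ℕ) (ζ : ℂ) (τ : ℝ) (n : ℕ) : ((Wt K ζ τ n : ℝ) : ℂ) = 1 / K *
    ∑ j ∈ range K, ∑ k ∈ range K, ζ ^ j * (starRingEnd ℂ) ζ ^ k *
      ee (((j : ℝ) - k) * τ * Real.log n) := by
  rw [Wt, ofReal_mul, normsq_sum]
  push_cast
  congr 1
  refine sum_congr rfl fun j _ => sum_congr rfl fun k _ => ?_
  rw [map_pow, map_mul, ee_conj, mul_pow, mul_pow, ← ee_nat_mul, ← ee_nat_mul, mul_mul_mul_comm, ← ee_add]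
  congr 2; ring
lemma prog_sum (σ x y : ℝ) (hx : 0 < x) (hy : 0 < y) (d : ℕ) (hd : 1 ≤ d) :
    ∑ n ∈ Ioc ⌊x⌋₊ ⌊y⌋₊, (if d ∣ n then ee (σ * Real.log n) else 0) =
    ee (σ * Real.log d) * ∑ k ∈ Ioc ⌊x / d⌋₊ ⌊y / d⌋₊, ee (σ * Real.log k) := by
  have hd0 : (0 : ℝ) < d := by exact_mod_cast hd
  rw [← sum_filter, mul_sum]
  symm
  refine sum_bij (fun k _ => d * k) ?_ ?_ ?_ ?_
  · intro k hk
    rw [mem_Iof (by positivity) (by positivity), div_lt_iff₀' hd0, le_div_iff₀' hd0] at hk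
    rw [mem_filter, mem_Iof hx.le hy.le]
    exact ⟨by push_cast; exact hk, Dvd.intro _ rfl⟩
  · intro a _ b _ h; exact eq_of_mul_eq_mul_left hd h
  · intro n hn
    rw [mem_filter, mem_Iof hx.le hy.le] at hn
    obtain ⟨h1, k, rfl⟩ := hn
    refine ⟨k, ?_, rfl⟩
    rw [mem_Iof (by positivity) (by positivity), div_lt_iff₀' hd0, le_div_iff₀' hd0]
    push_cast at h1; exact h1
  · intro k hk
    rw [mem_Iof (by positivity) (by positivity)] at hk
    have hk0 : (0 : ℝ) < k := lt_trans (by positivity) hk.1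
    rw [← ee_add]; congr 1; push_cast
    rw [log_mul hd0.ne' hk0.ne']; ring
lemma gg_div (τ x : ℝ) (hx : 0 < x) (d : ℕ) (hd : 1 ≤ d) :
    ee (τ * Real.log d) * gg τ (x / d) = gg τ x / d := by
  have hd0 : (0 : ℝ) < d := by exact_mod_cast hd
  rw [gg, gg, log_div hx.ne' hd0.ne', mul_sub, sub_eq_add_neg, ee_add, ee_neg]
  have := ee_ne (τ * Real.log d)
  push_cast; field_simp
lemma prog_approx (A : ℕ) : ∃ c C : ℝ, 0 < c ∧ c ≤ 1 / 2 ∧ 1 ≤ C ∧ ∀ (σ x y : ℝ) (d : ℕ), 1 ≤ d → (d : ℝ) ≤ x →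
    |σ| ≤ (x / d) ^ (A : ℝ) → x ≤ y → y ≤ 4 * x →
    ‖∑ n ∈ Ioc ⌊x⌋₊ ⌊y⌋₊, (if d ∣ n then ee (σ * Real.log n) else 0) - (gg σ y - gg σ x) / d‖
      ≤ C * (x / d) ^ (1 - c) := by
  obtain ⟨c, C, h1, h2, h3, H⟩ := weyl_main A
  refine ⟨c, C, h1, h2, h3, fun σ x y d hd hdx hσ hxy hy => ?_⟩
  have hd0 : (0 : ℝ) < d := by exact_mod_cast hd
  have hx : 0 < x := hd0.trans_le hdx
  have := H (x / d) σ (x / d) (y / d) ((one_le_div hd0).2 hdx) hσ le_rfl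
    (div_le_div_of_nonneg_right hxy hd0.le) (by rw [← mul_div_assoc]; exact div_le_div_of_nonneg_right hy hd0.le)
  rw [prog_sum σ x y hx (hx.trans_le hxy) d hd, sub_div, ← gg_div σ y (hx.trans_le hxy) d hd,
    ← gg_div σ x hx d hd, ← mul_sub, ← mul_sub, norm_mul, ee_norm, one_mul]
  exact this
lemma harm_le (R : ℕ) : ∑ n ∈ Icc 1 R, (1 : ℝ) / n ≤ 1 + Real.log R := by
  have := harmonic_le_one_add_log R
  rw [harmonic_eq_sum_Icc] at this
  simpa using this
lemma harm_ge (R : ℕ) : Real.log (R + 1) ≤ ∑ n ∈ Icc 1 R, (1 : ℝ) / n := by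
  have := log_add_one_le_harmonic R
  rw [harmonic_eq_sum_Icc] at this
  simpa using this
lemma lcm_sum (R : ℕ) : ∑ a ∈ Icc 1 R, ∑ b ∈ Icc 1 R, (1 : ℝ) / (a.lcm b : ℕ) ≤ (1 + Real.log R) ^ 3 := by
  have hin : ∀ g ∈ Icc 1 R, ∑ a ∈ Icc 1 R, (if g ∣ a then (1 : ℝ) / a else 0) ≤
      1 / g * (1 + Real.log R) := by
    intro g hg
    have hg1 := (mem_Icc.1 hg).1
    refine le_trans ?_ (mul_le_mul_of_nonneg_left (harm_le R) (by positivity))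
    rw [← sum_filter, mul_sum]
    have : ∀ a ∈ (Icc 1 R).filter (g ∣ ·), (1 : ℝ) / a = 1 / g * (1 / (a / g : ℕ)) := by
      intro a ha
      obtain ⟨k, rfl⟩ := (mem_filter.1 ha).2
      rw [Nat.mul_div_cancel_left _ hg1]; push_cast; rw [one_div_mul_one_div]
    rw [sum_congr rfl this, ← sum_image (s := (Icc 1 R).filter (g ∣ ·)) (g := (· / g))
      (f := fun k : ℕ => 1 / (g : ℝ) * (1 / k))]
    · refine sum_le_sum_of_subset_of_nonneg ?_ fun _ _ _ => by positivity
      intro k hk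
      obtain ⟨a, ha, rfl⟩ := mem_image.1 hk
      obtain ⟨h1, h2⟩ := mem_filter.1 ha
      have h1 := mem_Icc.1 h1
      exact mem_Icc.2 ⟨Nat.div_pos (le_of_dvd (by omega) h2) hg1, (Nat.div_le_self _ _).trans h1.2⟩
    · intro a ha b hb hab
      have ha := (mem_filter.1 ha).2
      have hb := (mem_filter.1 hb).2
      rw [← mul_div_cancel' ha, ← mul_div_cancel' hb]
      simp only at hab; rw [hab]
  have hl : 0 ≤ 1 + Real.log R := (sum_nonneg fun _ _ => by positivity).trans (harm_le R)
  calc _ ≤ ∑ a ∈ Icc 1 R, ∑ b ∈ Icc 1 R, ∑ g ∈ Icc 1 R,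
        (g : ℝ) * (if g ∣ a then (1 : ℝ) / a else 0) * (if g ∣ b then (1 : ℝ) / b else 0) := by
        refine sum_le_sum fun a ha => sum_le_sum fun b hb => ?_
        have ha := mem_Icc.1 ha
        have hb := mem_Icc.1 hb
        have hg : a.gcd b ∈ Icc 1 R := mem_Icc.2 ⟨Nat.gcd_pos_of_pos_left _ ha.1,
          (Nat.gcd_le_left _ ha.1).trans ha.2⟩
        refine le_trans (le_of_eq ?_) (single_le_sum (f := fun g : ℕ =>
          (g : ℝ) * (if g ∣ a then (1 : ℝ) / a else 0) * (if g ∣ b then (1 : ℝ) / b else 0))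
          (fun g _ => by split_ifs <;> positivity) hg)
        simp only [Nat.gcd_dvd_left, Nat.gcd_dvd_right, if_true]
        have h1 : ((a.gcd b : ℕ) : ℝ) * (a.lcm b : ℕ) = a * b := by exact_mod_cast Nat.gcd_mul_lcm a b
        have h2 : (0 : ℝ) < a := by exact_mod_cast ha.1
        have h3 : (0 : ℝ) < b := by exact_mod_cast hb.1
        have h4 : (0 : ℝ) < (a.lcm b : ℕ) := by exact_mod_cast lcm_pos ha.1 hb.1
        rw [div_eq_iff h4.ne']; field_simp; linarith
    _ = ∑ g ∈ Icc 1 R, (g : ℝ) * (∑ a ∈ Icc 1 R, (if g ∣ a then (1 : ℝ) / a else 0)) ^ 2 := by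
        rw [sum_congr rfl fun a _ => sum_comm, sum_comm]
        refine sum_congr rfl fun g _ => ?_
        rw [sq, sum_mul_sum, mul_sum]
        exact sum_congr rfl fun a _ => by rw [mul_sum]; simp only [mul_assoc]
    _ ≤ ∑ g ∈ Icc 1 R, 1 / (g : ℝ) * (1 + Real.log R) ^ 2 := by
        refine sum_le_sum fun g hg => ?_
        have hg1 : (0 : ℝ) < g := by exact_mod_cast (mem_Icc.1 hg).1
        refine (mul_le_mul_of_nonneg_left (pow_le_pow_left₀ (sum_nonneg fun a _ => by
          split_ifs <;> positivity) (hin g hg) 2) hg1.le).trans (le_of_eq ?_)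
        field_simp
    _ ≤ _ := by
        rw [← sum_mul, pow_succ', mul_comm (1 + Real.log R)]
        rw [mul_comm]
        exact mul_le_mul_of_nonneg_left (harm_le R) (by positivity)
noncomputable def invAF : ArithmeticFunction ℝ := ⟨fun n => (n : ℝ)⁻¹, by simp⟩
lemma invAF_mult : invAF.IsMultiplicative := ⟨by simp [invAF], fun {m n} _ => by
  change ((m * n : ℕ) : ℝ)⁻¹ = (m : ℝ)⁻¹ * (n : ℝ)⁻¹; push_cast; rw [mul_inv]⟩
noncomputable def invHom : ℕ →* ℝ := ⟨⟨fun n => (n : ℝ)⁻¹, by simp⟩, fun m n => by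
  change ((m * n : ℕ) : ℝ)⁻¹ = (m : ℝ)⁻¹ * (n : ℝ)⁻¹; push_cast; rw [mul_inv]⟩
lemma primorial_sqf (R : ℕ) : Squarefree (primorial R) := by
  rw [primorial]
  refine (Finset.squarefree_prod_of_pairwise_isCoprime ?_ ?_)
  · intro p hp q hq hpq
    have hp := (mem_filter.1 hp).2
    have hq := (mem_filter.1 hq).2
    exact Nat.coprime_iff_isRelPrime.1 ((coprime_primes hp hq).2 hpq)
  · intro p hp; exact (mem_filter.1 hp).2.prime.squarefree
lemma dvd_primorial_iff {p R : ℕ} (hp : p.Prime) : p ∣ primorial R ↔ p ≤ R := by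
  constructor
  · intro h
    obtain ⟨q, hq, hpq⟩ := (hp.prime.dvd_finset_prod_iff _).1 h
    have hq := mem_filter.1 hq
    have := (Nat.prime_dvd_prime_iff_eq hp hq.2).1 hpq
    have := mem_range.1 hq.1
    omega
  · intro h
    exact Finset.dvd_prod_of_mem (fun p : ℕ => p) (mem_filter.2 ⟨mem_range.2 (by omega), hp⟩)
lemma coprime_primorial {p R : ℕ} (hp : p.Prime) (h : R < p) : Coprime (primorial R) p := by
  rw [Nat.coprime_comm, hp.coprime_iff_not_dvd, dvd_primorial_iff hp]; omega
end
section
lemma sieveW (A : ℕ) : ∃ c C : ℝ, 0 < c ∧ c ≤ 1 / 2 ∧ 1 ≤ C ∧ ∀ (K : ℕ) (ζ : ℂ) (τ x y : ℝ) (R : ℕ), 1 ≤ K → ‖ζ‖ = 1 →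
    1 ≤ R → (R : ℝ) ^ 2 ≤ x → x ≤ y → y ≤ 4 * x → 2 * K * y ≤ |τ| * (y - x) → K * |τ| ≤ (x / R ^ 2) ^ (A : ℝ) →
    ∑ p ∈ prs x y, Wt K ζ τ p ≤ 2 * (y - x) / Real.log (R + 1) +
      K * C * x ^ (1 - c) * ((R : ℝ) ^ 2) ^ c * (1 + Real.log R) ^ 3 := by
  obtain ⟨c, C, hc, hc2, hC, H⟩ := prog_approx A
  refine ⟨c, C, hc, hc2, hC, fun K ζ τ x y R hK hζ hR hRx hxy hy4 hτ hτA => ?_⟩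
  have hR0 : (1 : ℝ) ≤ R := by exact_mod_cast hR
  have hK0 : (1 : ℝ) ≤ K := by exact_mod_cast hK
  have hx : 0 < x := lt_of_lt_of_le (by positivity) hRx
  have hy : 0 < y := hx.trans_le hxy
  set Mc : ℂ := 1 / K * ∑ j ∈ range K, ∑ k ∈ range K, ζ ^ j * (starRingEnd ℂ) ζ ^ k *
      (gg (((j : ℝ) - k) * τ) y - gg (((j : ℝ) - k) * τ) x) with hMc
  have hz : ∀ j k : ℕ, ‖ζ ^ j * (starRingEnd ℂ) ζ ^ k‖ = 1 := fun j k => by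
    rw [norm_mul, norm_pow, norm_pow, RCLike.norm_conj, hζ, one_pow, one_pow, one_mul]
  have hKn : ‖(1 / K : ℂ)‖ = 1 / K := by simp
  have hM1 : |Mc.re - (y - x)| ≤ y - x := by
    have e : (((y - x : ℝ)) : ℂ) = 1 / K * ∑ j ∈ range K, ∑ k ∈ range K,
        if j = k then ((y - x : ℝ) : ℂ) else 0 := by
      have hKc : (K : ℂ) ≠ 0 := by exact_mod_cast (by omega : K ≠ 0)
      have : ∀ j ∈ range K, (∑ k ∈ range K, if j = k then ((y - x : ℝ) : ℂ) else 0) = ((y - x : ℝ) : ℂ) :=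
        fun j hj => by rw [sum_ite_eq, if_pos hj]
      rw [sum_congr rfl this, sum_const, card_range, nsmul_eq_mul]
      field_simp
    have h1 : |Mc.re - (y - x)| ≤ ‖Mc - ((y - x : ℝ) : ℂ)‖ := by
      have := abs_re_le_norm (Mc - ((y - x : ℝ) : ℂ))
      rwa [sub_re, ofReal_re] at this
    refine h1.trans ?_
    rw [e, hMc, ← mul_sub, norm_mul, hKn, ← sum_sub_distrib]
    have hτ0 : 0 < |τ| := by
      by_contra h0
      have : |τ| = 0 := le_antisymm (not_lt.1 h0) (abs_nonneg _)
      rw [this, zero_mul] at hτ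
      have : 0 < 2 * (K : ℝ) * y := by positivity
      linarith
    have hterm : ∀ j ∈ range K, ‖∑ k ∈ range K, ζ ^ j * (starRingEnd ℂ) ζ ^ k *
        (gg (((j : ℝ) - k) * τ) y - gg (((j : ℝ) - k) * τ) x) -
        ∑ k ∈ range K, (if j = k then ((y - x : ℝ) : ℂ) else 0)‖ ≤ K * (2 * y / |τ|) := by
      intro j _
      rw [← sum_sub_distrib]
      refine (norm_sum_le _ _).trans ((sum_le_card_nsmul _ _ (2 * y / |τ|) fun k _ => ?_).trans
        (by rw [card_range, nsmul_eq_mul]))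
      by_cases hjk : j = k
      · subst hjk
        rw [if_pos rfl, sub_self, zero_mul]
        have : ζ ^ j * (starRingEnd ℂ) ζ ^ j = 1 := by
          rw [← mul_pow, mul_conj', hζ]; simp
        rw [this, one_mul]
        simp only [gg, zero_mul, ee_zero, Complex.ofReal_zero]
        norm_num; positivity
      · rw [if_neg hjk, sub_zero, norm_mul, hz, one_mul]
        have hjk1 : 1 ≤ |(j : ℝ) - k| := by
          have : (1 : ℤ) ≤ |(j : ℤ) - k| := Int.one_le_abs (sub_ne_zero.2 (by exact_mod_cast hjk))
          exact_mod_cast this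
        have hm : |τ| ≤ max 1 |((j : ℝ) - k) * τ| := by
          rw [abs_mul]; exact le_max_of_le_right (le_mul_of_one_le_left hτ0.le hjk1)
        have b : ∀ z, 0 ≤ z → z ≤ y → ‖gg (((j : ℝ) - k) * τ) z‖ ≤ y / |τ| := fun z hz hzy =>
          (gg_norm _ z hz).trans (div_le_div₀ hy.le hzy hτ0 hm)
        refine (norm_sub_le _ _).trans ((add_le_add (b y hy.le le_rfl) (b x hx.le hxy)).trans (le_of_eq (by ring)))
    calc _ ≤ 1 / (K : ℝ) * (K * (K * (2 * y / |τ|))) := by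
          refine mul_le_mul_of_nonneg_left ((norm_sum_le _ _).trans ((sum_le_card_nsmul _ _ _ hterm).trans
            (by rw [card_range, nsmul_eq_mul]))) (by positivity)
      _ = 2 * K * y / |τ| := by field_simp
      _ ≤ y - x := by rw [div_le_iff₀ hτ0]; linarith
  have hM2 := abs_le.1 hM1
  let s : BoundingSieve :=
    { support := Ioc ⌊x⌋₊ ⌊y⌋₊
      prodPrimes := primorial R
      prodPrimes_squarefree := primorial_sqf R
      weights := Wt K ζ τ
      weights_nonneg := Wt_nonneg K ζ τ
      totalMass := Mc.re
      nu := invAF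
      nu_mult := invAF_mult
      nu_pos_of_prime := fun p hp _ => inv_pos.2 (by exact_mod_cast hp.pos)
      nu_lt_one_of_prime := fun p hp _ => inv_lt_one_of_one_lt₀ (by exact_mod_cast hp.one_lt) }
  have hrem : ∀ d : ℕ, 1 ≤ d → (d : ℝ) ≤ R ^ 2 → |s.rem d| ≤ K * C * (x / d) ^ (1 - c) := by
    intro d hd hdR
    have hd0 : (0 : ℝ) < d := by exact_mod_cast hd
    have e : ((s.rem d : ℝ) : ℂ) = ((1 / K * ∑ j ∈ range K, ∑ k ∈ range K, ζ ^ j * (starRingEnd ℂ) ζ ^ k *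
        (∑ n ∈ Ioc ⌊x⌋₊ ⌊y⌋₊, (if d ∣ n then ee (((j : ℝ) - k) * τ * Real.log n) else 0) -
        (gg (((j : ℝ) - k) * τ) y - gg (((j : ℝ) - k) * τ) x) / d) : ℂ).re : ℝ) := by
      congr 1
      simp only [mul_sub (_ * _ : ℂ), sum_sub_distrib]
      rw [mul_sub, sub_re]
      change (∑ n ∈ Ioc ⌊x⌋₊ ⌊y⌋₊, if d ∣ n then Wt K ζ τ n else 0) - (d : ℝ)⁻¹ * Mc.re = _
      congr 1
      · rw [← ofReal_re (∑ n ∈ Ioc ⌊x⌋₊ ⌊y⌋₊, if d ∣ n then Wt K ζ τ n else 0)]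
        congr 1
        rw [ofReal_sum]
        have : ∀ n, (((if d ∣ n then Wt K ζ τ n else 0 : ℝ)) : ℂ) = ∑ j ∈ range K, ∑ k ∈ range K,
            1 / K * (ζ ^ j * (starRingEnd ℂ) ζ ^ k * (if d ∣ n then ee (((j : ℝ) - k) * τ * Real.log n) else 0)) := by
          intro n
          split_ifs
          · rw [Wt_expand, mul_sum]; simp only [mul_sum]
          · simp
        simp only [this]
        rw [sum_comm, mul_sum]
        refine sum_congr rfl fun j _ => ?_
        rw [sum_comm, mul_sum]
        refine sum_congr rfl fun k _ => ?_
        rw [mul_sum, mul_sum]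
      · rw [← Complex.re_ofReal_mul]
        congr 1
        rw [hMc]; push_cast
        simp only [mul_sum]
        refine sum_congr rfl fun j _ => sum_congr rfl fun k _ => ?_
        ring
    have e2 := Complex.ofReal_injective e
    rw [e2]
    refine (abs_re_le_norm _).trans ?_
    rw [norm_mul, hKn]
    have hterm : ∀ j ∈ range K, ∀ k ∈ range K, ‖ζ ^ j * (starRingEnd ℂ) ζ ^ k *
        (∑ n ∈ Ioc ⌊x⌋₊ ⌊y⌋₊, (if d ∣ n then ee (((j : ℝ) - k) * τ * Real.log n) else 0) -
        (gg (((j : ℝ) - k) * τ) y - gg (((j : ℝ) - k) * τ) x) / d)‖ ≤ C * (x / d) ^ (1 - c) := by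
      intro j hj k hk
      rw [norm_mul, hz, one_mul]
      refine H _ x y d hd (hdR.trans hRx) ?_ hxy hy4
      have hj : (j : ℝ) ≤ K := by exact_mod_cast (mem_range.1 hj).le
      have hk : (k : ℝ) ≤ K := by exact_mod_cast (mem_range.1 hk).le
      rw [abs_mul]
      refine (mul_le_mul_of_nonneg_right (abs_le.2 ⟨?_, ?_⟩) (abs_nonneg τ)).trans (hτA.trans
        (rpow_le_rpow (by positivity) (div_le_div_of_nonneg_left hx.le hd0 hdR) (by positivity)))
      · have := cast_nonneg (α := ℝ) j; linarith
      · have := cast_nonneg (α := ℝ) k; linarith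
    calc _ ≤ 1 / (K : ℝ) * (K * (K * (C * (x / d) ^ (1 - c)))) := by
          refine mul_le_mul_of_nonneg_left ((norm_sum_le _ _).trans ((sum_le_card_nsmul _ _ _ fun j hj =>
            (norm_sum_le _ _).trans ((sum_le_card_nsmul _ _ _ fun k hk => hterm j hj k hk).trans
            (by rw [card_range, nsmul_eq_mul]))).trans
            (by rw [card_range, nsmul_eq_mul]))) (by positivity)
      _ = _ := by field_simp
  have hsel := Sel.selberg s R hR invHom (fun n => inv_nonneg.2 (cast_nonneg n))
    (fun p hp => inv_lt_one_of_one_lt₀ (by exact_mod_cast hp.one_lt)) (fun p _ _ => rfl)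
    (fun p hp h => (dvd_primorial_iff hp).2 h) (by change 0 ≤ Mc.re; linarith)
  have hlog : 0 < Real.log (R + 1) := log_pos (by linarith)
  have hsift : ∑ p ∈ prs x y, Wt K ζ τ p ≤ s.siftedSum := by
    rw [BoundingSieve.siftedSum, ← sum_filter]
    refine sum_le_sum_of_subset_of_nonneg (fun p hp => ?_) fun n _ _ => Wt_nonneg _ _ _ _
    have h := (mem_prs hx.le hy.le).1 hp
    refine mem_filter.2 ⟨(mem_Iof hx.le hy.le).2 h.1, coprime_primorial h.2 ?_⟩
    have : (R : ℝ) < p := lt_of_le_of_lt (le_trans (by nlinarith) hRx) h.1.1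
    exact_mod_cast this
  refine hsift.trans (hsel.trans (add_le_add ?_ ?_))
  · refine div_le_div₀ (by linarith) (by change Mc.re ≤ _; linarith) hlog ((harm_ge R).trans (le_of_eq ?_))
    exact sum_congr rfl fun n _ => one_div _
  · have hsub : Sel.DR s R ⊆ Icc 1 R := fun d hd => by
      have := (Sel.mem_DR s R).1 hd
      exact mem_Icc.2 ⟨Nat.pos_of_ne_zero (ne_zero_of_dvd_ne_zero BoundingSieve.prodPrimes_ne_zero this.1), this.2⟩
    have hb : ∀ a ∈ Icc 1 R, ∀ b ∈ Icc 1 R, K * C * (x / (a.lcm b : ℕ)) ^ (1 - c) ≤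
        K * C * x ^ (1 - c) * ((R : ℝ) ^ 2) ^ c * (1 / (a.lcm b : ℕ)) ∧ |s.rem (a.lcm b)| ≤ K * C * (x / (a.lcm b : ℕ)) ^ (1 - c) := by
      intro a ha b hb
      have ha := mem_Icc.1 ha
      have hb := mem_Icc.1 hb
      have h4 := lcm_pos ha.1 hb.1
      have h4' : (0 : ℝ) < (a.lcm b : ℕ) := by exact_mod_cast h4
      have h5 : ((a.lcm b : ℕ) : ℝ) ≤ R ^ 2 := by
        have : a.lcm b ≤ R ^ 2 := (le_of_dvd (Nat.mul_pos ha.1 hb.1) (Nat.lcm_dvd_mul a b)).trans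
          (by rw [sq]; exact Nat.mul_le_mul ha.2 hb.2)
        exact_mod_cast this
      refine ⟨?_, hrem _ h4 h5⟩
      have h6 : 0 ≤ K * C * x ^ (1 - c) := by positivity
      rw [div_rpow hx.le h4'.le, rpow_sub h4', rpow_one, mul_assoc (K * C * x ^ (1 - c)),
        div_div_eq_mul_div, mul_div_assoc]
      rw [← mul_assoc, mul_one_div]
      exact mul_le_mul_of_nonneg_left (div_le_div_of_nonneg_right (rpow_le_rpow h4'.le h5 hc.le) h4'.le) h6
    calc _ ≤ ∑ a ∈ Icc 1 R, ∑ b ∈ Icc 1 R, K * C * x ^ (1 - c) * ((R : ℝ) ^ 2) ^ c * (1 / (a.lcm b : ℕ)) := by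
          refine (sum_le_sum fun a ha => (sum_le_sum fun b hb' =>
            ((hb a (hsub ha) b (hsub hb')).2.trans (hb a (hsub ha) b (hsub hb')).1)).trans
            (sum_le_sum_of_subset_of_nonneg hsub fun _ _ _ => by positivity)).trans
            (sum_le_sum_of_subset_of_nonneg hsub fun _ _ _ => sum_nonneg fun _ _ => by positivity)
      _ ≤ _ := by
          simp only [← mul_sum]
          exact mul_le_mul_of_nonneg_left (lcm_sum R) (by positivity)
end
section
lemma fejer_point (w : ℂ) (hw : ‖w‖ = 1) (m K : ℕ) (hm : 1 ≤ m) (hK : 1 ≤ K) :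
    w.re ≤ 1 - 1 / (4 * m ^ 2 * K ^ 2) + 1 / (2 * m ^ 2 * K ^ 3) * (1 / K * ‖∑ j ∈ range K, (w ^ m) ^ j‖ ^ 2) := by
  have hm0 : (1 : ℝ) ≤ m := by exact_mod_cast hm
  have hK0 : (1 : ℝ) ≤ K := by exact_mod_cast hK
  set D := ‖1 - w‖ with hD
  have hD2 : D ^ 2 = 2 * (1 - w.re) := by
    have h1 : w.re * w.re + w.im * w.im = 1 := by
      have := sq_norm w; rw [hw, normSq_apply] at this; linarith
    rw [hD, sq_norm, normSq_apply]; simp; nlinarith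
  have hpow : ∀ n : ℕ, ‖1 - w ^ n‖ ≤ n * D := by
    intro n
    induction n with
    | zero => simp
    | succ n ih =>
      have : 1 - w ^ (n + 1) = (1 - w ^ n) + w ^ n * (1 - w) := by ring
      rw [this]
      refine (norm_add_le _ _).trans ?_
      rw [norm_mul, norm_pow, hw, one_pow, one_mul]; push_cast; linarith
  set S := ‖∑ j ∈ range K, (w ^ m) ^ j‖ with hS
  have h1 : ‖(K : ℂ) - ∑ j ∈ range K, (w ^ m) ^ j‖ ≤ K * (m * K * D) := by
    have : (K : ℂ) - ∑ j ∈ range K, (w ^ m) ^ j = ∑ j ∈ range K, (1 - w ^ (m * j)) := by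
      rw [sum_sub_distrib]; simp [pow_mul]
    rw [this]
    refine (norm_sum_le _ _).trans ((sum_le_card_nsmul _ _ (m * K * D) fun j hj => (hpow _).trans ?_).trans
      (by rw [card_range, nsmul_eq_mul]))
    have hj : (j : ℝ) ≤ K := by exact_mod_cast (mem_range.1 hj).le
    push_cast
    exact mul_le_mul_of_nonneg_right (mul_le_mul_of_nonneg_left hj (by positivity)) (norm_nonneg _)
  have h2 : (K : ℝ) ≤ S + m * K ^ 2 * D := by
    have h3 : ‖(K : ℂ)‖ = K := by simp
    have := norm_sub_norm_le (K : ℂ) (∑ j ∈ range K, (w ^ m) ^ j)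
    rw [h3] at this; nlinarith
  have h3 : (K : ℝ) ^ 2 ≤ 2 * S ^ 2 + 2 * (m ^ 2 * K ^ 4 * (2 * (1 - w.re))) := by
    rw [← hD2]
    have := pow_le_pow_left₀ (by positivity) h2 2
    nlinarith [sq_nonneg (S - m * K ^ 2 * D)]
  have h4 : 1 - w.re ≥ (K ^ 2 / 2 - S ^ 2) / (2 * m ^ 2 * K ^ 4) := by
    rw [ge_iff_le, div_le_iff₀ (by positivity)]; nlinarith
  have h5 : (K ^ 2 / 2 - S ^ 2) / (2 * m ^ 2 * K ^ 4) = 1 / (4 * m ^ 2 * K ^ 2) - 1 / (2 * m ^ 2 * K ^ 3) * (1 / (K : ℝ) * S ^ 2) := by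
    field_simp; ring
  linarith
lemma blockW (h : ℝ) (hh : 4 ≤ h) (K : ℕ) (hK : 1 ≤ K) (A : ℕ) : ∃ u0 : ℝ, 1 ≤ u0 ∧ ∀ (v : ℕ) (τ : ℝ) (ζ : ℂ), u0 ≤ v / h →
    ‖ζ‖ = 1 → 4 * K * h ≤ |τ| → |τ| ≤ exp (v / h) ^ A → ∑ p ∈ Iv h v, Wt K ζ τ p / p ≤ 32 / v := by
  obtain ⟨c, C, hc, hc2, hC, H⟩ := sieveW (2 * A + 2)
  have hK0 : (1 : ℝ) ≤ K := by exact_mod_cast hK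
  have h0 : 0 < h := by linarith
  have ev : ∀ᶠ u : ℝ in atTop, K * C * h * (1 + u) ^ 3 * u * exp (-(c / 2 * u)) ≤ 16 := by
    have h1 := ((Real.tendsto_pow_mul_exp_neg_atTop_nhds_zero 4).comp
      (Filter.tendsto_id.const_mul_atTop (show 0 < c / 2 by positivity)))
    have h2 := (h1.const_mul (K * C * h * 8 / (c / 2) ^ 4)).eventually
      (gt_mem_nhds (show K * C * h * 8 / (c / 2) ^ 4 * 0 < 16 by simp))
    filter_upwards [h2, eventually_ge_atTop 1] with u hu hu1
    refine le_trans ?_ hu.le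
    simp only [Function.comp, id]
    have : K * C * h * 8 / (c / 2) ^ 4 * ((c / 2 * u) ^ 4 * exp (-(c / 2 * u))) =
        K * C * h * ((2 * u) ^ 3 * u) * exp (-(c / 2 * u)) := by field_simp; ring
    rw [this]
    refine mul_le_mul_of_nonneg_right ?_ (exp_pos _).le
    rw [mul_assoc]
    refine mul_le_mul_of_nonneg_left (mul_le_mul_of_nonneg_right (pow_le_pow_left₀ (by linarith) (by linarith) 3) (by linarith)) (by positivity)
  obtain ⟨u1, hu1⟩ := eventually_atTop.1 ev
  refine ⟨max 1 (max u1 K), le_max_left _ _, fun v τ ζ hv hζ hτ hτA => ?_⟩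
  set u := (v : ℝ) / h with hu
  have hu1' : 1 ≤ u := (le_max_left _ _).trans hv
  have huK : (K : ℝ) ≤ u := ((le_max_right _ _).trans (le_max_right _ _)).trans hv
  have hsm := hu1 u (((le_max_left _ _).trans (le_max_right _ _)).trans hv)
  have hv0 : (0 : ℝ) < v := by
    have : (v : ℝ) = u * h := by rw [hu]; field_simp
    rw [this]; positivity
  set x := exp u with hx
  have hx0 : 0 < x := exp_pos _
  set y := exp ((v + 1) / h) with hy
  have hyx : y = x * exp (1 / h) := by rw [hy, hx, hu, ← exp_add]; congr 1; ring
  have he1 := exp_inv_le (by linarith : (3 : ℝ) ≤ h)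
  have he2 := add_one_le_exp (1 / h)
  have hih : 2 / h ≤ 1 := by rw [div_le_one h0]; linarith
  have e21 : 2 / h = 2 * (1 / h) := by ring
  have hi0 : 0 < 1 / h := by positivity
  have hy1 : y - x ≤ 2 * x / h := by
    have := mul_le_mul_of_nonneg_left he1 hx0.le
    rw [hyx]; linarith [show x * (1 + 2 / h) = x + 2 * x / h by ring]
  have hy2 : x / h ≤ y - x := by
    have := mul_le_mul_of_nonneg_left he2 hx0.le
    rw [hyx]; linarith [show x * (1 / h + 1) = x + x / h by ring]
  have hy3 : y ≤ 2 * x := by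
    rw [hyx, mul_comm]; exact mul_le_mul_of_nonneg_right (by linarith) hx0.le
  set R := ⌊exp (u / 4)⌋₊ with hR
  have hR1 : 1 ≤ R := le_floor (by simpa using one_le_exp (by positivity))
  have hR1' : (1 : ℝ) ≤ R := by exact_mod_cast hR1
  have hRle : (R : ℝ) ≤ exp (u / 4) := floor_le (exp_pos _).le
  have hR2 : (R : ℝ) ^ 2 ≤ exp (u / 2) :=
    (pow_le_pow_left₀ (by positivity) hRle 2).trans (le_of_eq (by rw [← exp_nat_mul]; congr 1; push_cast; ring))
  have hlogR : u / 4 ≤ Real.log (R + 1) := by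
    rw [le_log_iff_exp_le (by positivity)]; exact (lt_floor_add_one _).le
  have hlogR2 : Real.log R ≤ u := by
    rw [Real.log_le_iff_le_exp (by linarith)]; exact hRle.trans (exp_le_exp.2 (by linarith))
  have hRx : (R : ℝ) ^ 2 ≤ x := hR2.trans (exp_le_exp.2 (by linarith))
  have key := H K ζ τ x y R hK hζ hR1 hRx (by have := div_pos hx0 h0; linarith) (by linarith) (by
      calc 2 * K * y ≤ 4 * K * x := by
            have := mul_le_mul_of_nonneg_left hy3 (show 0 ≤ 2 * (K : ℝ) by positivity); linarith
        _ = 4 * K * h * (x / h) := by field_simp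
        _ ≤ |τ| * (y - x) := mul_le_mul hτ hy2 (by positivity) (abs_nonneg _)) (by
      have hq : exp (u / 2) ≤ x / R ^ 2 := by
        rw [le_div_iff₀ (by positivity)]
        refine (mul_le_mul_of_nonneg_left hR2 (exp_pos _).le).trans (le_of_eq ?_)
        rw [← exp_add, hx]; congr 1; ring
      rw [rpow_natCast]
      refine le_trans ?_ (pow_le_pow_left₀ (exp_pos _).le hq _)
      rw [← exp_nat_mul]
      calc K * |τ| ≤ x * x ^ A := mul_le_mul (huK.trans (by have := add_one_le_exp u; linarith)) hτA (abs_nonneg _) hx0.le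
        _ = _ := by rw [hx, ← exp_nat_mul, ← exp_add]; congr 1; push_cast; ring)
  have hmain : 2 * (y - x) / Real.log (R + 1) ≤ x * (16 / v) := by
    calc _ ≤ (4 * x / h) / (u / 4) := div_le_div₀ (by positivity) (by linarith [show 4 * x / h = 2 * (2 * x / h) by ring]) (by positivity) hlogR
      _ = _ := by rw [hu]; field_simp; ring
  have herr : K * C * x ^ (1 - c) * ((R : ℝ) ^ 2) ^ c * (1 + Real.log R) ^ 3 ≤ x * (16 / v) := by
    have hp : x ^ (1 - c) * ((R : ℝ) ^ 2) ^ c ≤ x * exp (-(c / 2 * u)) := by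
      calc _ ≤ x ^ (1 - c) * (exp (u / 2)) ^ c :=
            mul_le_mul_of_nonneg_left (rpow_le_rpow (by positivity) hR2 hc.le) (by positivity)
        _ = _ := by
            rw [hx, ← exp_mul, ← exp_mul, ← exp_add, ← exp_add]; congr 1; ring
    have hl0 : 0 ≤ 1 + Real.log R := by have := Real.log_nonneg hR1'; linarith
    calc _ = K * C * (x ^ (1 - c) * ((R : ℝ) ^ 2) ^ c) * (1 + Real.log R) ^ 3 := by ring
      _ ≤ K * C * (x * exp (-(c / 2 * u))) * (1 + u) ^ 3 :=
          mul_le_mul (mul_le_mul_of_nonneg_left hp (by positivity))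
            (pow_le_pow_left₀ hl0 (by linarith) 3) (by positivity) (by positivity)
      _ = x / v * (K * C * h * (1 + u) ^ 3 * u * exp (-(c / 2 * u))) := by
          rw [hu]; field_simp
      _ ≤ x / v * 16 := mul_le_mul_of_nonneg_left hsm (by positivity)
      _ = _ := by ring
  have hsum : ∑ p ∈ Iv h v, Wt K ζ τ p / p ≤ ∑ p ∈ Iv h v, Wt K ζ τ p / x :=
    sum_le_sum fun p hp => div_le_div_of_nonneg_left (Wt_nonneg _ _ _ _) hx0 (mem_Iv.1 hp).1.1.le
  refine hsum.trans ?_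
  rw [← sum_div, div_le_iff₀ hx0]
  change ∑ p ∈ prs x y, Wt K ζ τ p ≤ _
  linarith [show 32 / (v : ℝ) * x = x * (16 / v) + x * (16 / v) by ring]
lemma sum_inv_Ico (V0 n : ℕ) (h0 : 1 ≤ V0) (h : V0 ≤ n) : ∑ v ∈ Ico V0 (n + 1), 1 / (v : ℝ) ≤ 1 / V0 + Real.log (n / V0) := by
  have hV : (0 : ℝ) < V0 := by exact_mod_cast h0
  induction n, h using le_induction with
  | base => rw [sum_Ico_succ_top le_rfl, Finset.Ico_self, div_self hV.ne']; simp
  | succ n hn ih =>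
    have hn0 : (0 : ℝ) < n := by exact_mod_cast (by omega : 0 < n)
    rw [sum_Ico_succ_top (by omega)]
    have h1 := Real.one_sub_inv_le_log_of_pos (show 0 < ((n : ℝ) + 1) / n by positivity)
    rw [log_div (by positivity) hV.ne'] at ih ⊢
    rw [log_div (by positivity) hn0.ne'] at h1
    have : 1 - (((n : ℝ) + 1) / n)⁻¹ = 1 / (n + 1) := by field_simp; ring
    push_cast; linarith
/-- contraction of the prime polynomial at non-small frequencies -/
lemma contract (m : ℕ) (hm : 1 ≤ m) : ∃ c T : ℝ, 0 < c ∧ c < 1 ∧ 1 ≤ T ∧ ∀ (h : ℝ) (A : ℕ), 4 ≤ h → ∃ u0 : ℝ, 1 ≤ u0 ∧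
    ∀ f : ℕ → ℂ, (∀ p : ℕ, p.Prime → f p = 0 ∨ f p ^ m = 1) → ∀ (V0 V1 : ℕ), u0 ≤ V0 / h → 1000 * V0 ≤ V1 →
    Real.log ((V1 : ℝ) / V0) / 48 ≤ sumInv (prs (exp (V0 / h)) (exp (V1 / h))) ∧ ∀ t : ℤ,
    T * h ≤ |(t : ℝ)| → m * |(t : ℝ)| ≤ exp (V0 / h) ^ A →
    ∑ v ∈ Ico V0 V1, ‖QQ f h v t‖ ≤ (1 - c) * sumInv (prs (exp (V0 / h)) (exp (V1 / h))) := by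
  have hm0 : (1 : ℝ) ≤ m := by exact_mod_cast hm
  obtain ⟨K, hKd⟩ : ∃ K : ℕ, K = 12288 := ⟨_, rfl⟩
  have hKr : (K : ℝ) = 12288 := by rw [hKd]; norm_num
  have hm2 : (1 : ℝ) ≤ m ^ 2 := one_le_pow₀ hm0
  obtain ⟨a0, ha0, hmert⟩ := mertens
  refine ⟨1 / (8 * m ^ 2 * K ^ 2), 4 * K, by rw [hKr]; positivity, ?_, by rw [hKr]; norm_num, fun h A hh => ?_⟩
  · rw [div_lt_one (by rw [hKr]; positivity), hKr]; nlinarith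
  obtain ⟨u0, hu0, HB⟩ := blockW h hh K (by omega) A
  have h0 : 0 < h := by linarith
  refine ⟨max u0 a0, hu0.trans (le_max_left _ _), fun f hfm V0 V1 hV0 hV1 => ?_⟩
  have hua := (le_max_left u0 a0).trans hV0
  have hub := (le_max_right u0 a0).trans hV0
  have hV0h : h ≤ V0 := by rw [← one_le_div h0]; linarith
  have hV0p : (0 : ℝ) < V0 := by linarith
  have hV0n : 1 ≤ V0 := by exact_mod_cast (by linarith : (1 : ℝ) ≤ V0)
  have hV1r : 1000 * (V0 : ℝ) ≤ V1 := by exact_mod_cast hV1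
  have hV1p : (0 : ℝ) < V1 := by linarith
  set Λ := Real.log ((V1 : ℝ) / V0) with hΛ
  have hlog4 : Real.log 1000 ≤ Λ := log_le_log (by norm_num) (by rw [le_div_iff₀ hV0p]; exact hV1r)
  have hl2 := log_two_gt_d9
  have hl1000 : 2 * Real.log 4 ≤ Real.log 1000 ∧ 1 ≤ Real.log 1000 := by
    have h4 : 2 * Real.log 4 = Real.log (4 ^ 2) := by rw [log_pow]; norm_num
    have h5 : Real.log (2 ^ 2) ≤ Real.log 1000 := log_le_log (by norm_num) (by norm_num)
    rw [log_pow] at h5; push_cast at h5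
    exact ⟨by rw [h4]; exact log_le_log (by norm_num) (by norm_num), by linarith⟩
  set L := sumInv (prs (exp (V0 / h)) (exp (V1 / h))) with hL
  have hLlow : Λ / 48 ≤ L := by
    have h1 := hmert (V0 / h) (V1 / h) hub (div_le_div_of_nonneg_right (by linarith) h0.le)
    have h2 : Real.log (V0 / h + 3) ≤ Real.log 4 + Real.log (V0 / h) := by
      rw [← log_mul (by norm_num) (by positivity)]
      exact log_le_log (by positivity) (by linarith)
    have h3 : Real.log (V1 / h) - Real.log (V0 / h) = Λ := by
      rw [hΛ, log_div hV1p.ne' h0.ne', log_div hV0p.ne' h0.ne', log_div hV1p.ne' hV0p.ne']; ring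
    linarith
  refine ⟨hLlow, fun t htT htA => ?_⟩
  have hV : V0 ≤ V1 := by omega
  have hsumv : ∑ v ∈ Ico V0 V1, 1 / (v : ℝ) ≤ 2 * Λ := by
    obtain ⟨n, rfl⟩ : ∃ n, V1 = n + 1 := ⟨V1 - 1, by omega⟩
    have h1 := sum_inv_Ico V0 n hV0n (by omega)
    have h2 : Real.log ((n : ℝ) / V0) ≤ Λ := log_le_log
      (div_pos (by exact_mod_cast (by omega : 0 < n)) hV0p) (div_le_div_of_nonneg_right (by push_cast; linarith) hV0p.le)
    have h3 : 1 / (V0 : ℝ) ≤ 1 := by rw [div_le_one hV0p]; linarith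
    linarith
  have hblock : ∀ v ∈ Ico V0 V1, ‖QQ f h v t‖ ≤ (1 - 1 / (4 * m ^ 2 * K ^ 2)) * ∑ p ∈ Iv h v, 1 / (p : ℝ) +
      1 / (2 * m ^ 2 * K ^ 3) * (32 / v) := by
    intro v hv
    have hvV : (V0 : ℝ) ≤ v := by exact_mod_cast (mem_Ico.1 hv).1
    obtain ⟨ζ, hζ, hζQ⟩ : ∃ ζ : ℂ, ‖ζ‖ = 1 ∧ ((‖QQ f h v t‖ : ℝ) : ℂ) = ζ * QQ f h v t := by
      rcases eq_or_ne (QQ f h v t) 0 with h1 | h1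
      · exact ⟨1, by simp, by simp [h1]⟩
      · have hn : (‖QQ f h v t‖ : ℂ) ≠ 0 := by exact_mod_cast norm_ne_zero_iff.2 h1
        refine ⟨(starRingEnd ℂ) (QQ f h v t) / ‖QQ f h v t‖, ?_, ?_⟩
        · rw [norm_div, RCLike.norm_conj, norm_real, norm_norm, div_self (norm_ne_zero_iff.2 h1)]
        · rw [div_mul_eq_mul_div, conj_mul', eq_div_iff hn]; ring
    have hB := HB v (-(m * t)) (ζ ^ m) (hua.trans (div_le_div_of_nonneg_right hvV h0.le)) (by rw [norm_pow, hζ, one_pow])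
      (by rw [abs_neg, abs_mul, abs_cast]; exact htT.trans (le_mul_of_one_le_left (abs_nonneg _) hm0))
      (by rw [abs_neg, abs_mul, abs_cast]; exact htA.trans (pow_le_pow_left₀ (exp_pos _).le
            (exp_le_exp.2 (div_le_div_of_nonneg_right hvV h0.le)) A))
    have e1 : ‖QQ f h v t‖ = ∑ p ∈ Iv h v, (ζ * f p * ee (-t * Real.log p)).re / p := by
      rw [← ofReal_re ‖QQ f h v t‖, hζQ, QQ, mul_sum, re_sum]
      refine sum_congr rfl fun p _ => ?_
      rw [GG, ← Complex.div_natCast_re]; congr 1; ring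
    rw [e1]
    refine le_trans ?_ (add_le_add_right (mul_le_mul_of_nonneg_left hB (by positivity)) _)
    rw [mul_sum, mul_sum, ← sum_add_distrib]
    refine sum_le_sum fun p hp => ?_
    have hpp := (mem_Iv.1 hp).2
    have hp0 : (0 : ℝ) < p := by exact_mod_cast hpp.pos
    rw [← mul_div_assoc, ← mul_div_assoc, ← add_div, mul_one]
    refine div_le_div_of_nonneg_right ?_ hp0.le
    rcases hfm p hpp with h1 | h1
    · rw [h1, mul_zero, zero_mul, Complex.zero_re]
      have h2 : 1 / (4 * (m : ℝ) ^ 2 * K ^ 2) ≤ 1 := by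
        rw [div_le_one (by rw [hKr]; positivity), hKr]; nlinarith
      have h3 : 0 ≤ 1 / (2 * (m : ℝ) ^ 2 * K ^ 3) * Wt K (ζ ^ m) (-(m * t)) p :=
        mul_nonneg (by positivity) (Wt_nonneg _ _ _ _)
      linarith
    · have hfn : ‖f p‖ = 1 := by
        have := congrArg norm h1
        rw [norm_pow, norm_one] at this
        exact (pow_eq_one_iff_of_nonneg (norm_nonneg _) (by omega)).1 this
      have := fejer_point (ζ * f p * ee (-t * Real.log p)) (by rw [norm_mul, norm_mul, hζ, hfn, ee_norm]; norm_num) m K hm (by omega)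
      refine this.trans (le_of_eq ?_)
      rw [Wt, mul_pow, mul_pow, h1, mul_one, ← ee_nat_mul]
      congr 6; ring_nf
  refine (sum_le_sum hblock).trans ?_
  rw [sum_add_distrib, ← mul_sum, ← mul_sum, Iv_union h0 hV]
  change (1 - 1 / (4 * (m : ℝ) ^ 2 * K ^ 2)) * L + _ ≤ _
  have e2 : ∑ v ∈ Ico V0 V1, 32 / (v : ℝ) = 32 * ∑ v ∈ Ico V0 V1, 1 / (v : ℝ) := by
    rw [mul_sum]; exact sum_congr rfl fun v _ => by ring
  rw [e2]
  have h5 : 32 * ∑ v ∈ Ico V0 V1, 1 / (v : ℝ) ≤ 3072 * L := by linarith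
  have h6 := mul_le_mul_of_nonneg_left h5 (show 0 ≤ 1 / (2 * (m : ℝ) ^ 2 * K ^ 3) by positivity)
  refine (add_le_add_right h6 _).trans (le_of_eq ?_)
  rw [hKr]; field_simp; ring
end
section
lemma QQ_le {f : ℕ → ℂ} (hb : ∀ n, ‖f n‖ ≤ 1) (h : ℝ) (v : ℕ) (t : ℤ) : ‖QQ f h v t‖ ≤ sumInv (Iv h v) := by
  refine (norm_sum_le _ _).trans (sum_le_sum fun p _ => ?_)
  rw [GG, norm_mul, ee_norm, mul_one, norm_div, Complex.norm_natCast]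
  exact div_le_div_of_nonneg_right (hb p) (cast_nonneg _)
lemma thin_step {f : ℕ → ℂ} (hf : ∀ m n, f (m * n) = f m * f n) (hb : ∀ n, ‖f n‖ ≤ 1) {h Y : ℝ} (hh : 4 ≤ h) (hY : h ≤ Y)
    {V0 V1 : ℕ} (hV : V0 ≤ V1) (hVX : exp (V1 / h) ≤ Y) {L : ℝ}
    (hL : 0 < L) (hLd : sumInv (prs (exp (V0 / h)) (exp (V1 / h))) = L) {c C0 B : ℝ} (c0 : 0 < c) (c1 : c < 1)
    (hC0 : 0 ≤ C0) (𝒯 : Finset ℤ) (Hm : ∀ b : ℕ → ℂ, ∑ t ∈ 𝒯, ‖∑ n ∈ Ioc ⌊Y⌋₊ ⌊3 * Y⌋₊, b n * ee (-t * Real.log n)‖ ^ 2 ≤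
      C0 * Y * ∑ n ∈ Ioc ⌊Y⌋₊ ⌊3 * Y⌋₊, ‖b n‖ ^ 2)
    (Hc : ∀ t ∈ 𝒯, ∑ v ∈ Ico V0 V1, ‖QQ f h v t‖ ≤ (1 - c) * L)
    (HB : ∀ v ∈ Ico V0 V1, EN f (Y * exp (-(v / h))) 𝒯 ≤ B) :
    EN f Y 𝒯 ≤ (1 + c) * ((1 - c) * B) + (1 + 1 / c) * (C0 * 64 * (1 / L + 1 / h)) := by
  have hY0 : 0 < Y := by linarith
  obtain ⟨b, hb1, hb2⟩ := factor hf hb hh hY hV hVX (by rw [hLd]; exact hL)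
  rw [hLd] at hb1 hb2
  have e2 : ∀ x y : ℂ, ‖x + y‖ ^ 2 ≤ (1 + c) * ‖x‖ ^ 2 + (1 + 1 / c) * ‖y‖ ^ 2 := fun x y => by
    have k1 : ‖x + y‖ ^ 2 ≤ (‖x‖ + ‖y‖) ^ 2 := pow_le_pow_left₀ (norm_nonneg _) (norm_add_le _ _) 2
    have k2 : 0 ≤ (c * ‖x‖ - ‖y‖) ^ 2 / c := by positivity
    have k3 : (c * ‖x‖ - ‖y‖) ^ 2 / c = c * ‖x‖ ^ 2 - 2 * ‖x‖ * ‖y‖ + 1 / c * ‖y‖ ^ 2 := by field_simp; ring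
    rw [k3] at k2; linarith
  have Lsum : ∑ v ∈ Ico V0 V1, sumInv (Iv h v) = L := by
    rw [← hLd]; exact Iv_union (by linarith) hV _
  have m1 : ∀ t ∈ 𝒯, ‖((1 / L : ℝ) : ℂ) * ∑ v ∈ Ico V0 V1, QQ f h v t * DD f (Y * exp (-(v / h))) (2 * (Y * exp (-(v / h)))) t‖ ^ 2
      ≤ (1 - c) / L * ∑ v ∈ Ico V0 V1, sumInv (Iv h v) * ‖DD f (Y * exp (-(v / h))) (2 * (Y * exp (-(v / h)))) t‖ ^ 2 := by
    intro t ht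
    rw [norm_mul, mul_pow, norm_real, norm_of_nonneg (by positivity)]
    have k1 := pow_le_pow_left₀ (norm_nonneg _) (norm_sum_le (Ico V0 V1) fun v => QQ f h v t * DD f (Y * exp (-(v / h))) (2 * (Y * exp (-(v / h)))) t) 2
    have k2 := Finset.sum_sq_le_sum_mul_sum_of_sq_eq_mul (Ico V0 V1)
      (r := fun v : ℕ => ‖QQ f h v t * DD f (Y * exp (-(v / h))) (2 * (Y * exp (-(v / h)))) t‖)
      (f := fun v => ‖QQ f h v t‖) (g := fun v => ‖QQ f h v t‖ * ‖DD f (Y * exp (-(v / h))) (2 * (Y * exp (-(v / h)))) t‖ ^ 2)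
      (fun v _ => norm_nonneg _) (fun v _ => mul_nonneg (norm_nonneg _) (sq_nonneg _)) (fun v _ => by rw [norm_mul]; ring)
    have k3 : ∑ v ∈ Ico V0 V1, ‖QQ f h v t‖ * ‖DD f (Y * exp (-(v / h))) (2 * (Y * exp (-(v / h)))) t‖ ^ 2 ≤
      ∑ v ∈ Ico V0 V1, sumInv (Iv h v) * ‖DD f (Y * exp (-(v / h))) (2 * (Y * exp (-(v / h)))) t‖ ^ 2 :=
      sum_le_sum fun v _ => mul_le_mul_of_nonneg_right (QQ_le hb h v t) (sq_nonneg _)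
    have k4 := (k1.trans k2).trans (mul_le_mul (Hc t ht) k3
      (sum_nonneg fun v _ => mul_nonneg (norm_nonneg _) (sq_nonneg _)) (mul_nonneg (by linarith) hL.le))
    refine (mul_le_mul_of_nonneg_left k4 (by positivity)).trans (le_of_eq ?_)
    have : ∀ S : ℝ, (1 / L) ^ 2 * ((1 - c) * L * S) = (1 - c) / L * S := fun S => by field_simp
    exact this _
  calc EN f Y 𝒯 ≤ ∑ t ∈ 𝒯, ((1 + c) * ((1 - c) / L * ∑ v ∈ Ico V0 V1, sumInv (Iv h v) * ‖DD f (Y * exp (-(v / h))) (2 * (Y * exp (-(v / h)))) t‖ ^ 2) + (1 + 1 / c) * ‖∑ n ∈ Ioc ⌊Y⌋₊ ⌊3 * Y⌋₊, b n * ee (-t * Real.log n)‖ ^ 2) := by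
        refine sum_le_sum fun t ht => ?_
        rw [hb1 t]
        exact (e2 _ _).trans (add_le_add_left (mul_le_mul_of_nonneg_left (m1 t ht) (by linarith)) _)
    _ = (1 + c) * ((1 - c) / L * ∑ v ∈ Ico V0 V1, sumInv (Iv h v) * EN f (Y * exp (-(v / h))) 𝒯) + (1 + 1 / c) * ∑ t ∈ 𝒯, ‖∑ n ∈ Ioc ⌊Y⌋₊ ⌊3 * Y⌋₊, b n * ee (-t * Real.log n)‖ ^ 2 := by
        rw [sum_add_distrib, ← mul_sum, ← mul_sum, ← mul_sum, sum_comm]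
        simp only [EN, mul_sum]
    _ ≤ _ := by
        have k1 : ∑ v ∈ Ico V0 V1, sumInv (Iv h v) * EN f (Y * exp (-(v / h))) 𝒯 ≤ L * B := by
          rw [← Lsum, sum_mul]
          exact sum_le_sum fun v hv => mul_le_mul_of_nonneg_left (HB v hv) (sumInv_nonneg _)
        have k2 : (1 - c) / L * (L * B) = (1 - c) * B := by field_simp
        have k3 := (Hm b).trans (mul_le_mul_of_nonneg_left hb2 (by positivity))
        have k4 : C0 * Y * (64 / Y * (1 / L + 1 / h)) = C0 * 64 * (1 / L + 1 / h) := by field_simp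
        rw [k4] at k3
        have k5 := mul_le_mul_of_nonneg_left k1 (div_nonneg (by linarith : 0 ≤ 1 - c) hL.le)
        rw [k2] at k5
        exact add_le_add (mul_le_mul_of_nonneg_left k5 (by linarith)) (mul_le_mul_of_nonneg_left k3 (by positivity))
set_option maxHeartbeats 1000000 in
lemma thin : ∃ a : ℝ, 0 < a ∧ a ≤ 1 ∧ ∀ m : ℕ, 1 ≤ m → ∀ ε : ℝ, 0 < ε → ∃ T0 x0 : ℝ, 1 ≤ T0 ∧ ∀ f : ℕ → ℂ,
    (∀ m n, f (m * n) = f m * f n) → (∀ n, ‖f n‖ ≤ 1) → (∀ p : ℕ, p.Prime → f p = 0 ∨ f p ^ m = 1) →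
    ∀ x : ℝ, x0 ≤ x → ∀ 𝒯 : Finset ℤ, (∀ t ∈ 𝒯, T0 ≤ |(t : ℝ)| ∧ |(t : ℝ)| ≤ exp x) →
    (𝒯.card : ℝ) ≤ exp x ^ (4 * a) → EN f (exp x) 𝒯 ≤ ε := by
  obtain ⟨c0, C0, hc0, hc02, hC0, HM⟩ := hm
  refine ⟨c0 / 8, by positivity, by linarith, fun m hm1 ε hε => ?_⟩
  obtain ⟨c, T, c0', c1, hT, HC⟩ := contract m hm1
  obtain ⟨η, hη⟩ : ∃ η : ℝ, η = ε * c ^ 2 / (4 * ((1 + 1 / c) * (C0 * 64))) := ⟨_, rfl⟩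
  have hη0 : 0 < η := by rw [hη]; positivity
  obtain ⟨h, hhd⟩ : ∃ h : ℝ, h = max 4 (1 / η) := ⟨_, rfl⟩
  have hh : 4 ≤ h := hhd ▸ le_max_left _ _
  have hhη : 1 / h ≤ η := by
    rw [div_le_comm₀ (by linarith) hη0]; exact hhd ▸ le_max_right _ _
  obtain ⟨A0, hA0⟩ := exists_nat_ge (max 1000 (exp (48 / η)))
  have A1 : (1000 : ℝ) ≤ A0 := (le_max_left _ _).trans hA0
  have A2 : 48 / η ≤ Real.log A0 := (le_log_iff_exp_le (by linarith)).mpr ((le_max_right _ _).trans hA0)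
  have hcc : c ^ 2 < 1 := by nlinarith
  obtain ⟨k, hk⟩ := exists_pow_lt_of_lt_one (show 0 < ε / (4 * C0) by positivity) (show 1 - c ^ 2 < 1 by nlinarith)
  obtain ⟨K, hKd⟩ : ∃ K : ℝ, K = 4 * (k + 1) * A0 := ⟨_, rfl⟩
  have hK : 4000 ≤ K := by rw [hKd]; nlinarith [(cast_nonneg k : (0 : ℝ) ≤ k)]
  obtain ⟨u0, hu0, HU⟩ := HC h (16 * (k + 1) * A0) hh
  obtain ⟨x0, hx0⟩ : ∃ x0 : ℝ, x0 = K * (u0 + 1) + 4 * K + Real.log m + 2 * h := ⟨_, rfl⟩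
  have lm : 0 ≤ Real.log m := log_natCast_nonneg m
  refine ⟨T * h, x0, by nlinarith, fun f hf hb hfm x hx 𝒯 h𝒯 hcard => ?_⟩
  have hKu : 0 ≤ K * (u0 + 1) := by positivity
  obtain ⟨V0, hV0⟩ : ∃ V0 : ℕ, V0 = ⌊h * x / K⌋₊ := ⟨_, rfl⟩
  have h0 : 0 < h := by linarith
  have K0 : 0 < K := by linarith
  have x00 : 0 < x := by linarith
  have v1 : (V0 : ℝ) / h ≤ x / K := by
    rw [div_le_iff₀ h0, hV0]
    exact (floor_le (by positivity)).trans (le_of_eq (by ring))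
  have v2 : x / K - 1 ≤ V0 / h := by
    rw [le_div_iff₀ h0, hV0]
    have := lt_floor_add_one (h * x / K)
    have e : x / K * h = h * x / K := by ring
    linarith
  have v3 : u0 ≤ V0 / h := by
    refine le_trans ?_ v2
    rw [le_sub_iff_add_le, le_div_iff₀ K0]; linarith
  have V0p : (0 : ℝ) < V0 := by
    have : (0 : ℝ) < V0 / h := by linarith
    exact (div_pos_iff_of_pos_right h0).mp this
  obtain ⟨HL, HQ⟩ := HU f hfm V0 (A0 * V0) v3 (Nat.mul_le_mul_right _ (by exact_mod_cast A1))
  obtain ⟨L, hL⟩ : ∃ L, sumInv (prs (exp (V0 / h)) (exp ((A0 * V0 : ℕ) / h))) = L := ⟨_, rfl⟩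
  rw [hL] at HL HQ
  have L1 : 1 / η ≤ L := by
    refine le_trans ?_ HL
    rw [cast_mul, mul_div_assoc, div_self V0p.ne', mul_one, le_div_iff₀ (by norm_num)]
    exact (le_of_eq (by ring)).trans A2
  have L0 : 0 < L := lt_of_lt_of_le (by positivity) L1
  have L2 : 1 / L ≤ η := by rwa [div_le_comm₀ L0 hη0]
  have w1 : ((k : ℝ) + 1) * ((A0 * V0 : ℕ) / h) ≤ x / 4 := by
    have := mul_le_mul_of_nonneg_left v1 (show 0 ≤ ((k : ℝ) + 1) * A0 by positivity)
    have e : ((k : ℝ) + 1) * A0 * (x / K) = x / 4 := by rw [hKd]; field_simp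
    rw [e] at this
    exact (le_of_eq (by push_cast; ring)).trans this
  have wn : (0 : ℝ) ≤ (A0 * V0 : ℕ) / h := by positivity
  have HQ' : ∀ t ∈ 𝒯, ∑ v ∈ Ico V0 (A0 * V0), ‖QQ f h v t‖ ≤ (1 - c) * L := fun t ht => by
    refine HQ t (h𝒯 t ht).1 ?_
    have m0 : (0 : ℝ) < m := by exact_mod_cast hm1
    calc (m : ℝ) * |(t : ℝ)| ≤ exp (Real.log m) * exp x := by
          rw [exp_log m0]; exact mul_le_mul_of_nonneg_left (h𝒯 t ht).2 m0.le
      _ = exp (Real.log m + x) := (exp_add _ _).symm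
      _ ≤ _ := by
          rw [← exp_nat_mul]
          refine exp_le_exp.mpr ?_
          have e : ((16 * (k + 1) * A0 : ℕ) : ℝ) = 4 * K := by rw [hKd]; push_cast; ring
          rw [e]
          have := mul_le_mul_of_nonneg_left v2 (show 0 ≤ 4 * K by positivity)
          have e2 : 4 * K * (x / K - 1) = 4 * x - 4 * K := by field_simp
          linarith
  have key : ∀ y : ℝ, x / 2 ≤ y → y ≤ x → 3 ≤ exp y ∧ (𝒯.card : ℝ) ≤ exp y ^ c0 ∧ ∀ t ∈ 𝒯, |(t : ℝ)| ≤ exp y ^ 2 := by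
    intro y hy hy2
    refine ⟨by linarith [add_one_le_exp y], ?_, fun t ht => (h𝒯 t ht).2.trans ?_⟩
    · refine hcard.trans ?_
      rw [← exp_mul, ← exp_mul]
      exact exp_le_exp.mpr (by linarith [mul_le_mul_of_nonneg_right hy hc0.le])
    · rw [← exp_nat_mul]
      refine exp_le_exp.mpr ?_
      push_cast; linarith
  obtain ⟨E, hE⟩ : ∃ E, E = (1 + 1 / c) * (C0 * 64 * (1 / L + 1 / h)) := ⟨_, rfl⟩
  have it : ∀ j : ℕ, j ≤ k → ∀ y : ℝ, x / 2 + j * ((A0 * V0 : ℕ) / h) ≤ y → y ≤ x →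
      EN f (exp y) 𝒯 ≤ (1 - c ^ 2) ^ j * (2 * C0) + E / c ^ 2 := by
    intro j
    induction j with
    | zero =>
      intro _ y hy hy2
      obtain ⟨y3, yc, yt⟩ := key y (by simpa using hy) hy2
      have := HM (exp y) 𝒯 y3 yc yt (Ioc ⌊exp y⌋₊ ⌊2 * exp y⌋₊) (fun n => f n / n) (fun n hn => by
        have := (mem_Iof (by positivity) (by positivity)).mp hn
        exact ⟨this.1, by linarith [this.2]⟩)
      have h2 := mul_le_mul_of_nonneg_left (coef_sq hb (show 1 ≤ exp y by linarith)) (show 0 ≤ C0 * exp y by positivity)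
      have e : C0 * exp y * (2 / exp y) = 2 * C0 := by field_simp
      have hEp : 0 ≤ E / c ^ 2 := by rw [hE]; positivity
      rw [e] at h2
      rw [pow_zero, one_mul]
      have h3 := this.trans h2
      unfold EN DD GG
      linarith
    | succ j ih =>
      intro hj y hy hy2
      push_cast at hy
      have jw : 0 ≤ (j : ℝ) * ((A0 * V0 : ℕ) / h) := by positivity
      push_cast at jw w1 wn
      obtain ⟨y3, yc, yt⟩ := key y (by linarith) hy2
      have kw : 0 ≤ (k : ℝ) * (A0 * V0 / h) := by positivity
      have st := thin_step hf hb hh (Y := exp y) (by linarith [add_one_le_exp y])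
        (V0 := V0) (V1 := A0 * V0) (Nat.le_mul_of_pos_left _ (by exact_mod_cast (by linarith : (0 : ℝ) < A0)))
        (exp_le_exp.mpr (by push_cast; linarith)) L0 hL c0' c1 (C0 := C0) (by linarith) 𝒯
        (fun b => HM (exp y) 𝒯 y3 yc yt _ b fun n hn => (mem_Iof (by positivity) (by positivity)).mp hn) HQ'
        (B := (1 - c ^ 2) ^ j * (2 * C0) + E / c ^ 2) (fun v hv => by
          rw [← exp_add]
          have hv' : (v : ℝ) / h ≤ A0 * V0 / h := by
            refine div_le_div_of_nonneg_right ?_ h0.le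
            exact_mod_cast (mem_Ico.mp hv).2.le
          have : 0 ≤ (v : ℝ) / h := by positivity
          exact ih (by omega) _ (by push_cast; linarith) (by linarith))
      refine st.trans (le_of_eq ?_)
      rw [← hE, pow_succ]
      field_simp
      ring
  have fin := it k le_rfl x (by linarith) le_rfl
  refine fin.trans ?_
  have e1 : (1 - c ^ 2) ^ k * (2 * C0) ≤ ε / 2 := by
    have := mul_le_mul_of_nonneg_right hk.le (show 0 ≤ 2 * C0 by linarith)
    have e : ε / (4 * C0) * (2 * C0) = ε / 2 := by field_simp; norm_num
    linarith
  have e2 : E / c ^ 2 ≤ ε / 2 := by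
    rw [div_le_iff₀ (by positivity), hE]
    have := mul_le_mul_of_nonneg_left (add_le_add L2 hhη) (show 0 ≤ (1 + 1 / c) * (C0 * 64) by positivity)
    have e : (1 + 1 / c) * (C0 * 64) * (η + η) = ε / 2 * c ^ 2 := by rw [hη]; field_simp; ring
    linarith
  linarith
end
section
open Classical in
lemma HF {m : ℕ} (hm : 1 ≤ m) {f : ℕ → ℂ} (hf : ∀ m n, f (m * n) = f m * f n) (hb : ∀ n, ‖f n‖ ≤ 1) (hf1 : f 1 = 1)
    (hfm : ∀ p : ℕ, p.Prime → f p = 0 ∨ f p ^ m = 1) {ε : ℝ} (hε : 0 < ε) : ∃ H T0 x0 : ℝ, 1 ≤ H ∧ 1 ≤ T0 ∧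
    ∀ x : ℝ, x0 ≤ x → ∀ 𝒯 : Finset ℤ, (∀ t ∈ 𝒯, T0 ≤ |(t : ℝ)| ∧ |(t : ℝ)| ≤ exp x / H) → EN f (exp x) 𝒯 ≤ ε := by
  obtain ⟨a, a0, a1, TH⟩ := thin
  obtain ⟨T0, x0, hT0, TH⟩ := TH m hm (ε / 2) (by positivity)
  obtain ⟨w0, hw0, CH⟩ := chain hf hb a0 a1
  obtain ⟨w3, S3⟩ := eventually_atTop.mp (stage3 hf hb hf1 a0)
  have ev : ∀ᶠ w : ℕ in atTop, 4000001 * 6 / ε ≤ Real.log w :=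
    (Real.tendsto_log_atTop.comp tendsto_natCast_atTop_atTop).eventually_ge_atTop _
  obtain ⟨w, S1, hlog, hww0, hww3⟩ := ((stage1 hf hb a0).and (ev.and ((eventually_ge_atTop w0).and (eventually_ge_atTop w3)))).exists
  have hlp : 0 < Real.log w := lt_of_lt_of_le (by positivity) hlog
  have hle : 3 * (4000001 / Real.log w) ≤ ε / 2 := by
    rw [div_le_iff₀ hε] at hlog
    rw [← mul_div_assoc, div_le_iff₀ hlp]; linarith
  refine ⟨exp ((w : ℝ) ^ 4), T0, max x0 (max ((w : ℝ) ^ 8) ((w : ℝ) ^ 4)), one_le_exp (by positivity), hT0, fun x hx 𝒯 h𝒯 => ?_⟩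
  have x1 : x0 ≤ x := (le_max_left _ _).trans hx
  have x2 : (w : ℝ) ^ 8 ≤ x := (le_max_left _ _).trans ((le_max_right _ _).trans hx)
  have x3 : (w : ℝ) ^ 4 ≤ x := (le_max_right _ _).trans ((le_max_right _ _).trans hx)
  have e1 : 1 ≤ exp x / exp ((w : ℝ) ^ 4) := (one_le_div (exp_pos _)).mpr (exp_le_exp.mpr x3)
  have e0 : exp x / exp ((w : ℝ) ^ 4) ≤ exp x := div_le_self (exp_pos _).le (one_le_exp (by positivity))
  obtain ⟨T, hT⟩ : ∃ T : ℕ, T = ⌊exp x / exp ((w : ℝ) ^ 4)⌋₊ := ⟨_, rfl⟩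
  have T1 : 1 ≤ T := hT ▸ le_floor (by exact_mod_cast e1)
  have T2 : (T : ℝ) ≤ exp x / exp ((w : ℝ) ^ 4) := hT ▸ floor_le (by positivity)
  have T3 : ∀ t ∈ 𝒯, |t| ≤ T := fun t ht => by
    have := (h𝒯 t ht).2
    have k : ((t.natAbs : ℕ) : ℝ) = |(t : ℝ)| := by rw [Nat.cast_natAbs, Int.cast_abs]
    rw [← k] at this
    have := le_floor this
    rw [← hT] at this
    rw [Int.abs_eq_natAbs]; exact_mod_cast this
  have sp : EN f (exp x) 𝒯 = EN f (exp x) (𝒯.filter fun t => good f a w t) + EN f (exp x) (𝒯.filter fun t => ¬ good f a w t) :=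
    (Finset.sum_filter_add_sum_filter_not _ _ _).symm
  have g1 := S1 (exp x) (𝒯.filter fun t => good f a w t) T T1 (fun t ht => T3 t (mem_filter.mp ht).1)
    (T2.trans (le_of_eq (by rw [exp_neg]; rfl))) (fun t ht => (mem_filter.mp ht).2)
  obtain ⟨w', hw', l1, l2, g2⟩ := CH (exp x) 𝒯 T T1 T3 (T2.trans e0) w hww0 (by rwa [log_exp])
  have cd := S3 w' (hww3.trans hw') (exp x) (𝒯.filter fun t => ¬ good f a w' t) T T1
    (fun t ht => T3 t (mem_filter.mp ht).1) (T2.trans e0) l1 l2.le (fun t ht => (mem_filter.mp ht).2)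
  have g3 := TH f hf hb hfm x x1 _ (fun t ht => ⟨(h𝒯 t (mem_filter.mp ht).1).1,
    ((h𝒯 t (mem_filter.mp ht).1).2).trans e0⟩) cd
  rw [sp]; linarith
end
section
open MeasureTheory FourierTransform in
lemma cauchy_ft1 (x : ℝ) : ∫ w : ℝ, ee (2 * Real.pi * (w * x)) * ((1 / (1 + w ^ 2) : ℝ) : ℂ) = ((Real.pi * exp (-(2 * Real.pi * |x|)) : ℝ) : ℂ) := by
  have pi0 := pi_pos
  have fc : Continuous fun x : ℝ => ((exp (-(2 * Real.pi * |x|)) : ℝ) : ℂ) := by fun_prop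
  have i1 : ∀ w : ℝ, IntegrableOn (fun v : ℝ => ee (-2 * Real.pi * (v * w)) * ((exp (-(2 * Real.pi * |v|)) : ℝ) : ℂ)) (Set.Ioi 0) ∧
      ∫ v in Set.Ioi 0, ee (-2 * Real.pi * (v * w)) * ((exp (-(2 * Real.pi * |v|)) : ℝ) : ℂ) = 1 / (2 * Real.pi * (1 + w * Complex.I)) := fun w => by
    have e : Set.EqOn (fun v : ℝ => Complex.exp (-(2 * Real.pi * (1 + w * Complex.I)) * v)) (fun v : ℝ => ee (-2 * Real.pi * (v * w)) * ((exp (-(2 * Real.pi * |v|)) : ℝ) : ℂ)) (Set.Ioi 0) := fun v hv => by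
      simp only [ee]
      rw [abs_of_pos hv, ofReal_exp, ← Complex.exp_add]; congr 1; push_cast; ring
    have re : (-(2 * Real.pi * (1 + w * Complex.I)) : ℂ).re < 0 := by simp; positivity
    refine ⟨(integrableOn_exp_mul_complex_Ioi re 0).congr_fun e measurableSet_Ioi, ?_⟩
    rw [← setIntegral_congr_fun measurableSet_Ioi e, integral_exp_mul_complex_Ioi re]
    simp [neg_div_neg_eq]
  have i2 : ∀ w : ℝ, IntegrableOn (fun v : ℝ => ee (-2 * Real.pi * (v * w)) * ((exp (-(2 * Real.pi * |v|)) : ℝ) : ℂ)) (Set.Iic 0) ∧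
      ∫ v in Set.Iic 0, ee (-2 * Real.pi * (v * w)) * ((exp (-(2 * Real.pi * |v|)) : ℝ) : ℂ) = 1 / (2 * Real.pi * (1 - w * Complex.I)) := fun w => by
    have e : Set.EqOn (fun v : ℝ => Complex.exp ((2 * Real.pi * (1 - w * Complex.I)) * v)) (fun v : ℝ => ee (-2 * Real.pi * (v * w)) * ((exp (-(2 * Real.pi * |v|)) : ℝ) : ℂ)) (Set.Iic 0) := fun v hv => by
      simp only [ee]
      rw [abs_of_nonpos hv, ofReal_exp, ← Complex.exp_add]; congr 1; push_cast; ring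
    have re : 0 < ((2 * Real.pi * (1 - w * Complex.I)) : ℂ).re := by simp; positivity
    refine ⟨(integrableOn_exp_mul_complex_Iic re 0).congr_fun e measurableSet_Iic, ?_⟩
    rw [← setIntegral_congr_fun measurableSet_Iic e, integral_exp_mul_complex_Iic re]
    simp
  have fi : Integrable fun x : ℝ => ((exp (-(2 * Real.pi * |x|)) : ℝ) : ℂ) := by
    have := (i2 0).1.union (i1 0).1
    rw [Set.Iic_union_Ioi, integrableOn_univ] at this
    simpa [ee_zero] using this
  have ft : 𝓕 (fun x : ℝ => ((exp (-(2 * Real.pi * |x|)) : ℝ) : ℂ)) = fun w : ℝ => ((1 / Real.pi * (1 / (1 + w ^ 2)) : ℝ) : ℂ) := by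
    funext w
    rw [Real.fourier_eq']
    have : ∀ v : ℝ, Complex.exp (((-2 * Real.pi * inner ℝ v w : ℝ) : ℂ) * Complex.I) • ((exp (-(2 * Real.pi * |v|)) : ℝ) : ℂ) =
      ee (-2 * Real.pi * (v * w)) * ((exp (-(2 * Real.pi * |v|)) : ℝ) : ℂ) := fun v => by
      simp [ee, mul_comm]
    simp_rw [this]
    rw [← setIntegral_univ, ← Set.Iic_union_Ioi (a := (0 : ℝ)), setIntegral_union (Set.Iic_disjoint_Ioi le_rfl) measurableSet_Ioi (i2 w).1 (i1 w).1,
      (i1 w).2, (i2 w).2]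
    have h1 : (1 + w * Complex.I : ℂ) ≠ 0 := fun h => by simpa using congrArg Complex.re h
    have h2 : (1 - w * Complex.I : ℂ) ≠ 0 := fun h => by simpa using congrArg Complex.re h
    have h3 : (1 + w ^ 2 : ℂ) = (1 + w * Complex.I) * (1 - w * Complex.I) := by
      ring_nf; rw [I_sq]; ring
    have h4 : (Real.pi : ℂ) ≠ 0 := by exact_mod_cast pi0.ne'
    push_cast
    rw [h3]; field_simp; ring
  have inv := congrFun (fc.fourierInv_fourier_eq fi (by
    rw [ft]
    exact ((integrable_inv_one_add_sq.congr (ae_of_all _ fun w => (one_div _).symm)).const_mul (1 / Real.pi)).ofReal)) x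
  rw [ft, Real.fourierInv_eq'] at inv
  simp only [ofReal_mul (Real.pi : ℝ)]
  rw [← inv, ← integral_const_mul]
  refine integral_congr_ae (ae_of_all _ fun w => ?_)
  have h4 : (Real.pi : ℂ) ≠ 0 := by exact_mod_cast pi0.ne'
  simp only [ee, smul_eq_mul]
  have : (inner ℝ w x : ℝ) = w * x := by simp [mul_comm]
  rw [this]; push_cast; field_simp
open MeasureTheory in
lemma cauchy_ft {q : ℝ} (hq : 0 < q) (x : ℝ) : ∫ y : ℝ, ee (y * x) * ((1 / (q ^ 2 + y ^ 2) : ℝ) : ℂ) = ((Real.pi / q * exp (-(q * |x|)) : ℝ) : ℂ) := by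
  have h := cauchy_ft1 (q * x / (2 * Real.pi))
  have pi0 := pi_pos
  have h2 := Measure.integral_comp_mul_left (fun y : ℝ => ee (y * x) * ((1 / (q ^ 2 + y ^ 2) : ℝ) : ℂ)) q
  have e : ∀ w : ℝ, ee (2 * Real.pi * (w * (q * x / (2 * Real.pi)))) * ((1 / (1 + w ^ 2) : ℝ) : ℂ) =
     ((q ^ 2 : ℝ) : ℂ) * (ee (q * w * x) * ((1 / (q ^ 2 + (q * w) ^ 2) : ℝ) : ℂ)) := fun w => by
    have : 2 * Real.pi * (w * (q * x / (2 * Real.pi))) = q * w * x := by field_simp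
    rw [this, mul_left_comm, ← ofReal_mul]
    congr 3; field_simp
  simp_rw [e] at h
  rw [integral_const_mul, h2, abs_of_pos (inv_pos.mpr hq)] at h
  have e2 : 2 * Real.pi * |q * x / (2 * Real.pi)| = q * |x| := by
    rw [abs_div, abs_mul, abs_of_pos hq, abs_of_pos (show 0 < 2 * Real.pi by positivity)]; field_simp
  rw [e2] at h
  have q0 : (q : ℂ) ≠ 0 := by exact_mod_cast hq.ne'
  rw [real_smul] at h
  generalize (∫ y : ℝ, ee (y * x) * ((1 / (q ^ 2 + y ^ 2) : ℝ) : ℂ)) = Z at h ⊢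
  push_cast at h ⊢
  field_simp at h ⊢
  exact h
end
section
noncomputable def kf (q l u : ℝ) : ℝ := if l ≤ u then exp (-(q * (u - l))) else 0
noncomputable def Ph (q : ℝ) (S : Finset ℕ) (c : ℕ → ℂ) (u : ℝ) : ℂ := ∑ n ∈ S, c n * ((kf q (Real.log n) u : ℝ) : ℂ)
noncomputable def Fs (S : Finset ℕ) (c : ℕ → ℂ) (y : ℝ) : ℂ := ∑ n ∈ S, c n * ee (-(y * Real.log n))
open MeasureTheory
lemma kf_mul {q : ℝ} (hq : 0 < q) (a b : ℝ) : Integrable (fun u => kf q a u * kf q b u) ∧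
    ∫ u, kf q a u * kf q b u = 1 / (2 * q) * exp (-(q * |b - a|)) := by
  have e : (fun u => kf q a u * kf q b u) = (Set.Ici (max a b)).indicator fun u => exp (q * (a + b)) * exp (-(2 * q) * u) := by
    funext u
    rw [Set.indicator_apply]
    by_cases h : max a b ≤ u
    · have h' := max_le_iff.mp h
      rw [if_pos (Set.mem_Ici.mpr h), kf, kf, if_pos h'.1, if_pos h'.2, ← exp_add, ← exp_add]; congr 1; ring
    · rw [if_neg (fun h' => h (Set.mem_Ici.mp h')), kf, kf]
      rw [max_le_iff, not_and_or] at h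
      rcases h with h | h <;> simp [h]
  have h2 : -(2 * q) < 0 := by linarith
  rw [e]
  refine ⟨(integrable_indicator_iff measurableSet_Ici).mpr (((integrableOn_Ici_iff_integrableOn_Ioi (μ := volume)).mpr (integrableOn_exp_mul_Ioi h2 _)).const_mul _), ?_⟩
  rw [integral_indicator measurableSet_Ici, integral_Ici_eq_integral_Ioi, integral_const_mul, integral_exp_mul_Ioi h2]
  have : exp (-(q * |b - a|)) = exp (q * (a + b)) * exp (-(2 * q) * max a b) := by
    rw [← exp_add]; congr 1
    rcases le_total a b with h | h
    · rw [max_eq_right h, abs_of_nonneg (by linarith)]; ring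
    · rw [max_eq_left h, abs_of_nonpos (by linarith)]; ring
  rw [this]; field_simp
lemma int_cauchy {q : ℝ} (hq : 0 < q) : Integrable fun y : ℝ => 1 / (q ^ 2 + y ^ 2) := by
  refine (integrable_inv_one_add_sq.const_mul (1 + 1 / q ^ 2)).mono' (by
    refine Continuous.aestronglyMeasurable (continuous_const.div (by fun_prop) fun y => by positivity)) (ae_of_all _ fun y => ?_)
  rw [norm_of_nonneg (by positivity), ← div_eq_mul_inv, div_le_div_iff₀ (by positivity) (by positivity)]
  have : (1 + 1 / q ^ 2) * (q ^ 2 + y ^ 2) = 1 + y ^ 2 + (q ^ 2 + y ^ 2 / q ^ 2) := by field_simp; ring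
  rw [this]
  have : 0 ≤ q ^ 2 + y ^ 2 / q ^ 2 := by positivity
  linarith
lemma quad_int {S : Finset ℕ} {c : ℕ → ℂ} {g : ℝ → ℝ} {G : ℝ → ℕ → ℂ} {k : ℕ → ℕ → ℝ}
    (hg : ∀ y, ((g y : ℝ) : ℂ) = ∑ m ∈ S, ∑ n ∈ S, c m * (starRingEnd ℂ) (c n) * (G y m * (starRingEnd ℂ) (G y n)))
    (hi : ∀ m ∈ S, ∀ n ∈ S, Integrable fun y => G y m * (starRingEnd ℂ) (G y n))
    (hk : ∀ m ∈ S, ∀ n ∈ S, ∫ y, G y m * (starRingEnd ℂ) (G y n) = ((k m n : ℝ) : ℂ)) :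
    Integrable g ∧ ((∫ y, g y : ℝ) : ℂ) = ∑ m ∈ S, ∑ n ∈ S, c m * (starRingEnd ℂ) (c n) * ((k m n : ℝ) : ℂ) := by
  have i1 : ∀ m ∈ S, ∀ n ∈ S, Integrable fun y => c m * (starRingEnd ℂ) (c n) * (G y m * (starRingEnd ℂ) (G y n)) :=
    fun m hm n hn => (hi m hm n hn).const_mul _
  have e : (fun y => ((g y : ℝ) : ℂ)) = fun y => ∑ m ∈ S, ∑ n ∈ S, c m * (starRingEnd ℂ) (c n) * (G y m * (starRingEnd ℂ) (G y n)) := funext hg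
  have i2 : Integrable fun y => ((g y : ℝ) : ℂ) := by
    rw [e]; exact integrable_finset_sum _ fun m hm => integrable_finset_sum _ fun n hn => i1 m hm n hn
  refine ⟨by simpa using i2.re, ?_⟩
  refine (integral_ofReal (𝕜 := ℂ) (f := g)).symm.trans ?_
  change ∫ y, ((g y : ℝ) : ℂ) = _
  rw [e, integral_finset_sum _ fun m hm => integrable_finset_sum _ fun n hn => i1 m hm n hn]
  refine sum_congr rfl fun m hm => ?_
  rw [integral_finset_sum _ fun n hn => i1 m hm n hn]
  refine sum_congr rfl fun n hn => ?_
  rw [integral_const_mul, hk m hm n hn]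
lemma ph_form {q : ℝ} (hq : 0 < q) (S : Finset ℕ) (c : ℕ → ℂ) : Integrable (fun u => ‖Ph q S c u‖ ^ 2) ∧
    ((∫ u, ‖Ph q S c u‖ ^ 2 : ℝ) : ℂ) = ∑ m ∈ S, ∑ n ∈ S, c m * (starRingEnd ℂ) (c n) *
      ((1 / (2 * q) * exp (-(q * |Real.log n - Real.log m|)) : ℝ) : ℂ) := by
  refine quad_int (G := fun u n => ((kf q (Real.log n) u : ℝ) : ℂ)) (fun u => ?_) (fun m _ n _ => ?_) (fun m _ n _ => ?_)
  · rw [Ph, normsq_sum]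
    refine sum_congr rfl fun m _ => sum_congr rfl fun n _ => ?_
    rw [map_mul]; ring
  · simp only [conj_ofReal, ← ofReal_mul]
    exact (kf_mul hq _ _).1.ofReal
  · simp only [conj_ofReal, ← ofReal_mul]
    rw [← (kf_mul hq (Real.log m) (Real.log n)).2]; exact integral_ofReal
lemma fs_form {q : ℝ} (hq : 0 < q) (S : Finset ℕ) (c : ℕ → ℂ) : Integrable (fun y => ‖Fs S c y‖ ^ 2 * (1 / (q ^ 2 + y ^ 2))) ∧
    ((∫ y, ‖Fs S c y‖ ^ 2 * (1 / (q ^ 2 + y ^ 2)) : ℝ) : ℂ) = ∑ m ∈ S, ∑ n ∈ S, c m * (starRingEnd ℂ) (c n) *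
      ((Real.pi / q * exp (-(q * |Real.log n - Real.log m|)) : ℝ) : ℂ) := by
  have sq : ∀ y : ℝ, sqrt (1 / (q ^ 2 + y ^ 2)) * sqrt (1 / (q ^ 2 + y ^ 2)) = 1 / (q ^ 2 + y ^ 2) :=
    fun y => mul_self_sqrt (by positivity)
  have ge : ∀ (y : ℝ) (m n : ℕ), ee (-(y * Real.log m)) * (sqrt (1 / (q ^ 2 + y ^ 2)) : ℂ) * (starRingEnd ℂ) (ee (-(y * Real.log n)) * (sqrt (1 / (q ^ 2 + y ^ 2)) : ℂ))
      = ee (y * (Real.log n - Real.log m)) * ((1 / (q ^ 2 + y ^ 2) : ℝ) : ℂ) := fun y m n => by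
    have k := congrArg (fun x : ℝ => (x : ℂ)) (sq y)
    simp only [ofReal_mul] at k
    rw [map_mul, ee_conj, conj_ofReal, ← k]
    have : y * (Real.log n - Real.log m) = -(y * Real.log m) + -(-(y * Real.log n)) := by ring
    rw [this, ee_add]; ring
  refine quad_int (G := fun y n => ee (-(y * Real.log n)) * (sqrt (1 / (q ^ 2 + y ^ 2)) : ℂ)) (fun y => ?_) (fun m _ n _ => ?_) (fun m _ n _ => ?_)
  · rw [Fs, ofReal_mul, normsq_sum, sum_mul]
    refine sum_congr rfl fun m _ => ?_
    rw [sum_mul]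
    refine sum_congr rfl fun n _ => ?_
    have k := congrArg (fun x : ℝ => (x : ℂ)) (sq y)
    simp only [ofReal_mul] at k
    rw [← k]
    simp only [map_mul, conj_ofReal]; ring
  · simp_rw [ge]
    refine (int_cauchy hq).mono (Continuous.aestronglyMeasurable ?_) (ae_of_all _ fun y => ?_)
    · refine Continuous.mul (by unfold ee; fun_prop) (Complex.continuous_ofReal.comp (continuous_const.div (by fun_prop) fun y => by positivity))
    · rw [norm_mul, ee_norm, one_mul, norm_real]
  · simp_rw [ge]; exact cauchy_ft hq _
lemma planch {q : ℝ} (hq : 0 < q) (S : Finset ℕ) (c : ℕ → ℂ) : ∫ u, ‖Ph q S c u‖ ^ 2 =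
    1 / (2 * Real.pi) * ∫ y, ‖Fs S c y‖ ^ 2 * (1 / (q ^ 2 + y ^ 2)) := by
  have h1 := (ph_form hq S c).2
  have h2 := (fs_form hq S c).2
  have : ((∫ u, ‖Ph q S c u‖ ^ 2 : ℝ) : ℂ) = ((1 / (2 * Real.pi) * ∫ y, ‖Fs S c y‖ ^ 2 * (1 / (q ^ 2 + y ^ 2)) : ℝ) : ℂ) := by
    rw [h1, ofReal_mul, h2, mul_sum]
    refine sum_congr rfl fun m _ => ?_
    rw [mul_sum]
    refine sum_congr rfl fun n _ => ?_
    rw [mul_left_comm, ← ofReal_mul]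
    congr 2; have := pi_pos; field_simp
  exact_mod_cast this
lemma kf_window {q : ℝ} (hq : 0 < q) (l a b : ℝ) (hab : a ≤ b) : IntervalIntegrable (kf q l) volume a b ∧
    ((if l ≤ b then 1 else 0) - (if l ≤ a then 1 else 0) : ℝ) = kf q l b - kf q l a + q * ∫ u in a..b, kf q l u := by
  have ii : IntervalIntegrable (kf q l) volume a b := by
    have hm : Measurable (kf q l) := by
      unfold kf; exact Measurable.ite measurableSet_Ici (by fun_prop) measurable_const
    refine (intervalIntegrable_const (c := (1 : ℝ))).mono_fun hm.aestronglyMeasurable (ae_of_all _ fun u => ?_)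
    simp only [kf]
    split_ifs with h
    · rw [norm_of_nonneg (exp_pos _).le, norm_one]
      exact exp_le_one_iff.mpr (by have := mul_nonneg hq.le (sub_nonneg.mpr h); linarith)
    · simp
  refine ⟨ii, ?_⟩
  have ftc := intervalIntegral.integral_eq_sub_of_hasDeriv_right (a := a) (b := b)
    (f := fun u => 1 - exp (-(q * max (u - l) 0))) (f' := fun u => q * kf q l u) (by fun_prop) (fun u hu => ?_) (ii.const_mul q)
  · rw [intervalIntegral.integral_const_mul] at ftc
    rw [ftc]
    have : ∀ u : ℝ, (if l ≤ u then 1 else 0 : ℝ) = kf q l u + (1 - exp (-(q * max (u - l) 0))) := fun u => by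
      unfold kf
      split_ifs with h
      · rw [max_eq_left (by linarith)]; ring
      · rw [max_eq_right (by linarith)]; simp
    rw [this a, this b]; ring
  · by_cases h : l ≤ u
    · have h1 : HasDerivAt (fun u => 1 - exp (-(q * (u - l)))) (q * kf q l u) u := by
        have := (((((hasDerivAt_id u).sub_const l).const_mul q).neg).exp).const_sub 1
        convert! this using 1
        simp [kf, h]; ring
      refine h1.hasDerivWithinAt.congr (fun v hv => ?_) ?_
      · rw [max_eq_left (by have := Set.mem_Ioi.mp hv; linarith)]
      · rw [max_eq_left (by linarith)]
    · push Not at h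
      have : kf q l u = 0 := if_neg (by linarith)
      rw [this, mul_zero]
      refine ((hasDerivAt_const u (0 : ℝ)).congr_of_eventuallyEq ?_).hasDerivWithinAt
      filter_upwards [eventually_lt_nhds h] with v hv
      rw [max_eq_right (by linarith)]; simp
lemma ph_window {q : ℝ} (hq : 0 < q) (S : Finset ℕ) (c : ℕ → ℂ) (a b : ℝ) (hab : a ≤ b) :
    ∑ n ∈ S.filter (fun n : ℕ => a < Real.log n ∧ Real.log n ≤ b), c n = Ph q S c b - Ph q S c a + q * ∫ u in a..b, Ph q S c u := by
  unfold Ph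
  rw [intervalIntegral.integral_finset_sum fun n _ => (IntervalIntegrable.const_mul (by
      have h := (kf_window hq (Real.log n) a b hab).1
      exact ⟨h.1.ofReal, h.2.ofReal⟩) _), mul_sum, ← sum_sub_distrib,
    ← sum_add_distrib, sum_filter]
  refine sum_congr rfl fun n _ => ?_
  have h := congrArg (fun x : ℝ => (x : ℂ)) (kf_window hq (Real.log n) a b hab).2
  rw [intervalIntegral.integral_const_mul, intervalIntegral.integral_ofReal]
  push_cast at h
  have : (if a < Real.log n ∧ Real.log n ≤ b then c n else 0) = c n * (((if Real.log n ≤ b then 1 else 0) - (if Real.log n ≤ a then 1 else 0) : ℝ) : ℂ) := by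
    by_cases h1 : Real.log n ≤ b
    · by_cases h2 : Real.log n ≤ a
      · simp [h1, h2]
      · simp [h1, h2, not_le.mp h2]
    · simp [h1, show ¬ Real.log n ≤ a by linarith]
  rw [this]; push_cast; rw [h]; ring
end
section
open MeasureTheory
lemma bern (M q : ℕ) : (M : ℝ) ^ (q + 1) + (q + 1) * M ^ q ≤ (M + 1) ^ (q + 1) := by
  induction q with
  | zero => simp
  | succ q ih =>
    have := mul_le_mul_of_nonneg_right ih (show (0 : ℝ) ≤ M + 1 by positivity)
    rw [pow_succ ((M : ℝ) + 1)]
    refine le_trans ?_ this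
    have h : 0 ≤ ((q : ℝ) + 1) * M ^ q := by positivity
    push_cast
    calc _ = ((M : ℝ) ^ (q + 1) + (q + 1) * M ^ q) * (M + 1) - (q + 1) * M ^ q := by ring
      _ ≤ _ := by linarith
lemma pw_low (M q : ℕ) : ∑ n ∈ Icc 1 M, (n : ℝ) ^ q ≤ (M : ℝ) ^ (q + 1) / (q + 1) + M ^ q := by
  induction M with
  | zero => simp
  | succ M ih =>
    rw [sum_Icc_succ_top (by omega)]
    have b := bern M q
    have : ((M : ℝ) ^ (q + 1) + (q + 1) * M ^ q) / (q + 1) ≤ (M + 1) ^ (q + 1) / (q + 1) := by gcongr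
    have e : ((M : ℝ) ^ (q + 1) + (q + 1) * M ^ q) / (q + 1) = (M : ℝ) ^ (q + 1) / (q + 1) + M ^ q := by field_simp
    push_cast; linarith
lemma pw_high (m N q : ℕ) (hm : 1 ≤ m) : ∑ n ∈ Ioc m N, 1 / (n : ℝ) ^ (q + 2) ≤ 1 / (q + 1) * (1 / m ^ (q + 1)) := by
  have m0 : (0 : ℝ) < m := by exact_mod_cast hm
  rcases le_total N m with h | h
  · rw [Finset.Ioc_eq_empty (by omega), Finset.sum_empty]; positivity
  suffices H : ∑ n ∈ Ioc m N, 1 / (n : ℝ) ^ (q + 2) ≤ 1 / (q + 1) * (1 / m ^ (q + 1) - 1 / N ^ (q + 1)) by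
    refine H.trans (mul_le_mul_of_nonneg_left ?_ (by positivity))
    have : 0 ≤ 1 / (N : ℝ) ^ (q + 1) := by positivity
    linarith
  induction N, h using le_induction with
  | base => simp
  | succ N hN ih =>
    have N0 : (0 : ℝ) < N := by exact_mod_cast (by omega : 0 < N)
    rw [Finset.sum_Ioc_succ_top (by omega)]
    have b := bern N q
    have : 1 / ((N : ℝ) + 1) ^ (q + 2) ≤ 1 / (q + 1) * (1 / N ^ (q + 1) - 1 / (N + 1) ^ (q + 1)) := by
      have e : 1 / (q + 1) * (1 / (N : ℝ) ^ (q + 1) - 1 / (N + 1) ^ (q + 1)) = ((N + 1) ^ (q + 1) - N ^ (q + 1)) / ((q + 1) * N ^ (q + 1) * (N + 1) ^ (q + 1)) := by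
        field_simp
      rw [e, div_le_div_iff₀ (by positivity) (by positivity), one_mul, pow_succ ((N : ℝ) + 1) (q + 1)]
      have h1 : ((q : ℝ) + 1) * N ^ (q + 1) ≤ ((N + 1) ^ (q + 1) - N ^ (q + 1)) * (N + 1) := by
        have := mul_le_mul_of_nonneg_right (by linarith : ((q : ℝ) + 1) * N ^ q ≤ (N + 1) ^ (q + 1) - N ^ (q + 1)) (show (0 : ℝ) ≤ N + 1 by positivity)
        refine le_trans ?_ this
        have h0 : 0 ≤ ((q : ℝ) + 1) * N ^ q := by positivity
        calc ((q : ℝ) + 1) * N ^ (q + 1) = (q + 1) * N ^ q * (N + 1) - (q + 1) * N ^ q := by ring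
          _ ≤ _ := by linarith
      have := mul_le_mul_of_nonneg_right h1 (show 0 ≤ ((N : ℝ) + 1) ^ (q + 1) by positivity)
      linarith
    have := add_le_add (ih) this
    push_cast
    refine this.trans (le_of_eq (by ring))
lemma kf_sum (q N : ℕ) (u : ℝ) (hu : 0 ≤ u) : ∑ n ∈ Icc 1 N, 1 / (n : ℝ) * kf (q + 1) (Real.log n) u ≤ 1 / (q + 1) + exp (-u) := by
  obtain ⟨M, hM⟩ : ∃ M, M = ⌊exp u⌋₊ := ⟨_, rfl⟩
  have hM1 : (M : ℝ) ≤ exp u := hM ▸ floor_le (exp_pos _).le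
  calc _ ≤ ∑ n ∈ Icc 1 M, (n : ℝ) ^ q * exp (-((q + 1) * u)) := by
        have e : ∀ n ∈ Icc 1 N, 1 / (n : ℝ) * kf (q + 1) (Real.log n) u = if Real.log n ≤ u then (n : ℝ) ^ q * exp (-((q + 1) * u)) else 0 := fun n hn => by
          have n0 : (0 : ℝ) < n := by exact_mod_cast (mem_Icc.mp hn).1
          unfold kf
          split_ifs
          · have : exp (-((q + 1) * (u - Real.log n))) = (n : ℝ) ^ (q + 1) * exp (-((q + 1) * u)) := by
              rw [show -(((q : ℝ) + 1) * (u - Real.log n)) = ((q + 1 : ℕ) : ℝ) * Real.log n + -((q + 1) * u) by push_cast; ring,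
                exp_add, exp_nat_mul, exp_log n0]
            rw [this, pow_succ]; field_simp
          · simp
        rw [sum_congr rfl e, ← sum_filter]
        refine sum_le_sum_of_subset_of_nonneg (fun n hn => ?_) fun _ _ _ => by positivity
        obtain ⟨h1, h2⟩ := mem_filter.mp hn
        have n1 := (mem_Icc.mp h1).1
        refine mem_Icc.mpr ⟨n1, ?_⟩
        rw [hM]
        exact le_floor ((Real.log_le_iff_le_exp (by exact_mod_cast n1)).mp h2)
    _ ≤ ((M : ℝ) ^ (q + 1) / (q + 1) + M ^ q) * exp (-((q + 1) * u)) := by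
        rw [← sum_mul]
        exact mul_le_mul_of_nonneg_right (pw_low M q) (exp_pos _).le
    _ ≤ (exp u ^ (q + 1) / (q + 1) + exp u ^ q) * exp (-((q + 1) * u)) := by gcongr
    _ = _ := by
        have h1 : exp u ^ (q + 1) * exp (-((q + 1) * u)) = 1 := by
          rw [← exp_nat_mul, ← exp_add]; push_cast; simp
        have h2 : exp u ^ q * exp (-((q + 1) * u)) = exp (-u) := by
          rw [← exp_nat_mul, ← exp_add]; congr 1; ring
        rw [add_mul, div_mul_eq_mul_div, h1, h2]
lemma row_sum (q N m : ℕ) (hm : 1 ≤ m) : ∑ n ∈ Icc 1 N, 1 / (n : ℝ) * exp (-((q + 1) * |Real.log n - Real.log m|)) ≤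
    2 / (q + 1) + 1 / m := by
  have m0 : (0 : ℝ) < m := by exact_mod_cast hm
  have h1 := kf_sum q N (Real.log m) (log_natCast_nonneg m)
  rw [exp_neg, exp_log m0] at h1
  have h2 := mul_le_mul_of_nonneg_left (pw_high m N q hm) (show (0 : ℝ) ≤ m ^ (q + 1) by positivity)
  have e2 : (m : ℝ) ^ (q + 1) * (1 / (q + 1) * (1 / m ^ (q + 1))) = 1 / (q + 1) := by field_simp
  rw [e2] at h2
  have h3 : ∑ n ∈ Icc 1 N, (if m < n then (m : ℝ) ^ (q + 1) * (1 / (n : ℝ) ^ (q + 2)) else 0) ≤ (m : ℝ) ^ (q + 1) * ∑ n ∈ Ioc m N, 1 / (n : ℝ) ^ (q + 2) := by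
    rw [← sum_filter, mul_sum]
    refine sum_le_sum_of_subset_of_nonneg (fun n hn => ?_) fun _ _ _ => by positivity
    simp only [mem_filter, mem_Icc, mem_Ioc] at hn ⊢; omega
  refine le_trans (sum_le_sum fun n hn => ?_) ((sum_add_distrib (f := fun n : ℕ => 1 / (n : ℝ) * kf (q + 1) (Real.log n) (Real.log m))
    (g := fun n : ℕ => (if m < n then (m : ℝ) ^ (q + 1) * (1 / (n : ℝ) ^ (q + 2)) else 0))).le.trans ((add_le_add h1 (h3.trans h2)).trans (le_of_eq (by rw [inv_eq_one_div]; ring))))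
  have n0 : (0 : ℝ) < n := by exact_mod_cast (mem_Icc.mp hn).1
  by_cases h : m < n
  · have hl : Real.log m < Real.log n := Real.log_lt_log m0 (by exact_mod_cast h)
    rw [if_pos h, kf, if_neg (by linarith), mul_zero, zero_add, abs_of_pos (by linarith)]
    refine le_of_eq ?_
    rw [show -(((q : ℝ) + 1) * (Real.log n - Real.log m)) = ((q + 1 : ℕ) : ℝ) * Real.log m + -(((q + 1 : ℕ) : ℝ) * Real.log n) by push_cast; ring,
      exp_add, exp_neg, exp_nat_mul, exp_nat_mul, exp_log n0, exp_log m0, pow_succ (n : ℝ) (q + 1)]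
    field_simp
  · have hl : Real.log n ≤ Real.log m := log_le_log n0 (by exact_mod_cast not_lt.mp h)
    rw [if_neg h, kf, if_pos hl, abs_of_nonpos (by linarith), neg_sub, add_zero]
lemma sum_inv_sq (N : ℕ) : ∑ n ∈ Icc 1 N, 1 / (n : ℝ) ^ 2 ≤ 2 := by
  rcases Nat.eq_zero_or_pos N with h | h
  · subst h; simp
  have := pw_high 1 N 0 le_rfl
  rw [← Finset.add_sum_Ioc_eq_sum_Icc h]
  norm_num at this ⊢
  linarith
lemma fs_tail (q N : ℕ) (c : ℕ → ℂ) (hc : ∀ n, ‖c n‖ ≤ 1 / n) :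
    ∫ y, ‖Fs (Icc 1 N) c y‖ ^ 2 * (1 / (((q : ℝ) + 1) ^ 2 + y ^ 2)) ≤ Real.pi / (q + 1) * (2 / (q + 1) * ∑ n ∈ Icc 1 N, ‖c n‖ + 2) := by
  have hq : (0 : ℝ) < q + 1 := by positivity
  have pi0 := pi_pos
  have h := congrArg (fun z : ℂ => ‖z‖) (fs_form hq (Icc 1 N) c).2
  simp only [norm_real] at h
  refine (Real.le_norm_self _).trans ?_
  rw [h]
  refine (norm_sum_le _ _).trans ?_
  have k : ∀ m ∈ Icc 1 N, ‖∑ n ∈ Icc 1 N, c m * (starRingEnd ℂ) (c n) * ((Real.pi / (q + 1) * exp (-((q + 1) * |Real.log n - Real.log m|)) : ℝ) : ℂ)‖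
      ≤ Real.pi / (q + 1) * (2 / (q + 1) * ‖c m‖ + 1 / (m : ℝ) ^ 2) := fun m hm => by
    refine (norm_sum_le _ _).trans ?_
    have m1 := (mem_Icc.mp hm).1
    have m0 : (0 : ℝ) < m := by exact_mod_cast m1
    calc _ ≤ ∑ n ∈ Icc 1 N, ‖c m‖ * (Real.pi / (q + 1)) * (1 / (n : ℝ) * exp (-((q + 1) * |Real.log n - Real.log m|))) := by
          refine sum_le_sum fun n _ => ?_
          rw [norm_mul, norm_mul, RCLike.norm_conj, norm_real, norm_of_nonneg (by positivity)]
          have := mul_le_mul_of_nonneg_left (hc n) (show 0 ≤ ‖c m‖ * (Real.pi / (q + 1)) * exp (-((q + 1) * |Real.log n - Real.log m|)) by positivity)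
          linarith
      _ ≤ ‖c m‖ * (Real.pi / (q + 1)) * (2 / (q + 1) + 1 / m) := by
          rw [← mul_sum]
          exact mul_le_mul_of_nonneg_left (row_sum q N m m1) (by positivity)
      _ = Real.pi / (q + 1) * (2 / (q + 1) * ‖c m‖ + ‖c m‖ * (1 / m)) := by ring
      _ ≤ _ := by
          refine mul_le_mul_of_nonneg_left (add_le_add le_rfl ?_) (by positivity)
          refine (mul_le_mul_of_nonneg_right (hc m) (by positivity)).trans (le_of_eq (by field_simp))
  refine (sum_le_sum k).trans ?_
  rw [← mul_sum, sum_add_distrib, ← mul_sum]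
  have := sum_inv_sq N
  gcongr
end
section
open Filter Topology MeasureTheory
lemma ph_energy (q Q N : ℕ) (c : ℕ → ℂ) (hc : ∀ n, ‖c n‖ ≤ 1 / n) {B : ℝ} (hB0 : 0 ≤ B)
    (hB : ∀ y : ℝ, |y| ≤ Q + 1 → ‖Fs (Icc 1 N) c y‖ ^ 2 ≤ B) :
    ∫ u, ‖Ph (q + 1) (Icc 1 N) c u‖ ^ 2 ≤ B / 2 + (2 * (∑ n ∈ Icc 1 N, ‖c n‖) / (Q + 1) + 2) / (Q + 1) := by
  have hq : (0 : ℝ) < q + 1 := by positivity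
  have hQ : (0 : ℝ) < Q + 1 := by positivity
  have pi0 := pi_pos
  rw [planch hq]
  have h1 := (fs_form hq (Icc 1 N) c).1
  have h2 := (fs_form hQ (Icc 1 N) c).1
  have h3 : Integrable fun y : ℝ => (1 + y ^ 2)⁻¹ := integrable_inv_one_add_sq
  have key : ∫ y, ‖Fs (Icc 1 N) c y‖ ^ 2 * (1 / (((q : ℝ) + 1) ^ 2 + y ^ 2)) ≤
      ∫ y, (B * (1 + y ^ 2)⁻¹ + 2 * (‖Fs (Icc 1 N) c y‖ ^ 2 * (1 / (((Q : ℝ) + 1) ^ 2 + y ^ 2)))) := by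
    refine integral_mono h1 ((h3.const_mul B).add (h2.const_mul 2)) fun y => ?_
    dsimp only
    have n0 : 0 ≤ ‖Fs (Icc 1 N) c y‖ ^ 2 := by positivity
    by_cases hy : |y| ≤ Q + 1
    · have a1 : 0 ≤ 2 * (‖Fs (Icc 1 N) c y‖ ^ 2 * (1 / (((Q : ℝ) + 1) ^ 2 + y ^ 2))) := by positivity
      have a2 : ‖Fs (Icc 1 N) c y‖ ^ 2 * (1 / (((q : ℝ) + 1) ^ 2 + y ^ 2)) ≤ B * (1 + y ^ 2)⁻¹ := by
        refine mul_le_mul (hB y hy) ?_ (by positivity) hB0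
        rw [one_div]
        refine inv_anti₀ (by positivity) ?_
        have : (0 : ℝ) ≤ q := by positivity
        nlinarith
      linarith
    · push Not at hy
      have a1 : 0 ≤ B * (1 + y ^ 2)⁻¹ := by positivity
      have a3 : ((Q : ℝ) + 1) ^ 2 ≤ y ^ 2 := by rw [← sq_abs y]; exact pow_le_pow_left₀ hQ.le hy.le 2
      have a2 : 1 / (((q : ℝ) + 1) ^ 2 + y ^ 2) ≤ 2 * (1 / (((Q : ℝ) + 1) ^ 2 + y ^ 2)) := by
        rw [mul_one_div, div_le_div_iff₀ (by positivity) (by positivity)]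
        have : 0 ≤ ((q : ℝ) + 1) ^ 2 := by positivity
        linarith
      have := mul_le_mul_of_nonneg_left a2 n0
      linarith
  rw [integral_add (h3.const_mul B) (h2.const_mul 2), integral_const_mul, integral_const_mul, integral_univ_inv_one_add_sq] at key
  have ft := fs_tail Q N c hc
  have k2 := key.trans (add_le_add le_rfl (mul_le_mul_of_nonneg_left ft zero_le_two))
  refine (mul_le_mul_of_nonneg_left k2 (by positivity)).trans (le_of_eq ?_)
  field_simp
lemma ph_bound (q N : ℕ) (c : ℕ → ℂ) (hc : ∀ n, ‖c n‖ ≤ 1 / n) {u : ℝ} (hu : 0 ≤ u) :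
    ‖Ph (q + 1) (Icc 1 N) c u‖ ≤ 1 / (q + 1) + exp (-u) := by
  refine (norm_sum_le _ _).trans (le_trans (sum_le_sum fun n _ => ?_) (kf_sum q N u hu))
  have k0 : 0 ≤ kf (q + 1) (Real.log n) u := by unfold kf; split_ifs <;> positivity
  rw [norm_mul, norm_real, norm_of_nonneg k0]
  exact mul_le_mul_of_nonneg_right (hc n) k0
lemma ph_ii (q N : ℕ) (c : ℕ → ℂ) {a b : ℝ} (hab : a ≤ b) :
    IntervalIntegrable (Ph (q + 1) (Icc 1 N) c) volume a b := by
  have hq : (0 : ℝ) < q + 1 := by positivity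
  have e : Ph (q + 1) (Icc 1 N) c = ∑ n ∈ Icc 1 N, fun u => c n * ((kf (q + 1) (Real.log n) u : ℝ) : ℂ) := by
    ext u; simp [Ph]
  rw [e]
  exact IntervalIntegrable.sum _ fun n _ => (IntervalIntegrable.const_mul (by
      have h := (kf_window hq (Real.log n) a b hab).1
      exact ⟨h.1.ofReal, h.2.ofReal⟩) _)
lemma lowmain (q Q N I : ℕ) (c : ℕ → ℂ) (hc : ∀ n, ‖c n‖ ≤ 1 / n) {B s : ℝ} (hB0 : 0 ≤ B) (hs : 0 < s)
    (hB : ∀ y : ℝ, |y| ≤ Q + 1 → ‖Fs (Icc 1 N) c y‖ ^ 2 ≤ B) :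
    ∑ i ∈ range I, ‖∑ n ∈ (Icc 1 N).filter (fun n : ℕ => i * Real.log 2 < Real.log n ∧ Real.log n ≤ (i + 1 : ℕ) * Real.log 2), c n‖ ≤
      2 * I / (q + 1) + 4 + (q + 1) * (s * I + (1 / s) * (B / 2 + (2 * (∑ n ∈ Icc 1 N, ‖c n‖) / (Q + 1) + 2) / (Q + 1))) := by
  have hq : (0 : ℝ) < q + 1 := by positivity
  have l0 : 0 < Real.log 2 := log_pos (by norm_num)
  have l1 : Real.log 2 ≤ 1 := by have := log_two_lt_d9; linarith
  set P := Ph (q + 1) (Icc 1 N) c with hP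
  have mon : ∀ i : ℕ, (i : ℝ) * Real.log 2 ≤ (i + 1 : ℕ) * Real.log 2 := fun i => by gcongr; simp
  have e2 : ∀ i : ℕ, exp (-(i * Real.log 2)) = (1 / 2) ^ i := fun i => by
    rw [exp_neg, mul_comm, exp_mul, exp_log (by norm_num), rpow_natCast]; simp
  have h1 : ∀ i ∈ range I, ‖∑ n ∈ (Icc 1 N).filter (fun n : ℕ => i * Real.log 2 < Real.log n ∧ Real.log n ≤ (i + 1 : ℕ) * Real.log 2), c n‖
      ≤ (2 / (q + 1) + 2 * (1 / 2) ^ i) + (q + 1) * ∫ u in (i * Real.log 2)..((i + 1 : ℕ) * Real.log 2), ‖P u‖ := fun i _ => by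
    rw [ph_window hq (Icc 1 N) c _ _ (mon i)]
    have b1 := ph_bound q N c hc (u := i * Real.log 2) (by positivity)
    have b2 := ph_bound q N c hc (u := (i + 1 : ℕ) * Real.log 2) (by positivity)
    rw [e2] at b1 b2
    have b3 : ((1 : ℝ) / 2) ^ (i + 1) ≤ (1 / 2) ^ i := pow_le_pow_of_le_one (by norm_num) (by norm_num) (by omega)
    have b4 := intervalIntegral.norm_integral_le_integral_norm (μ := volume) (f := P) (mon i)
    refine (norm_add_le _ _).trans (add_le_add ((norm_sub_le _ _).trans ?_) ?_)
    · have : 2 / ((q : ℝ) + 1) = 1 / (q + 1) + 1 / (q + 1) := by ring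
      linarith
    · rw [norm_mul]
      have : ‖((((q : ℝ) + 1 : ℝ)) : ℂ)‖ = q + 1 := by rw [norm_real, norm_of_nonneg hq.le]
      rw [this]
      exact mul_le_mul_of_nonneg_left b4 hq.le
  refine (sum_le_sum h1).trans ?_
  rw [sum_add_distrib, sum_add_distrib, ← mul_sum, ← mul_sum, sum_const, card_range, nsmul_eq_mul]
  have g : ∑ i ∈ range I, (1 / 2 : ℝ) ^ i ≤ 2 := by
    have := (summable_geometric_two).sum_le_tsum (range I) fun i _ => by positivity
    rwa [tsum_geometric_two] at this
  have tel := intervalIntegral.sum_integral_adjacent_intervals (μ := volume) (f := fun u => ‖P u‖) (a := fun i : ℕ => (i : ℝ) * Real.log 2) (n := I)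
    fun k _ => (ph_ii q N c (mon k)).norm
  rw [tel]
  have I0 : (0 : ℝ) ≤ I * Real.log 2 := by positivity
  have pI := (ph_form hq (Icc 1 N) c).1
  have m : ∫ u in (((0 : ℕ) : ℝ) * Real.log 2)..(I * Real.log 2), ‖P u‖ ≤ ∫ u in (0 : ℝ)..(I * Real.log 2), (s + 1 / s * ‖P u‖ ^ 2) := by
    rw [cast_zero, zero_mul]
    refine intervalIntegral.integral_mono_on I0 (ph_ii q N c I0).norm
      (intervalIntegrable_const.add (pI.intervalIntegrable.const_mul _)) fun u _ => ?_
    have : 1 / s * ‖P u‖ ^ 2 = ‖P u‖ ^ 2 / s := by ring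
    rw [this, ← sub_nonneg]
    have : s + ‖P u‖ ^ 2 / s - ‖P u‖ = ((s - ‖P u‖) ^ 2 + s * ‖P u‖) / s := by field_simp; ring
    rw [this]; positivity
  rw [intervalIntegral.integral_add intervalIntegrable_const (pI.intervalIntegrable.const_mul _), intervalIntegral.integral_const,
    intervalIntegral.integral_const_mul, smul_eq_mul, sub_zero] at m
  have en : ∫ u in (0 : ℝ)..(I * Real.log 2), ‖P u‖ ^ 2 ≤ ∫ u, ‖P u‖ ^ 2 := by
    rw [intervalIntegral.integral_of_le I0]
    exact setIntegral_le_integral pI (ae_of_all _ fun u => by positivity)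
  have en2 := en.trans (ph_energy q Q N c hc hB0 hB)
  have m2 := m.trans (add_le_add (show I * Real.log 2 * s ≤ s * I by
    have := mul_le_mul_of_nonneg_left l1 (show 0 ≤ s * I by positivity); linarith) (mul_le_mul_of_nonneg_left en2 (show 0 ≤ 1 / s by positivity)))
  have m3 := mul_le_mul_of_nonneg_left m2 hq.le
  have : (I : ℝ) * (2 / (q + 1)) = 2 * I / (q + 1) := by ring
  linarith
end
section
def LB (f : ℕ → ℂ) : Prop := ∀ Y : ℝ, ∃ B : ℝ, 0 ≤ B ∧ ∀ s : ℂ, 1 < s.re → s.re ≤ 2 → |s.im| ≤ Y → ‖LSeries f s‖ ≤ B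
noncomputable def cd (f : ℕ → ℂ) (t : ℤ) (δ : ℝ) (n : ℕ) : ℂ := GG f t n * ((exp (-(δ * Real.log n)) : ℝ) : ℂ)
lemma GG_norm {f : ℕ → ℂ} (hb : ∀ n, ‖f n‖ ≤ 1) (t : ℤ) (n : ℕ) : ‖GG f t n‖ ≤ 1 / n := by
  unfold GG
  rw [norm_mul, ee_norm, mul_one, norm_div, Complex.norm_natCast]
  exact div_le_div_of_nonneg_right (hb n) (by positivity)
lemma cd_norm {f : ℕ → ℂ} (hb : ∀ n, ‖f n‖ ≤ 1) (t : ℤ) {δ : ℝ} (hδ : 0 < δ) (n : ℕ) :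
    ‖cd f t δ n‖ ≤ 1 / n * exp (-(δ * Real.log n)) ∧ ‖cd f t δ n‖ ≤ 1 / n := by
  have h1 : ‖cd f t δ n‖ ≤ 1 / n * exp (-(δ * Real.log n)) := by
    unfold cd
    rw [norm_mul, norm_real, norm_of_nonneg (exp_pos _).le]
    exact mul_le_mul_of_nonneg_right (GG_norm hb t n) (exp_pos _).le
  refine ⟨h1, h1.trans (mul_le_of_le_one_right (by positivity) (exp_le_one_iff.mpr ?_))⟩
  have := mul_nonneg hδ.le (log_natCast_nonneg n); linarith
lemma cd_sum {δ : ℝ} (hδ : 0 < δ) (N : ℕ) : ∑ n ∈ Icc 1 (N + 1), 1 / (n : ℝ) * exp (-(δ * Real.log n)) ≤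
    1 + 1 / δ * (1 - exp (-(δ * Real.log (N + 1 : ℕ)))) := by
  induction N with
  | zero => simp
  | succ N ih =>
    rw [sum_Icc_succ_top (by omega)]
    set E := exp (-(δ * Real.log (N + 1 + 1 : ℕ))) with hE
    have E0 : 0 < E := exp_pos _
    have h1 : E * (1 + δ * (1 / (N + 1 + 1 : ℕ))) ≤ exp (-(δ * Real.log (N + 1 : ℕ))) := by
      have : exp (-(δ * Real.log (N + 1 : ℕ))) = E * exp (δ * (Real.log (N + 1 + 1 : ℕ) - Real.log (N + 1 : ℕ))) := by
        rw [hE, ← exp_add]; congr 1; ring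
      rw [this]
      refine mul_le_mul_of_nonneg_left ?_ E0.le
      have a := add_one_le_exp (δ * (Real.log (N + 1 + 1 : ℕ) - Real.log (N + 1 : ℕ)))
      have b : 1 / ((N + 1 + 1 : ℕ) : ℝ) ≤ Real.log (N + 1 + 1 : ℕ) - Real.log (N + 1 : ℕ) := by
        have := log_le_sub_one_of_pos (show 0 < ((N + 1 : ℕ) : ℝ) / (N + 1 + 1 : ℕ) by positivity)
        rw [log_div (by positivity) (by positivity)] at this
        have e : ((N + 1 : ℕ) : ℝ) / (N + 1 + 1 : ℕ) - 1 = - (1 / ((N + 1 + 1 : ℕ) : ℝ)) := by push_cast; field_simp; ring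
        linarith
      have := mul_le_mul_of_nonneg_left b hδ.le
      linarith
    have h2 : 1 / ((N + 1 + 1 : ℕ) : ℝ) * E = 1 / δ * (E * (δ * (1 / (N + 1 + 1 : ℕ)))) := by field_simp
    have h3 : 1 / δ * (E * (δ * (1 / (N + 1 + 1 : ℕ)))) ≤ 1 / δ * (exp (-(δ * Real.log (N + 1 : ℕ))) - E) :=
      mul_le_mul_of_nonneg_left (by linarith) (by positivity)
    rw [h2]
    have : 1 / δ * (1 - E) = 1 / δ * (1 - exp (-(δ * Real.log (N + 1 : ℕ)))) + 1 / δ * (exp (-(δ * Real.log (N + 1 : ℕ))) - E) := by ring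
    rw [this]; linarith
lemma cd_term (f : ℕ → ℂ) (t : ℤ) (δ y : ℝ) (n : ℕ) (hn : n ≠ 0) :
    cd f t δ n * ee (-(y * Real.log n)) = LSeries.term f ((1 + δ : ℝ) + (t + y : ℝ) * Complex.I) n := by
  have n0 : (n : ℂ) ≠ 0 := by exact_mod_cast hn
  rw [LSeries.term_of_ne_zero hn, Complex.cpow_def_of_ne_zero n0, ← natCast_log]
  unfold cd GG ee
  have : Complex.exp (Real.log n * ((1 + δ : ℝ) + (t + y : ℝ) * Complex.I)) = n * Complex.exp (Real.log n * (δ + (t + y) * Complex.I)) := by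
    have e : (n : ℂ) = Complex.exp (Real.log n) := by rw [natCast_log, Complex.exp_log n0]
    rw [show (n : ℂ) * Complex.exp (Real.log n * (δ + (t + y) * Complex.I)) = Complex.exp (Real.log n) * Complex.exp (Real.log n * (δ + (t + y) * Complex.I)) by rw [← e], ← Complex.exp_add]; congr 1; push_cast; ring
  rw [this, div_eq_mul_inv, div_eq_mul_inv, mul_inv, ← Complex.exp_neg, ofReal_exp]
  rw [mul_assoc (f n * _), mul_assoc (f n * _), ← Complex.exp_add, ← Complex.exp_add, ← mul_assoc (f n)]
  congr 2; push_cast; ring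
lemma cd_fs {f : ℕ → ℂ} (hb : ∀ n, ‖f n‖ ≤ 1) {δ : ℝ} (hδ : 0 < δ) (M : ℕ) : ∃ N ≥ M, ∀ (t : ℤ) (y : ℝ),
    ‖Fs (Icc 1 N) (cd f t δ) y‖ ≤ ‖LSeries f ((1 + δ : ℝ) + (t + y : ℝ) * Complex.I)‖ + 1 := by
  have sg : Summable fun n : ℕ => 1 / (n : ℝ) ^ (1 + δ) := Real.summable_one_div_nat_rpow.mpr (by linarith)
  have tl := tendsto_sum_nat_add (fun n : ℕ => 1 / (n : ℝ) ^ (1 + δ))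
  obtain ⟨N, hN⟩ := (((tendsto_add_atTop_iff_nat 1).mpr tl).eventually (gt_mem_nhds one_pos) |>.and (eventually_ge_atTop M)).exists
  refine ⟨N, hN.2, fun t y => ?_⟩
  set s : ℂ := (1 + δ : ℝ) + (t + y : ℝ) * Complex.I with hs
  have sre : s.re = 1 + δ := by simp [hs]
  have tb : ∀ n : ℕ, ‖LSeries.term f s n‖ ≤ 1 / (n : ℝ) ^ (1 + δ) := fun n => by
    rw [LSeries.norm_term_eq, sre]; split_ifs
    · positivity
    · exact div_le_div_of_nonneg_right (hb n) (by positivity)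
  have sm : Summable (LSeries.term f s) := Summable.of_norm_bounded sg tb
  have e1 : Fs (Icc 1 N) (cd f t δ) y = ∑ n ∈ range (N + 1), LSeries.term f s n := by
    unfold Fs
    rw [Finset.range_eq_Ico, Finset.sum_eq_sum_Ico_succ_bot (by omega), LSeries.term_zero, zero_add]
    refine sum_congr (by ext; simp) fun n hn => ?_
    exact cd_term f t δ y n (by have := (mem_Ico.mp hn).1; omega)
  have e2 := sm.sum_add_tsum_nat_add (N + 1)
  have e3 : ‖∑' i, LSeries.term f s (i + (N + 1))‖ ≤ ∑' i : ℕ, 1 / ((i + (N + 1) : ℕ) : ℝ) ^ (1 + δ) :=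
    tsum_of_norm_bounded ((summable_nat_add_iff (N + 1)).mpr sg).hasSum fun i => tb _
  rw [e1, eq_sub_of_add_eq e2]
  exact (norm_sub_le _ _).trans (add_le_add le_rfl (e3.trans hN.1.le))
lemma dyad_filter (N i : ℕ) (h : 2 ^ (i + 1) ≤ N) : (Icc 1 N).filter (fun n : ℕ => i * Real.log 2 < Real.log n ∧ Real.log n ≤ (i + 1 : ℕ) * Real.log 2)
    = Ioc (2 ^ i) (2 ^ (i + 1)) := by
  ext n
  simp only [mem_filter, mem_Icc, mem_Ioc]
  have key : ∀ j : ℕ, (j : ℝ) * Real.log 2 = Real.log ((2 ^ j : ℕ) : ℝ) := fun j => by push_cast; rw [log_pow]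
  rw [key, key]
  constructor
  · rintro ⟨⟨h1, _⟩, h2, h3⟩
    have n0 : (0 : ℝ) < n := by exact_mod_cast h1
    rw [Real.log_lt_log_iff (by positivity) n0] at h2
    rw [Real.log_le_log_iff n0 (by positivity)] at h3
    exact ⟨by exact_mod_cast h2, by exact_mod_cast h3⟩
  · rintro ⟨h1, h2⟩
    have n1 : 1 ≤ n := by omega
    have n0 : (0 : ℝ) < n := by exact_mod_cast n1
    refine ⟨⟨n1, h2.trans h⟩, Real.log_lt_log (by positivity) (by exact_mod_cast h1), log_le_log n0 (by exact_mod_cast h2)⟩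
lemma DD_cd {f : ℕ → ℂ} (hb : ∀ n, ‖f n‖ ≤ 1) (t : ℤ) {δ : ℝ} (hδ : 0 < δ) (i : ℕ) (hi : δ * i ≤ 1) :
    ‖DD f (2 ^ i) (2 * 2 ^ i) t‖ ≤ 2 * ‖∑ n ∈ Ioc (2 ^ i) (2 ^ (i + 1)), cd f t δ n‖ + 2 * δ := by
  have l0 : 0 < Real.log 2 := log_pos (by norm_num)
  have l1 : Real.log 2 ≤ 1 := by have := log_two_lt_d9; linarith
  set w := exp (-(δ * (i * Real.log 2))) with hw
  have w0 : 1 / 2 ≤ w := by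
    have : exp (-Real.log 2) = 1 / 2 := by rw [exp_neg, exp_log (by norm_num)]; norm_num
    rw [← this, hw]
    refine exp_le_exp.mpr ?_
    have := mul_le_mul_of_nonneg_right hi l0.le
    linarith
  have w1 : w ≤ 1 := exp_le_one_iff.mpr (neg_nonpos.mpr (by positivity))
  have e1 : DD f (2 ^ i) (2 * 2 ^ i) t = ∑ n ∈ Ioc (2 ^ i) (2 ^ (i + 1)), GG f t n := by
    unfold DD
    have a : ⌊(2 : ℝ) ^ i⌋₊ = 2 ^ i := by exact_mod_cast floor_natCast (R := ℝ) (2 ^ i)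
    have b : ⌊2 * (2 : ℝ) ^ i⌋₊ = 2 ^ (i + 1) := by rw [pow_succ']; exact_mod_cast floor_natCast (R := ℝ) (2 * 2 ^ i)
    rw [a, b]
  have d : ‖(w : ℂ) * DD f (2 ^ i) (2 * 2 ^ i) t - ∑ n ∈ Ioc (2 ^ i) (2 ^ (i + 1)), cd f t δ n‖ ≤ δ := by
    rw [e1, mul_sum, ← sum_sub_distrib]
    have : ∀ n ∈ Ioc (2 ^ i) (2 ^ (i + 1)), ‖(w : ℂ) * GG f t n - cd f t δ n‖ ≤ δ * (1 / 2 ^ i) := fun n hn => by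
      obtain ⟨n1, n2⟩ := mem_Ioc.mp hn
      have r1 : (2 : ℝ) ^ i < n := by exact_mod_cast n1
      have r2 : (n : ℝ) ≤ 2 * 2 ^ i := by rw [← pow_succ']; exact_mod_cast n2
      have p0 : (0 : ℝ) < 2 ^ i := by positivity
      have n0 : (0 : ℝ) < n := p0.trans r1
      have e : (w : ℂ) * GG f t n - cd f t δ n = GG f t n * ((w - exp (-(δ * Real.log n)) : ℝ) : ℂ) := by
        unfold cd; push_cast; ring
      have L1 : i * Real.log 2 ≤ Real.log n := by rw [← log_pow]; exact log_le_log p0 r1.le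
      have L2 : Real.log n ≤ Real.log 2 + i * Real.log 2 := by
        rw [← log_pow, ← log_mul (by norm_num) p0.ne']; exact log_le_log n0 r2
      have b : |w - exp (-(δ * Real.log n))| ≤ δ := by
        have s : exp (-(δ * Real.log n)) = w * exp (-(δ * (Real.log n - i * Real.log 2))) := by
          rw [hw, ← exp_add]; congr 1; ring
        have g0 : 0 ≤ δ * (Real.log n - i * Real.log 2) := mul_nonneg hδ.le (by linarith)
        have g1 : δ * (Real.log n - i * Real.log 2) ≤ δ := by
          have := mul_le_mul_of_nonneg_left (show Real.log n - i * Real.log 2 ≤ 1 by linarith) hδ.le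
          linarith
        have g2 := add_one_le_exp (-(δ * (Real.log n - i * Real.log 2)))
        have g3 : exp (-(δ * (Real.log n - i * Real.log 2))) ≤ 1 := exp_le_one_iff.mpr (by linarith)
        rw [s, show w - w * exp (-(δ * (Real.log n - i * Real.log 2))) = w * (1 - exp (-(δ * (Real.log n - i * Real.log 2)))) by ring,
          abs_of_nonneg (mul_nonneg (by linarith) (by linarith))]
        have := mul_le_mul w1 (show 1 - exp (-(δ * (Real.log n - i * Real.log 2))) ≤ δ by linarith) (by linarith) zero_le_one
        linarith
      rw [e, norm_mul, norm_real, norm_eq_abs, mul_comm]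
      exact mul_le_mul b ((GG_norm hb t n).trans (one_div_le_one_div_of_le p0 r1.le)) (norm_nonneg _) hδ.le
    refine (norm_sum_le_of_le _ this).trans (le_of_eq ?_)
    rw [sum_const, card_Ioc, nsmul_eq_mul, pow_succ]
    have : 2 ^ i * 2 - 2 ^ i = 2 ^ i := by omega
    rw [this]; push_cast; field_simp
  have n1 : ‖(w : ℂ) * DD f (2 ^ i) (2 * 2 ^ i) t‖ = w * ‖DD f (2 ^ i) (2 * 2 ^ i) t‖ := by
    rw [norm_mul, norm_real, norm_of_nonneg (by linarith)]
  have n2 := norm_sub_norm_le ((w : ℂ) * DD f (2 ^ i) (2 * 2 ^ i) t) (∑ n ∈ Ioc (2 ^ i) (2 ^ (i + 1)), cd f t δ n)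
  have n3 := mul_le_mul_of_nonneg_right w0 (norm_nonneg (DD f (2 ^ i) (2 * 2 ^ i) t))
  rw [n1] at n2
  linarith
theorem low_avg {f : ℕ → ℂ} (hb : ∀ n, ‖f n‖ ≤ 1) (hL : LB f) (t : ℤ) {ε : ℝ} (hε : 0 < ε) :
    ∃ I0 : ℕ, ∀ I ≥ I0, ∑ i ∈ range I, ‖DD f (2 ^ i) (2 * 2 ^ i) t‖ ≤ ε * I := by
  obtain ⟨q, hq⟩ := exists_nat_gt (32 / ε)
  have q0 : (0 : ℝ) < q + 1 := by positivity
  set s := ε / (16 * (q + 1)) with hs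
  have s0 : 0 < s := by positivity
  obtain ⟨Q, hQ⟩ := exists_nat_gt (64 * (q + 1) / (s * ε))
  have Q0 : (0 : ℝ) < Q + 1 := by positivity
  obtain ⟨B0, B00, hB0⟩ := hL (|(t : ℝ)| + (Q + 1))
  set K := 2 * (4 + (q + 1) * (1 / s * ((B0 + 1) ^ 2 / 2 + 2))) + 2 with hK
  obtain ⟨I0, hI0⟩ := exists_nat_gt (8 * K / ε)
  refine ⟨max I0 1, fun I hI => ?_⟩
  have I1 : 1 ≤ I := (le_max_right _ _).trans hI
  have Ir : (1 : ℝ) ≤ I := by exact_mod_cast I1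
  have Ik : 8 * K / ε ≤ I := hI0.le.trans (by exact_mod_cast (le_max_left _ _).trans hI)
  rw [div_le_iff₀ hε] at Ik
  have d0 : (0 : ℝ) < 1 / I := by positivity
  have d1 : (1 : ℝ) / I ≤ 1 := by rw [div_le_one (by positivity)]; exact Ir
  obtain ⟨N, hN, hF⟩ := cd_fs hb d0 (2 ^ I + 1)
  have lm := lowmain q Q N I (cd f t (1 / I)) (fun n => (cd_norm hb t d0 n).2) (B := (B0 + 1) ^ 2) (s := s) (by positivity) s0 (fun y hy => by
    have h1 := hF t y
    have h2 := hB0 ((1 + 1 / I : ℝ) + (t + y : ℝ) * Complex.I) (by simp; linarith) (by simp; rw [one_div] at d1; linarith)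
      (by simp; refine (abs_add_le _ _).trans ?_; linarith)
    exact pow_le_pow_left₀ (norm_nonneg _) (by linarith) 2)
  have cs : ∑ n ∈ Icc 1 N, ‖cd f t (1 / I) n‖ ≤ 2 * I := by
    obtain ⟨N', rfl⟩ : ∃ N', N = N' + 1 := ⟨N - 1, by have := one_le_two_pow (n := I); omega⟩
    refine (sum_le_sum fun n _ => (cd_norm hb t d0 n).1).trans ((cd_sum d0 N').trans ?_)
    have : 1 / ((1 : ℝ) / I) = I := by simp
    rw [this]
    have : 0 ≤ (I : ℝ) * exp (-((1 / I : ℝ) * Real.log (N' + 1 : ℕ))) := by positivity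
    linarith
  have s1 : ∑ i ∈ range I, ‖DD f (2 ^ i) (2 * 2 ^ i) t‖ ≤ ∑ i ∈ range I, (2 * ‖∑ n ∈ (Icc 1 N).filter (fun n : ℕ => i * Real.log 2 < Real.log n ∧ Real.log n ≤ (i + 1 : ℕ) * Real.log 2), cd f t (1 / I) n‖ + 2 * (1 / I)) := by
    refine sum_le_sum fun i hi => ?_
    have iI := mem_range.mp hi
    rw [dyad_filter N i ((pow_le_pow_right (by norm_num) iI).trans (by omega))]
    refine DD_cd hb t d0 i ?_
    rw [one_div, inv_mul_le_iff₀ (by positivity), mul_one]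
    exact_mod_cast iI.le
  rw [sum_add_distrib, ← mul_sum, sum_const, card_range, nsmul_eq_mul, show (I : ℝ) * (2 * (1 / I)) = 2 by field_simp] at s1
  have t1 : 2 * (2 * (I : ℝ) / (q + 1)) ≤ ε / 8 * I := by
    rw [div_lt_iff₀ hε] at hq
    rw [← mul_div_assoc, div_le_iff₀ q0]
    have := mul_le_mul_of_nonneg_right (show 32 ≤ ε * (q + 1) by nlinarith) (show (0 : ℝ) ≤ I by positivity)
    linarith
  have t2 : 2 * (((q : ℝ) + 1) * (s * I)) = ε / 8 * I := by rw [hs]; field_simp; norm_num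
  have t3 : (2 * (∑ n ∈ Icc 1 N, ‖cd f t (1 / I) n‖) / ((Q : ℝ) + 1) + 2) / (Q + 1) ≤ 4 * I / (Q + 1) + 2 := by
    have Q1 : (1 : ℝ) ≤ Q + 1 := by have : (0 : ℝ) ≤ Q := by positivity
                                    linarith
    have x0 : (0 : ℝ) ≤ 4 * I / (Q + 1) + 2 := by positivity
    refine le_trans ?_ (div_le_self x0 Q1)
    refine div_le_div_of_nonneg_right ?_ Q0.le
    have := div_le_div_of_nonneg_right (show 2 * (∑ n ∈ Icc 1 N, ‖cd f t (1 / I) n‖) ≤ 4 * I by linarith) Q0.le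
    linarith
  have t4 : 2 * (((q : ℝ) + 1) * (1 / s * (4 * I / (Q + 1)))) ≤ ε / 8 * I := by
    rw [div_lt_iff₀ (by positivity)] at hQ
    have : 2 * (((q : ℝ) + 1) * (1 / s * (4 * I / (Q + 1)))) = (8 * (q + 1) * I) / (s * (Q + 1)) := by field_simp; norm_num
    rw [this, div_le_iff₀ (by positivity)]
    have sε : 0 < s * ε := by positivity
    have := mul_le_mul_of_nonneg_right (show 64 * ((q : ℝ) + 1) ≤ (Q + 1) * (s * ε) by linarith) (show (0 : ℝ) ≤ I by positivity)
    linarith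
  have t5 := mul_le_mul_of_nonneg_left (mul_le_mul_of_nonneg_left (add_le_add (le_refl ((B0 + 1) ^ 2 / 2)) t3) (show 0 ≤ 1 / s by positivity)) q0.le
  have t6 : (q + 1) * (1 / s * ((B0 + 1) ^ 2 / 2 + (4 * I / (Q + 1) + 2))) = (q + 1) * (1 / s * ((B0 + 1) ^ 2 / 2 + 2)) + ((q : ℝ) + 1) * (1 / s * (4 * I / (Q + 1))) := by ring
  have eI : 0 ≤ ε * I := by positivity
  rw [mul_add] at lm
  linarith
end
section
noncomputable def lc {q : ℕ} (χ : DirichletCharacter ℂ q) (n : ℕ) : ℂ := (ArithmeticFunction.liouville n : ℂ) * χ n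
lemma lc_mul {q : ℕ} (χ : DirichletCharacter ℂ q) (m n : ℕ) : lc χ (m * n) = lc χ m * lc χ n := by
  simp only [lc, ArithmeticFunction.liouville_apply_mul, cast_mul, map_mul, Int.cast_mul]; ring
lemma lc_one {q : ℕ} (χ : DirichletCharacter ℂ q) : lc χ 1 = 1 := by
  simp [lc, ArithmeticFunction.liouville_apply_one]
lemma lam_abs (n : ℕ) : ‖(ArithmeticFunction.liouville n : ℂ)‖ ≤ 1 := by
  rcases eq_or_ne n 0 with rfl | hn
  · simp
  · rw [ArithmeticFunction.liouville_apply hn]; simp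
lemma lc_norm {q : ℕ} (χ : DirichletCharacter ℂ q) (n : ℕ) : ‖lc χ n‖ ≤ 1 := by
  unfold lc; rw [norm_mul]
  exact mul_le_one₀ (lam_abs n) (norm_nonneg _) (χ.norm_le_one _)
lemma lc_prime {q : ℕ} (χ : DirichletCharacter ℂ q) {p : ℕ} (hp : p.Prime) : lc χ p = - χ p := by
  unfold lc
  rw [ArithmeticFunction.liouville_apply hp.ne_zero, ArithmeticFunction.cardFactors_apply_prime hp]; simp
lemma lc_root {q : ℕ} [NeZero q] (χ : DirichletCharacter ℂ q) (p : ℕ) (hp : p.Prime) : lc χ p = 0 ∨ lc χ p ^ (2 * q.totient) = 1 := by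
  rw [lc_prime χ hp]
  by_cases h : IsUnit (p : ZMod q)
  · right
    obtain ⟨u, hu⟩ := h
    rw [pow_mul, neg_sq, ← pow_mul, mul_comm, pow_mul, ← hu, ← map_pow, ← Units.val_pow_eq_pow_val, ZMod.pow_totient]
    simp
  · left; rw [χ.map_nonunit h, neg_zero]
lemma lc_lseries {q : ℕ} (χ : DirichletCharacter ℂ q) {s : ℂ} (hs : 1 < s.re) :
    LSeries (lc χ) s * LSeries (fun n => χ n) s = LSeries (fun n => (χ ^ 2) n) (2 * s) := by
  have s0 : s ≠ 0 := by rintro rfl; simp at hs; linarith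
  have hs2 : 1 < (2 * s).re := by simp; linarith
  have h1 := DirichletCharacter.LSeries_eulerProduct_hasProd χ hs
  have h2 := DirichletCharacter.LSeries_eulerProduct_hasProd (χ ^ 2) hs2
  let g : ℕ →*₀ ℂ :=
    { toFun := fun n => lc χ n * (n : ℂ) ^ (-s)
      map_zero' := by simp [lc]
      map_one' := by simp [lc_one]
      map_mul' := fun m n => by
        rw [lc_mul, cast_mul, Complex.natCast_mul_natCast_cpow]; ring }
  have hterm : ∀ n, g n = LSeries.term (lc χ) s n := fun n => by
    change lc χ n * (n : ℂ) ^ (-s) = _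
    rw [LSeries.term_of_ne_zero' s0, Complex.cpow_neg, div_eq_mul_inv]
  have hsum : Summable (‖g ·‖) := by
    simp_rw [hterm]
    refine (Real.summable_one_div_nat_rpow.mpr hs).of_nonneg_of_le (fun _ => norm_nonneg _) fun n => ?_
    rw [LSeries.norm_term_eq]; split_ifs
    · positivity
    · exact div_le_div_of_nonneg_right (lc_norm χ n) (by positivity)
  have h3 := EulerProduct.eulerProduct_completely_multiplicative_hasProd hsum
  simp_rw [hterm] at h3
  change HasProd _ (LSeries (lc χ) s) at h3
  refine (h3.mul h1).unique ?_
  convert h2 using 2 with p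
  rw [← hterm]
  change (1 - lc χ p * (p : ℂ) ^ (-s))⁻¹ * _ = _
  rw [lc_prime χ p.2, ← mul_inv]
  congr 1
  have : ((p : ℕ) : ℂ) ^ (-(2 * s)) = ((p : ℕ) : ℂ) ^ (-s) * ((p : ℕ) : ℂ) ^ (-s) := by
    rw [← Complex.cpow_add _ _ (by exact_mod_cast p.2.ne_zero)]; congr 1; ring
  rw [this, MulChar.pow_apply' _ (by norm_num)]; ring
lemma lfun_low {q : ℕ} [NeZero q] (χ : DirichletCharacter ℂ q) (Y : ℝ) : ∃ c > 0, ∀ s : ℂ, 1 < s.re → s.re ≤ 2 → |s.im| ≤ Y →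
    c ≤ ‖LSeries (fun n => χ n) s‖ := by
  have key : ∃ g : ℂ → ℂ, Continuous g ∧ (∀ s : ℂ, 1 ≤ s.re → g s ≠ 0) ∧ ∃ M > 0, ∀ s : ℂ, 1 < s.re → s.re ≤ 2 → |s.im| ≤ Y →
      ‖g s‖ ≤ M * ‖LSeries (fun n => χ n) s‖ := by
    by_cases h : χ = 1
    · subst h
      refine ⟨DirichletCharacter.LFunctionTrivChar₁ q, (DirichletCharacter.differentiable_LFunctionTrivChar₁ q).continuous, fun s hs => ?_, |Y| + 3, by positivity, fun s h1 h2 h3 => ?_⟩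
      · rcases eq_or_ne s 1 with rfl | h1
        · exact DirichletCharacter.LFunctionTrivChar₁_apply_one_ne_zero q
        · rw [DirichletCharacter.LFunctionTrivChar₁, Function.update_of_ne h1]
          exact mul_ne_zero (sub_ne_zero.mpr h1) (DirichletCharacter.LFunction_ne_zero_of_one_le_re _ (.inr h1) hs)
      · have : s ≠ 1 := by rintro rfl; simp at h1
        rw [DirichletCharacter.LFunctionTrivChar₁, Function.update_of_ne this, norm_mul, DirichletCharacter.LFunctionTrivChar,
          DirichletCharacter.LFunction_eq_LSeries _ h1]
        refine mul_le_mul_of_nonneg_right ?_ (norm_nonneg _)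
        refine (Complex.norm_le_abs_re_add_abs_im _).trans ?_
        simp only [sub_re, one_re, sub_im, one_im, sub_zero]
        rw [abs_of_nonneg (by linarith)]
        have := le_abs_self Y
        linarith
    · exact ⟨DirichletCharacter.LFunction χ, (DirichletCharacter.differentiable_LFunction h).continuous,
        fun s hs => DirichletCharacter.LFunction_ne_zero_of_one_le_re _ (.inl h) hs, 1, one_pos, fun s h1 _ _ => by
          rw [DirichletCharacter.LFunction_eq_LSeries _ h1, one_mul]⟩
  obtain ⟨g, gc, g0, M, M0, hM⟩ := key
  have K : IsCompact ((Set.Icc (1 : ℝ) 2) ×ℂ (Set.Icc (-Y) Y)) := isCompact_Icc.reProdIm isCompact_Icc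
  rcases Set.eq_empty_or_nonempty ((Set.Icc (1 : ℝ) 2) ×ℂ (Set.Icc (-Y) Y)) with e | ne
  · refine ⟨1, one_pos, fun s h1 h2 h3 => ?_⟩
    have : s ∈ (Set.Icc (1 : ℝ) 2) ×ℂ (Set.Icc (-Y) Y) := mem_reProdIm.mpr ⟨⟨h1.le, h2⟩, abs_le.mp h3⟩
    rw [e] at this; exact this.elim
  obtain ⟨z, hz, zmin⟩ := K.exists_isMinOn ne (gc.norm.continuousOn)
  refine ⟨‖g z‖ / M, div_pos (norm_pos_iff.mpr (g0 z (mem_reProdIm.mp hz).1.1)) M0, fun s h1 h2 h3 => ?_⟩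
  rw [div_le_iff₀ M0, mul_comm]
  exact (zmin (mem_reProdIm.mpr ⟨⟨h1.le, h2⟩, abs_le.mp h3⟩)).trans (hM s h1 h2 h3)
theorem lc_LB {q : ℕ} [NeZero q] (χ : DirichletCharacter ℂ q) : LB (lc χ) := fun Y => by
  obtain ⟨c, c0, hc⟩ := lfun_low χ Y
  set Z := ∑' n : ℕ, 1 / (n : ℝ) ^ (2 : ℝ) with hZ
  have sz : Summable fun n : ℕ => 1 / (n : ℝ) ^ (2 : ℝ) := Real.summable_one_div_nat_rpow.mpr (by norm_num)
  have Z0 : 0 ≤ Z := tsum_nonneg fun n => by positivity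
  refine ⟨Z / c, by positivity, fun s h1 h2 h3 => ?_⟩
  have e := congrArg norm (lc_lseries χ h1)
  rw [norm_mul] at e
  have up : ‖LSeries (fun n => (χ ^ 2) n) (2 * s)‖ ≤ Z := by
    refine tsum_of_norm_bounded sz.hasSum fun n => ?_
    rw [LSeries.norm_term_eq]; split_ifs with h
    · positivity
    · have n1 : (1 : ℝ) ≤ n := by exact_mod_cast one_le_iff_ne_zero.mpr h
      refine div_le_div₀ zero_le_one (DirichletCharacter.norm_le_one _ _) (by positivity) (rpow_le_rpow_of_exponent_le n1 ?_)
      simp; linarith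
  rw [le_div_iff₀ c0]
  exact (mul_le_mul_of_nonneg_left (hc s h1 h2 h3) (norm_nonneg _)).trans (e.le.trans up)
end
section
lemma ee_orth {J : ℕ} (hJ : 1 ≤ J) {m : ℤ} (hm : m ≠ 0) (hmJ : |m| < J) (w : ℝ) :
    ∑ j ∈ range J, ee (m * (w + 2 * Real.pi * j / J)) = 0 := by
  have J0 : (J : ℝ) ≠ 0 := by positivity
  have pi0 := pi_pos
  have e : ∀ j : ℕ, ee (m * (w + 2 * Real.pi * j / J)) = ee (m * w) * ee (2 * Real.pi * m / J) ^ j := fun j => by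
    rw [← ee_nat_mul, ← ee_add]; congr 1; ring
  simp_rw [e]
  rw [← mul_sum]
  have z1 : ee (2 * Real.pi * m / J) ≠ 1 := by
    intro h
    obtain ⟨k, hk⟩ := exp_eq_one_iff.mp h
    have : ((2 * Real.pi * m / J : ℝ) : ℂ) = ((k * (2 * Real.pi) : ℝ) : ℂ) := by
      have := mul_right_cancel₀ Complex.I_ne_zero (hk.trans (by push_cast; ring : _ = ((k * (2 * Real.pi) : ℝ) : ℂ) * Complex.I))
      exact this
    have r : 2 * Real.pi * m / J = k * (2 * Real.pi) := by exact_mod_cast this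
    rw [div_eq_iff J0] at r
    have r2 : (m : ℝ) = k * J := by
      have : 2 * Real.pi * m = 2 * Real.pi * (k * J) := by linarith
      exact mul_left_cancel₀ (by positivity) this
    have r3 : m = k * J := by exact_mod_cast r2
    have : (J : ℤ) ∣ m := ⟨k, by rw [r3]; ring⟩
    exact hm (Int.eq_zero_of_abs_lt_dvd this hmJ)
  have zJ : ee (2 * Real.pi * m / J) ^ J = 1 := by
    rw [← ee_nat_mul]
    refine exp_eq_one_iff.mpr ⟨m, ?_⟩
    have : (J : ℝ) * (2 * Real.pi * m / J) = m * (2 * Real.pi) := by field_simp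
    rw [this]; push_cast; ring
  have g := mul_geom_sum (ee (2 * Real.pi * m / J)) J
  rw [zJ, sub_self] at g
  rw [(mul_eq_zero.mp g).resolve_left (sub_ne_zero.mpr z1), mul_zero]
noncomputable def Dk (T : ℕ) (x : ℝ) : ℂ := ∑ a ∈ range T, ee (a * x)
lemma Dk_sq (T : ℕ) (x : ℝ) : ((‖Dk T x‖ ^ 2 : ℝ) : ℂ) = ∑ a ∈ range T, ∑ b ∈ range T, ee (((a : ℤ) - b : ℤ) * x) := by
  unfold Dk
  rw [normsq_sum]
  refine sum_congr rfl fun a _ => sum_congr rfl fun b _ => ?_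
  rw [ee_conj, ← ee_add]; congr 1; push_cast; ring
lemma Dk_mass {J K : ℕ} (hJ : 1 ≤ J) (hK : K ≤ J) (w : ℝ) : ∑ j ∈ range J, ‖Dk K (w + 2 * Real.pi * j / J)‖ ^ 2 = J * K := by
  have : ((∑ j ∈ range J, ‖Dk K (w + 2 * Real.pi * j / J)‖ ^ 2 : ℝ) : ℂ) = ((J * K : ℝ) : ℂ) := by
    rw [ofReal_sum]
    simp_rw [Dk_sq]
    rw [sum_comm]
    have : ∀ a ∈ range K, ∑ j ∈ range J, ∑ b ∈ range K, ee (((a : ℤ) - b : ℤ) * (w + 2 * Real.pi * j / J)) = J := fun a ha => by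
      rw [sum_comm, sum_eq_single a]
      · simp [ee_zero]
      · intro b hb hba
        have := mem_range.mp ha
        have := mem_range.mp hb
        exact ee_orth hJ (by omega) (by rw [abs_lt]; omega) w
      · exact fun h => (h ha).elim
    rw [sum_congr rfl this]; simp; ring
  exact_mod_cast this
lemma grid_bessel {J T : ℕ} (hJ : 1 ≤ J) (hT : 2 * T ≤ J) (Ψ : ℕ → ℂ) (w : ℝ) (hΨ : ∀ j, ‖Ψ j‖ ≤ 1) :
    ∑ t ∈ Ioo (-(T : ℤ)) T, ‖∑ j ∈ range J, Ψ j * ee (t * (w + 2 * Real.pi * j / J))‖ ^ 2 ≤ J * J := by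
  have J0 : (J : ℝ) ≠ 0 := by positivity
  have h1 : ∑ t ∈ range J, ‖∑ j ∈ range J, Ψ j * ee (((t : ℤ) - T : ℤ) * (w + 2 * Real.pi * j / J))‖ ^ 2 ≤ J * J := by
    have e : ((∑ t ∈ range J, ‖∑ j ∈ range J, Ψ j * ee (((t : ℤ) - T : ℤ) * (w + 2 * Real.pi * j / J))‖ ^ 2 : ℝ) : ℂ)
        = ((J * ∑ j ∈ range J, ‖Ψ j‖ ^ 2 : ℝ) : ℂ) := by
      rw [ofReal_sum, ofReal_mul, ofReal_sum]
      simp_rw [normsq_sum]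
      rw [sum_comm, mul_sum]
      refine sum_congr rfl fun j hj => ?_
      rw [sum_comm, sum_eq_single j]
      · have : ∀ t ∈ range J, Ψ j * ee (((t : ℤ) - T : ℤ) * (w + 2 * Real.pi * j / J)) * (starRingEnd ℂ) (Ψ j * ee (((t : ℤ) - T : ℤ) * (w + 2 * Real.pi * j / J))) = (‖Ψ j‖ : ℂ) ^ 2 := fun t _ => by
          rw [mul_conj', norm_mul, ee_norm, mul_one]
        rw [sum_congr rfl this]; simp
      · intro k hk hkj
        have hj' := mem_range.mp hj
        have hk' := mem_range.mp hk
        have o := ee_orth hJ (m := (j : ℤ) - k) (by omega) (by rw [abs_lt]; omega) 0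
        have : ∀ t ∈ range J, Ψ j * ee (((t : ℤ) - T : ℤ) * (w + 2 * Real.pi * j / J)) * (starRingEnd ℂ) (Ψ k * ee (((t : ℤ) - T : ℤ) * (w + 2 * Real.pi * k / J)))
            = Ψ j * (starRingEnd ℂ) (Ψ k) * ee (-(T * (2 * Real.pi * (j - k) / J))) * ee (((j : ℤ) - k : ℤ) * (0 + 2 * Real.pi * t / J)) := fun t _ => by
          rw [map_mul, ee_conj, mul_assoc (Ψ j * _), ← ee_add]
          have : ee (((t : ℤ) - T : ℤ) * (w + 2 * Real.pi * j / J)) * ee (-(((t : ℤ) - T : ℤ) * (w + 2 * Real.pi * k / J))) =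
              ee (-(T * (2 * Real.pi * (j - k) / J)) + ((j : ℤ) - k : ℤ) * (0 + 2 * Real.pi * t / J)) := by
            rw [← ee_add]; congr 1; push_cast; field_simp; ring
          rw [← this]; ring
        rw [sum_congr rfl this, ← mul_sum, o, mul_zero]
      · exact fun h => (h hj).elim
    have e' : _ = _ := Complex.ofReal_injective e
    rw [e']
    refine mul_le_mul_of_nonneg_left ?_ (by positivity)
    refine (sum_le_sum fun j _ => pow_le_one₀ (norm_nonneg _) (hΨ j)).trans ?_
    simp
  refine le_trans ?_ h1
  rw [← sum_image (f := fun t : ℤ => ‖∑ j ∈ range J, Ψ j * ee (t * (w + 2 * Real.pi * j / J))‖ ^ 2) (g := fun t : ℕ => (t : ℤ) - T)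
    (fun a _ b _ h => by simpa using h)]
  refine sum_le_sum_of_subset_of_nonneg (fun t ht => ?_) fun _ _ _ => by positivity
  have := mem_Ioo.mp ht
  exact mem_image.mpr ⟨(t + T).toNat, mem_range.mpr (by omega), by omega⟩
lemma Dk_mul (K : ℕ) (x : ℝ) : (ee x - 1) * Dk K x = ee (K * x) - 1 := by
  unfold Dk; simp_rw [ee_nat_mul]; exact mul_geom_sum _ _
lemma ee_sq (y : ℝ) : ‖ee y - 1‖ ^ 2 = 2 - 2 * (ee y).re := by
  have h1 : ‖ee y‖ ^ 2 = 1 := by rw [ee_norm]; norm_num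
  rw [← normSq_eq_norm_sq, normSq_apply] at *
  simp only [sub_re, one_re, sub_im, one_im, sub_zero]
  linarith
lemma Dk_tail (T : ℕ) {M : ℕ} (hM : 1 ≤ M) {x : ℝ} (h1 : |x| ≤ Real.pi) (h2 : 2 * Real.pi / M ≤ |x|) :
    ‖Dk T x‖ ^ 2 ≤ 4 / M * ∑ K ∈ range M, ‖Dk K x‖ ^ 2 := by
  have M0 : (0 : ℝ) < M := by exact_mod_cast hM
  have pi0 := pi_pos
  have x0 : 0 < |x| := lt_of_lt_of_le (by positivity) h2
  have z0 : 0 < ‖ee x - 1‖ := lt_of_lt_of_le (by positivity) (ee_sub_one_ge x h1)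
  have key : (M : ℝ) ≤ ∑ K ∈ range M, ‖ee (K * x) - 1‖ ^ 2 := by
    simp_rw [ee_sq]
    rw [sum_sub_distrib, ← mul_sum, ← re_sum, sum_const, card_range, nsmul_eq_mul]
    have g := (re_le_norm _).trans (geom_le' M x (abs_pos.mp x0) h1)
    have : Real.pi / |x| ≤ M / 2 := by
      rw [div_le_iff₀ M0] at h2
      rw [div_le_iff₀ x0]; linarith
    linarith
  have e : ∀ K : ℕ, ‖ee x - 1‖ ^ 2 * ‖Dk K x‖ ^ 2 = ‖ee (K * x) - 1‖ ^ 2 := fun K => by rw [← mul_pow, ← norm_mul, Dk_mul]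
  have l4 : ‖ee (T * x) - 1‖ ^ 2 ≤ 4 := by
    have := norm_sub_le (ee (T * x)) 1
    rw [ee_norm, norm_one] at this
    have := pow_le_pow_left₀ (norm_nonneg _) this 2
    norm_num at this ⊢; linarith
  have z2 : 0 < ‖ee x - 1‖ ^ 2 := by positivity
  refine le_of_mul_le_mul_left ?_ z2
  rw [e, mul_left_comm, mul_sum]
  simp_rw [e]
  rw [div_mul_eq_mul_div, le_div_iff₀ M0]
  exact mul_le_mul l4 key M0.le (by norm_num)
lemma Dk_per (K : ℕ) (x : ℝ) : Dk K (x + 2 * Real.pi) = Dk K x := by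
  unfold Dk
  refine sum_congr rfl fun a _ => ?_
  rw [mul_add, ee_add]
  have : ee (a * (2 * Real.pi)) = 1 := exp_eq_one_iff.mpr ⟨a, by push_cast; ring⟩
  rw [this, mul_one]
lemma fejer_approx {J T M : ℕ} (hJ : 1 ≤ J) (hT : 1 ≤ T) (hTJ : T ≤ J) (hM : 3 ≤ M) (hMJ : M ≤ J) (Ψ : ℕ → ℂ) (hΨ : ∀ j, ‖Ψ j‖ ≤ 1) (w v : ℝ)
    (hv0 : w + Real.pi ≤ v) (hv1 : v ≤ w + Real.pi + 1) {z : ℂ} (hz : ‖z‖ ≤ 1) {η : ℝ} (hη : 0 ≤ η)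
    (hn : ∀ j ∈ range J, |w + 2 * Real.pi * j / J - v| ≤ 2 * Real.pi / M → ‖z - Ψ j‖ ≤ η) :
    ‖J * T * z - ∑ j ∈ range J, Ψ j * ((‖Dk T (w - v + 2 * Real.pi * j / J)‖ ^ 2 : ℝ) : ℂ)‖ ≤ J * T * (η + 8 * M / T) := by
  have J0 : (0 : ℝ) < J := by exact_mod_cast hJ
  have M0 : (0 : ℝ) < M := by exact_mod_cast (by omega : 0 < M)
  have T0 : (0 : ℝ) < T := by exact_mod_cast hT
  have pi0 := pi_pos
  have pi3 := pi_gt_three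
  have m1 := Dk_mass hJ hTJ (w - v)
  have e1 : (J * T * z : ℂ) = ∑ j ∈ range J, z * ((‖Dk T (w - v + 2 * Real.pi * j / J)‖ ^ 2 : ℝ) : ℂ) := by
    rw [← mul_sum, ← ofReal_sum, m1]; push_cast; ring
  rw [e1, ← sum_sub_distrib]
  have b : ∀ j ∈ range J, ‖z * ((‖Dk T (w - v + 2 * Real.pi * j / J)‖ ^ 2 : ℝ) : ℂ) - Ψ j * ((‖Dk T (w - v + 2 * Real.pi * j / J)‖ ^ 2 : ℝ) : ℂ)‖
      ≤ η * ‖Dk T (w - v + 2 * Real.pi * j / J)‖ ^ 2 + 8 / M * ∑ K ∈ range M, ‖Dk K (w - v + 2 * Real.pi * j / J)‖ ^ 2 := fun j hj => by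
    rw [← sub_mul, norm_mul, norm_real, norm_of_nonneg (by positivity)]
    set x := w - v + 2 * Real.pi * j / J with hx
    have d0 : 0 ≤ ‖Dk T x‖ ^ 2 := by positivity
    have s0 : 0 ≤ ∑ K ∈ range M, ‖Dk K x‖ ^ 2 := sum_nonneg fun _ _ => by positivity
    by_cases h : |x| ≤ 2 * Real.pi / M
    · have := hn j hj (by rwa [show w + 2 * Real.pi * j / J - v = x by rw [hx]; ring])
      have h2 := mul_le_mul_of_nonneg_right this d0
      have : 0 ≤ 8 / M * ∑ K ∈ range M, ‖Dk K x‖ ^ 2 := by positivity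
      linarith
    · push Not at h
      have t : ‖Dk T x‖ ^ 2 ≤ 4 / M * ∑ K ∈ range M, ‖Dk K x‖ ^ 2 := by
        have j1 : 2 * Real.pi * j / J ≤ 2 * Real.pi := by
          rw [div_le_iff₀ J0]
          exact mul_le_mul_of_nonneg_left (by exact_mod_cast (mem_range.mp hj).le) (by positivity)
        have j2 : 0 ≤ 2 * Real.pi * j / J := by positivity
        by_cases hx2 : -Real.pi ≤ x
        · exact Dk_tail T (by omega) (abs_le.mpr ⟨hx2, by linarith⟩) h.le
        · push Not at hx2
          have a1 : 0 ≤ x + 2 * Real.pi := by linarith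
          have a2 : 2 * Real.pi / M ≤ 2 * Real.pi / 3 := div_le_div_of_nonneg_left (by positivity) (by norm_num) (by exact_mod_cast hM)
          have := Dk_tail T (M := M) (by omega) (x := x + 2 * Real.pi) (by rw [abs_of_nonneg a1]; linarith) (by rw [abs_of_nonneg a1]; linarith)
          simp_rw [Dk_per] at this
          exact this
      have h2 : ‖z - Ψ j‖ ≤ 2 := (norm_sub_le _ _).trans (by have := hΨ j; linarith)
      have h3 := mul_le_mul h2 t d0 (by norm_num)
      have : 0 ≤ η * ‖Dk T x‖ ^ 2 := by positivity
      have : 8 / M * ∑ K ∈ range M, ‖Dk K x‖ ^ 2 = 2 * (4 / M * ∑ K ∈ range M, ‖Dk K x‖ ^ 2) := by ring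
      linarith
  refine (norm_sum_le_of_le _ b).trans ?_
  rw [sum_add_distrib, ← mul_sum, ← mul_sum, m1, sum_comm]
  have m2 : ∑ K ∈ range M, ∑ j ∈ range J, ‖Dk K (w - v + 2 * Real.pi * j / J)‖ ^ 2 ≤ M * (J * M) := by
    refine (sum_le_card_nsmul _ _ (J * M : ℝ) fun K hK => ?_).trans (by simp)
    have := mem_range.mp hK
    rw [Dk_mass hJ (by omega)]
    exact mul_le_mul_of_nonneg_left (by exact_mod_cast this.le) J0.le
  have m3 := mul_le_mul_of_nonneg_left m2 (show (0 : ℝ) ≤ 8 / M by positivity)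
  have e3 : 8 / (M : ℝ) * (M * (J * M)) = J * T * (8 * M / T) := by field_simp
  rw [e3] at m3
  linarith
lemma fejer_expand {J T : ℕ} (hJ : 1 ≤ J) (hT : 2 * T ≤ J) (Ψ : ℕ → ℂ) (hΨ : ∀ j, ‖Ψ j‖ ≤ 1) (w : ℝ) (S : Finset ℕ) (a : ℕ → ℂ) (v : ℕ → ℝ) {E : ℝ}
    (hE : ∑ t ∈ Ioo (-(T : ℤ)) T, ‖∑ n ∈ S, a n * ee (-t * v n)‖ ^ 2 ≤ E) :
    ‖∑ n ∈ S, a n * ∑ j ∈ range J, Ψ j * ((‖Dk T (w - v n + 2 * Real.pi * j / J)‖ ^ 2 : ℝ) : ℂ)‖ ≤ J * T * √E := by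
  set A : ℤ → ℂ := fun t => ∑ n ∈ S, a n * ee (-t * v n) with hA
  set B : ℤ → ℂ := fun t => ∑ j ∈ range J, Ψ j * ee (t * (w + 2 * Real.pi * j / J)) with hB
  have e : ∑ n ∈ S, a n * ∑ j ∈ range J, Ψ j * ((‖Dk T (w - v n + 2 * Real.pi * j / J)‖ ^ 2 : ℝ) : ℂ)
      = ∑ x ∈ range T, ∑ y ∈ range T, A ((x : ℤ) - y) * B ((x : ℤ) - y) := by
    simp_rw [Dk_sq, hA, hB, sum_mul_sum, mul_sum]
    rw [sum_congr rfl fun n _ => sum_comm, sum_comm]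
    refine sum_congr rfl fun x _ => ?_
    rw [sum_congr rfl fun n _ => (sum_congr rfl fun j _ => rfl : _ = _)]
    rw [sum_congr rfl fun n _ => sum_comm, sum_comm]
    refine sum_congr rfl fun y _ => sum_congr rfl fun n _ => sum_congr rfl fun j _ => ?_
    have : ee ((((x : ℤ) - y : ℤ) : ℝ) * (w - v n + 2 * Real.pi * j / J)) = ee (-(((x : ℤ) - y : ℤ) : ℝ) * v n) * ee ((((x : ℤ) - y : ℤ) : ℝ) * (w + 2 * Real.pi * j / J)) := by
      rw [← ee_add]; congr 1; ring
    rw [this]; ring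
  rw [e]
  have bes := grid_bessel hJ hT Ψ w hΨ
  have J0 : (0 : ℝ) ≤ J := by positivity
  have row : ∀ x ∈ range T, ‖∑ y ∈ range T, A ((x : ℤ) - y) * B ((x : ℤ) - y)‖ ≤ J * √E := fun x hx => by
    have inj : ∀ F : ℤ → ℂ, ∑ y ∈ range T, ‖F ((x : ℤ) - y)‖ ^ 2 ≤ ∑ t ∈ Ioo (-(T : ℤ)) T, ‖F t‖ ^ 2 := fun F => by
      rw [← sum_image (f := fun t : ℤ => ‖F t‖ ^ 2) (g := fun y : ℕ => (x : ℤ) - y) (fun a _ b _ h => by simpa using h)]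
      refine sum_le_sum_of_subset_of_nonneg (fun t ht => ?_) fun _ _ _ => by positivity
      obtain ⟨y, hy, rfl⟩ := mem_image.mp ht
      have := mem_range.mp hx
      have := mem_range.mp hy
      exact mem_Ioo.mpr ⟨by omega, by omega⟩
    have cs := Real.sum_mul_le_sqrt_mul_sqrt (range T) (fun y => ‖A ((x : ℤ) - y)‖) (fun y => ‖B ((x : ℤ) - y)‖)
    refine (norm_sum_le _ _).trans ?_
    simp_rw [norm_mul]
    refine cs.trans ?_
    rw [mul_comm]
    refine mul_le_mul ?_ (Real.sqrt_le_sqrt ((inj A).trans hE)) (Real.sqrt_nonneg _) J0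
    refine Real.sqrt_le_iff.mpr ⟨J0, ((inj B).trans bes).trans (by rw [sq])⟩
  refine (norm_sum_le_of_le _ row).trans (le_of_eq ?_)
  simp; ring
end
section
lemma slow_diff {ψ : ℕ → ℂ} {κ : ℝ} (hκ : ∀ n, ‖ψ (n + 1) - ψ n‖ ≤ κ) (m n : ℕ) : ‖ψ m - ψ n‖ ≤ κ * |(m : ℝ) - n| := by
  have aux : ∀ k n : ℕ, ‖ψ (n + k) - ψ n‖ ≤ κ * k := fun k n => by
    induction k with
    | zero => simp
    | succ k ih =>
      have := hκ (n + k)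
      have e : ψ (n + (k + 1)) - ψ n = (ψ (n + k + 1) - ψ (n + k)) + (ψ (n + k) - ψ n) := by rw [← add_assoc]; ring
      rw [e]; push_cast
      refine (norm_add_le _ _).trans ?_
      linarith
  rcases le_total m n with h | h
  · obtain ⟨k, rfl⟩ := Nat.exists_eq_add_of_le h
    rw [norm_sub_rev]
    refine (aux k m).trans (le_of_eq ?_)
    congr 1; push_cast; rw [abs_sub_comm, add_sub_cancel_left, abs_cast]
  · obtain ⟨k, rfl⟩ := Nat.exists_eq_add_of_le h
    refine (aux k n).trans (le_of_eq ?_)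
    congr 1; push_cast; rw [add_sub_cancel_left, abs_cast]
lemma DD_dyad (f : ℕ → ℂ) (i : ℕ) (t : ℤ) : DD f (2 ^ i) (2 * 2 ^ i) t = ∑ n ∈ Ioc (2 ^ i) (2 ^ (i + 1)), GG f t n := by
  unfold DD
  have a : ⌊(2 : ℝ) ^ i⌋₊ = 2 ^ i := by exact_mod_cast floor_natCast (R := ℝ) (2 ^ i)
  have b : ⌊2 * (2 : ℝ) ^ i⌋₊ = 2 ^ (i + 1) := by rw [pow_succ']; exact_mod_cast floor_natCast (R := ℝ) (2 * 2 ^ i)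
  rw [a, b]
lemma dyad_harm (i : ℕ) : ∑ n ∈ Ioc ((2 : ℕ) ^ i) (2 ^ (i + 1)), 1 / (n : ℝ) ≤ 1 := by
  have h : ∀ n ∈ Ioc ((2 : ℕ) ^ i) (2 ^ (i + 1)), 1 / (n : ℝ) ≤ 1 / 2 ^ i := fun n hn =>
    one_div_le_one_div_of_le (by positivity) (by exact_mod_cast (mem_Ioc.mp hn).1.le)
  refine (sum_le_card_nsmul _ _ _ h).trans (le_of_eq ?_)
  rw [card_Ioc, nsmul_eq_mul, pow_succ, show 2 ^ i * 2 - 2 ^ i = 2 ^ i by omega]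
  push_cast; field_simp
lemma fn_norm {f : ℕ → ℂ} (hb : ∀ n, ‖f n‖ ≤ 1) (n : ℕ) : ‖f n / n‖ ≤ 1 / n := by
  rw [norm_div, Complex.norm_natCast]
  exact div_le_div_of_nonneg_right (hb n) (by positivity)
lemma slow_scale {f : ℕ → ℂ} (hb : ∀ n, ‖f n‖ ≤ 1) {ψ : ℕ → ℂ} {κ : ℝ} (hψ : ∀ n, ‖ψ n‖ ≤ 1) (hκ : ∀ n, ‖ψ (n + 1) - ψ n‖ ≤ κ)
    (i T M : ℕ) (hM : 7 ≤ M) (hMT : M ≤ T) :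
    ‖∑ n ∈ Ioc (2 ^ i) (2 ^ (i + 1)), f n / n * ψ n‖ ≤
      √(EN f (2 ^ i) (Ioo (-(T : ℤ)) T)) + (κ * (28 * 2 ^ i / M + 1) + 8 * M / T) := by
  have pi0 := pi_pos
  have pi3 := pi_lt_d2
  have κ0 : 0 ≤ κ := (norm_nonneg _).trans (hκ 0)
  have T0 : (0 : ℝ) < T := by exact_mod_cast (by omega : 0 < T)
  have M0 : (0 : ℝ) < M := by exact_mod_cast (by omega : 0 < M)
  have M7 : (7 : ℝ) ≤ M := by exact_mod_cast hM
  have l0 : 0 < Real.log 2 := log_pos (by norm_num)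
  have l1 : Real.log 2 ≤ 1 := by have := log_two_lt_d9; linarith
  set J := 2 * T with hJ
  have J0 : (0 : ℝ) < J := by rw [hJ]; push_cast; linarith
  set w : ℝ := i * Real.log 2 - Real.pi with hw
  set Ψ : ℕ → ℂ := fun j => ψ ⌊exp (w + 2 * Real.pi * j / J)⌋₊ with hΨ
  set η := κ * (28 * 2 ^ i / M + 1) with hη
  have η0 : 0 ≤ η := by positivity
  set S := Ioc (2 ^ i) (2 ^ (i + 1)) with hS
  set R : ℕ → ℂ := fun n => ∑ j ∈ range J, Ψ j * ((‖Dk T (w - Real.log n + 2 * Real.pi * j / J)‖ ^ 2 : ℝ) : ℂ) with hR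
  have b1 : ‖∑ n ∈ S, f n / n * R n‖ ≤ J * T * √(EN f (2 ^ i) (Ioo (-(T : ℤ)) T)) := by
    refine fejer_expand (by omega) (by omega) Ψ (fun j => hψ _) w S (fun n => f n / n) (fun n => Real.log n) ?_
    unfold EN
    simp_rw [DD_dyad]
    exact le_rfl
  have b2 : ∀ n ∈ S, ‖J * T * ψ n - R n‖ ≤ J * T * (η + 8 * M / T) := fun n hn => by
    obtain ⟨n1, n2⟩ := mem_Ioc.mp hn
    have r1 : (2 : ℝ) ^ i < n := by exact_mod_cast n1
    have r2 : (n : ℝ) ≤ 2 * 2 ^ i := by rw [← pow_succ']; exact_mod_cast n2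
    have p0 : (0 : ℝ) < 2 ^ i := by positivity
    have n0 : (0 : ℝ) < n := p0.trans r1
    have L1 : i * Real.log 2 ≤ Real.log n := by rw [← log_pow]; exact log_le_log p0 r1.le
    have L2 : Real.log n ≤ Real.log 2 + i * Real.log 2 := by
      rw [← log_pow, ← log_mul (by norm_num) p0.ne']; exact log_le_log n0 r2
    refine fejer_approx (by omega) (by omega) (by omega) (by omega) (by omega) Ψ (fun j => hψ _) w (Real.log n) (by rw [hw]; linarith) (by rw [hw]; linarith) (hψ n) η0 fun j _ hj => ?_
    set u := w + 2 * Real.pi * j / J with hu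
    have q1 : 2 * Real.pi / M ≤ 7 / M := div_le_div_of_nonneg_right (by linarith) M0.le
    have q2 : 7 / (M : ℝ) ≤ 1 := by rw [div_le_one M0]; exact M7
    have ex := Real.abs_exp_sub_one_le (x := u - Real.log n) (by linarith)
    have eu : exp u - n = n * (exp (u - Real.log n) - 1) := by
      rw [exp_sub, exp_log n0]; field_simp
    have d1 : |exp u - n| ≤ 28 * 2 ^ i / M := by
      rw [eu, abs_mul, abs_cast]
      have := mul_le_mul r2 (show |exp (u - Real.log n) - 1| ≤ 2 * (7 / M) by linarith) (abs_nonneg _) (by positivity)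
      refine this.trans (le_of_eq ?_)
      ring
    have d2 : |(n : ℝ) - ⌊exp u⌋₊| ≤ 28 * 2 ^ i / M + 1 := by
      have f1 := floor_le (exp_pos u).le
      have f2 := lt_floor_add_one (exp u)
      rw [abs_le] at d1 ⊢
      constructor <;> linarith
    exact (slow_diff hκ _ _).trans (mul_le_mul_of_nonneg_left d2 κ0)
  have b3 : ‖∑ n ∈ S, f n / n * (J * T * ψ n - R n)‖ ≤ J * T * (η + 8 * M / T) := by
    have : ∀ n ∈ S, ‖f n / n * (J * T * ψ n - R n)‖ ≤ 1 / n * (J * T * (η + 8 * M / T)) := fun n hn => by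
      rw [norm_mul]; exact mul_le_mul (fn_norm hb n) (b2 n hn) (norm_nonneg _) (by positivity)
    refine (norm_sum_le_of_le _ this).trans ?_
    rw [← sum_mul]
    exact mul_le_of_le_one_left (by positivity) (dyad_harm i)
  have e : (J * T : ℂ) * ∑ n ∈ S, f n / n * ψ n = ∑ n ∈ S, f n / n * R n + ∑ n ∈ S, f n / n * (J * T * ψ n - R n) := by
    rw [← sum_add_distrib, mul_sum]
    exact sum_congr rfl fun n _ => by ring
  have e2 := congrArg norm e
  rw [norm_mul, norm_mul, Complex.norm_natCast, Complex.norm_natCast] at e2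
  have := e2.le.trans ((norm_add_le _ _).trans (add_le_add b1 b3))
  rw [← mul_add] at this
  exact le_of_mul_le_mul_left this (by positivity)
lemma dyad_split (g : ℕ → ℂ) (I : ℕ) : ∑ n ∈ Icc 1 (2 ^ I), g n = g 1 + ∑ i ∈ range I, ∑ n ∈ Ioc (2 ^ i) (2 ^ (i + 1)), g n := by
  induction I with
  | zero => simp
  | succ I ih =>
    rw [sum_range_succ, ← add_assoc, ← ih]
    have h1 : 1 ≤ 2 ^ I := one_le_two_pow
    have h2 : 2 ^ I ≤ 2 ^ (I + 1) := pow_le_pow_right (by norm_num) (by omega)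
    have e : ∀ M : ℕ, Icc 1 M = Ioc 0 M := fun M => by ext; simp [one_le_iff_ne_zero, Nat.pos_iff_ne_zero]
    rw [e, e, sum_Ioc_consecutive _ (by omega) h2]
theorem MRP {m : ℕ} (hm : 1 ≤ m) {f : ℕ → ℂ} (hf : ∀ m n, f (m * n) = f m * f n) (hb : ∀ n, ‖f n‖ ≤ 1) (hf1 : f 1 = 1)
    (hfm : ∀ p, p.Prime → f p = 0 ∨ f p ^ m = 1) (hL : LB f) {ε : ℝ} (hε : 0 < ε) :
    ∃ κ > 0, ∃ N0 : ℕ, ∀ ψ : ℕ → ℂ, (∀ n, ‖ψ n‖ ≤ 1) → (∀ n, ‖ψ (n + 1) - ψ n‖ ≤ κ) → ∀ N ≥ N0,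
      ‖∑ n ∈ Icc 1 N, f n / n * ψ n‖ ≤ ε * Real.log N := by
  obtain ⟨H, T0, x0, H1, T1, hHF⟩ := HF hm hf hb hf1 hfm (ε := (ε / 16) ^ 2) (by positivity)
  obtain ⟨R, hR⟩ := exists_nat_gt (128 / ε)
  have R0 : (0 : ℝ) < R := lt_trans (by positivity) hR
  set L := ⌈T0⌉₊ with hLd
  choose I0 hI0 using fun t : ℤ => low_avg hb hL t (ε := ε / (16 * (2 * L + 1))) (by positivity)
  set κ := ε / (16 * (28 * (4 * H * R) + 1)) with hκd
  have κ0 : 0 < κ := by have : 0 < H := by linarith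
                        positivity
  obtain ⟨i0, hi0⟩ := ((tendsto_natCast_atTop_atTop (R := ℝ)).eventually_ge_atTop (max (x0 / Real.log 2) (28 * (4 * H * R)))).exists
  set I1 := ∑ t ∈ Icc (-(L : ℤ)) L, I0 t with hI1
  obtain ⟨I2, hI2⟩ := exists_nat_gt ((i0 + 2) * 16 / ε)
  have l0 : 0 < Real.log 2 := log_pos (by norm_num)
  have l2 : 1 / 2 ≤ Real.log 2 := by have := log_two_gt_d9; linarith
  refine ⟨κ, κ0, 2 ^ (I1 + I2 + 1), fun ψ hψ hκ N hN => ?_⟩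
  set I := Nat.log 2 N with hI
  have N0 : N ≠ 0 := by have := one_le_two_pow (n := I1 + I2 + 1); omega
  have N1 : 2 ^ I ≤ N := Nat.pow_log_le_self 2 N0
  have N2 : N < 2 ^ (I + 1) := Nat.lt_pow_succ_log_self (by norm_num) N
  have II : I1 + I2 + 1 ≤ I := (Nat.le_log_iff_pow_le (by norm_num) N0).mpr hN
  have logN : (I : ℝ) * Real.log 2 ≤ Real.log N := by
    rw [← log_pow]; exact log_le_log (by positivity) (by exact_mod_cast N1)
  have triv : ∀ i, ‖∑ n ∈ Ioc (2 ^ i) (2 ^ (i + 1)), f n / n * ψ n‖ ≤ 1 := fun i => by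
    have : ∀ n ∈ Ioc (2 ^ i) (2 ^ (i + 1)), ‖f n / n * ψ n‖ ≤ 1 / (n : ℝ) := fun n _ => by
      rw [norm_mul]
      exact (mul_le_mul (fn_norm hb n) (hψ n) (norm_nonneg _) (by positivity)).trans (by rw [mul_one])
    exact (norm_sum_le_of_le _ this).trans (dyad_harm i)
  have scale : ∀ i ∈ range I, ‖∑ n ∈ Ioc (2 ^ i) (2 ^ (i + 1)), f n / n * ψ n‖ ≤
      (if i < i0 then 1 else 0) + (3 * ε / 16 + ∑ t ∈ Icc (-(L : ℤ)) L, ‖DD f (2 ^ i) (2 * 2 ^ i) t‖) := fun i _ => by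
    have s0 : 0 ≤ ∑ t ∈ Icc (-(L : ℤ)) L, ‖DD f (2 ^ i) (2 * 2 ^ i) t‖ := sum_nonneg fun _ _ => norm_nonneg _
    split_ifs with hi
    · have := triv i; linarith
    · push Not at hi
      have hir : (i0 : ℝ) ≤ i := by exact_mod_cast hi
      have X1 : x0 ≤ i * Real.log 2 := by
        have := ((le_max_left _ _).trans hi0).trans hir
        rwa [div_le_iff₀ l0] at this
      have X2 : 28 * (4 * H * R) ≤ (2 : ℝ) ^ i := by
        have := ((le_max_right _ _).trans hi0).trans hir
        exact this.trans (by exact_mod_cast (Nat.lt_two_pow_self (n := i)).le)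
      have H0 : 0 < H := by linarith
      have R1 : (1 : ℝ) ≤ R := by
        have : (0 : ℕ) < R := by exact_mod_cast R0
        exact_mod_cast this
      set X : ℝ := 2 ^ i with hX
      set T := ⌊X / H⌋₊ with hT
      have T2 : (T : ℝ) ≤ X / H := floor_le (by positivity)
      have XH : 28 * 4 * R ≤ X / H := by rw [le_div_iff₀ H0]; linarith
      have T3 : X / H ≤ 2 * T := by
        have := lt_floor_add_one (X / H)
        rw [← hT] at this
        linarith
      have T4 : 28 * 2 * R ≤ (T : ℝ) := by linarith
      have T0' : (0 : ℝ) < T := by linarith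
      set M := ⌊(T : ℝ) / R⌋₊ with hM
      have M2 : (M : ℝ) ≤ T / R := floor_le (by positivity)
      have TR : 28 * 2 ≤ (T : ℝ) / R := by rw [le_div_iff₀ R0]; linarith
      have M3 : (T : ℝ) / R ≤ 2 * M := by
        have := lt_floor_add_one ((T : ℝ) / R)
        rw [← hM] at this
        linarith
      have M28 : (28 : ℝ) ≤ M := by linarith
      have MT : M ≤ T := by
        have : (T : ℝ) / R ≤ T := div_le_self T0'.le R1
        exact_mod_cast M2.trans this
      have ss := slow_scale hb hψ hκ i T M (by have : 28 ≤ M := by exact_mod_cast M28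
                                               omega) MT
      rw [← hX] at ss
      have t1 : 8 * (M : ℝ) / T ≤ ε / 16 := by
        rw [le_div_iff₀ R0] at M2
        rw [div_lt_iff₀ hε] at hR
        rw [div_le_iff₀ T0']
        have M0 : (0 : ℝ) < M := by linarith
        have q1 := mul_le_mul_of_nonneg_right hR.le M0.le
        have q2 := mul_le_mul_of_nonneg_left M2 hε.le
        linarith
      have t2 : κ * (28 * X / M + 1) ≤ ε / 16 := by
        have : 28 * X / M ≤ 28 * (4 * H * R) := by
          rw [div_le_iff₀ (by linarith)]
          rw [div_le_iff₀ H0] at T3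
          rw [div_le_iff₀ R0] at M3
          have := mul_le_mul_of_nonneg_right M3 H0.le
          linarith
        have := mul_le_mul_of_nonneg_left (add_le_add this (le_refl 1)) κ0.le
        refine this.trans (le_of_eq ?_)
        rw [hκd]; field_simp
      have t3 : √(EN f X (Ioo (-(T : ℤ)) T)) ≤ ε / 16 + ∑ t ∈ Icc (-(L : ℤ)) L, ‖DD f X (2 * X) t‖ := by
        refine Real.sqrt_le_iff.mpr ⟨by positivity, ?_⟩
        have hh := hHF (i * Real.log 2) X1 ((Ioo (-(T : ℤ)) T).filter fun t => T0 ≤ |(t : ℝ)|) (fun t ht => by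
          obtain ⟨h1, h2⟩ := mem_filter.mp ht
          refine ⟨h2, ?_⟩
          have e : exp (i * Real.log 2) = X := by rw [hX, mul_comm, exp_mul, exp_log (by norm_num), rpow_natCast]
          rw [e]
          refine le_trans ?_ T2
          obtain ⟨a, b⟩ := mem_Ioo.mp h1
          rw [abs_le]
          exact ⟨by exact_mod_cast a.le, by exact_mod_cast b.le⟩)
        have e : exp (i * Real.log 2) = X := by rw [hX, mul_comm, exp_mul, exp_log (by norm_num), rpow_natCast]
        rw [e] at hh
        unfold EN at hh ⊢
        rw [← Finset.sum_filter_add_sum_filter_not _ (fun t : ℤ => T0 ≤ |(t : ℝ)|)]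
        have low : ∑ t ∈ (Ioo (-(T : ℤ)) T).filter (fun t : ℤ => ¬ T0 ≤ |(t : ℝ)|), ‖DD f X (2 * X) t‖ ^ 2 ≤ (∑ t ∈ Icc (-(L : ℤ)) L, ‖DD f X (2 * X) t‖) ^ 2 := by
          refine le_trans (sum_le_sum_of_subset_of_nonneg (t := Icc (-(L : ℤ)) L) (fun t ht => ?_) fun _ _ _ => by positivity)
            (Finset.sum_sq_le_sq_sum_of_nonneg fun _ _ => norm_nonneg _)
          have := not_le.mp (mem_filter.mp ht).2
          have := this.le.trans (le_ceil T0)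
          rw [← hLd, abs_le] at this
          exact mem_Icc.mpr ⟨by exact_mod_cast this.1, by exact_mod_cast this.2⟩
        have : 0 ≤ ε / 16 * ∑ t ∈ Icc (-(L : ℤ)) L, ‖DD f X (2 * X) t‖ := by positivity
        have e3 : ∀ a b : ℝ, (a + b) ^ 2 = a ^ 2 + b ^ 2 + 2 * (a * b) := fun a b => by ring
        rw [e3]
        linarith
      linarith
  have lows : ∑ i ∈ range I, ∑ t ∈ Icc (-(L : ℤ)) L, ‖DD f (2 ^ i) (2 * 2 ^ i) t‖ ≤ ε / 16 * I := by
    rw [sum_comm]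
    refine (sum_le_card_nsmul _ _ (ε / (16 * (2 * L + 1)) * I) fun t ht => hI0 t I ?_).trans (le_of_eq ?_)
    · have := single_le_sum (f := I0) (fun _ _ => Nat.zero_le _) ht
      omega
    · rw [Int.card_Icc, nsmul_eq_mul, show ((L : ℤ) + 1 - -L).toNat = 2 * L + 1 by omega]
      push_cast; field_simp
  have tot : ‖∑ n ∈ Icc 1 N, f n / n * ψ n‖ ≤ 1 + ∑ i ∈ range I, ‖∑ n ∈ Ioc (2 ^ i) (2 ^ (i + 1)), f n / n * ψ n‖ + 1 := by
    have e : ∀ M : ℕ, Icc 1 M = Ioc 0 M := fun M => by ext; simp [one_le_iff_ne_zero, Nat.pos_iff_ne_zero]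
    rw [e, ← sum_Ioc_consecutive _ (Nat.zero_le (2 ^ I)) N1, ← e, dyad_split]
    refine (norm_add_le _ _).trans (add_le_add ((norm_add_le _ _).trans (add_le_add ?_ (norm_sum_le _ _))) ?_)
    · rw [norm_mul]
      have := mul_le_mul (fn_norm hb 1) (hψ 1) (norm_nonneg _) (by norm_num)
      simpa using this
    · have : ∀ n ∈ Ioc (2 ^ I) N, ‖f n / n * ψ n‖ ≤ 1 / (n : ℝ) := fun n _ => by
        rw [norm_mul]
        exact (mul_le_mul (fn_norm hb n) (hψ n) (norm_nonneg _) (by positivity)).trans (by rw [mul_one])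
      refine (norm_sum_le_of_le _ this).trans ((sum_le_sum_of_subset_of_nonneg (fun n hn => ?_) fun _ _ _ => by positivity).trans (dyad_harm I))
      have := mem_Ioc.mp hn
      exact mem_Ioc.mpr ⟨this.1, by omega⟩
  have sc := sum_le_sum scale
  rw [sum_add_distrib, sum_add_distrib, sum_const, card_range, nsmul_eq_mul] at sc
  have c1 : ∑ i ∈ range I, (if i < i0 then (1 : ℝ) else 0) ≤ i0 := by
    rw [sum_boole]
    exact_mod_cast (card_le_card (t := range i0) fun x hx => mem_range.mpr (mem_filter.mp hx).2).trans (card_range i0).le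
  have c2 : (i0 : ℝ) + 2 ≤ ε / 16 * I := by
    rw [div_lt_iff₀ hε] at hI2
    have : (I2 : ℝ) ≤ I := by exact_mod_cast (by omega : I2 ≤ I)
    have := mul_le_mul_of_nonneg_right this hε.le
    linarith
  have c3 : ε * ((1 / 2) * I) ≤ ε * Real.log N := mul_le_mul_of_nonneg_left (by
    have := mul_le_mul_of_nonneg_left l2 (show (0 : ℝ) ≤ I by positivity)
    linarith) hε.le
  have c4 : 0 ≤ ε * I := by positivity
  linarith
theorem MRlam {q : ℕ} [NeZero q] (χ : DirichletCharacter ℂ q) {ε : ℝ} (hε : 0 < ε) :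
    ∃ κ > 0, ∃ N0 : ℕ, ∀ ψ : ℕ → ℂ, (∀ n, ‖ψ n‖ ≤ 1) → (∀ n, ‖ψ (n + 1) - ψ n‖ ≤ κ) → ∀ N ≥ N0,
      ‖∑ n ∈ Icc 1 N, lc χ n / n * ψ n‖ ≤ ε * Real.log N :=
  MRP (m := 2 * q.totient) (by have := Nat.totient_pos.mpr (NeZero.pos q); omega) (lc_mul χ) (lc_norm χ) (lc_one χ) (lc_root χ) (lc_LB χ) hε
end
section
section av
variable {𝕜 : Type} [RCLike 𝕜]
noncomputable def lsum (N : ℕ) (g : ℕ → 𝕜) : 𝕜 := ∑ n ∈ Icc 1 N, ((n : ℝ)⁻¹ : ℝ) • g n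
def Bd (g : ℕ → 𝕜) : Prop := ∃ C : ℝ, ∀ n, ‖g n‖ ≤ C
def IsAv (U : Ultrafilter ℕ) (E : (ℕ → 𝕜) →ₗ[𝕜] 𝕜) : Prop :=
  (U : Filter ℕ) ≤ atTop ∧ ∀ g, Bd g → Tendsto (fun N : ℕ => ((Real.log N)⁻¹ : ℝ) • lsum N g) U (𝓝 (E g))
lemma lsum_le {g : ℕ → 𝕜} {C : ℝ} (h : ∀ n, ‖g n‖ ≤ C) (N : ℕ) : ‖lsum N g‖ ≤ C * (1 + Real.log N) := by
  have C0 := (norm_nonneg _).trans (h 0)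
  refine le_trans ?_ (mul_le_mul_of_nonneg_left (harm_le N) C0)
  rw [lsum, mul_sum]
  refine norm_sum_le_of_le _ fun n _ => ?_
  rw [norm_smul, norm_inv, RCLike.norm_natCast, one_div, mul_comm]
  exact mul_le_mul_of_nonneg_right (h n) (by positivity)
lemma exists_av (𝕜 : Type) [RCLike 𝕜] (U : Ultrafilter ℕ) (hU : (U : Filter ℕ) ≤ atTop) : ∃ E : (ℕ → 𝕜) →ₗ[𝕜] 𝕜, IsAv U E := by
  have ad : ∀ (f g : ℕ → 𝕜) (N : ℕ), lsum N (f + g) = lsum N f + lsum N g := fun f g N => by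
    simp only [lsum, Pi.add_apply, smul_add, sum_add_distrib]
  have sm : ∀ (c : 𝕜) (g : ℕ → 𝕜) (N : ℕ), lsum N (c • g) = c • lsum N g := fun c g N => by
    simp only [lsum, Pi.smul_apply, Finset.smul_sum, smul_comm c]
  have key : ∀ g : ℕ → 𝕜, Bd g → ∃ a, Tendsto (fun N : ℕ => ((Real.log N)⁻¹ : ℝ) • lsum N g) U (𝓝 a) := by
    rintro g ⟨C, hC⟩
    have ev : ∀ᶠ N : ℕ in U, ((Real.log N)⁻¹ : ℝ) • lsum N g ∈ Metric.closedBall (0 : 𝕜) (2 * C) := by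
      refine hU ?_
      filter_upwards [eventually_ge_atTop 3] with N hN
      have l1 : 1 ≤ Real.log N := by
        rw [le_log_iff_exp_le (by positivity)]
        have : (3 : ℝ) ≤ N := by exact_mod_cast hN
        linarith [exp_one_lt_d9]
      have := lsum_le hC N
      have C0 := (norm_nonneg _).trans (hC 0)
      rw [mem_closedBall_zero_iff, norm_smul, norm_inv, norm_of_nonneg (by linarith), inv_mul_le_iff₀ (by linarith)]
      nlinarith
    obtain ⟨a, -, ha⟩ := (isCompact_closedBall (0 : 𝕜) (2 * C)).ultrafilter_le_nhds (U.map fun N : ℕ => ((Real.log N)⁻¹ : ℝ) • lsum N g) (le_principal_iff.mpr ev)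
    exact ⟨a, ha⟩
  choose! L hL using key
  let B : Submodule 𝕜 (ℕ → 𝕜) :=
    { carrier := {g | Bd g}
      add_mem' := fun {f g} ⟨C, hC⟩ ⟨D, hD⟩ => ⟨C + D, fun n => norm_add_le_of_le (hC n) (hD n)⟩
      zero_mem' := ⟨0, fun n => by simp⟩
      smul_mem' := fun c g ⟨C, hC⟩ => ⟨‖c‖ * C, fun n => by
        rw [Pi.smul_apply, norm_smul]; exact mul_le_mul_of_nonneg_left (hC n) (norm_nonneg _)⟩ }
  let l : B →ₗ[𝕜] 𝕜 :=
    { toFun := fun g => L g.1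
      map_add' := fun f g => by
        refine tendsto_nhds_unique (hL _ (f + g).2) (((hL _ f.2).add (hL _ g.2)).congr fun N => ?_)
        rw [← smul_add, ← ad]; rfl
      map_smul' := fun c g => by
        refine tendsto_nhds_unique (hL _ (c • g).2) (((hL _ g.2).const_smul c).congr fun N => ?_)
        rw [smul_comm, ← sm]; rfl }
  obtain ⟨E, hE⟩ := l.exists_extend
  refine ⟨E, hU, fun g hg => ?_⟩
  have : E g = L g := congrArg (fun m => m ⟨g, hg⟩) hE
  rw [this]
  exact hL g hg
variable {U : Ultrafilter ℕ} {E : (ℕ → 𝕜) →ₗ[𝕜] 𝕜} {R : (ℕ → ℝ) →ₗ[ℝ] ℝ}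
lemma log_at (U : Ultrafilter ℕ) (hU : (U : Filter ℕ) ≤ atTop) : Tendsto (fun N : ℕ => Real.log N) U atTop :=
  (Real.tendsto_log_atTop.comp tendsto_natCast_atTop_atTop).mono_left hU
lemma av_le (hE : IsAv U E) {g : ℕ → 𝕜} (hg : Bd g) {C ε : ℝ} {N0 : ℕ} (h : ∀ N ≥ N0, ‖lsum N g‖ ≤ C + ε * Real.log N) : ‖E g‖ ≤ ε := by
  have t1 := (hE.2 g hg).norm
  have lg := log_at U hE.1
  have t2 : Tendsto (fun N : ℕ => C * (Real.log N)⁻¹ + ε) U (𝓝 (C * 0 + ε)) := ((tendsto_inv_atTop_zero.comp lg).const_mul C).add_const ε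
  rw [mul_zero, zero_add] at t2
  refine le_of_tendsto_of_tendsto t1 t2 ?_
  filter_upwards [lg.eventually_gt_atTop 0, hE.1 (eventually_ge_atTop N0)] with N h0 hN
  rw [norm_smul, norm_inv, norm_of_nonneg h0.le, inv_mul_le_iff₀ h0]
  refine (h N hN).trans (le_of_eq ?_)
  field_simp
lemma av_null (hE : IsAv U E) {g : ℕ → 𝕜} (hg : Bd g) {C : ℝ} (h : ∀ N, ‖lsum N g‖ ≤ C) : E g = 0 :=
  norm_le_zero_iff.mp (av_le hE hg (C := C) (N0 := 0) fun N _ => by have := h N; linarith)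
lemma Bd.sub {f g : ℕ → 𝕜} (hf : Bd f) (hg : Bd g) : Bd (f - g) := by
  obtain ⟨C, hC⟩ := hf
  obtain ⟨D, hD⟩ := hg
  exact ⟨C + D, fun n => norm_sub_le_of_le (hC n) (hD n)⟩
lemma Bd.add {f g : ℕ → 𝕜} (hf : Bd f) (hg : Bd g) : Bd (f + g) := by
  obtain ⟨C, hC⟩ := hf
  obtain ⟨D, hD⟩ := hg
  exact ⟨C + D, fun n => norm_add_le_of_le (hC n) (hD n)⟩
lemma Bd.mul {f g : ℕ → 𝕜} (hf : Bd f) (hg : Bd g) : Bd (fun n => f n * g n) := by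
  obtain ⟨C, hC⟩ := hf
  obtain ⟨D, hD⟩ := hg
  exact ⟨C * D, fun n => by rw [norm_mul]; exact mul_le_mul (hC n) (hD n) (norm_nonneg _) ((norm_nonneg _).trans (hC n))⟩
lemma av_shift (hE : IsAv U E) {g : ℕ → 𝕜} (hg : Bd g) (k : ℕ) : E (fun n => g (n + k)) = E g := by
  induction k with
  | zero => rfl
  | succ k ih =>
    rw [← ih, ← sub_eq_zero, ← map_sub]
    obtain ⟨C, hC⟩ := hg
    have C0 := (norm_nonneg _).trans (hC 0)
    refine av_null hE (C := C * 3) (Bd.sub ⟨C, fun n => hC _⟩ ⟨C, fun n => hC _⟩) fun N => ?_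
    have key : ∀ N : ℕ, ‖lsum (N + 1) ((fun n => g (n + (k + 1))) - fun n => g (n + k)) - ((N + 1 : ℝ)⁻¹ : ℝ) • g (N + 1 + (k + 1))‖ ≤ C * (2 - (N + 1 : ℝ)⁻¹) := by
      intro N
      induction N with
      | zero =>
        simp only [lsum, Pi.sub_apply, zero_add, Finset.Icc_self, Finset.sum_singleton, cast_zero, Nat.cast_one, inv_one, one_smul]
        rw [sub_sub_cancel_left, norm_neg]
        linarith [hC (1 + k)]
      | succ N ih2 =>
        rw [lsum, sum_Icc_succ_top (by omega), ← lsum]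
        have e : ∀ a b c : 𝕜, ∀ r s : ℝ, a + s • (c - b) - s • c = (a - r • b) + (r - s) • b := fun a b c r s => by
          rw [smul_sub, sub_smul]; ring
        have := e (lsum (N + 1) ((fun n => g (n + (k + 1))) - fun n => g (n + k))) (g (N + 1 + (k + 1))) (g (N + 1 + 1 + (k + 1))) (N + 1 : ℝ)⁻¹ ((N + 1 : ℕ) + 1 : ℝ)⁻¹
        have e2 : N + 1 + 1 + k = N + 1 + (k + 1) := by ring
        simp only [Pi.sub_apply, e2]
        push_cast at this ⊢
        rw [this]
        have p : (N + 1 + 1 : ℝ)⁻¹ ≤ (N + 1 : ℝ)⁻¹ := inv_anti₀ (by positivity) (by linarith)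
        have q : ‖((N + 1 : ℝ)⁻¹ - (N + 1 + 1 : ℝ)⁻¹) • g (N + 1 + (k + 1))‖ ≤ ((N + 1 : ℝ)⁻¹ - (N + 1 + 1 : ℝ)⁻¹) * C := by
          rw [norm_smul, norm_of_nonneg (by linarith)]
          exact mul_le_mul_of_nonneg_left (hC _) (by linarith)
        refine (norm_add_le_of_le ih2 q).trans (le_of_eq (by ring))
    rcases N with _ | N
    · simpa [lsum] using C0
    · have i1 : ‖((N + 1 : ℝ)⁻¹ : ℝ) • g (N + 1 + (k + 1))‖ ≤ C := by
        rw [norm_smul, norm_inv]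
        refine (mul_le_of_le_one_left (norm_nonneg _) (inv_le_one_of_one_le₀ ?_)).trans (hC _)
        rw [norm_of_nonneg (by positivity)]
        linarith [show (0 : ℝ) ≤ N by positivity]
      have := norm_le_norm_sub_add (lsum (N + 1) ((fun n => g (n + (k + 1))) - fun n => g (n + k))) (((N + 1 : ℝ)⁻¹ : ℝ) • g (N + 1 + (k + 1)))
      have h0 : 0 ≤ C * (N + 1 : ℝ)⁻¹ := by positivity
      linarith [key N]
lemma av_dil (hE : IsAv U E) {g : ℕ → 𝕜} (hg : Bd g) {d : ℕ} (hd : 1 ≤ d) : E (fun n => if d ∣ n then g n else 0) = (d : 𝕜)⁻¹ * E (fun n => g (d * n)) := by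
  rw [← smul_eq_mul, ← map_smul, ← sub_eq_zero, ← map_sub]
  obtain ⟨C, hC⟩ := hg
  have C0 := (norm_nonneg _).trans (hC 0)
  have d0 : (0 : ℝ) < d := by exact_mod_cast hd
  have d1 : (1 : ℝ) ≤ d := by exact_mod_cast hd
  refine av_null hE (C := C * (1 + Real.log d)) (Bd.sub ⟨C, fun n => ?_⟩ ⟨C, fun n => ?_⟩) fun N => ?_
  · dsimp only
    split_ifs
    · exact hC n
    · simpa using C0
  · rw [Pi.smul_apply, norm_smul, norm_inv, RCLike.norm_natCast]
    exact (mul_le_of_le_one_left (norm_nonneg _) (inv_le_one_of_one_le₀ d1)).trans (hC _)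
  · have e1 : lsum N (fun n => if d ∣ n then g n else 0) = lsum (N / d) ((d : 𝕜)⁻¹ • fun n => g (d * n)) := by
      simp only [lsum, smul_ite, smul_zero]
      rw [← sum_filter]
      refine Finset.sum_nbij' (fun n => n / d) (fun m => d * m) ?_ ?_ ?_ ?_ ?_
      · intro n hn
        obtain ⟨hn, k, rfl⟩ := mem_filter.mp hn
        rw [mem_Icc] at hn ⊢
        rw [Nat.mul_div_cancel_left _ hd]
        refine ⟨Nat.pos_of_ne_zero fun h => by simp [h] at hn, (Nat.le_div_iff_mul_le hd).mpr (by linarith [hn.2])⟩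
      · intro m hm
        rw [mem_Icc] at hm
        refine mem_filter.mpr ⟨mem_Icc.mpr ⟨Nat.mul_pos hd hm.1, ?_⟩, dvd_mul_right _ _⟩
        have := (Nat.le_div_iff_mul_le hd).mp hm.2
        linarith
      · intro n hn
        exact mul_div_cancel' (mem_filter.mp hn).2
      · intro m _
        exact Nat.mul_div_cancel_left _ hd
      · intro n hn
        obtain ⟨k, rfl⟩ := (mem_filter.mp hn).2
        rw [Nat.mul_div_cancel_left _ hd]
        simp only [Pi.smul_apply, smul_eq_mul, RCLike.real_smul_eq_coe_mul]
        push_cast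
        ring
    have e2 : lsum N ((d : 𝕜)⁻¹ • fun n => g (d * n)) = lsum (N / d) ((d : 𝕜)⁻¹ • fun n => g (d * n)) + ∑ n ∈ Ioc (N / d) N, ((n : ℝ)⁻¹ : ℝ) • ((d : 𝕜)⁻¹ • fun n => g (d * n)) n := by
      simp only [lsum]
      have e : ∀ M : ℕ, Icc 1 M = Ioc 0 M := fun M => by ext; simp [one_le_iff_ne_zero, Nat.pos_iff_ne_zero]
      rw [e, e, sum_Ioc_consecutive _ (Nat.zero_le _) (Nat.div_le_self N d)]
    have e3 : lsum N ((fun n => if d ∣ n then g n else 0) - (d : 𝕜)⁻¹ • fun n => g (d * n)) = - ∑ n ∈ Ioc (N / d) N, ((n : ℝ)⁻¹ : ℝ) • ((d : 𝕜)⁻¹ • fun n => g (d * n)) n := by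
      have : lsum N ((fun n => if d ∣ n then g n else 0) - (d : 𝕜)⁻¹ • fun n => g (d * n)) = lsum N (fun n => if d ∣ n then g n else 0) - lsum N ((d : 𝕜)⁻¹ • fun n => g (d * n)) := by
        simp only [lsum, Pi.sub_apply, smul_sub, sum_sub_distrib]
      rw [this, e1, e2]; ring
    rw [e3, norm_neg]
    have b : ∀ n ∈ Ioc (N / d) N, ‖((n : ℝ)⁻¹ : ℝ) • ((d : 𝕜)⁻¹ • fun n => g (d * n)) n‖ ≤ C * (1 / n) := fun n _ => by
      rw [norm_smul, Pi.smul_apply, norm_smul, norm_inv, norm_inv, RCLike.norm_natCast, RCLike.norm_natCast, one_div, mul_comm]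
      refine mul_le_mul_of_nonneg_right ((mul_le_of_le_one_left (norm_nonneg _) (inv_le_one_of_one_le₀ d1)).trans (hC _)) (by positivity)
    refine (norm_sum_le_of_le _ b).trans ?_
    rw [← mul_sum]
    refine mul_le_mul_of_nonneg_left ?_ C0
    rcases Nat.eq_zero_or_pos N with rfl | hN
    · simpa using (Real.log_nonneg d1).trans (by linarith)
    have h1 := harm_le N
    have h2 := harm_ge (N / d)
    have e : ∀ M : ℕ, Icc 1 M = Ioc 0 M := fun M => by ext; simp [one_le_iff_ne_zero, Nat.pos_iff_ne_zero]
    rw [e, ← sum_Ioc_consecutive _ (Nat.zero_le _) (Nat.div_le_self N d), ← e] at h1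
    have h3 : Real.log N ≤ Real.log d + Real.log ((N / d : ℕ) + 1) := by
      rw [← log_mul d0.ne' (by positivity)]
      refine log_le_log (by exact_mod_cast hN) ?_
      have := Nat.lt_mul_div_succ N hd
      exact_mod_cast this.le
    linarith
lemma av_one (hE : IsAv U E) : E (fun _ => 1) = 1 := by
  refine tendsto_nhds_unique (hE.2 _ ⟨1, fun _ => by simp⟩) ?_
  have lg := log_at U hE.1
  have e : ∀ N : ℕ, ((Real.log N)⁻¹ : ℝ) • lsum N (fun _ => (1 : 𝕜)) = (((Real.log N)⁻¹ * ∑ n ∈ Icc 1 N, (1 : ℝ) / n : ℝ) : 𝕜) := fun N => by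
    simp [lsum, RCLike.real_smul_eq_coe_mul]
  simp_rw [e]
  suffices h : Tendsto (fun N : ℕ => (Real.log N)⁻¹ * ∑ n ∈ Icc 1 N, (1 : ℝ) / n) U (𝓝 1) by
    have t := ((RCLike.continuous_ofReal (K := 𝕜)).tendsto (1 : ℝ)).comp h
    rw [RCLike.ofReal_one] at t
    exact t
  have t2 : Tendsto (fun N : ℕ => (Real.log N)⁻¹ + 1) U (𝓝 (0 + 1)) := (tendsto_inv_atTop_zero.comp lg).add_const 1
  rw [zero_add] at t2
  refine tendsto_of_tendsto_of_tendsto_of_le_of_le' tendsto_const_nhds t2 ?_ ?_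
  · filter_upwards [lg.eventually_gt_atTop 0] with N h0
    rw [← div_eq_inv_mul, one_le_div h0]
    refine le_trans (log_le_log (Nat.cast_pos.mpr (Nat.pos_of_ne_zero fun h => by simp [h] at h0)) (by linarith)) (harm_ge N)
  · filter_upwards [lg.eventually_gt_atTop 0] with N h0
    have := harm_le N
    rw [← div_eq_inv_mul, div_le_iff₀ h0, add_mul, inv_mul_cancel₀ h0.ne']
    linarith
lemma av_norm (hE : IsAv U E) (hR : IsAv U R) {g : ℕ → 𝕜} {b : ℕ → ℝ} (hb : Bd b) (h : ∀ n, ‖g n‖ ≤ b n) : ‖E g‖ ≤ R b := by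
  have hg : Bd g := by
    obtain ⟨C, hC⟩ := hb
    exact ⟨C, fun n => (h n).trans ((le_abs_self _).trans (hC n))⟩
  refine le_of_tendsto_of_tendsto (hE.2 g hg).norm (hR.2 b hb) ?_
  filter_upwards [(log_at U hE.1).eventually_gt_atTop 0] with N h0
  rw [norm_smul, norm_inv, norm_of_nonneg h0.le, smul_eq_mul]
  refine mul_le_mul_of_nonneg_left (norm_sum_le_of_le _ fun n _ => ?_) (by positivity)
  rw [norm_smul, norm_inv, RCLike.norm_natCast]
  exact mul_le_mul_of_nonneg_left (h n) (by positivity)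
lemma av_nonneg (hR : IsAv U R) {b : ℕ → ℝ} (hb : Bd b) (h : ∀ n, 0 ≤ b n) : 0 ≤ R b :=
  (norm_nonneg _).trans (av_norm hR hR hb fun n => (norm_of_nonneg (h n)).le)
lemma av_mono (hR : IsAv U R) {a b : ℕ → ℝ} (ha : Bd a) (hb : Bd b) (h : ∀ n, a n ≤ b n) : R a ≤ R b := by
  rw [← sub_nonneg, ← map_sub]
  exact av_nonneg hR (hb.sub ha) fun n => sub_nonneg.mpr (h n)
lemma av_real (hE : IsAv U E) (hR : IsAv U R) {b : ℕ → ℝ} (hb : Bd b) : E (fun n => (b n : 𝕜)) = (R b : 𝕜) := by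
  obtain ⟨C, hC⟩ := hb
  refine tendsto_nhds_unique (hE.2 _ ⟨C, fun n => by rw [RCLike.norm_ofReal]; exact hC n⟩) (((RCLike.continuous_ofReal (K := 𝕜)).tendsto _).comp (hR.2 b ⟨C, hC⟩) |>.congr fun N => ?_)
  simp [lsum, RCLike.real_smul_eq_coe_mul]
lemma av_congr (hE : IsAv U E) {f g : ℕ → 𝕜} (hf : Bd f) (hg : Bd g) (h : ∀ n, 1 ≤ n → f n = g n) : E f = E g := by
  rw [← sub_eq_zero, ← map_sub]
  refine av_null hE (hf.sub hg) (C := 0) fun N => ?_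
  rw [lsum, sum_eq_zero fun n hn => ?_, norm_zero]
  rw [Pi.sub_apply, h n (mem_Icc.mp hn).1, sub_self, smul_zero]
end av
end
section
noncomputable def lr (n : ℕ) : ℝ := (ArithmeticFunction.liouville n : ℤ)
lemma lr_mul (m n : ℕ) : lr (m * n) = lr m * lr n := by simp [lr, ArithmeticFunction.liouville_apply_mul]
lemma lr_norm (n : ℕ) : ‖lr n‖ ≤ 1 := by
  have := lam_abs n
  rwa [← Complex.ofReal_intCast, norm_real] at this
lemma lr_sq {n : ℕ} (h : 1 ≤ n) : lr n * lr n = 1 := by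
  rw [lr, ArithmeticFunction.liouville_apply (by omega)]
  push_cast
  rw [← mul_pow]; simp
lemma lr_cn (n : ℕ) : ‖(lr n : ℂ)‖ ≤ 1 := by rw [norm_real]; exact lr_norm n
def Sl (θ κ : ℝ) (ψ : ℕ → ℂ) : Prop := (∀ n, ‖ψ n‖ ≤ 1) ∧ ∀ n, ‖ψ (n + 1) - ee θ * ψ n‖ ≤ κ
lemma Sl.step {θ κ : ℝ} {ψ : ℕ → ℂ} (h : Sl θ κ ψ) (n k : ℕ) : ‖ψ (n + k) - ee (k * θ) * ψ n‖ ≤ k * κ := by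
  induction k with
  | zero => simp [ee_zero]
  | succ k ih =>
    have e : ψ (n + (k + 1)) - ee ((k + 1 : ℕ) * θ) * ψ n = (ψ (n + k + 1) - ee θ * ψ (n + k)) + ee θ * (ψ (n + k) - ee (k * θ) * ψ n) := by
      rw [show ((k + 1 : ℕ) : ℝ) * θ = θ + k * θ by push_cast; ring, ee_add, ← add_assoc]; ring
    rw [e]
    refine (norm_add_le_of_le (h.2 _) (show _ ≤ k * κ by rw [norm_mul, ee_norm, one_mul]; exact ih)).trans (le_of_eq ?_)
    push_cast; ring
lemma fin_min {ι : Type*} (S : Finset ι) (f : ι → ℝ) (h : ∀ i ∈ S, 0 < f i) : ∃ κ > 0, ∀ i ∈ S, κ ≤ f i := by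
  classical
  induction S using Finset.induction with
  | empty => exact ⟨1, one_pos, by simp⟩
  | insert a S _ ih =>
    obtain ⟨κ, h0, hk⟩ := ih fun i hi => h i (Finset.mem_insert_of_mem hi)
    refine ⟨min κ (f a), lt_min h0 (h a (Finset.mem_insert_self _ _)), fun i hi => ?_⟩
    rcases Finset.mem_insert.mp hi with rfl | hi
    · exact min_le_right _ _
    · exact (min_le_left _ _).trans (hk i hi)
lemma Bd1 {𝕜 : Type} [RCLike 𝕜] {g : ℕ → 𝕜} (h : ∀ n, ‖g n‖ ≤ 1) : Bd g := ⟨1, h⟩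
section
variable {U : Ultrafilter ℕ} {E : (ℕ → ℂ) →ₗ[ℂ] ℂ} {R : (ℕ → ℝ) →ₗ[ℝ] ℝ}
lemma char_small (hE : IsAv U E) {q : ℕ} [NeZero q] (χ : DirichletCharacter ℂ q) {ε : ℝ} (hε : 0 < ε) :
    ∃ κ > 0, ∀ ψ, Sl 0 κ ψ → ‖E (fun n => χ n * (lr n * ψ n))‖ ≤ ε := by
  obtain ⟨κ, k0, N0, h⟩ := MRlam χ hε
  refine ⟨κ, k0, fun ψ hψ => av_le hE (C := 0) (N0 := N0) (Bd1 fun n => ?_) fun N hN => ?_⟩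
  · rw [norm_mul, norm_mul]
    exact mul_le_one₀ (χ.norm_le_one _) (by positivity) (mul_le_one₀ (lr_cn n) (norm_nonneg _) (hψ.1 n))
  · rw [zero_add]
    refine le_trans (le_of_eq (congrArg norm ?_)) (h ψ hψ.1 (fun n => by simpa [ee_zero] using hψ.2 n) N hN)
    refine sum_congr rfl fun n _ => ?_
    simp only [lc, lr, real_smul]
    push_cast
    ring
lemma cop_small (hE : IsAv U E) {q : ℕ} (hq : 1 ≤ q) {ε : ℝ} (hε : 0 < ε) :
    ∃ κ > 0, ∀ ψ, Sl 0 κ ψ → ∀ b : ℕ, b.Coprime q → ‖E (fun n => if n ≡ b [MOD q] then lr n * ψ n else 0)‖ ≤ ε := by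
  haveI : NeZero q := ⟨by omega⟩
  choose κ k0 hk using fun χ : DirichletCharacter ℂ q => char_small hE χ hε
  obtain ⟨κ', k', hk'⟩ := fin_min univ κ fun i _ => k0 i
  refine ⟨κ', k', fun ψ hψ b hb => ?_⟩
  have bu : IsUnit (b : ZMod q) := (ZMod.isUnit_iff_coprime b q).mpr hb
  have t0 : (0 : ℝ) < q.totient := by exact_mod_cast Nat.totient_pos.mpr hq
  have e : (fun n : ℕ => if n ≡ b [MOD q] then lr n * ψ n else 0) = ∑ χ : DirichletCharacter ℂ q, ((q.totient : ℂ)⁻¹ * χ (b : ZMod q)⁻¹) • fun n : ℕ => χ n * (lr n * ψ n) := by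
    funext n
    have := DirichletCharacter.sum_char_inv_mul_char_eq ℂ bu (n : ZMod q)
    have t1 : (q.totient : ℂ) ≠ 0 := by exact_mod_cast t0.ne'
    simp only [Finset.sum_apply, Pi.smul_apply, smul_eq_mul]
    have e2 : ∀ χ : DirichletCharacter ℂ q, (q.totient : ℂ)⁻¹ * χ (b : ZMod q)⁻¹ * (χ n * (lr n * ψ n)) = (q.totient : ℂ)⁻¹ * (lr n * ψ n) * (χ (b : ZMod q)⁻¹ * χ n) := fun χ => by ring
    simp_rw [e2]
    rw [← mul_sum, this]
    have e3 : ((b : ZMod q) = n) ↔ n ≡ b [MOD q] := by rw [ZMod.natCast_eq_natCast_iff]; exact ⟨fun h => h.symm, fun h => h.symm⟩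
    by_cases hc : n ≡ b [MOD q]
    · rw [if_pos hc, if_pos (e3.mpr hc)]; field_simp
    · rw [if_neg hc, if_neg (mt e3.mp hc), mul_zero]
  rw [e, map_sum]
  have : ∀ χ ∈ (univ : Finset (DirichletCharacter ℂ q)), ‖E (((q.totient : ℂ)⁻¹ * χ (b : ZMod q)⁻¹) • fun n : ℕ => χ n * (lr n * ψ n))‖ ≤ (q.totient : ℝ)⁻¹ * ε := fun χ _ => by
    rw [map_smul, norm_smul, norm_mul, norm_inv, Complex.norm_natCast]
    have h1 := hk χ ψ ⟨hψ.1, fun n => (hψ.2 n).trans (hk' χ (mem_univ _))⟩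
    refine mul_le_mul (mul_le_of_le_one_right (by positivity) (χ.norm_le_one _)) h1 (norm_nonneg _) (by positivity)
  refine (norm_sum_le_of_le _ this).trans ?_
  rw [sum_const, nsmul_eq_mul, card_univ, ← Nat.card_eq_fintype_card, DirichletCharacter.card_eq_totient_of_hasEnoughRootsOfUnity ℂ q, ← mul_assoc, mul_inv_cancel₀ t0.ne', one_mul]
lemma rat_small (hE : IsAv U E) {q : ℕ} (hq : 1 ≤ q) {ε : ℝ} (hε : 0 < ε) :
    ∃ κ > 0, ∀ ψ, Sl 0 κ ψ → ∀ b : ℕ, ‖E (fun n => if n ≡ b [MOD q] then lr n * ψ n else 0)‖ ≤ ε := by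
  choose! κ k0 hk using fun (q : ℕ) (h : 1 ≤ q) => cop_small hE h hε
  obtain ⟨κ', k', hk'⟩ := fin_min (Icc 1 q) κ fun i hi => k0 i (mem_Icc.mp hi).1
  have q0 : (0 : ℝ) < q := by exact_mod_cast hq
  refine ⟨κ' / q, by positivity, fun ψ hψ b => ?_⟩
  obtain ⟨d, hd⟩ : ∃ d, d = b.gcd q := ⟨_, rfl⟩
  have d0 : 0 < d := hd ▸ Nat.gcd_pos_of_pos_right b hq
  obtain ⟨q', hq'⟩ : d ∣ q := hd ▸ Nat.gcd_dvd_right b q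
  obtain ⟨b', hb'⟩ : d ∣ b := hd ▸ Nat.gcd_dvd_left b q
  have cop : b'.Coprime q' := by
    have := hd
    rw [hb', hq', Nat.gcd_mul_left] at this
    exact eq_of_mul_eq_mul_left d0 (by rw [mul_one]; exact this.symm)
  have q1 : 1 ≤ q' := Nat.pos_of_ne_zero fun h => by simp [h] at hq'; omega
  have B : Bd (fun n => if n ≡ b [MOD q] then (lr n : ℂ) * ψ n else 0) := Bd1 fun n => by
    split_ifs
    · rw [norm_mul]; exact mul_le_one₀ (lr_cn n) (norm_nonneg _) (hψ.1 n)
    · simp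
  have e1 : (fun n => if n ≡ b [MOD q] then (lr n : ℂ) * ψ n else 0) = fun n => if d ∣ n then (if n ≡ b [MOD q] then (lr n : ℂ) * ψ n else 0) else 0 := by
    funext n
    by_cases h : d ∣ n
    · rw [if_pos h]
    · rw [if_neg h, if_neg fun hc => h ?_]
      exact (hc.dvd_iff (hd ▸ Nat.gcd_dvd_right b q)).mpr ⟨b', hb'⟩
  have e2 : (fun n => if d * n ≡ b [MOD q] then (lr (d * n) : ℂ) * ψ (d * n) else 0) = (lr d : ℂ) • fun n => if n ≡ b' [MOD q'] then (lr n : ℂ) * ψ (d * n) else 0 := by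
    funext n
    rw [hb', hq']
    simp only [ModEq.mul_left_cancel_iff' d0.ne', Pi.smul_apply, smul_eq_mul, lr_mul]
    split_ifs
    · push_cast; ring
    · simp
  rw [e1, av_dil hE B d0, e2, map_smul, smul_eq_mul, norm_mul, norm_mul, norm_inv, Complex.norm_natCast]
  have dq : d ≤ q := le_of_dvd hq (hd ▸ Nat.gcd_dvd_right b q)
  have s : Sl 0 (κ q') (fun n => ψ (d * n)) := ⟨fun n => hψ.1 _, fun n => by
    have := hψ.step (d * n) d
    rw [mul_zero, ← mul_add_one] at this
    refine this.trans (le_trans ?_ (hk' q' (mem_Icc.mpr ⟨q1, le_of_dvd hq ⟨d, by rw [hq', mul_comm]⟩⟩)))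
    rw [mul_div_assoc', div_le_iff₀ q0, mul_comm]
    exact mul_le_mul_of_nonneg_left (by exact_mod_cast dq) k'.le⟩
  have d1 : ((d : ℕ) : ℝ)⁻¹ ≤ 1 := inv_le_one_of_one_le₀ (by exact_mod_cast d0)
  calc _ ≤ 1 * (1 * ε) := mul_le_mul d1 (mul_le_mul (lr_cn d) (hk q' q1 _ s b' cop) (norm_nonneg _) zero_le_one) (by positivity) zero_le_one
    _ = ε := by ring
lemma ratθ (hE : IsAv U E) {θ : ℝ} {q : ℕ} (hq : 1 ≤ q) (hθ : ee (q * θ) = 1) {ε : ℝ} (hε : 0 < ε) :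
    ∃ κ > 0, ∀ ψ, Sl θ κ ψ → ‖E (fun n => lr n * ψ n)‖ ≤ ε := by
  have q0 : (0 : ℝ) < q := by exact_mod_cast hq
  obtain ⟨κ, k0, hk⟩ := rat_small hE hq (ε := ε / q) (by positivity)
  refine ⟨κ, k0, fun ψ hψ => ?_⟩
  set ψ0 : ℕ → ℂ := fun n => ee (-(n * θ)) * ψ n with h0
  have s : Sl 0 κ ψ0 := ⟨fun n => by rw [h0, norm_mul, ee_norm, one_mul]; exact hψ.1 n, fun n => by
    have : ψ0 (n + 1) - ee 0 * ψ0 n = ee (-((n + 1 : ℕ) * θ)) * (ψ (n + 1) - ee θ * ψ n) := by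
      rw [h0, ee_zero, mul_sub, ← mul_assoc (ee _) (ee θ), ← ee_add, show -(((n + 1 : ℕ) : ℝ) * θ) + θ = -(n * θ) by push_cast; ring, one_mul]
    rw [this, norm_mul, ee_norm, one_mul]; exact hψ.2 n⟩
  have e : (fun n : ℕ => (lr n : ℂ) * ψ n) = ∑ b ∈ range q, ee (b * θ) • fun n : ℕ => if n ≡ b [MOD q] then lr n * ψ0 n else 0 := by
    funext n
    simp only [Finset.sum_apply, Pi.smul_apply, smul_eq_mul, mul_ite, mul_zero]
    rw [sum_eq_single (n % q)]
    · rw [if_pos (Nat.mod_modEq n q).symm]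
      have : ee (n * θ) = ee ((n % q : ℕ) * θ) := by
        conv_lhs => rw [← Nat.mod_add_div n q]
        rw [show (((n % q + q * (n / q) : ℕ) : ℝ)) * θ = (n % q : ℕ) * θ + (n / q : ℕ) * (q * θ) by push_cast; ring, ee_add, ee_nat_mul (n / q), hθ, one_pow, mul_one]
      rw [← this, h0]
      calc _ = (ee (n * θ) * ee (-(n * θ))) * (lr n * ψ n) := by rw [← ee_add, add_neg_cancel, ee_zero, one_mul]
        _ = _ := by ring
    · intro b hb hne
      rw [if_neg fun hc => hne ?_]
      rw [hc, Nat.mod_eq_of_lt (mem_range.mp hb)]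
    · intro h; exact absurd (mem_range.mpr (Nat.mod_lt n hq)) h
  rw [e, map_sum]
  have : ∀ b ∈ range q, ‖E (ee (b * θ) • fun n : ℕ => if n ≡ b [MOD q] then lr n * ψ0 n else 0)‖ ≤ ε / q := fun b _ => by
    rw [map_smul, norm_smul, ee_norm, one_mul]; exact hk ψ0 s b
  refine (norm_sum_le_of_le _ this).trans (le_of_eq ?_)
  rw [sum_const, card_range, nsmul_eq_mul]; field_simp
lemma off_diag (hE : IsAv U E) {θ κ : ℝ} {ψ : ℕ → ℂ} (h : Sl θ κ ψ) (p r : ℕ) :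
    ‖1 - ee ((p - r) * θ)‖ * ‖E (fun m => ψ (p * m) * (starRingEnd ℂ) (ψ (r * m)))‖ ≤ (p + r) * κ := by
  set g : ℕ → ℂ := fun m => ψ (p * m) * (starRingEnd ℂ) (ψ (r * m)) with hg
  have B : Bd g := Bd1 fun n => by
    rw [hg, norm_mul, RCLike.norm_conj]; exact mul_le_one₀ (h.1 _) (norm_nonneg _) (h.1 _)
  have e : (1 - ee ((p - r) * θ)) * E g = E ((fun m => g (m + 1)) - ee ((p - r) * θ) • g) := by
    rw [map_sub, map_smul, av_shift hE B, smul_eq_mul]; ring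
  have k0 : 0 ≤ κ := (norm_nonneg _).trans (h.2 0)
  rw [← norm_mul, e]
  have key : ∀ m, ‖((fun m => g (m + 1)) - ee ((p - r) * θ) • g) m‖ ≤ (p + r) * κ := fun m => by
    have h1 := h.step (p * m) p
    have h2 := h.step (r * m) r
    rw [← mul_add_one] at h1 h2
    rw [← RCLike.norm_conj, map_sub, map_mul, ee_conj] at h2
    have e2 : ((fun m => g (m + 1)) - ee ((p - r) * θ) • g) m = (ψ (p * (m + 1)) - ee (p * θ) * ψ (p * m)) * (starRingEnd ℂ) (ψ (r * (m + 1)))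
        + ee (p * θ) * ψ (p * m) * ((starRingEnd ℂ) (ψ (r * (m + 1))) - ee (-(r * θ)) * (starRingEnd ℂ) (ψ (r * m))) := by
      simp only [Pi.sub_apply, Pi.smul_apply, smul_eq_mul, hg]
      rw [show ((p : ℝ) - r) * θ = p * θ + -(r * θ) by ring, ee_add]; ring
    rw [e2, add_mul]
    refine norm_add_le_of_le ?_ ?_
    · rw [norm_mul, RCLike.norm_conj]
      exact (mul_le_mul h1 (h.1 _) (norm_nonneg _) (by positivity)).trans (by rw [mul_one])
    · rw [norm_mul, norm_mul, ee_norm, one_mul]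
      exact (mul_le_mul (h.1 _) h2 (norm_nonneg _) zero_le_one).trans (by rw [one_mul])
  refine av_le hE (C := (p + r) * κ) (N0 := 0) ⟨_, key⟩ fun N _ => (lsum_le key N).trans (le_of_eq (by ring))
lemma av_dvd (hR : IsAv U R) {d : ℕ} (hd : 1 ≤ d) : R (fun n => if d ∣ n then 1 else 0) = (d : ℝ)⁻¹ := by
  rw [av_dil hR (g := fun _ => 1) (Bd1 fun _ => by simp) hd, av_one hR, mul_one]
lemma av_tk (hR : IsAv U R) (P : Finset ℕ) (hP : ∀ p ∈ P, p.Prime) : R (fun n => (om P n - sumInv P) ^ 2) ≤ sumInv P := by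
  have e : (fun n => (om P n - sumInv P) ^ 2) = (∑ p ∈ P, ∑ r ∈ P, fun n => (if p ∣ n then (1 : ℝ) else 0) * (if r ∣ n then 1 else 0))
      - (2 * sumInv P) • (∑ p ∈ P, fun n => if p ∣ n then (1 : ℝ) else 0) + sumInv P ^ 2 • fun _ => 1 := by
    funext n
    simp only [Pi.add_apply, Pi.sub_apply, Pi.smul_apply, Finset.sum_apply, smul_eq_mul, om]
    rw [← sum_mul_sum]; ring
  rw [e, map_add, map_sub, map_smul, map_smul, map_sum, map_sum, av_one hR]
  simp_rw [map_sum]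
  have e2 : ∑ p ∈ P, R (fun n => if p ∣ n then (1 : ℝ) else 0) = sumInv P := sum_congr rfl fun p hp => by rw [av_dvd hR (hP p hp).one_le, one_div]
  have e3 : ∀ p ∈ P, ∀ r ∈ P, R (fun n => (if p ∣ n then (1 : ℝ) else 0) * (if r ∣ n then 1 else 0)) ≤ 1 / (p : ℝ) * (1 / r) + if p = r then 1 / (p : ℝ) else 0 := fun p hp r hr => by
    have : ∀ n, (if p ∣ n then (1 : ℝ) else 0) * (if r ∣ n then 1 else 0) = if p.lcm r ∣ n then 1 else 0 := fun n => by
      by_cases h1 : p ∣ n <;> by_cases h2 : r ∣ n <;> simp [h1, h2, Nat.lcm_dvd_iff]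
    simp_rw [this]
    have p0 := (hP p hp).pos
    rw [av_dvd hR (lcm_pos p0 (hP r hr).pos)]
    split_ifs with h
    · subst h
      rw [Nat.lcm_self, one_div]
      have : 0 ≤ (p : ℝ)⁻¹ * (p : ℝ)⁻¹ := by positivity
      linarith
    · rw [((coprime_primes (hP p hp) (hP r hr)).mpr h).lcm_eq_mul, add_zero, cast_mul, mul_inv, one_div, one_div]
  have e4 := sum_le_sum fun p hp => sum_le_sum (e3 p hp)
  simp_rw [sum_add_distrib, ← mul_sum, ← sum_mul, sum_ite_eq] at e4
  have e5 : ∑ p ∈ P, (if p ∈ P then 1 / (p : ℝ) else 0) = sumInv P := sum_congr rfl fun p hp => if_pos hp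
  rw [e5] at e4
  change _ ≤ sumInv P * sumInv P + sumInv P at e4
  rw [e2, smul_eq_mul, smul_eq_mul]
  linarith
lemma amgm {L : ℝ} (hL : 0 < L) (x : ℝ) : |x| ≤ (2 * √L)⁻¹ * x ^ 2 + √L / 2 := by
  have s0 : 0 < √L := sqrt_pos.mpr hL
  have : (2 * √L)⁻¹ * x ^ 2 + √L / 2 - |x| = (2 * √L)⁻¹ * (|x| - √L) ^ 2 := by
    rw [sub_sq, sq_abs]; field_simp; ring
  have h2 : 0 ≤ (2 * √L)⁻¹ * (|x| - √L) ^ 2 := by positivity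
  linarith
lemma av_amgm (hR : IsAv U R) {L K : ℝ} (hL : 0 < L) {b : ℕ → ℝ} (hb : Bd b) (h : R (fun n => b n ^ 2) ≤ K * L) : R (fun n => |b n|) ≤ (K + 1) / 2 * √L := by
  have s0 : 0 < √L := sqrt_pos.mpr hL
  have ss : √L * √L = L := mul_self_sqrt hL.le
  have B2 : Bd (fun n => b n ^ 2) := by simpa only [sq] using hb.mul hb
  have := av_mono hR (a := fun n => |b n|) (b := (2 * √L)⁻¹ • (fun n => b n ^ 2) + (√L / 2) • fun _ => 1)
    (by obtain ⟨C, hC⟩ := hb; exact ⟨C, fun n => by rw [norm_eq_abs, abs_abs]; exact hC n⟩)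
    (Bd.add (Bd.mul (f := fun _ => (2 * √L)⁻¹) ⟨_, fun _ => le_rfl⟩ B2) (Bd.mul (f := fun _ => √L / 2) ⟨_, fun _ => le_rfl⟩ (Bd1 (g := fun _ => (1 : ℝ)) fun _ => by simp)))
    fun n => by simpa using amgm hL (b n)
  refine this.trans ?_
  rw [map_add, map_smul, map_smul, av_one hR, smul_eq_mul, smul_eq_mul, mul_one]
  have h3 : (2 * √L)⁻¹ * R (fun n => b n ^ 2) ≤ (2 * √L)⁻¹ * (K * (√L * √L)) := mul_le_mul_of_nonneg_left (by rw [ss]; exact h) (by positivity)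
  have h4 : (2 * √L)⁻¹ * (K * (√L * √L)) = K / 2 * √L := by field_simp
  linarith
lemma irrθ (hE : IsAv U E) (hR : IsAv U R) {θ : ℝ} (hθ : ∀ q : ℕ, 1 ≤ q → ee (q * θ) ≠ 1) {ε : ℝ} (hε : 0 < ε) :
    ∃ κ > 0, ∀ ψ, Sl θ κ ψ → ‖E (fun n => lr n * ψ n)‖ ≤ ε := by
  obtain ⟨P, hP, hL⟩ : ∃ P : Finset ℕ, (∀ p ∈ P, p.Prime) ∧ 9 / ε ^ 2 + 1 ≤ sumInv P := by
    obtain ⟨a, a1, ha⟩ := mertens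
    refine ⟨prs (exp a) (exp (exp (24 * (9 / ε ^ 2 + 1) + Real.log (a + 3)))), fun p hp => (mem_filter.mp hp).2, ?_⟩
    refine le_trans (le_of_eq ?_) (ha a _ le_rfl ?_)
    · rw [log_exp]; ring
    · rw [exp_add, exp_log (by linarith)]
      have := one_le_exp (show 0 ≤ 24 * (9 / ε ^ 2 + 1) by positivity)
      nlinarith
  set L := sumInv P with hLd
  have L0 : 0 < L := lt_of_lt_of_le (by positivity) hL
  have ne1 : ∀ x ∈ P.offDiag, ee (((x.1 : ℝ) - x.2) * θ) ≠ 1 := fun x hx hc => by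
    obtain ⟨-, -, hne⟩ := mem_offDiag.mp hx
    rcases lt_or_gt_of_ne hne with h | h
    · refine hθ (x.2 - x.1) (by omega) ?_
      rw [cast_sub h.le, show ((x.2 : ℝ) - x.1) * θ = -((x.1 - x.2) * θ) by ring, ee_neg, hc, inv_one]
    · exact hθ (x.1 - x.2) (by omega) (by rw [cast_sub h.le]; exact hc)
  obtain ⟨κ, k0, hk⟩ := fin_min P.offDiag (fun x => ‖1 - ee (((x.1 : ℝ) - x.2) * θ)‖ / ((x.1 + x.2) * L)) fun x hx => by
    have h1 := norm_pos_iff.mpr (sub_ne_zero.mpr (ne1 x hx).symm)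
    have h2 : (0 : ℝ) < x.1 := by exact_mod_cast (hP _ (mem_offDiag.mp hx).1).pos
    positivity
  refine ⟨κ, k0, fun ψ hψ => ?_⟩
  have od : ∀ p ∈ P, ∀ r ∈ P, ‖E (fun m => ψ (p * m) * (starRingEnd ℂ) (ψ (r * m)))‖ ≤ 1 / L + if p = r then 1 else 0 := fun p hp r hr => by
    by_cases h : p = r
    · rw [if_pos h]
      have : ‖E (fun m => ψ (p * m) * (starRingEnd ℂ) (ψ (r * m)))‖ ≤ R (fun _ => 1) := av_norm hE hR (Bd1 fun _ => by simp) fun n => by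
        rw [norm_mul, RCLike.norm_conj]; exact mul_le_one₀ (hψ.1 _) (norm_nonneg _) (hψ.1 _)
      rw [av_one hR] at this
      have : 0 ≤ 1 / L := by positivity
      linarith
    · have hx : (p, r) ∈ P.offDiag := mem_offDiag.mpr ⟨hp, hr, h⟩
      have h1 := norm_pos_iff.mpr (sub_ne_zero.mpr (ne1 _ hx).symm)
      have h2 : (0 : ℝ) < p := by exact_mod_cast (hP p hp).pos
      have h3 := off_diag hE hψ p r
      have h4 := hk _ hx
      simp only at h1 h4
      rw [le_div_iff₀ (by positivity)] at h4
      rw [if_neg h, add_zero, le_div_iff₀ L0]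
      refine le_of_mul_le_mul_left ?_ h1
      have := mul_le_mul_of_nonneg_right h3 L0.le
      linarith
  set z : ℕ → ℂ := fun m => ∑ p ∈ P, (p : ℂ)⁻¹ * ψ (p * m) with hz
  have zb : Bd z := ⟨∑ p ∈ P, (p : ℝ)⁻¹, fun n => norm_sum_le_of_le _ fun p _ => by
    rw [norm_mul, norm_inv, Complex.norm_natCast]; exact mul_le_of_le_one_right (by positivity) (hψ.1 _)⟩
  have zn : Bd (fun n => ‖z n‖) := by
    obtain ⟨C, hC⟩ := zb
    exact ⟨C, fun n => by rw [norm_norm]; exact hC n⟩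
  have z2 : R (fun n => ‖z n‖ ^ 2) ≤ 2 * L := by
    have e := av_real hE hR (b := fun n => ‖z n‖ ^ 2) (by simpa only [sq] using zn.mul zn)
    have e2 : (fun n => ((‖z n‖ ^ 2 : ℝ) : ℂ)) = ∑ p ∈ P, ∑ r ∈ P, ((p : ℂ)⁻¹ * (r : ℂ)⁻¹) • fun m => ψ (p * m) * (starRingEnd ℂ) (ψ (r * m)) := by
      funext n
      rw [hz, normsq_sum]
      simp only [Finset.sum_apply, Pi.smul_apply, smul_eq_mul, map_mul, map_inv₀, Complex.conj_natCast]
      exact sum_congr rfl fun p _ => sum_congr rfl fun r _ => by ring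
    have e3 := congrArg norm e
    change ‖E (fun n => ((‖z n‖ ^ 2 : ℝ) : ℂ))‖ = ‖((R (fun n => ‖z n‖ ^ 2) : ℝ) : ℂ)‖ at e3
    rw [norm_real, e2] at e3
    refine (le_abs_self _).trans (e3.symm.le.trans ?_)
    simp_rw [map_sum, map_smul]
    have : ∀ p ∈ P, ‖∑ r ∈ P, ((p : ℂ)⁻¹ * (r : ℂ)⁻¹) • E (fun m => ψ (p * m) * (starRingEnd ℂ) (ψ (r * m)))‖ ≤ 1 / p * L * (1 / L) + 1 / p := fun p hp => by
      refine (norm_sum_le_of_le _ (f := fun r : ℕ => ((p : ℂ)⁻¹ * (r : ℂ)⁻¹) • E (fun m => ψ (p * m) * (starRingEnd ℂ) (ψ (r * m)))) (fun r hr => (?_ : _ ≤ 1 / (p : ℝ) * (1 / r) * (1 / L) + if p = r then 1 / (p : ℝ) else 0))).trans ?_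
      · rw [norm_smul, norm_mul, norm_inv, norm_inv, Complex.norm_natCast, Complex.norm_natCast]
        refine (mul_le_mul_of_nonneg_left (od p hp r hr) (by positivity)).trans ?_
        rw [mul_add, one_div (p : ℝ), one_div (r : ℝ)]
        refine add_le_add le_rfl ?_
        split_ifs
        · rw [mul_one]
          exact mul_le_of_le_one_right (by positivity) (inv_le_one_of_one_le₀ (by exact_mod_cast (hP r hr).one_le))
        · rw [mul_zero]
      · rw [sum_add_distrib, ← sum_mul, ← mul_sum, sum_ite_eq, if_pos hp]
        exact le_rfl
    refine (norm_sum_le_of_le _ this).trans ?_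
    rw [sum_add_distrib, ← sum_mul, ← sum_mul]
    change L * L * (1 / L) + L ≤ 2 * L
    rw [mul_assoc, mul_one_div_cancel L0.ne']
    linarith
  have omb : Bd (fun n => om P n - L) := ⟨P.card + L, fun n => by
    refine (abs_sub _ _).trans (add_le_add ?_ (abs_of_pos L0).le)
    rw [abs_of_nonneg (om_nonneg P n), om, sum_boole]
    exact_mod_cast card_filter_le _ _⟩
  have f1 : R (fun n => |om P n - L|) ≤ (1 + 1) / 2 * √L := av_amgm hR L0 omb (by rw [one_mul]; exact av_tk hR P hP)
  have f2 : R (fun n => |‖z n‖|) ≤ (2 + 1) / 2 * √L := av_amgm hR L0 zn z2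
  have B : Bd (fun n => (lr n : ℂ) * ψ n) := Bd1 fun n => by rw [norm_mul]; exact mul_le_one₀ (lr_cn n) (norm_nonneg _) (hψ.1 n)
  have main : (L : ℂ) * E (fun n => lr n * ψ n) = - E (fun n => lr n * z n) - E (fun n => ((om P n - L : ℝ) : ℂ) * (lr n * ψ n)) := by
    have e1 : (fun n => ((om P n - L : ℝ) : ℂ) * (lr n * ψ n)) = (∑ p ∈ P, fun n => if p ∣ n then (lr n : ℂ) * ψ n else 0) - (L : ℂ) • fun n => lr n * ψ n := by
      funext n
      simp only [Pi.sub_apply, Finset.sum_apply, Pi.smul_apply, smul_eq_mul, om]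
      push_cast
      rw [sub_mul, sum_mul]
      congr 1
      exact sum_congr rfl fun p _ => by split_ifs <;> simp
    have e2 : (fun n => (lr n : ℂ) * z n) = ∑ p ∈ P, (p : ℂ)⁻¹ • fun n => lr n * ψ (p * n) := by
      funext n
      simp only [hz, Finset.sum_apply, Pi.smul_apply, smul_eq_mul, mul_sum]
      exact sum_congr rfl fun p _ => by ring
    have e3 : ∀ p ∈ P, E (fun n => if p ∣ n then (lr n : ℂ) * ψ n else 0) = - E ((p : ℂ)⁻¹ • fun n => lr n * ψ (p * n)) := fun p hp => by
      rw [av_dil hE B (hP p hp).one_le, map_smul, smul_eq_mul, ← mul_neg, ← map_neg]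
      congr 2
      funext n
      have : lr p = -1 := by simp [lr, ArithmeticFunction.liouville_apply (hP p hp).ne_zero, ArithmeticFunction.cardFactors_apply_prime (hP p hp)]
      simp [lr_mul, this]
    rw [e1, e2, map_sub, map_sum, map_sum, sum_congr rfl e3, map_smul, smul_eq_mul, Finset.sum_neg_distrib]
    ring
  have g1 : ‖E (fun n => lr n * z n)‖ ≤ R (fun n => |‖z n‖|) := av_norm hE hR (by simpa using zn) fun n => by
    rw [norm_mul, abs_norm]; exact mul_le_of_le_one_left (norm_nonneg _) (lr_cn n)
  have g2 : ‖E (fun n => ((om P n - L : ℝ) : ℂ) * (lr n * ψ n))‖ ≤ R (fun n => |om P n - L|) := av_norm hE hR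
    (by obtain ⟨C, hC⟩ := omb; exact ⟨C, fun n => by rw [norm_eq_abs, abs_abs]; exact hC n⟩) fun n => by
    rw [norm_mul, norm_mul, norm_real]
    exact mul_le_of_le_one_right (norm_nonneg _) (mul_le_one₀ (lr_cn n) (norm_nonneg _) (hψ.1 n))
  have m2 := congrArg norm main
  rw [norm_mul, norm_real, norm_of_nonneg L0.le, ← neg_add', norm_neg] at m2
  have m3 := m2.le.trans (norm_add_le _ _)
  have s0 : 0 < √L := sqrt_pos.mpr L0
  have ss : √L * √L = L := mul_self_sqrt L0.le
  have s3 : 3 ≤ ε * √L := by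
    refine le_of_sq_le_sq ?_ (by positivity)
    rw [mul_pow, sq_sqrt L0.le]
    have : 9 / ε ^ 2 ≤ L := by linarith
    rw [div_le_iff₀ (by positivity)] at this
    linarith
  refine le_of_mul_le_mul_left ?_ L0
  have := mul_le_mul_of_nonneg_right s3 s0.le
  rw [mul_assoc, ss] at this
  linarith
theorem slowθ (hE : IsAv U E) (hR : IsAv U R) (θ : ℝ) {ε : ℝ} (hε : 0 < ε) :
    ∃ κ > 0, ∀ ψ, Sl θ κ ψ → ‖E (fun n => lr n * ψ n)‖ ≤ ε := by
  by_cases h : ∃ q : ℕ, 1 ≤ q ∧ ee (q * θ) = 1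
  · obtain ⟨q, hq, h⟩ := h
    exact ratθ hE hq h hε
  · push Not at h
    exact irrθ hE hR h hε
end
end
section
noncomputable def cor (R : (ℕ → ℝ) →ₗ[ℝ] ℝ) (d : ℕ) : ℝ := R (fun n => lr n * lr (n + d))
noncomputable def SS (D : ℕ) (θ : ℝ) (n : ℕ) : ℂ := ∑ j ∈ range D, lr (n + j) * ee (j * θ)
noncomputable def WW (R : (ℕ → ℝ) →ₗ[ℝ] ℝ) (D : ℕ) (θ : ℝ) : ℝ := R (fun n => ‖SS D θ n‖ ^ 2)
def NN (D : ℕ) (m : ℤ) : ℕ := ((range D ×ˢ range D).filter fun x => (x.1 : ℤ) - x.2 = m).card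
section
variable {U : Ultrafilter ℕ} {E : (ℕ → ℂ) →ₗ[ℂ] ℂ} {R : (ℕ → ℝ) →ₗ[ℝ] ℝ}
lemma lr2 (a b : ℕ) : ‖lr a * lr b‖ ≤ 1 := by rw [norm_mul]; exact mul_le_one₀ (lr_norm a) (norm_nonneg _) (lr_norm b)
lemma cor_shift (hR : IsAv U R) (j k : ℕ) : R (fun n => lr (n + j) * lr (n + k)) = cor R ((j : ℤ) - k).natAbs := by
  wlog h : j ≤ k with H
  · have := H hR k j (by omega)
    rw [show ((j : ℤ) - k).natAbs = ((k : ℤ) - j).natAbs by omega, ← this]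
    simp_rw [mul_comm]
  · have := av_shift hR (g := fun n => lr n * lr (n + (k - j))) (Bd1 fun n => lr2 _ _) j
    rw [show ((j : ℤ) - k).natAbs = k - j by omega, cor, ← this]
    congr 1; funext n
    rw [show n + j + (k - j) = n + k by omega]
lemma cor_le (hR : IsAv U R) (d : ℕ) : |cor R d| ≤ 1 := by
  have := av_norm hR hR (g := fun n => lr n * lr (n + d)) (b := fun _ => 1) (Bd1 fun _ => by simp) fun n => lr2 _ _
  rwa [av_one hR] at this
lemma SS_le (D : ℕ) (θ : ℝ) (n : ℕ) : ‖SS D θ n‖ ≤ D := by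
  have : ∀ j ∈ range D, ‖lr (n + j) * ee (j * θ)‖ ≤ 1 := fun j _ => by rw [norm_mul, ee_norm, mul_one]; exact lr_cn _
  exact (norm_sum_le_of_le _ this).trans (by simp)
lemma SS_bd (D : ℕ) (θ : ℝ) : Bd (fun n => ‖SS D θ n‖ ^ 2) := ⟨(D : ℝ) ^ 2, fun n => by
  rw [norm_pow, norm_norm]; exact pow_le_pow_left₀ (norm_nonneg _) (SS_le D θ n) 2⟩
lemma WW_nonneg (hR : IsAv U R) (D : ℕ) (θ : ℝ) : 0 ≤ WW R D θ := av_nonneg hR (SS_bd D θ) fun _ => by positivity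
lemma WW_eq (hE : IsAv U E) (hR : IsAv U R) (D : ℕ) (θ : ℝ) :
    (WW R D θ : ℂ) = ∑ m ∈ Ioo (-(D : ℤ)) D, ((NN D m * cor R m.natAbs : ℝ) : ℂ) * ee (m * θ) := by
  have e1 := av_real hE hR (SS_bd D θ)
  have e2 : (fun n => ((‖SS D θ n‖ ^ 2 : ℝ) : ℂ)) = ∑ j ∈ range D, ∑ k ∈ range D, ee (((j : ℤ) - k : ℤ) * θ) • fun n => ((lr (n + j) * lr (n + k) : ℝ) : ℂ) := by
    funext n
    rw [SS, normsq_sum]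
    simp only [Finset.sum_apply, Pi.smul_apply, smul_eq_mul, map_mul, ee_conj, conj_ofReal]
    refine sum_congr rfl fun j _ => sum_congr rfl fun k _ => ?_
    push_cast
    rw [sub_mul, ee_sub]; ring
  change E (fun n => ((‖SS D θ n‖ ^ 2 : ℝ) : ℂ)) = ((WW R D θ : ℝ) : ℂ) at e1
  rw [← e1, e2, map_sum]
  simp_rw [map_sum, map_smul]
  have e3 : ∀ j k : ℕ, E (fun n => ((lr (n + j) * lr (n + k) : ℝ) : ℂ)) = (cor R ((j : ℤ) - k).natAbs : ℂ) := fun j k => by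
    rw [← cor_shift hR]; exact av_real hE hR (Bd1 fun n => lr2 _ _)
  simp_rw [e3, smul_eq_mul]
  rw [← sum_product', ← Finset.sum_fiberwise_of_maps_to (g := fun x : ℕ × ℕ => (x.1 : ℤ) - x.2) (t := Ioo (-(D : ℤ)) D)]
  · refine sum_congr rfl fun m _ => ?_
    rw [sum_congr rfl fun x hx => by rw [(mem_filter.mp hx).2], sum_const, nsmul_eq_mul, NN]
    push_cast; ring
  · intro x hx
    have := mem_product.mp hx
    rw [mem_range, mem_range] at this
    rw [mem_Ioo]; omega
lemma WW_small (hE : IsAv U E) (hR : IsAv U R) (θ : ℝ) {ε : ℝ} (hε : 0 < ε) : ∃ D0 : ℕ, ∀ D ≥ D0, WW R D θ ≤ ε * D ^ 2 := by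
  obtain ⟨κ, k0, hk⟩ := slowθ hE hR θ hε
  obtain ⟨D0, hD0⟩ := exists_nat_gt (2 / κ)
  refine ⟨D0 + 1, fun D hD => ?_⟩
  have D1 : (0 : ℝ) < D := by exact_mod_cast (by omega : 0 < D)
  have Dk : 2 / κ ≤ D := hD0.le.trans (by exact_mod_cast (by omega : D0 ≤ D))
  set u : ℤ → ℂ := fun m => if 0 ≤ m then (starRingEnd ℂ) (SS D θ m.toNat) else 0 with hu
  have ub : ∀ m, ‖u m‖ ≤ D := fun m => by
    rw [hu]; dsimp only
    split_ifs
    · rw [RCLike.norm_conj]; exact SS_le _ _ _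
    · rw [norm_zero]; exact D1.le
  set v : ℕ → ℂ := fun n => ∑ j ∈ range D, ee (j * θ) * u (n - j) with hv
  have vb : ∀ n, ‖v n‖ ≤ D ^ 2 := fun n => by
    have : ∀ j ∈ range D, ‖ee (j * θ) * u (n - j)‖ ≤ D := fun j _ => by rw [norm_mul, ee_norm, one_mul]; exact ub _
    exact (norm_sum_le_of_le _ this).trans (by simp [sq])
  have s : Sl θ κ (fun n => (D ^ 2 : ℂ)⁻¹ * v n) := by
    constructor
    · intro n
      rw [norm_mul, norm_inv, norm_pow, Complex.norm_natCast, inv_mul_le_iff₀ (by positivity), mul_one]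
      exact vb n
    · intro n
      have e : v (n + 1) - ee θ * v n = u (n + 1) - ee (D * θ) * u (n + 1 - D) := by
        have h1 := sum_range_succ (fun j : ℕ => ee (j * θ) * u ((n : ℤ) + 1 - j)) D
        rw [sum_range_succ'] at h1
        have h2 : ∑ j ∈ range D, ee ((j + 1 : ℕ) * θ) * u ((n : ℤ) + 1 - (j + 1 : ℕ)) = ee θ * v n := by
          rw [hv, mul_sum]
          refine sum_congr rfl fun j _ => ?_
          rw [show ((j + 1 : ℕ) : ℝ) * θ = θ + j * θ by push_cast; ring, ee_add, show (n : ℤ) + 1 - (j + 1 : ℕ) = n - j by push_cast; ring, mul_assoc]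
        rw [h2] at h1
        have h3 : v (n + 1) = ∑ j ∈ range D, ee (j * θ) * u ((n : ℤ) + 1 - j) := by rw [hv]; push_cast; rfl
        rw [h3]
        simp only [cast_zero, zero_mul, ee_zero, one_mul, sub_zero] at h1
        linear_combination -h1
      rw [show ∀ a b c d : ℂ, a * b - c * (a * d) = a * (b - c * d) by intros; ring, e, norm_mul, norm_inv, norm_pow, Complex.norm_natCast, inv_mul_le_iff₀ (by positivity)]
      have h4 : ‖ee (D * θ) * u (n + 1 - D)‖ ≤ D := by rw [norm_mul, ee_norm, one_mul]; exact ub _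
      refine (norm_sub_le_of_le (ub _) h4).trans ?_
      rw [div_le_iff₀ k0] at Dk
      nlinarith
  have key : (WW R D θ : ℂ) = (D ^ 2 : ℂ) * E (fun n => lr n * ((D ^ 2 : ℂ)⁻¹ * v n)) := by
    rw [← smul_eq_mul, ← map_smul]
    have e0 : ((D ^ 2 : ℂ) • fun n => (lr n : ℂ) * ((D ^ 2 : ℂ)⁻¹ * v n)) = ∑ j ∈ range D, ee (j * θ) • fun n : ℕ => (lr n : ℂ) * u (n - j) := by
      funext n
      have : (D : ℂ) ≠ 0 := by exact_mod_cast D1.ne'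
      simp only [Finset.sum_apply, Pi.smul_apply, smul_eq_mul, hv]
      have g : ∀ a s : ℂ, (D ^ 2 : ℂ) * (a * ((D ^ 2 : ℂ)⁻¹ * s)) = a * s := fun a s => by field_simp
      rw [g, mul_sum]
      exact sum_congr rfl fun j _ => by ring
    have e1 := av_real hE hR (SS_bd D θ)
    change E (fun n => ((‖SS D θ n‖ ^ 2 : ℝ) : ℂ)) = ((WW R D θ : ℝ) : ℂ) at e1
    have e2 : (fun n => ((‖SS D θ n‖ ^ 2 : ℝ) : ℂ)) = ∑ j ∈ range D, ee (j * θ) • fun n : ℕ => (lr (n + j) : ℂ) * u ((n + j : ℕ) - j) := by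
      funext n
      simp only [Finset.sum_apply, Pi.smul_apply, smul_eq_mul]
      have e3 : ∀ j : ℕ, u ((n + j : ℕ) - j) = (starRingEnd ℂ) (SS D θ n) := fun j => by
        rw [hu]; simp
      simp_rw [e3]
      rw [ofReal_pow, ← mul_conj']
      conv_lhs => enter [1]; rw [SS]
      rw [sum_mul]
      exact sum_congr rfl fun j _ => by ring
    rw [e0, ← e1, e2, map_sum, map_sum]
    refine sum_congr rfl fun j _ => ?_
    rw [map_smul, map_smul]
    congr 1
    exact av_shift hE (g := fun n : ℕ => (lr n : ℂ) * u (n - j)) ⟨D, fun n => by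
      rw [norm_mul]; exact (mul_le_of_le_one_left (norm_nonneg _) (lr_cn n)).trans (ub _)⟩ j
  have k2 := congrArg norm key
  rw [norm_real, norm_mul, norm_pow, Complex.norm_natCast] at k2
  refine (le_abs_self _).trans (k2.le.trans ?_)
  rw [mul_comm]
  exact mul_le_mul_of_nonneg_right (hk _ s) (by positivity)
lemma WW_mono (hR : IsAv U R) (D D' : ℕ) (θ : ℝ) : D ^ 2 * WW R D' θ ≤ 2 * D' ^ 2 * WW R D θ + 8 * D ^ 4 := by
  have pt : ∀ n, D ^ 2 * ‖SS D' θ n‖ ^ 2 ≤ 2 * D' * ∑ j ∈ range D', ‖SS D θ (n + j)‖ ^ 2 + 8 * D ^ 4 := fun n => by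
    set F : ℕ → ℂ := fun j => lr (n + j) * ee (j * θ) with hF
    have Fb : ∀ j, ‖F j‖ ≤ 1 := fun j => by rw [hF, norm_mul, ee_norm, mul_one]; exact lr_cn _
    have sh : ∀ i, ‖∑ j ∈ range D', F j - ∑ j ∈ range D', F (j + i)‖ ≤ 2 * i := fun i => by
      have h1 := Finset.sum_range_add F i D'
      rw [add_comm i D', Finset.sum_range_add F D' i] at h1
      have : ∑ j ∈ range D', F j - ∑ j ∈ range D', F (j + i) = ∑ x ∈ range i, F x - ∑ x ∈ range i, F (D' + x) := by
        simp_rw [add_comm _ i]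
        linear_combination h1
      rw [this]
      refine (norm_sub_le_of_le (norm_sum_le_of_le _ fun x _ => Fb x) (norm_sum_le_of_le _ fun x _ => Fb _)).trans (le_of_eq ?_)
      simp; ring
    have e : (D : ℂ) * SS D' θ n = ∑ j ∈ range D', ee (j * θ) * SS D θ (n + j) + ∑ i ∈ range D, (∑ j ∈ range D', F j - ∑ j ∈ range D', F (j + i)) := by
      rw [sum_sub_distrib, sum_const, card_range, nsmul_eq_mul, sum_comm (s := range D)]
      have : ∑ j ∈ range D', ee (j * θ) * SS D θ (n + j) = ∑ j ∈ range D', ∑ i ∈ range D, F (j + i) := by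
        refine sum_congr rfl fun j _ => ?_
        rw [SS, mul_sum]
        refine sum_congr rfl fun i _ => ?_
        simp only [hF]
        rw [cast_add, add_mul, ee_add, add_assoc]; ring
      rw [this, SS]; ring
    have b2 : ‖∑ i ∈ range D, (∑ j ∈ range D', F j - ∑ j ∈ range D', F (j + i))‖ ≤ 2 * D ^ 2 := by
      have : ∀ i ∈ range D, ‖∑ j ∈ range D', F j - ∑ j ∈ range D', F (j + i)‖ ≤ 2 * D := fun i hi =>
        (sh i).trans (by have : (i : ℝ) ≤ D := by exact_mod_cast (mem_range.mp hi).le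
                         linarith)
      refine (norm_sum_le_of_le _ this).trans (le_of_eq ?_)
      simp; ring
    set A := ‖∑ j ∈ range D', ee (j * θ) * SS D θ (n + j)‖ with hA
    have b1 : A ^ 2 ≤ D' * ∑ j ∈ range D', ‖SS D θ (n + j)‖ ^ 2 := by
      have : A ≤ ∑ j ∈ range D', ‖SS D θ (n + j)‖ := norm_sum_le_of_le _ fun j _ => by rw [norm_mul, ee_norm, one_mul]
      refine (pow_le_pow_left₀ (norm_nonneg _) this 2).trans ?_
      have := sq_sum_le_card_mul_sum_sq (s := range D') (f := fun j => ‖SS D θ (n + j)‖)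
      rwa [card_range] at this
    have e2 := congrArg norm e
    rw [norm_mul, Complex.norm_natCast] at e2
    have e3 := e2.le.trans (norm_add_le_of_le le_rfl b2)
    rw [← hA] at e3
    have e4 := pow_le_pow_left₀ (by positivity) e3 2
    rw [mul_pow] at e4
    have e5 : (A + 2 * (D : ℝ) ^ 2) ^ 2 ≤ 2 * A ^ 2 + 8 * D ^ 4 := by nlinarith [sq_nonneg (A - 2 * (D : ℝ) ^ 2)]
    linarith
  have := av_mono hR (a := ((D : ℝ) ^ 2) • fun n => ‖SS D' θ n‖ ^ 2) (b := (2 * D' : ℝ) • (∑ j ∈ range D', fun n => ‖SS D θ (n + j)‖ ^ 2) + (8 * D ^ 4 : ℝ) • fun _ => 1)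
    (Bd.mul (f := fun _ => (D : ℝ) ^ 2) ⟨_, fun _ => le_rfl⟩ (SS_bd D' θ)) ⟨2 * D' * (D' * D ^ 2) + 8 * D ^ 4, fun n => by
      simp only [Pi.add_apply, Pi.smul_apply, Finset.sum_apply, smul_eq_mul, mul_one]
      rw [norm_of_nonneg (by positivity)]
      have : ∑ j ∈ range D', ‖SS D θ (n + j)‖ ^ 2 ≤ D' * D ^ 2 := by
        refine (sum_le_card_nsmul _ _ _ fun j _ => pow_le_pow_left₀ (norm_nonneg _) (SS_le D θ (n + j)) 2).trans (by simp)
      have := mul_le_mul_of_nonneg_left this (show (0 : ℝ) ≤ 2 * D' by positivity)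
      linarith⟩
    fun n => by simpa [Finset.sum_apply] using pt n
  rw [map_smul, map_add, map_smul, map_smul, map_sum, av_one hR] at this
  have e : ∀ j ∈ range D', R (fun n => ‖SS D θ (n + j)‖ ^ 2) = WW R D θ := fun j _ => av_shift hR (SS_bd D θ) j
  rw [sum_congr rfl e, sum_const, card_range, nsmul_eq_mul] at this
  simp only [smul_eq_mul, mul_one] at this
  change (D : ℝ) ^ 2 * WW R D' θ ≤ _ at this
  linarith
lemma NN_ge (D d : ℕ) : (D : ℝ) - d ≤ NN D d := by
  have : D - d ≤ NN D d := by
    conv_lhs => rw [← card_range (D - d)]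
    refine card_le_card_of_injOn (fun k => (k + d, k)) (fun k hk => ?_) fun a _ b _ h => (Prod.mk.inj h).2
    have := mem_range.mp hk
    simp only [coe_filter, Set.mem_setOf_eq, mem_product, mem_range]
    refine ⟨⟨by omega, by omega⟩, by push_cast; ring⟩
  have h2 : D ≤ NN D d + d := by omega
  have : (D : ℝ) ≤ NN D d + d := by exact_mod_cast h2
  linarith
lemma parseval_W (hE : IsAv U E) (hR : IsAv U R) {D : ℕ} (hD : 1 ≤ D) {w : ℝ} (hw : ∀ a ∈ range (4 * D), WW R (2 * D) (2 * Real.pi * a / (4 * D : ℕ)) ≤ w) :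
    D * ∑ d ∈ range D, cor R d ^ 2 ≤ 2 * w := by
  set J := 4 * D with hJ
  set M := Ioo (-((2 * D : ℕ) : ℤ)) (2 * D : ℕ) with hM
  set r : ℤ → ℝ := fun m => NN (2 * D) m * cor R m.natAbs with hr
  set W : ℕ → ℝ := fun a => WW R (2 * D) (2 * Real.pi * a / J) with hW
  have f : ∀ a : ℕ, (W a : ℂ) = ∑ m ∈ M, (r m : ℂ) * ee (m * (2 * Real.pi * a / J)) := fun a => WW_eq hE hR _ _
  have orth : ∀ m : ℤ, |m| < J → ∑ a ∈ range J, ee (m * (2 * Real.pi * a / J)) = if m = 0 then (J : ℂ) else 0 := fun m hm => by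
    split_ifs with h
    · subst h; simp [ee_zero]
    · have := ee_orth (by omega : 1 ≤ J) h hm 0
      simpa only [zero_add] using this
  have co : ∀ d ∈ M, ∑ a ∈ range J, (W a : ℂ) * ee (-(d * (2 * Real.pi * a / J))) = J * r d := fun d hd => by
    have e1 : ∀ a ∈ range J, (W a : ℂ) * ee (-(d * (2 * Real.pi * a / J))) = ∑ m ∈ M, (r m : ℂ) * ee ((m - d : ℤ) * (2 * Real.pi * a / J)) := fun a _ => by
      rw [f, sum_mul]
      refine sum_congr rfl fun m _ => ?_
      rw [mul_assoc, ← ee_add]; congr 2; push_cast; ring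
    rw [sum_congr rfl e1, sum_comm]
    simp_rw [← mul_sum]
    rw [sum_eq_single d]
    · rw [orth _ (by simp; omega), if_pos (sub_self d)]; ring
    · intro m hm hne
      rw [orth, if_neg (sub_ne_zero.mpr hne), mul_zero]
      rw [hM, mem_Ioo] at hm hd
      rw [abs_lt]; omega
    · intro h; exact absurd hd h
  have S1 : ∑ a ∈ range J, W a = J * r 0 := by
    have := co 0 (by rw [hM, mem_Ioo]; omega)
    simp only [Int.cast_zero, zero_mul, neg_zero, ee_zero, mul_one] at this
    exact_mod_cast this
  have S2 : ∑ a ∈ range J, W a ^ 2 = J * ∑ m ∈ M, r m ^ 2 := by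
    have : ∑ a ∈ range J, (W a : ℂ) ^ 2 = J * ∑ m ∈ M, (r m : ℂ) ^ 2 := by
      have e2 : ∀ a ∈ range J, (W a : ℂ) ^ 2 = ∑ m ∈ M, (r m : ℂ) * ((W a : ℂ) * ee (-(m * (2 * Real.pi * a / J)))) := fun a _ => by
        have := congrArg (starRingEnd ℂ) (f a)
        rw [conj_ofReal, map_sum] at this
        rw [sq]
        nth_rewrite 2 [this]
        rw [mul_sum]
        refine sum_congr rfl fun m _ => ?_
        rw [map_mul, ee_conj, conj_ofReal]; ring
      rw [sum_congr rfl e2, sum_comm, mul_sum]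
      refine sum_congr rfl fun m hm => ?_
      rw [← mul_sum, co m hm]; ring
    exact_mod_cast this
  have W0 : ∀ a, 0 ≤ W a := fun a => WW_nonneg hR _ _
  have w0 : 0 ≤ w := (W0 0).trans (hw 0 (mem_range.mpr (by omega)))
  have r0 : r 0 ≤ 2 * D := by
    have n0 : NN (2 * D) 0 ≤ 2 * D := by
      have : NN (2 * D) 0 ≤ (range (2 * D)).card := card_le_card_of_injOn (fun x => x.1) (fun x hx => by
        simp only [coe_filter, Set.mem_setOf_eq, mem_product] at hx
        exact hx.1.1) fun a ha b hb h => by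
        simp only [coe_filter, Set.mem_setOf_eq] at ha hb h
        exact Prod.ext h (by omega)
      simpa using this
    have h1 : cor R (0 : ℤ).natAbs ≤ 1 := (le_abs_self _).trans (cor_le hR _)
    calc r 0 ≤ NN (2 * D) 0 * 1 := mul_le_mul_of_nonneg_left h1 (by positivity)
      _ ≤ 2 * D := by rw [mul_one]; exact_mod_cast n0
  have J0 : (0 : ℝ) < J := by exact_mod_cast (by omega : 0 < J)
  have D0 : (0 : ℝ) < D := by exact_mod_cast hD
  have b1 : ∑ a ∈ range J, W a ^ 2 ≤ w * ∑ a ∈ range J, W a := by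
    rw [mul_sum]
    exact sum_le_sum fun a ha => by rw [sq]; exact mul_le_mul_of_nonneg_right (hw a ha) (W0 a)
  rw [S1, S2] at b1
  have b2 : ∑ m ∈ M, r m ^ 2 ≤ w * (2 * D) := by
    refine le_of_mul_le_mul_left (b1.trans ?_) J0
    rw [mul_left_comm]
    exact mul_le_mul_of_nonneg_left (mul_le_mul_of_nonneg_left r0 w0) J0.le
  have b3 : D ^ 2 * ∑ d ∈ range D, cor R d ^ 2 ≤ ∑ m ∈ M, r m ^ 2 := by
    have : ∑ m ∈ (range D).image (fun d : ℕ => (d : ℤ)), r m ^ 2 ≤ ∑ m ∈ M, r m ^ 2 := by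
      refine sum_le_sum_of_subset_of_nonneg (fun m hm => ?_) fun _ _ _ => sq_nonneg _
      obtain ⟨d, hd, rfl⟩ := mem_image.mp hm
      have := mem_range.mp hd
      rw [hM, mem_Ioo]; omega
    rw [sum_image (fun a _ b _ h => by simpa using h)] at this
    refine le_trans ?_ this
    rw [mul_sum]
    refine sum_le_sum fun d hd => ?_
    simp only [hr, Int.natAbs_natCast]
    rw [mul_pow]
    refine mul_le_mul_of_nonneg_right (pow_le_pow_left₀ D0.le (le_trans ?_ (NN_ge (2 * D) d)) 2) (sq_nonneg _)
    have : (d : ℝ) ≤ D := by exact_mod_cast (mem_range.mp hd).le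
    push_cast; linarith
  refine le_of_mul_le_mul_left ?_ D0
  linarith
theorem wiener (hE : IsAv U E) (hR : IsAv U R) {ε : ℝ} (hε : 0 < ε) : ∃ D0 : ℕ, ∀ D ≥ D0, ∑ d ∈ range D, cor R d ^ 2 ≤ ε * D := by
  by_contra hc
  push Not at hc
  have st : ∀ k : ℕ, ∃ D : ℕ, k + 1 ≤ D ∧ ∃ θ ∈ Set.Icc 0 (2 * Real.pi), ε / 8 * D ^ 2 ≤ WW R D θ := fun k => by
    obtain ⟨D, hD, h⟩ := hc (k + 1)
    refine ⟨2 * D, by omega, ?_⟩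
    by_contra hn
    push Not at hn
    have D0 : (0 : ℝ) < D := by exact_mod_cast (by omega : 0 < D)
    have := parseval_W hE hR (by omega : 1 ≤ D) (w := ε / 8 * (2 * D : ℕ) ^ 2) fun a ha => (hn _ ⟨by positivity, ?_⟩).le
    · push_cast at this
      have := mul_lt_mul_of_pos_left h D0
      linarith
    · have : (a : ℝ) ≤ (4 * D : ℕ) := by exact_mod_cast (mem_range.mp ha).le
      have p : (0 : ℝ) < (4 * D : ℕ) := by exact_mod_cast (by omega : 0 < 4 * D)
      rw [div_le_iff₀ p]
      exact mul_le_mul_of_nonneg_left this (by positivity)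
  choose Dk hD θk hθ hW using st
  obtain ⟨θ, -, φ, hφ, hlim⟩ := isCompact_Icc.tendsto_subseq hθ
  obtain ⟨D0, h0⟩ := WW_small hE hR θ (ε := ε / 32) (by positivity)
  set D := D0 + 1 with hDd
  have hd := h0 D (by omega)
  have Dp : (0 : ℝ) < D := by positivity
  have cont : Continuous (fun t => WW R D t) := by
    have : (fun t => WW R D t) = fun t => (∑ m ∈ Ioo (-(D : ℤ)) D, ((NN D m * cor R m.natAbs : ℝ) : ℂ) * ee (m * t)).re := by
      funext t; rw [← WW_eq hE hR, ofReal_re]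
    rw [this]
    unfold ee
    fun_prop
  have t1 : Tendsto (fun k => WW R D (θk (φ k))) atTop (𝓝 (WW R D θ)) := (cont.tendsto θ).comp hlim
  have t2 : Tendsto (fun k => 2 * WW R D (θk (φ k)) + 8 * D ^ 4 * ((Dk (φ k) : ℝ) ^ 2)⁻¹) atTop (𝓝 (2 * WW R D θ + 8 * D ^ 4 * 0)) := by
    refine (t1.const_mul 2).add (Tendsto.const_mul _ (tendsto_inv_atTop_zero.comp ?_))
    refine (tendsto_pow_atTop two_ne_zero).comp (tendsto_natCast_atTop_atTop.comp ?_)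
    exact tendsto_atTop_mono (fun k => by have := hD (φ k); have := hφ.le_apply (x := k); show k ≤ Dk (φ k); omega) tendsto_id
  have := ge_of_tendsto' t2 (b := D ^ 2 * (ε / 8)) fun k => by
    have h1 := WW_mono hR D (Dk (φ k)) (θk (φ k))
    have h2 := hW (φ k)
    have p : (0 : ℝ) < (Dk (φ k) : ℝ) ^ 2 := by
      have : (0 : ℝ) < Dk (φ k) := by exact_mod_cast (by have := hD (φ k); omega : 0 < Dk (φ k))
      positivity
    refine le_of_mul_le_mul_left ?_ p
    have h3 := mul_le_mul_of_nonneg_left h2 (show (0 : ℝ) ≤ D ^ 2 by positivity)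
    rw [mul_add, mul_left_comm _ (8 * (D : ℝ) ^ 4), mul_inv_cancel₀ p.ne']
    linarith
  have p : 0 < (D : ℝ) ^ 2 * ε := by positivity
  linarith
end
end
section
section
open scoped Classical
noncomputable def law {α : Type} (R : (ℕ → ℝ) →ₗ[ℝ] ℝ) (X : ℕ → α) (a : α) : ℝ := R (fun n => if X n = a then 1 else 0)
noncomputable def ent {α : Type} (R : (ℕ → ℝ) →ₗ[ℝ] ℝ) (X : ℕ → α) : ℝ := -R (fun n => Real.log (law R X (X n)))
variable {U : Ultrafilter ℕ} {R : (ℕ → ℝ) →ₗ[ℝ] ℝ} {α β γ : Type}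
lemma Bd_ite (p : ℕ → Prop) [DecidablePred p] : Bd (fun n => if p n then (1 : ℝ) else 0) := Bd1 fun n => by split_ifs <;> simp
lemma law_nonneg (hR : IsAv U R) (X : ℕ → α) (a : α) : 0 ≤ law R X a := av_nonneg hR (Bd_ite _) fun n => by split_ifs <;> simp
lemma law_mono (hR : IsAv U R) (X : ℕ → α) (Y : ℕ → β) (a : α) (b : β) (h : ∀ n, X n = a → Y n = b) : law R X a ≤ law R Y b :=
  av_mono hR (Bd_ite _) (Bd_ite _) fun n => by
    by_cases h1 : X n = a
    · simp [h1, h n h1]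
    · rw [if_neg h1]; split_ifs <;> simp
lemma law_le (hR : IsAv U R) (X : ℕ → α) (a : α) : law R X a ≤ 1 := by
  rw [← av_one hR]
  exact av_mono hR (Bd_ite _) (Bd1 fun _ => by simp) fun n => by split_ifs <;> simp
lemma Bd_fin [Fintype α] (X : ℕ → α) (F : α → ℝ) : Bd (fun n => F (X n)) :=
  ⟨∑ a, ‖F a‖, fun n => single_le_sum (f := fun a => ‖F a‖) (fun a _ => norm_nonneg _) (mem_univ (X n))⟩
lemma law_exp [Fintype α] (X : ℕ → α) (F : α → ℝ) : R (fun n => F (X n)) = ∑ a, law R X a * F a := by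
  have : (fun n => F (X n)) = ∑ a, F a • fun n => if X n = a then (1 : ℝ) else 0 := by
    funext n; simp [Finset.sum_apply]
  rw [this, map_sum]
  refine sum_congr rfl fun a _ => ?_
  rw [map_smul, smul_eq_mul, mul_comm, law]
lemma law_sum [Fintype α] (hR : IsAv U R) (X : ℕ → α) : ∑ a, law R X a = 1 := by
  have := law_exp (R := R) X fun _ => 1
  simpa [av_one hR] using this.symm
lemma law_marg [Fintype α] [Fintype β] (X : ℕ → α) (Y : ℕ → β) (b : β) : ∑ a, law R (fun n => (X n, Y n)) (a, b) = law R Y b := by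
  have := law_exp (R := R) (fun n => (X n, Y n)) fun z => if z.2 = b then 1 else 0
  rw [Fintype.sum_prod_type] at this
  simp only [mul_ite, mul_one, mul_zero, sum_ite_eq', mem_univ, if_true] at this
  rw [← this, law]
lemma ent_congr {X : ℕ → α} {Y : ℕ → β} (h : ∀ m n, X m = X n ↔ Y m = Y n) : ent R X = ent R Y := by
  simp only [ent, law, h]
lemma ent_shift [Fintype α] (hR : IsAv U R) (X : ℕ → α) (k : ℕ) : ent R (fun n => X (n + k)) = ent R X := by
  have : ∀ a, law R (fun n => X (n + k)) a = law R X a := fun a => av_shift hR (Bd_ite (fun n => X n = a)) k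
  simp only [ent, this]
  rw [av_shift hR (Bd_fin X fun a => Real.log (law R X a)) k]
lemma ent_nonneg [Fintype α] (hR : IsAv U R) (X : ℕ → α) : 0 ≤ ent R X := by
  rw [ent, ← map_neg]
  exact av_nonneg hR (Bd_fin X fun a => -Real.log (law R X a)) fun n => neg_nonneg.mpr (Real.log_nonpos (law_nonneg hR _ _) (law_le hR _ _))
lemma gibbs [Fintype α] (hR : IsAv U R) (X : ℕ → α) (L q : α → ℝ) (q0 : ∀ a, 0 ≤ q a) (q1 : ∑ a, q a ≤ 1)
    (h : ∀ a, law R X a ≠ 0 → exp (L a) ≤ q a) : R (fun n => L (X n)) + ent R X ≤ 0 := by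
  rw [ent, law_exp X L, law_exp X fun a => Real.log (law R X a), ← sub_eq_add_neg, ← sum_sub_distrib]
  have : ∑ a, (law R X a * L a - law R X a * Real.log (law R X a)) ≤ ∑ a, (q a - law R X a) := by
    refine sum_le_sum fun a _ => ?_
    by_cases h0 : law R X a = 0
    · rw [h0]; simpa using q0 a
    · have p : 0 < law R X a := lt_of_le_of_ne (law_nonneg hR X a) (Ne.symm h0)
      have h1 := log_le_sub_one_of_pos (div_pos (exp_pos (L a)) p)
      rw [log_div (exp_pos _).ne' h0, log_exp] at h1
      have h2 := mul_le_mul_of_nonneg_left h1 p.le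
      rw [mul_sub, mul_sub, mul_div_cancel₀ _ h0] at h2
      linarith [h a h0]
  rw [sum_sub_distrib (f := q), law_sum hR] at this
  linarith
lemma ent_mono [Fintype α] [Fintype β] (hR : IsAv U R) (X : ℕ → α) (Y : ℕ → β) : ent R X ≤ ent R (fun n => (X n, Y n)) := by
  rw [ent, ent, neg_le_neg_iff]
  have e1 := law_exp (R := R) (fun n => (X n, Y n)) fun a => Real.log (law R (fun n => (X n, Y n)) a)
  have e2 := law_exp (R := R) (fun n => (X n, Y n)) fun a => Real.log (law R X a.1)
  rw [e1]; refine le_of_le_of_eq ?_ e2.symm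
  refine sum_le_sum fun a _ => ?_
  have h0 := law_nonneg hR (fun n => (X n, Y n)) a
  rcases h0.eq_or_lt with h | h
  · rw [← h]; simp
  · exact mul_le_mul_of_nonneg_left (log_le_log h (law_mono hR _ _ _ _ fun n hn => by rw [← hn])) h0
lemma ent_cond [Fintype α] [Fintype β] [Fintype γ] (hR : IsAv U R) (X : ℕ → α) (Y : ℕ → β) (Z : ℕ → γ) :
    ent R (fun n => (X n, Y n, Z n)) + ent R Z ≤ ent R (fun n => (X n, Z n)) + ent R (fun n => (Y n, Z n)) := by
  set p1 := law R (fun n => (X n, Z n)) with h1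
  set p2 := law R (fun n => (Y n, Z n)) with h2
  set p3 := law R Z with h3
  have := gibbs hR (fun n => (X n, Y n, Z n)) (fun a => Real.log (p1 (a.1, a.2.2)) + Real.log (p2 a.2) - Real.log (p3 a.2.2))
    (fun a => p1 (a.1, a.2.2) * p2 a.2 / p3 a.2.2)
    (fun a => div_nonneg (mul_nonneg (law_nonneg hR _ _) (law_nonneg hR _ _)) (law_nonneg hR _ _)) ?_ ?_
  · have e : (fun n => Real.log (p1 (X n, Z n)) + Real.log (p2 (Y n, Z n)) - Real.log (p3 (Z n)))
      = (fun n => Real.log (p1 (X n, Z n))) + (fun n => Real.log (p2 (Y n, Z n))) - fun n => Real.log (p3 (Z n)) := rfl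
    simp only [] at this
    rw [e, map_sub, map_add] at this
    rw [show ent R Z = -R (fun n => Real.log (p3 (Z n))) from rfl, show ent R (fun n => (X n, Z n)) = -R (fun n => Real.log (p1 (X n, Z n))) from rfl,
      show ent R (fun n => (Y n, Z n)) = -R (fun n => Real.log (p2 (Y n, Z n))) from rfl]
    linarith
  · rw [Fintype.sum_prod_type_right, Fintype.sum_prod_type_right]
    refine le_of_le_of_eq (sum_le_sum (g := p3) fun c _ => ?_) (law_sum hR Z)
    simp only []
    have e1 : ∑ a, p1 (a, c) = p3 c := law_marg X Z c
    have e2 : ∑ b, p2 (b, c) = p3 c := law_marg Y Z c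
    calc _ = (∑ a, p1 (a, c)) * (∑ b, p2 (b, c)) / p3 c := by
          rw [sum_mul_sum, sum_comm, sum_div]; simp_rw [sum_div]
      _ ≤ _ := by
          rw [e1, e2]
          by_cases h : p3 c = 0
          · rw [h]; simp
          · rw [mul_div_assoc, div_self h, mul_one]
  · intro a h0
    have p := lt_of_le_of_ne (law_nonneg hR _ a) (Ne.symm h0)
    have q1 : 0 < p1 (a.1, a.2.2) := p.trans_le (law_mono hR _ _ _ _ fun n hn => by rw [← hn])
    have q2 : 0 < p2 a.2 := p.trans_le (law_mono hR _ _ _ _ fun n hn => by rw [← hn])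
    have q3 : 0 < p3 a.2.2 := p.trans_le (law_mono hR _ _ _ _ fun n hn => by rw [← hn])
    rw [exp_sub, exp_add, exp_log q1, exp_log q2, exp_log q3]
/-- Donsker–Varadhan -/
lemma dv [Fintype α] [Fintype β] (hR : IsAv U R) (X : ℕ → α) (Y : ℕ → β) (F : α → β → ℝ) (K : ℝ)
    (h : ∀ a, ∑ b, law R Y b * exp (F a b) ≤ exp K) : R (fun n => F (X n) (Y n)) ≤ K + ent R X + ent R Y - ent R (fun n => (X n, Y n)) := by
  have := gibbs hR (fun n => (X n, Y n)) (fun a => Real.log (law R X a.1) + Real.log (law R Y a.2) + F a.1 a.2 - K * 1)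
    (fun a => law R X a.1 * (law R Y a.2 * exp (F a.1 a.2)) * exp (-K))
    (fun a => mul_nonneg (mul_nonneg (law_nonneg hR _ _) (mul_nonneg (law_nonneg hR _ _) (exp_pos _).le)) (exp_pos _).le) ?_ ?_
  · have e : (fun n => Real.log (law R X (X n)) + Real.log (law R Y (Y n)) + F (X n) (Y n) - K * 1)
      = (fun n => Real.log (law R X (X n))) + (fun n => Real.log (law R Y (Y n))) + (fun n => F (X n) (Y n)) - K • fun _ => 1 := rfl
    simp only [] at this
    rw [e, map_sub, map_add, map_add, map_smul, av_one hR, smul_eq_mul] at this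
    simp only [ent] at this ⊢
    linarith
  · rw [Fintype.sum_prod_type]
    refine le_of_le_of_eq (sum_le_sum (g := law R X) fun a _ => ?_) (law_sum hR X)
    simp only []
    rw [← sum_mul, ← mul_sum, mul_assoc]
    refine mul_le_of_le_one_right (law_nonneg hR _ _) ?_
    rw [exp_neg, ← div_eq_mul_inv, div_le_one (exp_pos _)]
    exact h a
  · intro a h0
    have p := lt_of_le_of_ne (law_nonneg hR _ a) (Ne.symm h0)
    have q1 : 0 < law R X a.1 := p.trans_le (law_mono hR _ _ _ _ fun n hn => by rw [← hn])
    have q2 : 0 < law R Y a.2 := p.trans_le (law_mono hR _ _ _ _ fun n hn => by rw [← hn])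
    rw [sub_eq_add_neg, mul_one, exp_add, exp_add, exp_add, exp_log q1, exp_log q2, mul_assoc (law R X a.1)]
end
end
section
section
noncomputable def sg (n : ℕ) : SignType := SignType.sign (lr n)
lemma sg_cast (n : ℕ) : ((sg n : SignType) : ℝ) = lr n := by
  unfold sg
  rcases Nat.eq_zero_or_pos n with rfl | h
  · simp [lr]
  · rcases mul_self_eq_one_iff.mp (lr_sq h) with h | h <;> rw [h] <;> simp
noncomputable def xv (M n : ℕ) : Fin M → SignType := fun i => sg (n + i)
def yv (S : Finset ℕ) (n : ℕ) : (p : S) → ZMod p := fun p => (n : ZMod p)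
lemma xv_iff {M m n : ℕ} : xv M m = xv M n ↔ ∀ i < M, sg (m + i) = sg (n + i) := by
  rw [funext_iff]; exact ⟨fun h i hi => h ⟨i, hi⟩, fun h i => h i i.2⟩
lemma yv_iff {S : Finset ℕ} {m n : ℕ} (t : ℕ) : yv S (m + t) = yv S (n + t) ↔ yv S m = yv S n := by
  simp only [funext_iff, yv, cast_add, add_left_inj]
variable {U : Ultrafilter ℕ} {R : (ℕ → ℝ) →ₗ[ℝ] ℝ} {S : Finset ℕ}
lemma law_y [∀ p : S, NeZero p.1] (hR : IsAv U R) (hS : ∀ p ∈ S, p.Prime) (b : (p : S) → ZMod p) : law R (yv S) b = (∏ p : S, (p : ℝ))⁻¹ := by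
  classical
  have key : ∀ b, law R (yv S) b = law R (yv S) 0 := fun b => by
    obtain ⟨N, hN⟩ := Nat.chineseRemainderOfFinset (fun p : S => (b p).val) (fun p : S => p.1) univ (fun p _ => (hS p p.2).ne_zero)
      (fun p _ q _ h => (coprime_primes (hS p p.2) (hS q q.2)).mpr fun e => h (Subtype.ext e))
    have e : yv S N = b := funext fun p => by
      have := (ZMod.natCast_eq_natCast_iff _ _ _).mpr (hN p (mem_univ _))
      rw [yv, this, ZMod.natCast_zmod_val]
    have := av_shift hR (Bd_ite fun n => yv S n = b) N
    have e2 : ∀ n, (yv S (n + N) = b) = (yv S n = 0) := fun n => by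
      rw [← e]
      have := yv_iff (S := S) (m := n) (n := 0) N
      rw [zero_add] at this
      rw [this, show yv S 0 = 0 from funext fun p => by simp [yv]]
    simp only [e2] at this
    unfold law
    convert this.symm
  have := law_sum hR (yv S)
  simp_rw [key] at this
  rw [sum_const, card_univ, Fintype.card_pi, nsmul_eq_mul] at this
  simp_rw [ZMod.card] at this
  rw [key]
  push_cast at this
  exact eq_inv_of_mul_eq_one_right this
lemma ent_y [∀ p : S, NeZero p.1] (hR : IsAv U R) (hS : ∀ p ∈ S, p.Prime) : ent R (yv S) = ∑ p ∈ S, Real.log p := by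
  simp only [ent, law_y hR hS]
  have := map_smul R (Real.log (∏ p : S, (p : ℝ))⁻¹) (fun _ => (1 : ℝ))
  rw [av_one hR] at this
  simp only [smul_eq_mul, mul_one] at this
  rw [show (fun _ : ℕ => Real.log (∏ p : S, (p : ℝ))⁻¹) = Real.log (∏ p : S, (p : ℝ))⁻¹ • fun _ => (1 : ℝ) by funext n; simp, this,
    Real.log_inv, neg_neg, Real.log_prod fun p _ => by exact_mod_cast (hS p p.2).ne_zero]
  exact sum_coe_sort S fun p => Real.log p
lemma ent_k [∀ p : S, NeZero p.1] (hR : IsAv U R) (M k : ℕ) :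
    ent R (xv (k * M)) ≤ ent R (yv S) + k * (ent R (fun n => (xv M n, yv S n)) - ent R (yv S)) := by
  refine (ent_mono hR (xv (k * M)) (yv S)).trans ?_
  induction k with
  | zero =>
    refine le_of_eq ?_
    rw [cast_zero, zero_mul, zero_mul, add_zero]
    exact ent_congr fun m n => by rw [Prod.mk.injEq, xv_iff]; simp
  | succ k ih =>
    have h1 := ent_cond hR (xv (k * M)) (fun n => xv M (n + k * M)) (yv S)
    have h2 : ent R (fun n => (xv ((k + 1) * M) n, yv S n)) = ent R (fun n => (xv (k * M) n, xv M (n + k * M), yv S n)) :=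
      ent_congr fun m n => by
        rw [Prod.mk.injEq, Prod.mk.injEq, Prod.mk.injEq, ← and_assoc, xv_iff, xv_iff, xv_iff]
        refine and_congr_left fun _ => ⟨fun h => ⟨fun i hi => h i (by rw [add_mul]; omega), fun i hi => ?_⟩, fun h i hi => ?_⟩
        · rw [add_assoc, add_assoc]; exact h _ (by rw [add_mul]; omega)
        · by_cases h3 : i < k * M
          · exact h.1 i h3
          · have := h.2 (i - k * M) (by rw [add_mul] at hi; omega)
            rwa [show m + k * M + (i - k * M) = m + i by omega, show n + k * M + (i - k * M) = n + i by omega] at this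
    have h3 : ent R (fun n => (xv M (n + k * M), yv S n)) = ent R (fun n => (xv M n, yv S n)) := by
      rw [← ent_shift hR (fun n => (xv M n, yv S n)) (k * M)]
      exact ent_congr fun m n => by rw [Prod.mk.injEq, Prod.mk.injEq, yv_iff]
    rw [h2]; rw [h3] at h1; push_cast; linarith
noncomputable def ph (P p : ℕ) (w : ℕ → ℝ) (e : ℝ) (c : ZMod p) : ℝ := e * ((P : ℝ)⁻¹ * ∑ j ∈ range P, ((if c + j = 0 then (p : ℝ) else 0) - 1) * w j)
lemma ph_le {P p : ℕ} (hP : 1 ≤ P) (h1 : P < p) (h2 : p ≤ 8 * P) {w : ℕ → ℝ} (hw : ∀ j, |w j| ≤ 1) {e : ℝ} (he : |e| ≤ 1) (c : ZMod p) : |ph P p w e c| ≤ 9 := by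
  rw [ph, abs_mul]
  refine (mul_le_of_le_one_left (abs_nonneg _) he).trans ?_
  have P0 : (0 : ℝ) < P := by exact_mod_cast hP
  rw [abs_mul, abs_of_pos (by positivity), inv_mul_le_iff₀ P0]
  calc _ ≤ ∑ j ∈ range P, ((if c + j = 0 then (p : ℝ) else 0) + 1) := by
        refine (abs_sum_le_sum_abs _ _).trans (sum_le_sum fun j _ => ?_)
        rw [abs_mul]
        refine (mul_le_of_le_one_right (abs_nonneg _) (hw j)).trans ((abs_sub _ _).trans (le_of_eq ?_))
        rw [abs_one]; congr 1; split_ifs <;> simp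
    _ ≤ p + P := by
        rw [sum_add_distrib, ← sum_filter, sum_const, sum_const, card_range, nsmul_eq_mul, nsmul_one]
        refine add_le_add_left (mul_le_of_le_one_left (cast_nonneg _) ?_) _
        norm_cast
        refine Finset.card_le_one.mpr fun i hi j hj => ?_
        simp only [mem_filter, mem_range] at hi hj
        have := (ZMod.natCast_eq_natCast_iff _ _ _).mp (add_left_cancel (hi.2.trans hj.2.symm))
        exact ModEq.eq_of_lt_of_lt this (by omega) (by omega)
    _ ≤ P * 9 := by have : (p : ℝ) ≤ 8 * P := by exact_mod_cast h2
                    linarith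
lemma ph_exp {P p : ℕ} [NeZero p] (hP : 1 ≤ P) (h1 : P < p) (h2 : p ≤ 8 * P) {w : ℕ → ℝ} (hw : ∀ j, |w j| ≤ 1) {e : ℝ} (he : |e| ≤ 1) {s : ℝ} (s0 : 0 ≤ s) (s1 : 9 * s ≤ 1) :
    (p : ℝ)⁻¹ * ∑ c, exp (s * ph P p w e c) ≤ exp (81 * s ^ 2) := by
  have z : ∑ c, ph P p w e c = 0 := by
    simp only [ph]
    rw [← mul_sum, ← mul_sum, sum_comm]
    have : ∀ j ∈ range P, ∑ c : ZMod p, ((if c + j = 0 then (p : ℝ) else 0) - 1) * w j = 0 := fun j _ => by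
      rw [← sum_mul, sum_sub_distrib]
      simp [add_eq_zero_iff_eq_neg, ZMod.card]
    rw [sum_eq_zero this]; simp
  have p0 : (0 : ℝ) < p := by exact_mod_cast NeZero.pos p
  have h3 : ∑ c, exp (s * ph P p w e c) ≤ ∑ c, (1 + s * ph P p w e c + 81 * s ^ 2) := sum_le_sum fun c _ => by
    have b := ph_le hP h1 h2 hw he c
    have b1 : |s * ph P p w e c| ≤ 9 * s := by rw [abs_mul, abs_of_nonneg s0, mul_comm]; exact mul_le_mul_of_nonneg_right b s0
    have := (abs_le.mp (Real.abs_exp_sub_one_sub_id_le (b1.trans s1))).2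
    have b2 := pow_le_pow_left₀ (abs_nonneg _) b1 2
    rw [sq_abs] at b2
    linarith
  rw [inv_mul_le_iff₀ p0]
  refine h3.trans ?_
  rw [sum_add_distrib, sum_add_distrib, ← mul_sum, z, mul_zero, add_zero, sum_const, sum_const, card_univ, ZMod.card, nsmul_eq_mul, nsmul_eq_mul, ← mul_add]
  refine mul_le_mul_of_nonneg_left ?_ p0.le
  linarith [add_one_le_exp (81 * s ^ 2)]
lemma dec1 [∀ p : S, NeZero p.1] (hR : IsAv U R) (hS : ∀ p ∈ S, p.Prime) {P h : ℕ} (hP : 1 ≤ P) (hS1 : ∀ p ∈ S, P < p) (hS2 : ∀ p ∈ S, p ≤ 8 * P) {s : ℝ} (s0 : 0 ≤ s) (s1 : 9 * s ≤ 1) :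
    s * ∑ p ∈ S, |cor R h - cor R (p * h)| ≤ 81 * s ^ 2 * S.card + ent R (xv ((8 * h + 1) * P)) + ent R (yv S) - ent R (fun n => (xv ((8 * h + 1) * P) n, yv S n)) := by
  set M := (8 * h + 1) * P with hM
  set w : (Fin M → SignType) → ℕ → ℕ → ℝ := fun a p j => (if h1 : j < M then ((a ⟨j, h1⟩ : SignType) : ℝ) else 0) * (if h1 : j + p * h < M then ((a ⟨j + p * h, h1⟩ : SignType) : ℝ) else 0) with hw
  set e : ℕ → ℝ := fun p => if 0 ≤ cor R h - cor R (p * h) then 1 else -1 with he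
  have e1 : ∀ p, |e p| ≤ 1 := fun p => by simp only [he]; split_ifs <;> simp
  have w1 : ∀ a p j, |w a p j| ≤ 1 := fun a p j => by
    have : ∀ σ : SignType, |((σ : SignType) : ℝ)| ≤ 1 := fun σ => by cases σ <;> simp
    simp only [hw]; rw [abs_mul]
    refine mul_le_one₀ ?_ (abs_nonneg _) ?_ <;> split_ifs <;> first | exact this _ | simp
  have D := dv hR (xv M) (yv S) (fun a b => ∑ p : S, s * ph P p (w a p) (e p) (b p)) (81 * s ^ 2 * S.card) fun a => by
    simp_rw [law_y hR hS, exp_sum]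
    have := Finset.prod_univ_sum (fun p : S => (univ : Finset (ZMod p))) fun p c => exp (s * ph P p (w a p) (e p) c)
    rw [Fintype.piFinset_univ] at this
    rw [← mul_sum, ← this, ← Finset.prod_inv_distrib, ← Finset.prod_mul_distrib]
    refine (Finset.prod_le_prod (fun p _ => ?_) fun (p : S) _ => ph_exp hP (hS1 p p.2) (hS2 p p.2) (w1 a p) (e1 p) s0 s1).trans (le_of_eq ?_)
    · exact mul_nonneg (by positivity) (sum_nonneg fun _ _ => (exp_pos _).le)
    · rw [prod_const, card_univ, Fintype.card_coe, ← exp_nat_mul]; congr 1; ring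
  refine le_of_eq_of_le ?_ D
  set G : ℕ → ℕ → ℝ := fun p n => ((if p ∣ n then (p : ℝ) else 0) - 1) * (lr n * lr (n + p * h)) with hG
  have GR : ∀ p ∈ S, ∀ j, R (fun n => G p (n + j)) = cor R h - cor R (p * h) := fun p hp j => by
    have p1 := (hS p hp).one_le
    have B : Bd (fun n => lr n * lr (n + p * h)) := Bd1 fun n => lr2 _ _
    have GB : Bd (G p) := ⟨p + 1, fun n => by
      simp only [hG]; rw [norm_mul]
      refine (mul_le_of_le_one_right (norm_nonneg _) (lr2 _ _)).trans ((norm_sub_le _ _).trans ?_)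
      rw [norm_one]; split_ifs <;> simp⟩
    rw [av_shift hR GB j]
    have : G p = (p : ℝ) • (fun n => if p ∣ n then lr n * lr (n + p * h) else 0) - fun n => lr n * lr (n + p * h) := by
      funext n; simp only [hG, Pi.sub_apply, Pi.smul_apply, smul_eq_mul]; split_ifs <;> ring
    rw [this, map_sub, map_smul, av_dil hR B p1, smul_eq_mul, mul_inv_cancel_left₀ (by exact_mod_cast (hS p hp).ne_zero)]
    congr 2; funext n
    rw [← mul_add, lr_mul, lr_mul, mul_mul_mul_comm, lr_sq p1, one_mul]
  have F : (fun n => ∑ p : S, s * ph P p (w (xv M n) p) (e p) (yv S n p)) = ∑ p ∈ S, (s * (e p * (P : ℝ)⁻¹)) • ∑ j ∈ range P, fun n => G p (n + j) := by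
    funext n
    simp only [Finset.sum_apply, Pi.smul_apply, smul_eq_mul]
    rw [← sum_coe_sort S]
    refine sum_congr rfl fun p _ => ?_
    simp only [ph, mul_assoc]
    congr 3
    refine sum_congr rfl fun j hj => ?_
    rw [mem_range] at hj
    have h3 : p * h ≤ 8 * P * h := Nat.mul_le_mul_right _ (hS2 p p.2)
    have h4 : M = 8 * P * h + P := by rw [hM]; ring
    simp only [hw, hG, xv, yv]
    rw [dif_pos (by omega), dif_pos (by omega), sg_cast, sg_cast, ← add_assoc]
    congr 2
    simp only [← cast_add, ZMod.natCast_eq_zero_iff]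
  rw [F, map_sum, mul_sum]
  refine sum_congr rfl fun p hp => ?_
  have P0 : (P : ℝ) ≠ 0 := by exact_mod_cast (by omega : P ≠ 0)
  rw [map_smul, map_sum, sum_congr rfl fun j _ => GR p hp j, sum_const, card_range, nsmul_eq_mul, smul_eq_mul]
  have : |cor R h - cor R (p * h)| = e p * (cor R h - cor R (p * h)) := by
    simp only [he]; split_ifs with h1
    · rw [abs_of_nonneg h1, one_mul]
    · rw [abs_of_neg (not_le.mp h1)]; ring
  rw [this]; field_simp
end
end
section
section
lemma no_dec {f : ℕ → ℝ} (hf : ∀ m, 0 ≤ f m) {δ : ℝ} (hδ : 0 < δ) {m0 : ℕ} (h : ∀ m ≥ m0, ∀ r, f (m + r) ≤ f m - δ / m + 12 / 2 ^ r) : False := by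
  obtain ⟨C, hC⟩ := pow_unbounded_of_one_lt (48 / δ) (one_lt_two)
  rw [div_lt_iff₀ hδ] at hC
  set A := C + m0 + 2
  have cl : ∀ a ≥ A, f (2 ^ (a + 1)) ≤ f (2 ^ a) - δ / (8 * (a + C)) := fun a ha => by
    have a2 : 2 * a ≤ 2 ^ a := by
      obtain ⟨k, rfl⟩ : ∃ k, a = k + 1 := ⟨a - 1, by omega⟩
      have := Nat.lt_two_pow_self (n := k)
      rw [pow_succ]; omega
    set b := Nat.clog 2 (a + C) with hb
    have b1 : a + C ≤ 2 ^ b := Nat.le_pow_clog (by norm_num) _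
    have b2 : b ≤ a := Nat.clog_le_of_le_pow (by omega)
    have b3 : 2 ^ b ≤ 2 * (a + C) := by
      have h1 := Nat.pow_pred_clog_lt_self (b := 2) (by norm_num) (x := a + C) (by omega)
      rw [← hb] at h1
      have h2 : 0 < b := by rw [hb]; exact Nat.clog_pos (by norm_num) (by omega)
      obtain ⟨k, hk⟩ : ∃ k, b = k + 1 := ⟨b - 1, by omega⟩
      rw [hk] at h1 ⊢; simp at h1; rw [pow_succ]; omega
    have sm : 12 / (2 : ℝ) ^ 2 ^ b ≤ δ / 2 ^ (a + 2) := by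
      rw [div_le_div_iff₀ (by positivity) (by positivity)]
      have h1 : (2 : ℝ) ^ (a + C) ≤ 2 ^ 2 ^ b := pow_le_pow_right₀ (by norm_num) b1
      rw [pow_add] at h1 ⊢
      have h2 := mul_le_mul_of_nonneg_left hC.le (show (0 : ℝ) ≤ 2 ^ a by positivity)
      have h3 := mul_le_mul_of_nonneg_left h1 hδ.le
      linarith
    have st : ∀ i ≤ 2 ^ (a - b), f (2 ^ a + i * 2 ^ b) ≤ f (2 ^ a) - i * (δ / 2 ^ (a + 2)) := fun i => by
      induction i with
      | zero => simp
      | succ i ih =>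
        intro hi
        have h1 := ih (by omega)
        have m1 : 2 ^ a + i * 2 ^ b ≤ 2 ^ (a + 1) := by
          have : i * 2 ^ b ≤ 2 ^ (a - b) * 2 ^ b := Nat.mul_le_mul_right _ (by omega)
          rw [← pow_add, Nat.sub_add_cancel b2] at this
          rw [pow_succ]; omega
        have h2 := h (2 ^ a + i * 2 ^ b) (by omega) (2 ^ b)
        have m2 : δ / 2 ^ (a + 1) ≤ δ / (2 ^ a + i * 2 ^ b : ℕ) :=
          div_le_div_of_nonneg_left hδ.le (by positivity) (by exact_mod_cast m1)
        have m3 : δ / 2 ^ (a + 1) = 2 * (δ / 2 ^ (a + 2)) := by rw [pow_succ _ (a + 1)]; field_simp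
        rw [show 2 ^ a + (i + 1) * 2 ^ b = 2 ^ a + i * 2 ^ b + 2 ^ b by ring]
        push_cast at *; linarith
    have h1 := st _ le_rfl
    rw [← pow_add, Nat.sub_add_cancel b2, show 2 ^ a + 2 ^ a = 2 ^ (a + 1) by ring] at h1
    refine h1.trans (sub_le_sub_left ?_ _)
    have h2 : (2 : ℝ) ^ (a + 2) = 2 ^ (a - b) * 2 ^ b * 4 := by rw [← pow_add, Nat.sub_add_cancel b2]; ring
    rw [h2]
    have h3 : ((2 : ℝ) ^ b) ≤ 2 * (a + C) := by exact_mod_cast b3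
    calc _ ≤ δ / (4 * 2 ^ b) := div_le_div_of_nonneg_left hδ.le (by positivity) (by linarith)
      _ = _ := by push_cast; field_simp
  set c := δ / (8 * (A + C : ℝ)) with hc
  have A0 : (0 : ℝ) < A := by positivity
  have c0 : 0 < c := by positivity
  have it : ∀ k : ℕ, f (2 ^ (A + k)) ≤ f (2 ^ A) - c * ∑ i ∈ range k, 1 / ((i : ℝ) + 1) := fun k => by
    induction k with
    | zero => simp
    | succ k ih =>
      have h1 := cl (A + k) (by omega)
      rw [sum_range_succ, mul_add, ← add_assoc]
      have : c * (1 / ((k : ℝ) + 1)) ≤ δ / (8 * ((A + k : ℕ) + C)) := by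
        rw [hc, div_mul_div_comm, mul_one]
        refine div_le_div_of_nonneg_left hδ.le (by positivity) ?_
        have : (0 : ℝ) ≤ k * (A + C - 1) := mul_nonneg (by positivity) (by
          have : (1 : ℝ) ≤ A := by exact_mod_cast (by omega : 1 ≤ A)
          have : (0 : ℝ) ≤ C := by positivity
          linarith)
        push_cast; linarith
      linarith
  have T := Real.tendsto_sum_range_one_div_nat_succ_atTop.const_mul_atTop c0
  obtain ⟨k, hk⟩ := (T.eventually_gt_atTop (f (2 ^ A))).exists
  linarith [it k, hf (2 ^ (A + k))]
variable {U : Ultrafilter ℕ} {R : (ℕ → ℝ) →ₗ[ℝ] ℝ}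
theorem decr (hR : IsAv U R) (h : ℕ) {ε : ℝ} (hε : 0 < ε) (m0 : ℕ) :
    ∃ m ≥ m0, ∑ p ∈ prs (2 ^ m) (8 * 2 ^ m), |cor R h - cor R (p * h)| ≤ ε * (prs (2 ^ m) (8 * 2 ^ m)).card := by
  by_contra! con
  obtain ⟨x0, -, hx⟩ := prs_block
  obtain ⟨m1, hm1⟩ := pow_unbounded_of_one_lt x0 (one_lt_two (α := ℝ))
  set s := min ε 1 / 162 with hs
  have s0 : 0 < s := div_pos (lt_min hε one_pos) (by norm_num)
  have sε : 162 * s ≤ ε := by rw [hs]; linarith [min_le_left ε 1]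
  have s1 : 9 * s ≤ 1 := by rw [hs]; linarith [min_le_right ε 1]
  set K : ℝ := 8 * h + 1 with hK
  have K1 : 1 ≤ K := by rw [hK]; linarith [cast_nonneg (α := ℝ) h]
  set δ := 81 * s ^ 2 / (4 * K) with hδ
  refine no_dec (f := fun m => ent R (xv ((8 * h + 1) * 2 ^ m)) / (K * 2 ^ m)) (fun m => div_nonneg (ent_nonneg hR _) (by positivity)) (δ := δ) (by positivity) (m0 := m0 + m1 + 1) ?_
  intro m hm r
  set P : ℝ := 2 ^ m with hP
  have P0 : 0 < P := by positivity
  set S := prs P (8 * P) with hS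
  have mS : ∀ p ∈ S, (P < p ∧ (p : ℝ) ≤ 8 * P) ∧ p.Prime := fun p hp => (mem_prs P0.le (by positivity)).mp hp
  have hS0 : ∀ p ∈ S, p.Prime := fun p hp => (mS p hp).2
  haveI : ∀ p : S, NeZero p.1 := fun p => ⟨(hS0 p p.2).ne_zero⟩
  have d1 := dec1 (h := h) hR hS0 (P := 2 ^ m) one_le_two_pow (fun p hp => by have := (mS p hp).1.1; rw [hP] at this; exact_mod_cast this) (fun p hp => by have := (mS p hp).1.2; rw [hP] at this; exact_mod_cast this) s0.le s1
  have d2 := ent_k (S := S) hR ((8 * h + 1) * 2 ^ m) (2 ^ r)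
  have c1 := mul_le_mul_of_nonneg_left (con m (by omega)).le s0.le
  rw [← hP, ← hS] at c1
  have y1 : ent R (yv S) ≤ 12 * P := by
    rw [ent_y hR hS0]
    have h1 := Chebyshev.theta_le_log4_mul_x (x := 8 * P) (by positivity)
    have h2 : ∑ p ∈ S, Real.log p ≤ Chebyshev.theta (8 * P) :=
      sum_le_sum_of_subset_of_nonneg (fun p hp => by
        rw [mem_filter, mem_Ioc]
        exact ⟨⟨(hS0 p hp).pos, le_floor (mS p hp).1.2⟩, hS0 p hp⟩) fun p _ _ => log_natCast_nonneg p
    have h3 : Real.log 4 ≤ 1.4 := by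
      rw [show (4 : ℝ) = 2 ^ 2 by norm_num, log_pow]; have := log_two_lt_d9; push_cast; linarith
    have := mul_le_mul_of_nonneg_right h3 (show 0 ≤ 8 * P by positivity)
    linarith
  have m0' : (1 : ℝ) ≤ m := by exact_mod_cast (by omega : 1 ≤ m)
  have N1 : P / (4 * m) ≤ S.card := by
    have h1 := (hx P (hm1.le.trans (pow_le_pow_right₀ (by norm_num) (by omega)))).2
    refine le_trans (div_le_div_of_nonneg_left P0.le (log_pos ?_) ?_) h1
    · have : (1 : ℝ) ≤ P := one_le_pow₀ (by norm_num)
      linarith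
    · rw [hP, show (8 : ℝ) * 2 ^ m = 2 ^ (m + 3) by ring, log_pow]
      have := log_two_lt_d9
      have h4 := mul_le_mul_of_nonneg_left (show Real.log 2 ≤ 1 by linarith) (show (0 : ℝ) ≤ (m + 3 : ℕ) by positivity)
      push_cast at h4 ⊢; linarith
  set X := ent R (xv ((8 * h + 1) * 2 ^ m))
  set Y := ent R (yv S)
  set Z := ent R (fun n => (xv ((8 * h + 1) * 2 ^ m) n, yv S n))
  set N : ℝ := (S.card : ℝ)
  have N0 : 0 ≤ N := cast_nonneg _
  have D1 : 81 * s ^ 2 * (P / (4 * m)) ≤ X + Y - Z := by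
    have h1 := mul_le_mul_of_nonneg_left sε (mul_nonneg s0.le N0)
    have h2 := mul_le_mul_of_nonneg_left N1 (show 0 ≤ 81 * s ^ 2 by positivity)
    linarith
  have e : 2 ^ r * ((8 * h + 1) * 2 ^ m) = (8 * h + 1) * 2 ^ (m + r) := by ring
  rw [e] at d2
  rw [show (2 : ℝ) ^ (m + r) = P * 2 ^ r by rw [hP, pow_add], div_le_iff₀ (by positivity)]
  refine d2.trans ?_
  have h5 : Z - Y ≤ X - 81 * s ^ 2 * (P / (4 * m)) := by linarith
  have h6 := mul_le_mul_of_nonneg_left h5 (show (0 : ℝ) ≤ 2 ^ r by positivity)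
  have h7 : (X / (K * P) - δ / m + 12 / 2 ^ r) * (K * (P * 2 ^ r)) = 2 ^ r * (X - 81 * s ^ 2 * (P / (4 * m))) + 12 * P * K := by
    rw [hδ]; field_simp
  rw [h7]
  have h8 : 12 * P * 1 ≤ 12 * P * K := mul_le_mul_of_nonneg_left K1 (by positivity)
  push_cast; linarith
end
end
section
section
def tD (d n : ℕ) : ℕ := (n.primeFactorsList.filter fun p => ¬ p ∣ d).length
lemma tD_mul (d : ℕ) {m n : ℕ} (hm : m ≠ 0) (hn : n ≠ 0) : tD d (m * n) = tD d m + tD d n := by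
  rw [tD, ((Nat.perm_primeFactorsList_mul hm hn).filter _).length_eq, List.filter_append, List.length_append]; rfl
noncomputable def GD (d : ℕ) : ℕ →* ℝ := ⟨⟨fun n => 2 ^ tD d n * (n : ℝ)⁻¹, by simp [tD]⟩, fun m n => by
  change 2 ^ tD d (m * n) * ((m * n : ℕ) : ℝ)⁻¹ = 2 ^ tD d m * (m : ℝ)⁻¹ * (2 ^ tD d n * (n : ℝ)⁻¹)
  by_cases hm : m = 0
  · simp [hm]
  by_cases hn : n = 0
  · simp [hn]
  rw [tD_mul d hm hn, pow_add]; push_cast; rw [mul_inv]; ring⟩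
lemma GD_apply (d n : ℕ) : GD d n = 2 ^ tD d n * (n : ℝ)⁻¹ := rfl
lemma GD_nonneg (d n : ℕ) : 0 ≤ GD d n := by rw [GD_apply]; positivity
lemma tD_prime (d : ℕ) {p : ℕ} (hp : p.Prime) : tD d p = if p ∣ d then 0 else 1 := by
  rw [tD, Nat.primeFactorsList_prime hp]; split_ifs with h <;> simp [h]
lemma GD_lt {d : ℕ} (hd : 2 ∣ d) {p : ℕ} (hp : p.Prime) : GD d p < 1 := by
  have p0 : (0 : ℝ) < p := by exact_mod_cast hp.pos
  rw [GD_apply, tD_prime d hp, ← div_eq_mul_inv, div_lt_one p0]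
  split_ifs with h
  · simpa using hp.one_lt
  · have : 2 < p := lt_of_le_of_ne hp.two_le fun e => h (e ▸ hd)
    simpa using this
noncomputable def rho (d k : ℕ) : ℕ := Nat.card {x : ZMod k // x * (x + d) = 0}
lemma rho_mul (d : ℕ) {m n : ℕ} (h : m.Coprime n) : rho d (m * n) = rho d m * rho d n := by
  rw [rho, rho, rho, ← Nat.card_prod]
  refine Nat.card_congr (((ZMod.chineseRemainder h).toEquiv.subtypeEquiv (q := fun z => z.1 * (z.1 + (d : ZMod m)) = 0 ∧ z.2 * (z.2 + (d : ZMod n)) = 0) fun x => ?_).trans (Equiv.subtypeProdEquivProd (p := fun x : ZMod m => x * (x + (d : ZMod m)) = 0) (q := fun x : ZMod n => x * (x + (d : ZMod n)) = 0)))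
  rw [← map_eq_zero_iff (ZMod.chineseRemainder h) (ZMod.chineseRemainder h).injective, map_mul, map_add, map_natCast, Prod.ext_iff]
  rfl
lemma rho_prime (d : ℕ) {p : ℕ} (hp : p.Prime) : rho d p = 2 ^ tD d p := by
  haveI := Fact.mk hp
  rw [rho, Nat.card_eq_fintype_card, Fintype.card_subtype,
    show (univ.filter fun x : ZMod p => x * (x + d) = 0) = {0, -(d : ZMod p)} by
      ext x; simp [add_eq_zero_iff_eq_neg], tD_prime d hp]
  split_ifs with h
  · rw [(ZMod.natCast_eq_zero_iff d p).mpr h]; simp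
  · rw [Finset.card_pair]; · rfl
    intro e
    exact h ((ZMod.natCast_eq_zero_iff d p).mp (by rw [← neg_neg (d : ZMod p), ← e, neg_zero]))
lemma rho_sqf (d k : ℕ) : Squarefree k → rho d k = 2 ^ tD d k := by
  induction k using induction_on_primes with
  | zero => intro h; simp at h
  | one => intro _; simp [rho, tD, Subsingleton.elim (α := ZMod 1) _ 0]
  | prime_mul p a hp ih =>
    intro h
    obtain ⟨h1, h2, h3⟩ := Nat.squarefree_mul_iff.mp h
    rw [rho_mul d h1, rho_prime d hp, ih h3, tD_mul d hp.ne_zero h3.ne_zero, pow_add]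
lemma cnt_res (A B v : ℕ) {k : ℕ} (hk : 0 < k) (hAB : A ≤ B) : |(((Ioc A B).filter (· ≡ v [MOD k])).card : ℝ) - (B - A : ℝ) / k| ≤ 1 := by
  have h := Nat.Ioc_filter_modEq_card A B hk v
  have k0 : (0 : ℚ) < k := by exact_mod_cast hk
  rw [max_eq_left (sub_nonneg.mpr (Int.floor_le_floor (by
    refine div_le_div_of_nonneg_right (sub_le_sub_right ?_ _) k0.le; exact_mod_cast hAB)))] at h
  have h1 : |(((Ioc A B).filter (· ≡ v [MOD k])).card : ℚ) - (B - A : ℚ) / k| ≤ 1 := by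
    have h2 : (((Ioc A B).filter (· ≡ v [MOD k])).card : ℚ) = ⌊((B : ℚ) - v) / k⌋ - ⌊((A : ℚ) - v) / k⌋ := by exact_mod_cast h
    rw [h2]
    have e : (B - A : ℚ) / k = ((B : ℚ) - v) / k - ((A : ℚ) - v) / k := by ring
    rw [e, abs_le]
    have := Int.floor_le (((B : ℚ) - v) / k); have := Int.lt_floor_add_one (((B : ℚ) - v) / k)
    have := Int.floor_le (((A : ℚ) - v) / k); have := Int.lt_floor_add_one (((A : ℚ) - v) / k)
    constructor <;> linarith
  have h3 := (Rat.cast_le (K := ℝ)).mpr h1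
  push_cast at h3
  exact h3
lemma cnt_rho (d A B : ℕ) {k : ℕ} (hk : 0 < k) (hAB : A ≤ B) :
    |(((Ioc A B).filter fun n => k ∣ n * (n + d)).card : ℝ) - rho d k * ((B - A : ℝ) / k)| ≤ k := by
  haveI : NeZero k := ⟨hk.ne'⟩
  set S := univ.filter fun x : ZMod k => x * (x + d) = 0 with hS
  have r : rho d k = S.card := by rw [rho, Nat.card_eq_fintype_card, Fintype.card_subtype]
  have e : ((Ioc A B).filter fun n => k ∣ n * (n + d)).card = ∑ x ∈ S, ((Ioc A B).filter (· ≡ x.val [MOD k])).card := by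
    rw [Finset.card_eq_sum_card_fiberwise (f := fun n : ℕ => (n : ZMod k)) (t := S)]
    · refine sum_congr rfl fun x hx => ?_
      rw [Finset.filter_filter]
      congr 1
      refine Finset.filter_congr fun n _ => ?_
      rw [← ZMod.natCast_eq_natCast_iff, ZMod.natCast_zmod_val]
      refine ⟨fun h => h.2, fun h => ⟨?_, h⟩⟩
      rw [hS, mem_filter, ← h] at hx
      exact (ZMod.natCast_eq_zero_iff _ _).mp (by push_cast; exact hx.2)
    · intro n hn
      rw [mem_coe, mem_filter] at hn
      have := (ZMod.natCast_eq_zero_iff _ _).mpr hn.2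
      push_cast at this
      simp [hS]
      simpa using this
  rw [e, r, Nat.cast_sum, ← nsmul_eq_mul, ← sum_const, ← sum_sub_distrib]
  refine (abs_sum_le_sum_abs _ _).trans ((sum_le_card_nsmul _ _ 1 fun x _ => cnt_res A B _ hk hAB).trans ?_)
  rw [nsmul_one]
  have := Finset.card_le_univ S
  rw [ZMod.card] at this
  exact_mod_cast this
end
end
section
section
noncomputable def dS (d : ℕ) : ℝ := ∑ e ∈ d.divisors, 1 / (e : ℝ)
noncomputable def cB (d z : ℕ) : ℝ := ∑ b ∈ (Icc 1 z).filter (·.Coprime d), 1 / (b : ℝ)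
lemma T_le (d n : ℕ) : (n.divisors.filter (·.Coprime d)).card ≤ 2 ^ tD d n := by
  induction n using induction_on_primes with
  | zero => simp
  | one => exact (card_filter_le _ _).trans (by simpa using one_le_two_pow)
  | prime_mul p a hp ih =>
    by_cases ha : a = 0
    · simp [ha]
    rw [tD_mul d hp.ne_zero ha, tD_prime d hp]
    set T := a.divisors.filter (·.Coprime d) with hT
    have mT : ∀ b, b ∈ T ↔ b ∣ a ∧ b.Coprime d := fun b => by simp [hT, ha]
    split_ifs with h
    · rw [zero_add]
      refine (card_le_card fun b hb => ?_).trans ih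
      rw [mem_filter, mem_divisors] at hb
      exact (mT b).mpr ⟨(Coprime.coprime_dvd_right h hb.2).dvd_of_dvd_mul_left hb.1.1, hb.2⟩
    · have : (p * a).divisors.filter (·.Coprime d) ⊆ T ∪ T.image (p * ·) := fun b hb => by
        rw [mem_filter, mem_divisors] at hb
        rw [mem_union, mem_image]
        by_cases hpb : p ∣ b
        · obtain ⟨c, rfl⟩ := hpb
          exact Or.inr ⟨c, (mT c).mpr ⟨Nat.dvd_of_mul_dvd_mul_left hp.pos hb.1.1, (Coprime.coprime_dvd_left (Dvd.intro_left p rfl) hb.2)⟩, rfl⟩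
        · exact Or.inl ((mT b).mpr ⟨(((hp.coprime_iff_not_dvd).mpr hpb).symm).dvd_of_dvd_mul_left hb.1.1, hb.2⟩)
      refine (card_le_card this).trans ((Finset.card_union_le _ _).trans ?_)
      have := Finset.card_image_le (s := T) (f := (p * ·))
      rw [pow_add]; omega
lemma G_sum (d z : ℕ) : (∑ a ∈ Icc 1 z, 1 / (a : ℝ)) * cB d z ≤ ∑ n ∈ Icc 1 (z ^ 2), GD d n := by
  rw [cB, sum_mul_sum, ← sum_product']
  set B := (Icc 1 z).filter (·.Coprime d) with hB
  have mB : ∀ b ∈ B, 1 ≤ b ∧ b ≤ z ∧ b.Coprime d := fun b hb => by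
    rw [hB, mem_filter, mem_Icc] at hb; exact ⟨hb.1.1, hb.1.2, hb.2⟩
  rw [← Finset.sum_fiberwise_of_maps_to (g := fun x : ℕ × ℕ => x.1 * x.2) (t := Icc 1 (z ^ 2)) fun x hx => by
    rw [mem_product, mem_Icc] at hx
    have := mB _ hx.2
    rw [mem_Icc, sq]; exact ⟨Nat.mul_pos hx.1.1 this.1, Nat.mul_le_mul hx.1.2 this.2.1⟩]
  refine sum_le_sum fun n hn => ?_
  rw [mem_Icc] at hn
  have e : ∀ x ∈ (Icc 1 z ×ˢ B).filter (fun x => x.1 * x.2 = n), 1 / (x.1 : ℝ) * (1 / (x.2 : ℝ)) = (n : ℝ)⁻¹ := fun x hx => by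
    rw [← (mem_filter.mp hx).2]; push_cast; rw [mul_inv, one_div, one_div]
  rw [sum_congr rfl e, sum_const, nsmul_eq_mul, GD_apply]
  refine mul_le_mul_of_nonneg_right ?_ (by positivity)
  have : ((Icc 1 z ×ˢ B).filter (fun x => x.1 * x.2 = n)).card ≤ (n.divisors.filter (·.Coprime d)).card := by
    refine card_le_card_of_injOn Prod.snd (fun x hx => ?_) fun x hx y hy h => ?_
    · have hx := mem_filter.mp hx
      rw [mem_coe, mem_filter, mem_divisors]
      exact ⟨⟨⟨x.1, by rw [← hx.2, mul_comm]⟩, by omega⟩, (mB _ (mem_product.mp hx.1).2).2.2⟩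
    · have hx := mem_filter.mp hx
      have hy := mem_filter.mp hy
      have := (mB _ (mem_product.mp hx.1).2).1
      refine Prod.ext (Nat.eq_of_mul_eq_mul_right this ?_) h
      rw [hx.2, h, hy.2]
  exact_mod_cast this.trans (T_le d n)
lemma sq_sum (z : ℕ) : ∑ s ∈ Icc 1 z, 1 / ((s : ℝ) ^ 2) ≤ 2 := by
  have : ∀ z : ℕ, ∑ s ∈ Icc 1 (z + 1), 1 / ((s : ℝ) ^ 2) ≤ 2 - 1 / (z + 1 : ℝ) := fun z => by
    induction z with
    | zero => norm_num
    | succ z ih =>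
      rw [sum_Icc_succ_top (by omega)]
      refine (add_le_add_left ih _).trans ?_
      push_cast
      have : 1 / ((z : ℝ) + 1 + 1) ^ 2 ≤ 1 / (z + 1 : ℝ) - 1 / (z + 1 + 1 : ℝ) := by
        rw [div_sub_div _ _ (by positivity) (by positivity), div_le_div_iff₀ (by positivity) (by positivity)]; nlinarith
      linarith
  cases z with
  | zero => simp
  | succ z => exact (this z).trans (by have : 0 ≤ 1 / (z + 1 : ℝ) := by positivity
                                       linarith)
lemma B_ge {d : ℕ} (hd : d ≠ 0) (z : ℕ) : ∑ n ∈ Icc 1 z, 1 / (n : ℝ) ≤ 2 * dS d * cB d z := by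
  choose m s hms hm using fun n : ℕ => Nat.sq_mul_squarefree n
  set B := (Icc 1 z).filter (·.Coprime d) with hB
  set φ : ℕ → ℕ × ℕ × ℕ := fun n => (s n, (m n).gcd d, m n / (m n).gcd d) with hφ
  have fac : ∀ n, n = (s n) ^ 2 * ((m n).gcd d * (m n / (m n).gcd d)) := fun n => by
    rw [mul_div_cancel' (Nat.gcd_dvd_left _ _)]; exact (hms n).symm
  have F : ∀ n ∈ Icc 1 z, 1 / (n : ℝ) = (fun x : ℕ × ℕ × ℕ => 1 / (x.1 : ℝ) ^ 2 * (1 / (x.2.1 : ℝ) * (1 / (x.2.2 : ℝ)))) (φ n) := fun n _ => by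
    conv_lhs => rw [fac n]
    simp only [hφ]; push_cast; rw [one_div_mul_one_div, one_div_mul_one_div]
  rw [sum_congr rfl F, ← sum_image (g := φ) (f := fun x : ℕ × ℕ × ℕ => 1 / (x.1 : ℝ) ^ 2 * (1 / (x.2.1 : ℝ) * (1 / (x.2.2 : ℝ)))) fun a _ b _ h => by
    simp only [hφ, Prod.mk.injEq] at h
    rw [fac a, fac b, h.1, h.2.2, h.2.1]]
  refine (sum_le_sum_of_subset_of_nonneg (t := Icc 1 z ×ˢ d.divisors ×ˢ B) (fun x hx => ?_) fun _ _ _ => by positivity).trans ?_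
  · obtain ⟨n, hn, rfl⟩ := mem_image.mp hx
    rw [mem_Icc] at hn
    have m0 := (hm n).ne_zero
    have f := fac n
    have g1 : (m n).gcd d * (m n / (m n).gcd d) = m n := mul_div_cancel' (Nat.gcd_dvd_left _ _)
    have b0 : m n / (m n).gcd d ≠ 0 := fun h => m0 (by rw [← g1, h, mul_zero])
    have s0 : s n ≠ 0 := fun h => by rw [h] at f; simp at f; omega
    have sn : s n ≤ n := le_of_dvd (by omega) ⟨s n * m n, by have := hms n; rw [sq, mul_assoc] at this; exact this.symm⟩
    have bn : m n / (m n).gcd d ≤ n := (Nat.div_le_self _ _).trans (le_of_dvd (by omega) ⟨s n ^ 2, by rw [mul_comm]; exact (hms n).symm⟩)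
    simp only [hφ, hB, mem_product, mem_Icc, mem_divisors, mem_filter]
    refine ⟨⟨one_le_iff_ne_zero.mpr s0, sn.trans hn.2⟩, ⟨Nat.gcd_dvd_right _ _, hd⟩, ⟨one_le_iff_ne_zero.mpr b0, bn.trans hn.2⟩, ?_⟩
    have sq := hm n
    rw [← g1, Nat.squarefree_mul_iff] at sq
    have k1 := Nat.gcd_dvd_left (m n / (m n).gcd d) d
    exact Nat.eq_one_of_dvd_coprimes sq.1 (Nat.dvd_gcd (k1.trans ⟨(m n).gcd d, by rw [mul_comm]; exact g1.symm⟩) (Nat.gcd_dvd_right _ _)) k1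
  · rw [sum_product]
    simp_rw [sum_product, ← mul_sum]
    rw [← sum_mul, ← sum_mul, mul_assoc]
    refine mul_le_mul_of_nonneg_right (sq_sum z) (mul_nonneg (sum_nonneg fun _ _ => by positivity) (sum_nonneg fun _ _ => by positivity))
end
end
section
section
lemma pair_sieve {d z P : ℕ} (hd2 : 2 ∣ d) (hd : d ≠ 0) (hz : 1 ≤ z) (hzP : z ^ 2 ≤ P) {S : Finset ℕ}
    (hS : ∀ p ∈ S, P < p ∧ p ≤ 8 * P ∧ p.Prime) :
    ((S.filter fun p => p + d ∈ S).card : ℝ) ≤ 14 * P * dS d / Real.log (z + 1) ^ 2 + z ^ 8 := by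
  have inj : Function.Injective (fun n : ℕ => n * (n + d)) :=
    (show StrictMono (fun n : ℕ => n * (n + d)) from fun a b h => by
      change a * (a + d) < b * (b + d)
      exact Nat.mul_lt_mul_of_lt_of_le h (by omega) (by omega)).injective
  let s : BoundingSieve :=
    { support := (Ioc P (8 * P)).image fun n => n * (n + d)
      prodPrimes := primorial (z ^ 2)
      prodPrimes_squarefree := primorial_sqf _
      weights := fun _ => 1
      weights_nonneg := fun _ => zero_le_one
      totalMass := ((8 * P : ℕ) : ℝ) - P
      nu := ⟨fun n => GD d n, by simp [GD_apply]⟩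
      nu_mult := ⟨(GD d).map_one, fun {m n} _ => (GD d).map_mul m n⟩
      nu_pos_of_prime := fun p hp _ => by
        change 0 < GD d p; rw [GD_apply]; have : (0 : ℝ) < p := by exact_mod_cast hp.pos
        positivity
      nu_lt_one_of_prime := fun p hp _ => GD_lt hd2 hp }
  have hR : 1 ≤ z ^ 2 := Nat.one_le_pow _ _ hz
  have M0 : (0 : ℝ) ≤ ((8 * P : ℕ) : ℝ) - P := by push_cast; have := cast_nonneg (α := ℝ) P; linarith
  have hsel := Sel.selberg s (z ^ 2) hR (GD d) (GD_nonneg d) (fun p hp => GD_lt hd2 hp) (fun p _ _ => rfl)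
    (fun p hp h => (dvd_primorial_iff hp).2 h) M0
  have hrem : ∀ k, Squarefree k → |s.rem k| ≤ k := fun k hk => by
    have := cnt_rho d P (8 * P) (Nat.pos_of_ne_zero hk.ne_zero) (by omega)
    have e : s.rem k = (((Ioc P (8 * P)).filter fun n => k ∣ n * (n + d)).card : ℝ) - rho d k * ((((8 * P : ℕ) : ℝ) - P) / k) := by
      change (∑ n ∈ (Ioc P (8 * P)).image (fun n => n * (n + d)), if k ∣ n then (1 : ℝ) else 0) - GD d k * (((8 * P : ℕ) : ℝ) - P) = _
      rw [sum_image fun a _ b _ h => inj h, sum_boole, GD_apply, rho_sqf d k hk]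
      push_cast; ring
    rw [e]; exact this
  have hsift : ((S.filter fun p => p + d ∈ S).card : ℝ) ≤ s.siftedSum := by
    rw [BoundingSieve.siftedSum, ← sum_filter]
    change _ ≤ ∑ a ∈ _, (1 : ℝ)
    rw [sum_const, nsmul_one, ← Finset.card_image_of_injective _ inj, cast_le]
    refine card_le_card fun x hx => ?_
    obtain ⟨p, hp, rfl⟩ := mem_image.mp hx
    rw [mem_filter] at hp
    have h1 := hS _ hp.1
    have h2 := hS _ hp.2
    exact mem_filter.2 ⟨mem_image.mpr ⟨p, mem_Ioc.mpr ⟨h1.1, h1.2.1⟩, rfl⟩,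
      (coprime_primorial h1.2.2 (by omega)).mul_right (coprime_primorial h2.2.2 (by omega))⟩
  refine hsift.trans (hsel.trans (add_le_add ?_ ?_))
  · have L0 : 0 < Real.log (z + 1) := log_pos (lt_add_of_pos_left 1 (by exact_mod_cast hz))
    have h1 := harm_ge z
    have h2 := h1.trans (B_ge hd z)
    have D0 : 0 < dS d := sum_pos (fun e he => by
      have : 0 < e := Nat.pos_of_mem_divisors he
      positivity) ⟨1, by simpa using hd⟩
    have C0 : 0 ≤ cB d z := sum_nonneg fun _ _ => by positivity
    have h3 : Real.log (z + 1) ^ 2 ≤ 2 * dS d * ∑ n ∈ Icc 1 (z ^ 2), GD d n := by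
      rw [sq]
      refine (mul_le_mul h1 h2 L0.le (L0.le.trans h1)).trans ?_
      have := mul_le_mul_of_nonneg_left (G_sum d z) (show 0 ≤ 2 * dS d by positivity)
      linarith
    have G0 : 0 < ∑ n ∈ Icc 1 (z ^ 2), GD d n := by
      by_contra hc
      have := mul_nonpos_of_nonneg_of_nonpos (show 0 ≤ 2 * dS d by positivity) (not_lt.mp hc)
      have := pow_pos L0 2
      linarith
    rw [div_le_div_iff₀ G0 (pow_pos L0 2)]
    change (((8 * P : ℕ) : ℝ) - P) * _ ≤ _
    refine (mul_le_mul_of_nonneg_left h3 M0).trans (le_of_eq ?_)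
    push_cast; ring
  · have hb : ∀ a ∈ Sel.DR s (z ^ 2), ∀ b ∈ Sel.DR s (z ^ 2), |s.rem (a.lcm b)| ≤ (z : ℝ) ^ 4 := fun a ha b hb => by
      have ha := (Sel.mem_DR s _).1 ha
      have hb := (Sel.mem_DR s _).1 hb
      refine (hrem _ ((primorial_sqf _).squarefree_of_dvd (Nat.lcm_dvd ha.1 hb.1))).trans ?_
      have a0 := Nat.pos_of_ne_zero (ne_zero_of_dvd_ne_zero BoundingSieve.prodPrimes_ne_zero ha.1)
      have b0 := Nat.pos_of_ne_zero (ne_zero_of_dvd_ne_zero BoundingSieve.prodPrimes_ne_zero hb.1)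
      have : a.lcm b ≤ z ^ 4 := (le_of_dvd (Nat.mul_pos a0 b0) (Nat.lcm_dvd_mul a b)).trans
        ((Nat.mul_le_mul ha.2 hb.2).trans (le_of_eq (by ring)))
      exact_mod_cast this
    have hsub : Sel.DR s (z ^ 2) ⊆ Icc 1 (z ^ 2) := fun d hd => by
      have := (Sel.mem_DR s _).1 hd
      exact mem_Icc.2 ⟨Nat.pos_of_ne_zero (ne_zero_of_dvd_ne_zero BoundingSieve.prodPrimes_ne_zero this.1), this.2⟩
    have hc : ((Sel.DR s (z ^ 2)).card : ℝ) ≤ (z : ℝ) ^ 2 := by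
      have := card_le_card hsub
      rw [Nat.card_Icc, Nat.add_sub_cancel] at this; exact_mod_cast this
    refine (sum_le_card_nsmul _ _ _ fun a ha => sum_le_card_nsmul _ _ _ fun b hb' => hb a ha b hb').trans ?_
    rw [nsmul_eq_mul, nsmul_eq_mul]
    calc _ ≤ (z : ℝ) ^ 2 * ((z : ℝ) ^ 2 * z ^ 4) := by gcongr
      _ = _ := by ring
end
end
section
section
lemma dS_one {d : ℕ} (hd : d ≠ 0) : 1 ≤ dS d := by
  have := single_le_sum (f := fun e : ℕ => 1 / (e : ℝ)) (fun _ _ => by positivity) (show 1 ∈ d.divisors by simpa using hd)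
  simpa [dS] using this
lemma pair_bd {d m : ℕ} (hd : d ≠ 0) (hm : 16 ≤ m) {S : Finset ℕ} (hS : ∀ p ∈ S, 2 ^ m < p ∧ p ≤ 8 * 2 ^ m ∧ p.Prime) :
    ((S.filter fun p => p + d ∈ S).card : ℝ) ≤ 40000 * (2 ^ m / m ^ 2) * dS d := by
  have m0 : (0 : ℝ) < m := by exact_mod_cast (by omega : 0 < m)
  have d1 := dS_one hd
  by_cases h2 : 2 ∣ d
  · set q := m / 16 with hq
    have q1 : 16 * q ≤ m := by omega
    have q2 : m ≤ 16 * (q + 1) := by omega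
    have q3 : m ≤ 32 * q := by omega
    refine (pair_sieve h2 hd (z := 2 ^ q) (P := 2 ^ m) one_le_two_pow (by rw [← pow_mul]; exact pow_le_pow_right (by norm_num) (by omega)) hS).trans ?_
    have L : (m : ℝ) / 50 ≤ Real.log (((2 ^ q : ℕ) : ℝ) + 1) := by
      have h1 : Real.log ((2 : ℝ) ^ q) ≤ Real.log (((2 ^ q : ℕ) : ℝ) + 1) := log_le_log (by positivity) (by push_cast; linarith)
      rw [log_pow] at h1
      have h3 : (m : ℝ) ≤ 32 * q := by exact_mod_cast q3
      have h4 := log_two_gt_d9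
      have h5 := mul_le_mul_of_nonneg_left (show (0.64 : ℝ) ≤ Real.log 2 by linarith) (cast_nonneg (α := ℝ) q)
      linarith
    have A : 14 * ((2 ^ m : ℕ) : ℝ) * dS d / Real.log (((2 ^ q : ℕ) : ℝ) + 1) ^ 2 ≤ 14 * 2 ^ m * dS d / (m / 50) ^ 2 := by
      push_cast at L ⊢
      exact div_le_div_of_nonneg_left (by positivity) (by positivity) (pow_le_pow_left₀ (by positivity) L 2)
    have B : (((2 ^ q : ℕ) : ℝ)) ^ 8 ≤ 256 * (2 ^ m / m ^ 2) := by
      rw [← mul_div_assoc, le_div_iff₀ (by positivity)]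
      have h1 : q + 1 ≤ 2 ^ q := Nat.lt_two_pow_self
      have : (2 ^ q) ^ 8 * m ^ 2 ≤ 256 * 2 ^ m := calc
        _ ≤ (2 ^ q) ^ 8 * (16 * 2 ^ q) ^ 2 := Nat.mul_le_mul_left _ (Nat.pow_le_pow_left (by omega) 2)
        _ = 256 * 2 ^ (10 * q) := by ring
        _ ≤ _ := Nat.mul_le_mul_left _ (pow_le_pow_right (by norm_num) (by omega))
      exact_mod_cast this
    have e : 14 * 2 ^ m * dS d / ((m : ℝ) / 50) ^ 2 = 35000 * (2 ^ m / m ^ 2) * dS d := by field_simp; ring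
    have h6 : 256 * ((2 : ℝ) ^ m / m ^ 2) * 1 ≤ 256 * (2 ^ m / m ^ 2) * dS d := mul_le_mul_of_nonneg_left d1 (by positivity)
    have h7 : 0 ≤ (2 : ℝ) ^ m / m ^ 2 * dS d := by positivity
    linarith
  · have : S.filter (fun p => p + d ∈ S) = ∅ := Finset.filter_eq_empty_iff.mpr fun p hp hq => by
      have := hS _ hp; have hq := hS _ hq
      have h1 := one_le_two_pow (n := m)
      have h3 : 2 ≤ 2 ^ m := (show 2 = 2 ^ 1 by norm_num) ▸ pow_le_pow_right (by norm_num) (by omega)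
      have := this.2.2.eq_two_or_odd; have := hq.2.2.eq_two_or_odd
      omega
    rw [this]; simp; positivity
lemma dS_sq : ∃ C : ℝ, 0 ≤ C ∧ ∀ X : ℕ, ∑ d ∈ Icc 1 X, dS d ^ 2 ≤ C * X := by
  have sm : Summable (fun n : ℕ => (n : ℝ) ^ (-(3 / 2) : ℝ)) := Real.summable_nat_rpow.mpr (by norm_num)
  set C := ∑' n : ℕ, (n : ℝ) ^ (-(3 / 2) : ℝ) with hC
  have C0 : 0 ≤ C := tsum_nonneg fun n => by positivity
  have fs : ∀ T : Finset ℕ, ∑ n ∈ T, (n : ℝ) ^ (-(3 / 2) : ℝ) ≤ C := fun T => sm.sum_le_tsum T fun n _ => by positivity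
  refine ⟨C * C, by positivity, fun X => ?_⟩
  have h1 : ∀ d ∈ Icc 1 X, dS d ^ 2 ≤ C * ∑ e ∈ Icc 1 X, if e ∣ d then (e : ℝ) ^ (-(1 / 2) : ℝ) else 0 := fun d hd => by
    rw [mem_Icc] at hd
    have := Finset.sum_sq_le_sum_mul_sum_of_sq_eq_mul d.divisors (r := fun e : ℕ => 1 / (e : ℝ)) (f := fun e : ℕ => (e : ℝ) ^ (-(3 / 2) : ℝ)) (g := fun e : ℕ => (e : ℝ) ^ (-(1 / 2) : ℝ))
      (fun _ _ => by positivity) (fun _ _ => by positivity) fun e he => by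
        have : (0 : ℝ) < e := by exact_mod_cast Nat.pos_of_mem_divisors he
        rw [← rpow_add this, show (-(3 / 2) + -(1 / 2) : ℝ) = -2 by norm_num, rpow_neg this.le, one_div, inv_pow]
        norm_num
    refine this.trans (mul_le_mul (fs _) ?_ (sum_nonneg fun _ _ => by positivity) C0)
    rw [← sum_filter]
    refine sum_le_sum_of_subset_of_nonneg (fun e he => ?_) fun _ _ _ => by positivity
    have h3 := Nat.pos_of_mem_divisors he
    rw [mem_divisors] at he
    exact mem_filter.mpr ⟨mem_Icc.mpr ⟨h3, (le_of_dvd (by omega) he.1).trans hd.2⟩, he.1⟩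
  refine (sum_le_sum h1).trans ?_
  rw [← mul_sum, mul_assoc, sum_comm]
  refine mul_le_mul_of_nonneg_left ?_ C0
  refine le_trans (sum_le_sum fun e he => ?_) (show ∑ e ∈ Icc 1 X, (e : ℝ) ^ (-(3 / 2) : ℝ) * X ≤ C * X by
    rw [← sum_mul]; exact mul_le_mul_of_nonneg_right (fs _) (cast_nonneg _))
  have e0 : (0 : ℝ) < e := by exact_mod_cast (mem_Icc.mp he).1
  rw [← sum_filter, sum_const, nsmul_eq_mul, show Icc 1 X = Ioc 0 X from rfl, Nat.Ioc_filter_dvd_card_eq_div,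
    show (-(3 / 2) : ℝ) = -(1 / 2) - 1 by norm_num, Real.rpow_sub_one e0.ne']
  have := mul_le_mul_of_nonneg_right (cast_div_le (α := ℝ) (m := X) (n := e)) (show 0 ≤ (e : ℝ) ^ (-(1 / 2) : ℝ) by positivity)
  refine this.trans (le_of_eq (by ring))
lemma pair_sum (S : Finset ℕ) {g : ℕ → ℝ} (hg : ∀ n, 0 ≤ g n) {X : ℕ} (hX : ∀ p ∈ S, p ≤ X) :
    ∑ p ∈ S, ∑ q ∈ S, g ((p : ℤ) - q).natAbs ≤ S.card * g 0 + 2 * ∑ k ∈ Icc 1 X, ((S.filter fun p => p + k ∈ S).card : ℝ) * g k := by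
  have h1 : ∀ p ∈ S, ∑ q ∈ S, g ((p : ℤ) - q).natAbs ≤ g 0 + ∑ k ∈ Icc 1 X, ((if p + k ∈ S then g k else 0) + ∑ q ∈ S, if p = q + k then g k else 0) := fun p hp => by
    rw [← Finset.sum_erase_add _ _ hp, sub_self, Int.natAbs_zero, add_comm]
    refine add_le_add le_rfl ?_
    have e : ∑ k ∈ Icc 1 X, ((if p + k ∈ S then g k else 0) + ∑ q ∈ S, if p = q + k then g k else 0) =
        ∑ q ∈ S, ∑ k ∈ Icc 1 X, ((if q = p + k then g k else 0) + if p = q + k then g k else 0) := by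
      rw [sum_comm]
      refine sum_congr rfl fun k _ => ?_
      rw [sum_add_distrib, sum_ite_eq']
    rw [e]
    refine (sum_le_sum fun q hq => ?_).trans (sum_le_sum_of_subset_of_nonneg (S.erase_subset p) fun q _ _ =>
      sum_nonneg fun k _ => add_nonneg (by split_ifs; exacts [hg k, le_rfl]) (by split_ifs; exacts [hg k, le_rfl]))
    rw [Finset.mem_erase] at hq
    have a := hX p hp; have b := hX q hq.2
    refine le_trans ?_ (single_le_sum (fun k _ => add_nonneg (by split_ifs; exacts [hg k, le_rfl]) (by split_ifs; exacts [hg k, le_rfl]))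
      (show ((p : ℤ) - q).natAbs ∈ Icc 1 X by rw [mem_Icc]; omega))
    rcases lt_or_gt_of_ne hq.1 with h | h
    · rw [if_neg (by omega), if_pos (by omega), zero_add]
    · rw [if_pos (by omega), if_neg (by omega), add_zero]
  refine (sum_le_sum h1).trans (le_of_eq ?_)
  rw [sum_add_distrib, sum_const, nsmul_eq_mul, sum_comm, mul_sum]
  congr 1
  refine sum_congr rfl fun k _ => ?_
  rw [sum_add_distrib, ← sum_filter, sum_const, nsmul_eq_mul, sum_comm]
  have : ∀ q ∈ S, (∑ p ∈ S, if p = q + k then g k else 0) = if q + k ∈ S then g k else 0 := fun q _ => by rw [sum_ite_eq']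
  rw [sum_congr rfl this, ← sum_filter, sum_const, nsmul_eq_mul]; ring
end
end
section
section
variable {U : Ultrafilter ℕ} {E : (ℕ → ℂ) →ₗ[ℂ] ℂ} {R : (ℕ → ℝ) →ₗ[ℝ] ℝ}
lemma card_lb : ∃ m0 : ℕ, ∀ m ≥ m0, (2 : ℝ) ^ m / (4 * m) ≤ (prs (2 ^ m) (8 * 2 ^ m)).card := by
  obtain ⟨x0, -, hx⟩ := prs_block
  obtain ⟨m1, hm1⟩ := pow_unbounded_of_one_lt x0 (one_lt_two (α := ℝ))
  refine ⟨m1 + 1, fun m hm => le_trans (div_le_div_of_nonneg_left (by positivity) (log_pos ?_) ?_) (hx (2 ^ m) (hm1.le.trans (pow_le_pow_right₀ (by norm_num) (by omega)))).2⟩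
  · have : (1 : ℝ) ≤ 2 ^ m := one_le_pow₀ (by norm_num)
    linarith
  · rw [show (8 : ℝ) * 2 ^ m = 2 ^ (m + 3) by ring, log_pow]
    have := log_two_lt_d9
    have h4 := mul_le_mul_of_nonneg_left (show Real.log 2 ≤ 1 by linarith) (show (0 : ℝ) ≤ (m + 3 : ℕ) by positivity)
    have : (1 : ℝ) ≤ m := by exact_mod_cast (by omega : 1 ≤ m)
    push_cast at h4 ⊢; linarith
lemma var_bd (hR : IsAv U R) (h : ℕ) (S : Finset ℕ) : (∑ p ∈ S, cor R (p * h)) ^ 2 ≤ ∑ p ∈ S, ∑ q ∈ S, |cor R (((p : ℤ) - q).natAbs * h)| := by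
  set T := ∑ p ∈ S, cor R (p * h) with hT
  have hF : Bd (fun n => ∑ p ∈ S, lr (n + p * h)) := ⟨S.card, fun n => (norm_sum_le _ _).trans
    ((sum_le_card_nsmul _ _ 1 fun p _ => lr_norm _).trans (by rw [nsmul_one]))⟩
  have hl : Bd (fun n => T * lr n) := ⟨|T|, fun n => by
    rw [norm_mul, norm_eq_abs]; exact mul_le_of_le_one_right (abs_nonneg _) (lr_norm n)⟩
  have hd := hF.sub hl
  have h0 := av_nonneg hR (hd.mul hd) fun n => mul_self_nonneg _
  have e1 : (fun n => ((fun n => ∑ p ∈ S, lr (n + p * h)) - fun n => T * lr n) n * ((fun n => ∑ p ∈ S, lr (n + p * h)) - fun n => T * lr n) n) =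
      ∑ p ∈ S, ∑ q ∈ S, (fun n => lr (n + p * h) * lr (n + q * h)) - ((2 * T) • ∑ p ∈ S, (fun n => lr n * lr (n + p * h))) + (T ^ 2) • (fun n => lr n * lr (n + 0)) := by
    funext n
    simp only [Pi.sub_apply, Pi.add_apply, Pi.smul_apply, Finset.sum_apply, smul_eq_mul, ← mul_sum, ← sum_mul, add_zero]
    ring
  rw [e1, map_add, map_sub, map_smul, map_smul, map_sum, map_sum] at h0
  change 0 ≤ _ - (2 * T) • ∑ p ∈ S, cor R (p * h) + T ^ 2 • cor R 0 at h0
  rw [← hT, smul_eq_mul, smul_eq_mul] at h0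
  have h1 : T ^ 2 * cor R 0 ≤ T ^ 2 := mul_le_of_le_one_right (sq_nonneg _) ((le_abs_self _).trans (cor_le hR 0))
  refine le_trans (show T ^ 2 ≤ ∑ p ∈ S, R (∑ q ∈ S, fun n => lr (n + p * h) * lr (n + q * h)) by linarith) (sum_le_sum fun p _ => ?_)
  rw [map_sum]
  refine sum_le_sum fun q _ => ?_
  rw [cor_shift hR, show (((p * h : ℕ) : ℤ) - (q * h : ℕ)).natAbs = ((p : ℤ) - q).natAbs * h by
    push_cast; rw [← sub_mul, Int.natAbs_mul, Int.natAbs_natCast]]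
  exact le_abs_self _
theorem sum_small (hE : IsAv U E) (hR : IsAv U R) {h : ℕ} (hh : 1 ≤ h) {ε : ℝ} (hε : 0 < ε) :
    ∃ m0 : ℕ, ∀ m ≥ m0, |∑ p ∈ prs (2 ^ m) (8 * 2 ^ m), cor R (p * h)| ≤ ε * (prs (2 ^ m) (8 * 2 ^ m)).card := by
  obtain ⟨C, C0, hC⟩ := dS_sq
  obtain ⟨m1, hm1⟩ := card_lb
  have h0 : (1 : ℝ) ≤ h := by exact_mod_cast hh
  set M : ℝ := 10240000
  have hM : 0 < M := by norm_num [M]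
  set κ := ε ^ 2 / (2 * M * (C + 1)) with hκ
  have κ0 : 0 < κ := by positivity
  set η := κ * ε ^ 2 / (4 * M * h) with hη
  have η0 : 0 < η := by positivity
  obtain ⟨D0, hD⟩ := wiener hE hR η0
  obtain ⟨m2, hm2⟩ := exists_nat_gt (8 / ε ^ 2)
  refine ⟨m1 + m2 + D0 + 16, fun m hm => ?_⟩
  set S := prs (2 ^ m) (8 * 2 ^ m) with hS
  set N : ℝ := (S.card : ℝ)
  set P : ℝ := 2 ^ m with hP
  have P0 : 0 < P := by positivity
  have m0 : (0 : ℝ) < m := by exact_mod_cast (by omega : 0 < m)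
  have N1 : P / (4 * m) ≤ N := hm1 m (by omega)
  have mS : ∀ p ∈ S, 2 ^ m < p ∧ p ≤ 8 * 2 ^ m ∧ p.Prime := fun p hp => by
    have := (mem_prs (by positivity) (by positivity)).mp hp
    exact ⟨by exact_mod_cast this.1.1, by exact_mod_cast this.1.2, this.2⟩
  have msq : (m : ℝ) ^ 2 ≤ P := by
    have : ∀ k ≥ 4, k ^ 2 ≤ 2 ^ k := fun k hk => by
      induction k, hk using le_induction with
      | base => norm_num
      | succ k hk ih => rw [pow_succ 2 k]; nlinarith
    rw [hP]; exact_mod_cast this m (by omega)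
  have N2 : 2 ≤ ε ^ 2 * N := by
    have h1 : (m : ℝ) / 4 ≤ N := le_trans (by rw [div_le_div_iff₀ (by norm_num) (by positivity)]; linarith) N1
    have h2 : 8 / ε ^ 2 ≤ m := hm2.le.trans (by exact_mod_cast (by omega : m2 ≤ m))
    rw [div_le_iff₀ (by positivity)] at h2
    have := mul_le_mul_of_nonneg_left h1 (sq_nonneg ε)
    linarith
  have N0 : 0 ≤ N := cast_nonneg _
  set X := 8 * 2 ^ m with hX
  have Xc : (X : ℝ) = 8 * P := by rw [hX, hP]; push_cast; rfl
  have v := (var_bd hR h S).trans (pair_sum S (g := fun k => |cor R (k * h)|) (fun _ => abs_nonneg _) fun p hp => (mS p hp).2.1)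
  set Q := ∑ k ∈ Icc 1 X, cor R (k * h) ^ 2 with hQ
  have Q1 : Q ≤ η * (16 * h * P) := by
    have a : Q ≤ ∑ j ∈ range (X * h + 1), cor R j ^ 2 := by
      rw [hQ, ← sum_image (g := fun k => k * h) (f := fun j => cor R j ^ 2) fun a _ b _ e => Nat.eq_of_mul_eq_mul_right hh e]
      refine sum_le_sum_of_subset_of_nonneg (fun j hj => ?_) fun _ _ _ => sq_nonneg _
      obtain ⟨k, hk, rfl⟩ := mem_image.mp hj
      rw [mem_range, Nat.lt_succ_iff]
      exact Nat.mul_le_mul_right h (mem_Icc.mp hk).2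
    have b : m < 2 ^ m := Nat.lt_two_pow_self
    have c : X ≤ X * h := Nat.le_mul_of_pos_right _ hh
    refine a.trans ((hD _ (by omega)).trans (mul_le_mul_of_nonneg_left ?_ η0.le))
    have c' : (1 : ℝ) ≤ X * h := by exact_mod_cast (by omega : 1 ≤ X * h)
    push_cast; rw [Xc] at c' ⊢; linarith
  have B : ∑ k ∈ Icc 1 X, ((S.filter fun p => p + k ∈ S).card : ℝ) * |cor R (k * h)| ≤ 40000 * (P / m ^ 2) * (κ / 2 * (C * X) + Q / (2 * κ)) := by
    have : ∀ k ∈ Icc 1 X, ((S.filter fun p => p + k ∈ S).card : ℝ) * |cor R (k * h)| ≤ 40000 * (P / m ^ 2) * (κ / 2 * dS k ^ 2 + cor R (k * h) ^ 2 / (2 * κ)) := fun k hk => by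
      have k0 : k ≠ 0 := by have := mem_Icc.mp hk; omega
      refine (mul_le_mul_of_nonneg_right (pair_bd k0 (by omega) mS) (abs_nonneg _)).trans ?_
      rw [mul_assoc]
      refine mul_le_mul_of_nonneg_left ?_ (by positivity)
      have h1 := sq_nonneg (κ * dS k - |cor R (k * h)|)
      have e : κ / 2 * dS k ^ 2 + cor R (k * h) ^ 2 / (2 * κ) = dS k * |cor R (k * h)| + (κ * dS k - |cor R (k * h)|) ^ 2 / (2 * κ) := by
        rw [← sq_abs (cor R (k * h))]; field_simp; ring
      rw [e]
      have := div_nonneg h1 (show 0 ≤ 2 * κ by positivity)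
      linarith
    refine (sum_le_sum this).trans ?_
    rw [← mul_sum, sum_add_distrib, ← mul_sum, ← sum_div]
    exact mul_le_mul_of_nonneg_left (add_le_add (mul_le_mul_of_nonneg_left (hC X) (by positivity)) le_rfl) (by positivity)
  have g0 : N * |cor R (0 * h)| ≤ N := mul_le_of_le_one_right N0 (cor_le hR _)
  have T2 : κ / 2 * (C * X) + Q / (2 * κ) ≤ P * (4 * ε ^ 2 / M) := by
    have a : Q / (2 * κ) ≤ η * (16 * h * P) / (2 * κ) := div_le_div_of_nonneg_right Q1 (by positivity)
    have b : η * (16 * h * P) / (2 * κ) = 2 * P * (ε ^ 2 / M) := by rw [hη]; field_simp; ring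
    have c : κ * (C + 1) = ε ^ 2 / M / 2 := by rw [hκ]; field_simp
    have d : κ * C ≤ ε ^ 2 / M / 2 := by linarith
    have e := mul_le_mul_of_nonneg_right d P0.le
    have f : 0 ≤ P * (ε ^ 2 / M) := by positivity
    rw [Xc, mul_div_assoc]; linarith
  have T3 : 40000 * (P / m ^ 2) * (κ / 2 * (C * X) + Q / (2 * κ)) ≤ ε ^ 2 / 4 * N ^ 2 := by
    refine (mul_le_mul_of_nonneg_left T2 (by positivity)).trans ?_
    have e : 40000 * (P / m ^ 2) * (P * (4 * ε ^ 2 / M)) = ε ^ 2 / 4 * (P / (4 * m)) ^ 2 := by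
      simp only [M]; field_simp; ring
    rw [e]
    exact mul_le_mul_of_nonneg_left (pow_le_pow_left₀ (by positivity) N1 2) (by positivity)
  refine abs_le_of_sq_le_sq ?_ (by positivity)
  have := mul_le_mul_of_nonneg_right N2 N0
  have v' : (∑ p ∈ S, cor R (p * h)) ^ 2 ≤ N * |cor R (0 * h)| + 2 * ∑ k ∈ Icc 1 X, ((S.filter fun p => p + k ∈ S).card : ℝ) * |cor R (k * h)| := v
  have e : (ε * N) ^ 2 = ε ^ 2 * N * N := by ring
  rw [e]
  have : ε ^ 2 / 4 * N ^ 2 = ε ^ 2 * N * N / 4 := by ring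
  linarith
theorem cor_zero (hE : IsAv U E) (hR : IsAv U R) {h : ℕ} (hh : 1 ≤ h) : cor R h = 0 := by
  refine abs_eq_zero.mp (le_antisymm (le_of_forall_pos_le_add fun ε hε => ?_) (abs_nonneg _))
  obtain ⟨m1, H1⟩ := sum_small hE hR hh (half_pos hε)
  obtain ⟨m2, H2⟩ := card_lb
  obtain ⟨m, hm, H⟩ := decr hR h (half_pos hε) (m1 + m2 + 1)
  have a := H1 m (by omega)
  have b := H2 m (by omega)
  set S := prs (2 ^ m) (8 * 2 ^ m)
  have m0 : (0 : ℝ) < m := by exact_mod_cast (by omega : 0 < m)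
  have N0 : (0 : ℝ) < S.card := lt_of_lt_of_le (by positivity) b
  have e : ∑ p ∈ S, cor R (p * h) = S.card * cor R h - ∑ p ∈ S, (cor R h - cor R (p * h)) := by
    rw [sum_sub_distrib, sum_const, nsmul_eq_mul]; ring
  have f := abs_sum_le_sum_abs (fun p => cor R h - cor R (p * h)) S
  have g : |S.card * cor R h| ≤ |∑ p ∈ S, cor R (p * h)| + |∑ p ∈ S, (cor R h - cor R (p * h))| := by
    rw [show S.card * cor R h = ∑ p ∈ S, cor R (p * h) + ∑ p ∈ S, (cor R h - cor R (p * h)) by rw [e]; ring]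
    exact abs_add_le _ _
  rw [abs_mul, abs_of_pos N0] at g
  refine le_of_mul_le_mul_left ?_ N0
  linarith
end
end

end

/-- For every `h ≥ 1`, the logarithmically averaged two-point correlation of the
Liouville function vanishes:
`lim_{N→∞} (1/log N) Σ_{n≤N} λ(n)λ(n+h)/n = 0`. -/
theorem log_two_point_chowla_liouville (h : ℕ) (hh : 1 ≤ h) :
    Tendsto
      (fun N : ℕ => (1 / Real.log N) *
        ∑ n ∈ Finset.Icc 1 N, ((liouville n * liouville (n + h) : ℤ) : ℝ) / n)
      atTop (nhds 0) := by
  rw [tendsto_iff_ultrafilter]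
  intro U hU
  obtain ⟨E, hE⟩ := exists_av ℂ U hU
  obtain ⟨R, hR⟩ := exists_av ℝ U hU
  have t := hR.2 (fun n => lr n * lr (n + h)) (Bd1 fun n => lr2 _ _)
  have z := cor_zero hE hR hh
  rw [cor] at z
  rw [z] at t
  refine t.congr fun N => ?_
  rw [lsum, smul_eq_mul, one_div]
  congr 1
  refine Finset.sum_congr rfl fun n hn => ?_
  have n1 := (Finset.mem_Icc.mp hn).1
  rw [lr, lr, ArithmeticFunction.liouville_apply (by omega), ArithmeticFunction.liouville_apply (by omega), liouville, liouville, smul_eq_mul]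
  push_cast
  rw [div_eq_mul_inv, mul_comm]
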